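/- For all fixed reals 0 < α < 1/2 and 0 < ρ < 1 there exist constants c, k, n₀ ∈ ℕ such that the following holds for every n ≥ n₀, every integer r with 2 ≤ r ≤ (1−ρ)n, all ℓ, u ∈ ℕⁿ with [ℓᵢ,uᵢ] ⊆ [r − r^α, r + r^α] for all i, and every m ∈ ℕ with Σᵢℓᵢ ≤ 2m ≤ Σᵢuᵢ: every eigenvalue λ ≠ 1 of the transition matrix P of the switch–hinge flip Markov chain on G_m(ℓ,u) satisfies λ ≤ 1 − 1/(c·n^k). (This is the spectral-gap formulation of the statement that the switch–hinge flip Markov chain is rapidly mixing on G_m(ℓ,u); P is symmetric with uniform stationary distribution, so all its eigenvalues are real.) -/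

import Mathlib

/-- The degree of vertex `i` in a simple graph on `Fin n`. -/
noncomputable def degOf {n : ℕ} (G : SimpleGraph (Fin n)) (i : Fin n) : ℕ :=
  (G.neighborSet i).ncard

/-- Membership in `G_m(ℓ,u)`: degrees within `[ℓ,u]` and exactly `m` edges. -/
def memGm (n : ℕ) (ℓ u : Fin n → ℕ) (m : ℕ) (G : SimpleGraph (Fin n)) : Prop :=
  (∀ i, ℓ i ≤ degOf G i ∧ degOf G i ≤ u i) ∧ G.edgeSet.ncard = m

/-- `S(G,G')`: the number of ordered 4-tuples `(v,w,x,y)` with `{v,w},{x,y} ∈ E(G)`,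
`{v,y},{w,x} ∉ E(G)`, and `E(G') = (E(G)∖{{v,w},{x,y}}) ∪ {{v,y},{w,x}}`. -/
noncomputable def switchCount {n : ℕ} (G G' : SimpleGraph (Fin n)) : ℕ :=
  {t : Fin n × Fin n × Fin n × Fin n |
    G.Adj t.1 t.2.1 ∧ G.Adj t.2.2.1 t.2.2.2 ∧
    ¬ G.Adj t.1 t.2.2.2 ∧ ¬ G.Adj t.2.1 t.2.2.1 ∧
    G'.edgeSet = (G.edgeSet \ {s(t.1, t.2.1), s(t.2.2.1, t.2.2.2)}) ∪
      {s(t.1, t.2.2.2), s(t.2.1, t.2.2.1)}}.ncard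

/-- `F(G,G')`: the number of ordered triples `(v,w,x)` with `{v,w} ∈ E(G)`,
`{w,x} ∉ E(G)`, and `E(G') = (E(G)∖{{v,w}}) ∪ {{w,x}}`. -/
noncomputable def hingeCount {n : ℕ} (G G' : SimpleGraph (Fin n)) : ℕ :=
  {t : Fin n × Fin n × Fin n |
    G.Adj t.1 t.2.1 ∧ ¬ G.Adj t.2.1 t.2.2 ∧
    G'.edgeSet = (G.edgeSet \ {s(t.1, t.2.1)}) ∪ {s(t.2.1, t.2.2)}}.ncard

/-- The transition matrix of the switch–hinge flip Markov chain on `G_m(ℓ,u)`: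
off-diagonal entries `P(G,G') = S(G,G')/(6n⁴) + F(G,G')/(6n³)`, and diagonal entries
`P(G,G) = 1 − Σ_{G'≠G} P(G,G')`. -/
noncomputable def shfMatrix (n : ℕ) (ℓ u : Fin n → ℕ) (m : ℕ) :
    Matrix {G : SimpleGraph (Fin n) // memGm n ℓ u m G}
      {G : SimpleGraph (Fin n) // memGm n ℓ u m G} ℝ :=
  letI : Fintype {G : SimpleGraph (Fin n) // memGm n ℓ u m G} := Fintype.ofFinite _
  letI : DecidableEq {G : SimpleGraph (Fin n) // memGm n ℓ u m G} := Classical.decEq _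
  fun G G' =>
    if G = G' then
      1 - ∑ G'' ∈ Finset.univ.erase G,
        ((1 / (6 * (n : ℝ) ^ 4)) * switchCount G.1 G''.1 +
          (1 / (6 * (n : ℝ) ^ 3)) * hingeCount G.1 G''.1)
    else
      (1 / (6 * (n : ℝ) ^ 4)) * switchCount G.1 G'.1 +
        (1 / (6 * (n : ℝ) ^ 3)) * hingeCount G.1 G'.1

/-- The eigenvalue equation `P v = λ v` (the state space is finite). -/
def IsEigenPair {S : Type} [Finite S] (P : Matrix S S ℝ) (lam : ℝ) (v : S → ℝ) : Prop :=
  letI : Fintype S := Fintype.ofFinite S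
  P.mulVec v = lam • v

namespace SHF
open Finset
open scoped Classical

variable {n : ℕ}

/-- Neighbourhood of a vertex as a finset. -/
noncomputable def nb (G : SimpleGraph (Fin n)) (i : Fin n) : Finset (Fin n) :=
  univ.filter (G.Adj i)

lemma mem_nb {G : SimpleGraph (Fin n)} {i j : Fin n} : j ∈ nb G i ↔ G.Adj i j := by simp [nb]

/-- Degree of a vertex. -/
noncomputable def dg (G : SimpleGraph (Fin n)) (i : Fin n) : ℕ := (nb G i).card

/-- Replace the edge `vb` by the edge `va`. -/
def hg (G : SimpleGraph (Fin n)) (v b a : Fin n) : SimpleGraph (Fin n) where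
  Adj x y := (G.Adj x y ∧ s(x, y) ≠ s(v, b)) ∨ (s(x, y) = s(v, a) ∧ x ≠ y)
  symm := by
    constructor
    intro x y h
    rw [Sym2.eq_swap (a := y)]
    rcases h with h | h
    · exact Or.inl ⟨h.1.symm, h.2⟩
    · exact Or.inr ⟨h.1, h.2.symm⟩
  loopless := by
    constructor
    intro x h
    rcases h with h | h
    · exact h.1.ne rfl
    · exact h.2 rfl

/-- The switch in which `b` and `b'` exchange their neighbours `v` and `v'`. -/
def sw (G : SimpleGraph (Fin n)) (b v b' v' : Fin n) : SimpleGraph (Fin n) where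
  Adj x y := (G.Adj x y ∧ s(x, y) ≠ s(b, v) ∧ s(x, y) ≠ s(b', v')) ∨
    ((s(x, y) = s(b, v') ∨ s(x, y) = s(b', v)) ∧ x ≠ y)
  symm := by
    constructor
    intro x y h
    rw [Sym2.eq_swap (a := y)]
    rcases h with h | h
    · exact Or.inl ⟨h.1.symm, h.2⟩
    · exact Or.inr ⟨h.1, h.2.symm⟩
  loopless := by
    constructor
    intro x h
    rcases h with h | h
    · exact h.1.ne rfl
    · exact h.2 rfl

/-- Private neighbours of `b` relative to `b'`. -/
noncomputable def Lf (G : SimpleGraph (Fin n)) (b b' : Fin n) : Finset (Fin n) :=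
  univ.filter (fun v => v ≠ b' ∧ G.Adj b v ∧ ¬ G.Adj b' v)

lemma mem_Lf {G : SimpleGraph (Fin n)} {b b' v : Fin n} :
    v ∈ Lf G b b' ↔ v ≠ b' ∧ G.Adj b v ∧ ¬ G.Adj b' v := by simp [Lf]

lemma hg_adj {G : SimpleGraph (Fin n)} {v b a x y : Fin n} : (hg G v b a).Adj x y ↔
    (G.Adj x y ∧ s(x, y) ≠ s(v, b)) ∨ (s(x, y) = s(v, a) ∧ x ≠ y) := Iff.rfl

lemma sw_adj {G : SimpleGraph (Fin n)} {b v b' v' x y : Fin n} : (sw G b v b' v').Adj x y ↔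
    (G.Adj x y ∧ s(x, y) ≠ s(b, v) ∧ s(x, y) ≠ s(b', v')) ∨
    ((s(x, y) = s(b, v') ∨ s(x, y) = s(b', v)) ∧ x ≠ y) := Iff.rfl

section hinge
variable {G : SimpleGraph (Fin n)} {v b a : Fin n}

lemma nb_hg_self (h1 : G.Adj v b) (h2 : ¬ G.Adj v a) (h3 : v ≠ a) :
    nb (hg G v b a) v = insert a ((nb G v).erase b) := by
  have := h1.ne
  ext x
  simp only [mem_nb, hg_adj, mem_insert, mem_erase, ne_eq, Sym2.eq_iff]
  grind [SimpleGraph.irrefl]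

lemma nb_hg_rem (h1 : G.Adj v b) (h2 : ¬ G.Adj v a) :
    nb (hg G v b a) b = (nb G b).erase v := by
  have := h1.ne
  have := h1.symm
  ext x
  simp only [mem_nb, hg_adj, mem_erase, ne_eq, Sym2.eq_iff]
  grind [SimpleGraph.irrefl]

lemma nb_hg_add (h2 : ¬ G.Adj v a) (h3 : v ≠ a) :
    nb (hg G v b a) a = insert v (nb G a) := by
  ext x
  simp only [mem_nb, hg_adj, mem_insert, ne_eq, Sym2.eq_iff]
  grind [SimpleGraph.irrefl, SimpleGraph.Adj.symm]

lemma nb_hg_other {x : Fin n} (h1 : x ≠ v) (h2 : x ≠ b) (h3 : x ≠ a) :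
    nb (hg G v b a) x = nb G x := by
  ext y
  simp only [mem_nb, hg_adj, ne_eq, Sym2.eq_iff]
  grind

lemma dg_hg (h1 : G.Adj v b) (h2 : ¬ G.Adj v a) (h3 : v ≠ a) (x : Fin n) :
    dg (hg G v b a) x + (if x = b then 1 else 0) = dg G x + (if x = a then 1 else 0) := by
  have hvb := h1.ne
  have hab : a ≠ b := by rintro rfl; exact h2 h1
  unfold dg
  by_cases hv : x = v
  · subst hv
    rw [nb_hg_self h1 h2 h3, card_insert_of_notMem (by simp [mem_nb, h2]), if_neg hvb, if_neg h3]
    have := card_erase_add_one (mem_nb.2 h1)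
    omega
  by_cases hb : x = b
  · subst hb
    rw [nb_hg_rem h1 h2, if_pos rfl, if_neg hab.symm]
    have := card_erase_add_one (mem_nb.2 h1.symm)
    omega
  by_cases ha : x = a
  · subst ha
    rw [nb_hg_add h2 h3, if_pos rfl, if_neg hab,
      card_insert_of_notMem (by rw [mem_nb]; exact fun h => h2 h.symm)]
  · rw [nb_hg_other hv hb ha, if_neg hb, if_neg ha]

lemma hg_hg (h1 : G.Adj v b) (h2 : ¬ G.Adj v a) (h3 : v ≠ a) :
    hg (hg G v b a) v a b = G := by
  have := h1.ne
  have := h1.symm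
  have h4 : ¬ G.Adj a v := fun h => h2 h.symm
  ext x y
  simp only [hg_adj, ne_eq, Sym2.eq_iff]
  grind [SimpleGraph.irrefl]

lemma hg_pre (h1 : G.Adj v b) (h2 : ¬ G.Adj v a) (h3 : v ≠ a) :
    (hg G v b a).Adj v a ∧ ¬ (hg G v b a).Adj v b := by
  have hab : a ≠ b := by rintro rfl; exact h2 h1
  have := h1.ne
  simp only [hg_adj, ne_eq, Sym2.eq_iff]
  grind
end hinge

section switch
variable {G : SimpleGraph (Fin n)} {v b v' b' : Fin n}

lemma nb_sw_fst (h : v ∈ Lf G b b') (h' : v' ∈ Lf G b' b) :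
    nb (sw G b v b' v') b = insert v' ((nb G b).erase v) := by
  rw [mem_Lf] at h h'
  have := h.2.1.ne
  have := h'.2.1.ne
  ext x
  simp only [mem_nb, sw_adj, mem_insert, mem_erase, ne_eq, Sym2.eq_iff]
  grind [SimpleGraph.irrefl]

lemma sw_comm : sw G b v b' v' = sw G b' v' b v := by
  ext x y
  simp only [sw_adj]
  tauto

lemma sw_flip : sw G b v b' v' = sw G v b v' b' := by
  ext x y
  simp only [sw_adj, Sym2.eq_swap (a := b), Sym2.eq_swap (a := b')]
  tauto

lemma Lf_flip (h : v ∈ Lf G b b') (h' : v' ∈ Lf G b' b) : b ∈ Lf G v v' ∧ b' ∈ Lf G v' v := by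
  simp only [mem_Lf] at *
  refine ⟨⟨h'.1.symm, h.2.1.symm, fun hh => h'.2.2 hh.symm⟩,
    ⟨h.1.symm, h'.2.1.symm, fun hh => h.2.2 hh.symm⟩⟩

lemma nb_sw_snd (h : v ∈ Lf G b b') (h' : v' ∈ Lf G b' b) :
    nb (sw G b v b' v') b' = insert v ((nb G b').erase v') := by
  rw [sw_comm]; exact nb_sw_fst h' h

lemma nb_sw_fst' (h : v ∈ Lf G b b') (h' : v' ∈ Lf G b' b) :
    nb (sw G b v b' v') v = insert b' ((nb G v).erase b) := by
  rw [sw_flip]; exact nb_sw_fst (Lf_flip h h').1 (Lf_flip h h').2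

lemma nb_sw_snd' (h : v ∈ Lf G b b') (h' : v' ∈ Lf G b' b) :
    nb (sw G b v b' v') v' = insert b ((nb G v').erase b') := by
  rw [sw_comm]; exact nb_sw_fst' h' h

lemma nb_sw_other {x : Fin n} (h1 : x ≠ v) (h2 : x ≠ b) (h3 : x ≠ v') (h4 : x ≠ b') :
    nb (sw G b v b' v') x = nb G x := by
  ext y
  simp only [mem_nb, sw_adj, ne_eq, Sym2.eq_iff]
  grind

lemma dg_sw (h : v ∈ Lf G b b') (h' : v' ∈ Lf G b' b) (x : Fin n) :
    dg (sw G b v b' v') x = dg G x := by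
  have hh := mem_Lf.1 h
  have hh' := mem_Lf.1 h'
  have key : ∀ (A : Finset (Fin n)) (p q : Fin n), p ∈ A → q ∉ A →
      (insert q (A.erase p)).card = A.card := by
    intro A p q hp hq
    rw [card_insert_of_notMem (by simp [hq])]
    exact card_erase_add_one hp
  unfold dg
  by_cases h1 : x = b
  · subst h1
    rw [nb_sw_fst h h', key _ _ _ (mem_nb.2 hh.2.1) (by rw [mem_nb]; exact hh'.2.2)]
  by_cases h2 : x = b'
  · subst h2
    rw [nb_sw_snd h h', key _ _ _ (mem_nb.2 hh'.2.1) (by rw [mem_nb]; exact hh.2.2)]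
  by_cases h3 : x = v
  · subst h3
    rw [nb_sw_fst' h h', key _ _ _ (mem_nb.2 hh.2.1.symm)
      (by rw [mem_nb]; exact fun h => hh.2.2 h.symm)]
  by_cases h4 : x = v'
  · subst h4
    rw [nb_sw_snd' h h', key _ _ _ (mem_nb.2 hh'.2.1.symm)
      (by rw [mem_nb]; exact fun h => hh'.2.2 h.symm)]
  rw [nb_sw_other h3 h1 h4 h2]

lemma sw_pre (h : v ∈ Lf G b b') (h' : v' ∈ Lf G b' b) :
    v' ∈ Lf (sw G b v b' v') b b' ∧ v ∈ Lf (sw G b v b' v') b' b := by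
  have e1 := fun x => (mem_nb (G := sw G b v b' v') (i := b) (j := x)).symm
  have e2 := fun x => (mem_nb (G := sw G b v b' v') (i := b') (j := x)).symm
  have hh := mem_Lf.1 h
  have hh' := mem_Lf.1 h'
  have := hh.2.1.ne
  have := hh'.2.1.ne
  simp only [mem_Lf, e1, e2, nb_sw_fst h h', nb_sw_snd h h', mem_insert, mem_erase, mem_nb]
  grind

lemma sw_sw (h : v ∈ Lf G b b') (h' : v' ∈ Lf G b' b) :
    sw (sw G b v b' v') b v' b' v = G := by
  have hh := mem_Lf.1 h
  have hh' := mem_Lf.1 h'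
  have := hh.2.1.ne
  have := hh'.2.1.ne
  have := hh.2.1.symm
  have := hh'.2.1.symm
  have h4 : ¬ G.Adj v b' := fun h => hh.2.2 h.symm
  have h5 : ¬ G.Adj v' b := fun h => hh'.2.2 h.symm
  ext x y
  simp only [sw_adj, ne_eq, Sym2.eq_iff]
  grind [SimpleGraph.irrefl]
end switch

/-- A hinge move. -/
def Hinge (G G' : SimpleGraph (Fin n)) : Prop :=
  ∃ v b a, G.Adj v b ∧ ¬ G.Adj v a ∧ v ≠ a ∧ G' = hg G v b a

/-- A switch move. -/
def Switch (G G' : SimpleGraph (Fin n)) : Prop :=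
  ∃ b v b' v', v ∈ Lf G b b' ∧ v' ∈ Lf G b' b ∧ G' = sw G b v b' v'

def Step (G G' : SimpleGraph (Fin n)) : Prop := Hinge G G' ∨ Switch G G'

lemma Hinge.symm {G G' : SimpleGraph (Fin n)} (h : Hinge G G') : Hinge G' G := by
  obtain ⟨v, b, a, h1, h2, h3, rfl⟩ := h
  exact ⟨v, a, b, (hg_pre h1 h2 h3).1, (hg_pre h1 h2 h3).2, h1.ne, (hg_hg h1 h2 h3).symm⟩

lemma Switch.symm {G G' : SimpleGraph (Fin n)} (h : Switch G G') : Switch G' G := by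
  obtain ⟨b, v, b', v', h1, h2, rfl⟩ := h
  exact ⟨b, v', b', v, (sw_pre h1 h2).1, (sw_pre h1 h2).2, (sw_sw h1 h2).symm⟩

lemma Step.symm {G G' : SimpleGraph (Fin n)} (h : Step G G') : Step G' G :=
  h.imp Hinge.symm Switch.symm

lemma Switch.dg_eq {G G' : SimpleGraph (Fin n)} (h : Switch G G') (x : Fin n) :
    dg G' x = dg G x := by
  obtain ⟨b, v, b', v', h1, h2, rfl⟩ := h
  exact dg_sw h1 h2 x

/-- Graphs with degree sequence `d`. -/
noncomputable def Om (d : Fin n → ℕ) : Finset (SimpleGraph (Fin n)) :=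
  univ.filter (fun G => ∀ i, dg G i = d i)

lemma mem_Om {d : Fin n → ℕ} {G : SimpleGraph (Fin n)} : G ∈ Om d ↔ ∀ i, dg G i = d i := by
  simp [Om]

lemma Switch.mem_Om {d : Fin n → ℕ} {G G' : SimpleGraph (Fin n)} (h : Switch G G')
    (hG : G ∈ Om d) : G' ∈ Om d := by
  rw [SHF.mem_Om] at *
  intro i
  rw [h.dg_eq, hG]

end SHF

namespace SHF
open Finset
open scoped Classical

section reach
variable {α : Type}

/-- Connected by at most `j` steps of `S` inside `Ω`. -/
def Reach (S : α → α → Prop) (Ω : Finset α) : ℕ → α → α → Prop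
  | 0 => fun x y => x = y
  | j + 1 => fun x y => ∃ z ∈ Ω, (x = z ∨ S x z) ∧ Reach S Ω j z y

variable {S : α → α → Prop} {Ω : Finset α}

lemma Reach.refl {x : α} (hx : x ∈ Ω) : ∀ j, Reach S Ω j x x
  | 0 => rfl
  | j + 1 => ⟨x, hx, Or.inl rfl, Reach.refl hx j⟩

lemma Reach.trans {x y z : α} : ∀ {i j : ℕ}, Reach S Ω i x y → Reach S Ω j y z →
    Reach S Ω (i + j) x z
  | 0, j, h1, h2 => by cases h1; rwa [zero_add]
  | i + 1, j, ⟨w, hw, h, h1⟩, h2 => by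
    rw [Nat.succ_add_eq_add_succ]
    exact ⟨w, hw, h, h1.trans h2⟩

lemma Reach.one {x y : α} (hy : y ∈ Ω) (h : S x y) : Reach S Ω 1 x y :=
  ⟨y, hy, Or.inr h, rfl⟩

/-- Dirichlet form of the moves `S` inside `Ω`. -/
noncomputable def En (S : α → α → Prop) (Ω : Finset α) (f : α → ℝ) : ℝ :=
  ∑ x ∈ Ω, ∑ y ∈ Ω, if S x y then (f x - f y) ^ 2 else 0

lemma En_nonneg (f : α → ℝ) : 0 ≤ En S Ω f :=
  sum_nonneg fun _ _ => sum_nonneg fun _ _ => by split_ifs <;> positivity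

lemma Reach.zero_iff {x y : α} : Reach S Ω 0 x y ↔ x = y := Iff.rfl

variable [Fintype α] {M : ℕ}

lemma reach_card (hM : ∀ x, (univ.filter (fun y => x = y ∨ S x y)).card ≤ M) (x : α) :
    ∀ j, (univ.filter (fun y => Reach S Ω j x y)).card ≤ M ^ j := by
  intro j
  induction j generalizing x with
  | zero =>
    simp only [Reach.zero_iff, pow_zero]
    rw [card_le_one]
    simp only [mem_filter]
    rintro a ⟨_, rfl⟩ b ⟨_, rfl⟩
    rfl
  | succ j ih =>
    have : univ.filter (fun y => Reach S Ω (j + 1) x y) ⊆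
        (univ.filter (fun y => x = y ∨ S x y)).biUnion
          (fun z => univ.filter (fun y => Reach S Ω j z y)) := by
      intro y hy
      rw [mem_filter] at hy
      obtain ⟨_, w, _, h, h1⟩ := hy
      simp only [mem_biUnion, mem_filter, mem_univ, true_and]
      exact ⟨w, h, h1⟩
    refine (card_le_card this).trans (card_biUnion_le.trans ?_)
    refine (sum_le_sum (fun z _ => ih z)).trans ?_
    rw [sum_const, smul_eq_mul, pow_succ']
    exact Nat.mul_le_mul_right _ (hM x)

lemma reach_energy (hS : ∀ x y, S x y → S y x)
    (hM : ∀ x, (univ.filter (fun y => x = y ∨ S x y)).card ≤ M) (f : α → ℝ) (j : ℕ) :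
    ∑ x ∈ Ω, ∑ y ∈ Ω, (if Reach S Ω j x y then (f x - f y) ^ 2 else 0) ≤
      (4 * (M : ℝ)) ^ j * En S Ω f := by
  by_cases hα : Nonempty α
  swap
  · have : IsEmpty α := not_nonempty_iff.1 hα
    have : Ω = ∅ := eq_empty_of_isEmpty Ω
    simp [En, this]
  obtain ⟨x0⟩ := hα
  have hM1 : (1 : ℝ) ≤ M := by
    have : 0 < (univ.filter (fun y => x0 = y ∨ S x0 y)).card :=
      card_pos.2 ⟨x0, by simp⟩
    exact_mod_cast this.trans_le (hM x0)
  have hE : 0 ≤ En S Ω f := En_nonneg f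
  induction j with
  | zero =>
    simp only [Reach.zero_iff, pow_zero, one_mul]
    refine le_trans (le_of_eq ?_) hE
    refine sum_eq_zero fun x _ => sum_eq_zero fun y _ => ?_
    split_ifs with h
    · subst h; simp
    · rfl
  | succ j ih =>
    have h1 : ∀ x ∈ Ω, ∀ y ∈ Ω, (if Reach S Ω (j + 1) x y then (f x - f y) ^ 2 else 0) ≤
        ∑ z ∈ Ω, if (x = z ∨ S x z) ∧ Reach S Ω j z y then
          (2 * (f x - f z) ^ 2 + 2 * (f z - f y) ^ 2) else 0 := by
      intro x _ y _
      have hnn : ∀ z ∈ Ω, 0 ≤ if (x = z ∨ S x z) ∧ Reach S Ω j z y then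
          (2 * (f x - f z) ^ 2 + 2 * (f z - f y) ^ 2) else 0 := by
        intro z _
        split_ifs <;> positivity
      split_ifs with h
      · obtain ⟨z, hz, h2, h3⟩ := h
        refine le_trans ?_ (single_le_sum hnn hz)
        rw [if_pos ⟨h2, h3⟩]
        nlinarith [sq_nonneg ((f x - f z) - (f z - f y))]
      · exact sum_nonneg hnn
    have h2 : ∀ x z y, (if (x = z ∨ S x z) ∧ Reach S Ω j z y then
          (2 * (f x - f z) ^ 2 + 2 * (f z - f y) ^ 2) else 0) =
        2 * ((if S x z then (f x - f z) ^ 2 else 0) * (if Reach S Ω j z y then 1 else 0)) +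
        2 * ((if Reach S Ω j z y then (f z - f y) ^ 2 else 0) *
          (if z = x ∨ S z x then 1 else 0)) := by
      intro x z y
      have e : (z = x ∨ S z x) ↔ (x = z ∨ S x z) := by
        constructor
        · rintro (h | h)
          · exact Or.inl h.symm
          · exact Or.inr (hS _ _ h)
        · rintro (h | h)
          · exact Or.inl h.symm
          · exact Or.inr (hS _ _ h)
      simp only [e]
      by_cases a : x = z
      · subst a; by_cases b : Reach S Ω j x y <;> simp [b]
      · by_cases a' : S x z <;> by_cases b : Reach S Ω j z y <;> simp [a, a', b]
    have hcard : ∀ z, (∑ y ∈ Ω, if Reach S Ω j z y then (1 : ℝ) else 0) ≤ (M : ℝ) ^ j := by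
      intro z
      rw [sum_boole]
      refine le_trans ?_ (by exact_mod_cast reach_card (Ω := Ω) hM z j :
        ((univ.filter (fun y => Reach S Ω j z y)).card : ℝ) ≤ (M : ℝ) ^ j)
      exact_mod_cast card_le_card (filter_subset_filter _ (subset_univ _))
    have hcard' : ∀ z, (∑ y ∈ Ω, if z = y ∨ S z y then (1 : ℝ) else 0) ≤ (M : ℝ) := by
      intro z
      rw [sum_boole]
      refine le_trans ?_ (by exact_mod_cast hM z :
        ((univ.filter (fun y => z = y ∨ S z y)).card : ℝ) ≤ (M : ℝ))
      exact_mod_cast card_le_card (filter_subset_filter _ (subset_univ _))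
    calc _ ≤ ∑ x ∈ Ω, ∑ y ∈ Ω, ∑ z ∈ Ω, (if (x = z ∨ S x z) ∧ Reach S Ω j z y then
          (2 * (f x - f z) ^ 2 + 2 * (f z - f y) ^ 2) else 0) :=
          sum_le_sum fun x hx => sum_le_sum fun y hy => h1 x hx y hy
      _ = 2 * (∑ x ∈ Ω, ∑ z ∈ Ω, (if S x z then (f x - f z) ^ 2 else 0) *
            ∑ y ∈ Ω, (if Reach S Ω j z y then 1 else 0)) +
          2 * (∑ z ∈ Ω, ∑ y ∈ Ω, (if Reach S Ω j z y then (f z - f y) ^ 2 else 0) *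
            ∑ x ∈ Ω, (if z = x ∨ S z x then 1 else 0)) := by
          simp only [h2, sum_add_distrib, mul_sum]
          congr 1
          · refine sum_congr rfl fun x _ => ?_
            exact sum_comm
          · calc _ = ∑ x ∈ Ω, ∑ z ∈ Ω, ∑ y ∈ Ω, 2 *
                ((if Reach S Ω j z y then (f z - f y) ^ 2 else 0) *
                  (if z = x ∨ S z x then 1 else 0)) := by
                  refine sum_congr rfl fun x _ => ?_
                  exact sum_comm
              _ = _ := by
                  rw [sum_comm]
                  refine sum_congr rfl fun z _ => ?_
                  exact sum_comm
      _ ≤ 2 * (∑ x ∈ Ω, ∑ z ∈ Ω, (if S x z then (f x - f z) ^ 2 else 0) * (M : ℝ) ^ j) +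
          2 * (∑ z ∈ Ω, ∑ y ∈ Ω, (if Reach S Ω j z y then (f z - f y) ^ 2 else 0) * M) := by
          gcongr with x _ z _ z _ y _
          · exact hcard _
          · exact hcard' _
      _ = 2 * (M : ℝ) ^ j * En S Ω f + 2 * M *
            (∑ z ∈ Ω, ∑ y ∈ Ω, (if Reach S Ω j z y then (f z - f y) ^ 2 else 0)) := by
          simp only [← sum_mul, En]; ring
      _ ≤ 2 * (M : ℝ) ^ j * En S Ω f + 2 * M * ((4 * (M : ℝ)) ^ j * En S Ω f) := by gcongr
      _ ≤ _ := by
          have a1 : (M : ℝ) ^ j ≤ (4 * (M : ℝ)) ^ j := by gcongr; linarith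
          have a2 : (M : ℝ) ^ j * En S Ω f ≤ M * ((4 * (M : ℝ)) ^ j * En S Ω f) := by
            have : 0 ≤ (4 * (M : ℝ)) ^ j * En S Ω f := by positivity
            nlinarith [mul_le_mul_of_nonneg_right a1 hE]
          rw [pow_succ]
          nlinarith
end reach

variable {n : ℕ}

lemma step_card (hn : 1 ≤ n) (G : SimpleGraph (Fin n)) :
    (univ.filter (fun G' => G = G' ∨ Step G G')).card ≤ 3 * n ^ 4 := by
  have hsub : univ.filter (fun G' => G = G' ∨ Step G G') ⊆
      {G} ∪ (univ.image (fun t : Fin n × Fin n × Fin n => hg G t.1 t.2.1 t.2.2) ∪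
        univ.image (fun t : Fin n × Fin n × Fin n × Fin n => sw G t.1 t.2.1 t.2.2.1 t.2.2.2)) := by
    intro G' h
    rw [mem_filter] at h
    simp only [mem_union, mem_image, mem_singleton, mem_univ, true_and]
    rcases h.2 with h | ⟨v, b, a, _, _, _, h⟩ | ⟨b, v, b', v', _, _, h⟩
    · exact Or.inl h.symm
    · exact Or.inr (Or.inl ⟨(v, b, a), h.symm⟩)
    · exact Or.inr (Or.inr ⟨(b, v, b', v'), h.symm⟩)
  have h3 : n ^ 3 ≤ n ^ 4 := Nat.pow_le_pow_right hn (by norm_num)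
  have h4 : 1 ≤ n ^ 4 := Nat.one_le_pow _ _ hn
  have e1 : (univ.image (fun t : Fin n × Fin n × Fin n => hg G t.1 t.2.1 t.2.2)).card ≤ n ^ 3 := by
    refine card_image_le.trans (le_of_eq ?_)
    simp [card_univ]; ring
  have e2 : (univ.image (fun t : Fin n × Fin n × Fin n × Fin n =>
      sw G t.1 t.2.1 t.2.2.1 t.2.2.2)).card ≤ n ^ 4 := by
    refine card_image_le.trans (le_of_eq ?_)
    simp [card_univ]; ring
  have := card_le_card hsub
  have u1 := card_union_le {G} (univ.image (fun t : Fin n × Fin n × Fin n => hg G t.1 t.2.1 t.2.2) ∪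
        univ.image (fun t : Fin n × Fin n × Fin n × Fin n => sw G t.1 t.2.1 t.2.2.1 t.2.2.2))
  have u2 := card_union_le (univ.image (fun t : Fin n × Fin n × Fin n => hg G t.1 t.2.1 t.2.2))
        (univ.image (fun t : Fin n × Fin n × Fin n × Fin n => sw G t.1 t.2.1 t.2.2.1 t.2.2.2))
  rw [card_singleton] at u1
  omega

/-- Ordered pairs on which two graphs differ. -/
noncomputable def Df (G G' : SimpleGraph (Fin n)) : Finset (Fin n × Fin n) :=
  univ.filter (fun p => ¬ (G.Adj p.1 p.2 ↔ G'.Adj p.1 p.2))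

lemma mem_Df {G G' : SimpleGraph (Fin n)} {p : Fin n × Fin n} :
    p ∈ Df G G' ↔ ¬ (G.Adj p.1 p.2 ↔ G'.Adj p.1 p.2) := by simp [Df]

lemma Df_comm (G G' : SimpleGraph (Fin n)) : Df G G' = Df G' G := by
  ext p; simp only [mem_Df]; tauto

lemma Df_triangle (G G' G'' : SimpleGraph (Fin n)) :
    (Df G G'').card ≤ (Df G G').card + (Df G' G'').card := by
  refine (card_le_card ?_).trans (card_union_le _ _)
  intro p
  simp only [mem_union, mem_Df]
  tauto

lemma Df_eq_zero {G G' : SimpleGraph (Fin n)} (h : (Df G G').card = 0) : G = G' := by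
  rw [card_eq_zero] at h
  ext x y
  by_contra hc
  have : (x, y) ∈ Df G G' := mem_Df.2 hc
  rw [h] at this
  simp at this

lemma Df_hinge {G G' : SimpleGraph (Fin n)} (h : Hinge G G') : (Df G G').card ≤ 4 := by
  obtain ⟨v, b, a, h1, h2, h3, rfl⟩ := h
  have : Df G (hg G v b a) ⊆ {(v, b), (b, v), (v, a), (a, v)} := by
    rintro ⟨x, y⟩
    simp only [mem_Df, hg_adj, mem_insert, mem_singleton, Prod.mk.injEq, ne_eq, Sym2.eq_iff]
    have := @SimpleGraph.Adj.ne _ G x y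
    grind
  exact (card_le_card this).trans card_le_four

lemma Df_switch {G G' : SimpleGraph (Fin n)} (h : Switch G G') : (Df G G').card ≤ 8 := by
  obtain ⟨b, v, b', v', h1, h2, rfl⟩ := h
  have : Df G (sw G b v b' v') ⊆ {(v, b), (b, v), (v', b'), (b', v')} ∪
      {(v, b'), (b', v), (v', b), (b, v')} := by
    rintro ⟨x, y⟩
    simp only [mem_Df, sw_adj, mem_union, mem_insert, mem_singleton, Prod.mk.injEq, ne_eq,
      Sym2.eq_iff]
    have := @SimpleGraph.Adj.ne _ G x y
    grind
  refine (card_le_card this).trans ((card_union_le _ _).trans ?_)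
  exact add_le_add card_le_four card_le_four

/-- Neighbours in `G` but not in `G'`. -/
noncomputable def Rd (G G' : SimpleGraph (Fin n)) (x : Fin n) : Finset (Fin n) := nb G x \ nb G' x

lemma mem_Rd {G G' : SimpleGraph (Fin n)} {x y : Fin n} :
    y ∈ Rd G G' x ↔ G.Adj x y ∧ ¬ G'.Adj x y := by simp [Rd, mem_nb]

lemma Rd_card {G G' : SimpleGraph (Fin n)} (h : ∀ x, dg G x = dg G' x) (x : Fin n) :
    (Rd G G' x).card = (Rd G' G x).card := by
  unfold Rd
  exact card_sdiff_comm (h x)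

lemma sw_diff {G G' : SimpleGraph (Fin n)} {v w x y : Fin n} (h1 : v ∈ Lf G w y)
    (h2 : x ∈ Lf G y w) (g1 : ¬ G'.Adj w v) (g2 : G'.Adj y x → G'.Adj y v) (g3 : G'.Adj w x) :
    (Df (sw G w v y x) G').card < (Df G G').card := by
  have hh1 := mem_Lf.1 h1
  have hh2 := mem_Lf.1 h2
  have n1 := hh1.2.1.ne
  have n2 := hh2.2.1.ne
  have n3 : v ≠ x := by rintro rfl; exact hh2.2.2 hh1.2.1
  have n4 : w ≠ y := by rintro rfl; exact hh2.2.2 hh2.2.1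
  have s1 := hh1.2.1.symm
  have s2 := hh2.2.1.symm
  have s3 := g3.symm
  have t1 : ¬ G.Adj v y := fun h => hh1.2.2 h.symm
  have t2 : ¬ G.Adj x w := fun h => hh2.2.2 h.symm
  have t3 : ¬ G'.Adj v w := fun h => g1 h.symm
  have hin : ({(w, v), (v, w), (w, x), (x, w)} : Finset (Fin n × Fin n)) ⊆ Df G G' := by
    intro p hp
    simp only [mem_insert, mem_singleton] at hp
    rw [mem_Df]
    rcases hp with rfl | rfl | rfl | rfl <;> simp_all
  have hc : ({(w, v), (v, w), (w, x), (x, w)} : Finset (Fin n × Fin n)).card = 4 := by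
    rw [card_insert_of_notMem, card_insert_of_notMem, card_insert_of_notMem, card_singleton] <;>
    simp only [mem_insert, mem_singleton, Prod.mk.injEq] <;> grind
  have hcount : ∀ z : Fin n, Df (sw G w v y x) G' ⊆
      (Df G G' \ {(w, v), (v, w), (w, x), (x, w)}) ∪ {(y, z), (z, y)} →
      (Df (sw G w v y x) G').card < (Df G G').card := by
    intro z hsub
    have l1 := card_le_card hsub
    have l2 := card_union_le (Df G G' \ {(w, v), (v, w), (w, x), (x, w)}) {(y, z), (z, y)}
    have l3 : ({(y, z), (z, y)} : Finset (Fin n × Fin n)).card ≤ 2 := card_le_two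
    rw [card_sdiff_of_subset hin, hc] at l2
    have := card_le_card hin
    omega
  by_cases hyv : G'.Adj y v
  · have s4 := hyv.symm
    apply hcount x
    rintro ⟨p, q⟩
    simp only [mem_Df, sw_adj, mem_union, mem_sdiff, mem_insert, mem_singleton, Prod.mk.injEq,
      ne_eq, Sym2.eq_iff]
    grind [SimpleGraph.irrefl]
  · have t4 : ¬ G'.Adj y x := fun h => hyv (g2 h)
    have t5 : ¬ G'.Adj x y := fun h => t4 h.symm
    apply hcount v
    rintro ⟨p, q⟩
    simp only [mem_Df, sw_adj, mem_union, mem_sdiff, mem_insert, mem_singleton, Prod.mk.injEq,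
      ne_eq, Sym2.eq_iff]
    grind [SimpleGraph.irrefl]

lemma red_card_lt {G G' : SimpleGraph (Fin n)}
    (hno : ∀ G1, Switch G G1 → ¬ (Df G1 G').card < (Df G G').card)
    (hno' : ∀ G1, Switch G' G1 → ¬ (Df G1 G).card < (Df G G').card)
    {v w x : Fin n} (hv : v ∈ Rd G G' w) (hx : x ∈ Rd G' G w) :
    (Rd G G' x).card < (Rd G G' v).card := by
  have key : ∀ y ∈ Rd G G' x, y ≠ v → y ∈ Rd G G' v := by
    intro y hy hyv
    rw [mem_Rd] at hv hx hy ⊢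
    have hwy : w ≠ y := by rintro rfl; exact hx.2 hy.1.symm
    by_contra hc
    by_cases h : G.Adj v y
    · have h' : G'.Adj v y := by by_contra h'; exact hc ⟨h, h'⟩
      have a1 : x ∈ Lf G' w y := mem_Lf.2 ⟨hy.1.ne, hx.1, fun h => hy.2 h.symm⟩
      have a2 : v ∈ Lf G' y w := mem_Lf.2 ⟨hv.1.ne', h'.symm, hv.2⟩
      refine hno' (sw G' w x y v) ⟨w, x, y, v, a1, a2, rfl⟩ ?_
      rw [Df_comm G G']
      exact sw_diff a1 a2 hx.2 (fun _ => hy.1.symm) hv.1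
    · have a1 : v ∈ Lf G w y := mem_Lf.2 ⟨hyv.symm, hv.1, fun h' => h h'.symm⟩
      have a2 : x ∈ Lf G y w := mem_Lf.2 ⟨hx.1.ne', hy.1.symm, hx.2⟩
      exact hno (sw G w v y x) ⟨w, v, y, x, a1, a2, rfl⟩
        (sw_diff a1 a2 hv.2 (fun h => absurd h.symm hy.2) hx.1)
  rw [mem_Rd] at hv hx
  have hw : w ∈ Rd G G' v := mem_Rd.2 ⟨hv.1.symm, fun h => hv.2 h.symm⟩
  have hw' : w ∉ Rd G G' x := fun h => hx.2 (mem_Rd.1 h).1.symm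
  by_cases hvx : v ∈ Rd G G' x
  · have hxv : x ∈ Rd G G' v := by
      rw [mem_Rd] at hvx ⊢
      exact ⟨hvx.1.symm, fun h => hvx.2 h.symm⟩
    have hxx : x ∉ Rd G G' x := fun h => (mem_Rd.1 h).1.ne rfl
    have hsub : insert w (insert x ((Rd G G' x).erase v)) ⊆ Rd G G' v := by
      intro y hy
      simp only [mem_insert, mem_erase] at hy
      rcases hy with rfl | rfl | ⟨h1, h2⟩
      · exact hw
      · exact hxv
      · exact key y h2 h1
    have hwx : w ≠ x := hx.1.ne
    have := card_le_card hsub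
    rw [card_insert_of_notMem (by simp [hwx, hw']), card_insert_of_notMem (by simp [hxx])] at this
    have := card_erase_add_one hvx
    omega
  · have hsub : insert w (Rd G G' x) ⊆ Rd G G' v := by
      intro y hy
      simp only [mem_insert] at hy
      rcases hy with rfl | h
      · exact hw
      · exact key y h (by rintro rfl; exact hvx h)
    have := card_le_card hsub
    rw [card_insert_of_notMem hw'] at this
    omega

lemma switch_reduce {G G' : SimpleGraph (Fin n)} (hd : ∀ x, dg G x = dg G' x) (hne : G ≠ G') :
    (∃ G1, Switch G G1 ∧ (Df G1 G').card < (Df G G').card) ∨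
    (∃ G1, Switch G' G1 ∧ (Df G1 G).card < (Df G G').card) := by
  by_contra hc
  push Not at hc
  have hno : ∀ G1, Switch G G1 → ¬ (Df G1 G').card < (Df G G').card :=
    fun G1 h => not_lt.2 (hc.1 G1 h)
  have hno' : ∀ G1, Switch G' G1 → ¬ (Df G1 G).card < (Df G G').card :=
    fun G1 h => not_lt.2 (hc.2 G1 h)
  have hw : ∃ w, (Rd G G' w).Nonempty := by
    by_contra hw
    push Not at hw
    apply hne
    have hw' : ∀ w, Rd G' G w = ∅ := fun w => by
      rw [← card_eq_zero, ← Rd_card hd, hw w, card_empty]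
    ext x y
    constructor
    · intro h
      by_contra h'
      have := mem_Rd.2 ⟨h, h'⟩
      simp [hw] at this
    · intro h
      by_contra h'
      have := mem_Rd.2 ⟨h, h'⟩
      simp [hw'] at this
  obtain ⟨w, v, hv⟩ := hw
  have : (Rd G' G w).Nonempty := by
    rw [← card_pos, ← Rd_card hd]
    exact card_pos.2 ⟨v, hv⟩
  obtain ⟨x, hx⟩ := this
  have l1 := red_card_lt hno hno' hv hx
  rw [Df_comm] at hno hno'
  have l2 := red_card_lt (G := G') (G' := G) hno' hno hx hv
  rw [Rd_card hd, Rd_card hd v] at l1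
  omega

lemma reach_of_Df {d : Fin n → ℕ} (k : ℕ) : ∀ {G G' : SimpleGraph (Fin n)}, G ∈ Om d → G' ∈ Om d →
    (Df G G').card ≤ k → Reach Step (Om d) k G G' := by
  induction k with
  | zero =>
    intro G G' _ _ h
    exact Df_eq_zero (Nat.le_zero.1 h)
  | succ k ih =>
    intro G G' h1 h2 h
    by_cases hne : G = G'
    · subst hne; exact Reach.refl h1 _
    have hd : ∀ x, dg G x = dg G' x := fun x => by rw [mem_Om.1 h1, mem_Om.1 h2]
    rcases switch_reduce hd hne with ⟨G1, hs, hlt⟩ | ⟨G1, hs, hlt⟩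
    · exact ⟨G1, hs.mem_Om h1, Or.inr (Or.inr hs), ih (hs.mem_Om h1) h2 (by omega)⟩
    · refine Reach.trans (ih h1 (hs.mem_Om h2) ?_) (j := 1) (Reach.one h2 (Or.inr hs.symm))
      rw [Df_comm]; omega

end SHF

namespace SHF
open Finset
open scoped Classical

variable {n : ℕ}

lemma exists_hinge_after_switch {G : SimpleGraph (Fin n)} {Δ δ e : ℕ} {i j : Fin n} (hij : i ≠ j)
    (hΔ : ∀ x, dg G x ≤ Δ) (hδ : (univ.filter (fun x => dg G x < δ)).card ≤ e)
    (hw : δ ≤ dg G j) (hj1 : 1 ≤ dg G j)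
    (hnum : (Δ + 1) * (Δ + 1 - δ) < (n - (Δ + 2 + e)) * δ) :
    ∃ G1, (G = G1 ∨ Switch G G1) ∧ ∃ x, G1.Adj x j ∧ ¬ G1.Adj x i ∧ x ≠ i := by
  by_contra hc
  push Not at hc
  have h0 : ∀ x, G.Adj x j → ¬ G.Adj x i → x = i := hc G (Or.inl rfl)
  have h1 : ∀ x, x ≠ i → x ≠ j → ¬ G.Adj x i → ∀ y, G.Adj x y → ∀ x', G.Adj j x' → x' ≠ y →
      G.Adj x' y := by
    intro x hxi hxj hx y hy x' hx' hne
    by_contra hcc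
    have hnj : ¬ G.Adj x j := fun h => hxi (h0 x h hx)
    have a1 : y ∈ Lf G x x' := mem_Lf.2 ⟨hne.symm, hy, hcc⟩
    have a2 : j ∈ Lf G x' x := mem_Lf.2 ⟨hxj.symm, hx'.symm, hnj⟩
    refine hxi (hc (sw G x y x' j) (Or.inr ⟨x, y, x', j, a1, a2, rfl⟩) x ?_ ?_)
    · rw [sw_adj]; exact Or.inr ⟨Or.inl rfl, hxj⟩
    · rw [sw_adj]
      rintro (h | ⟨h | h, _⟩)
      · exact hx h.1
      · rw [Sym2.eq_iff] at h
        rcases h with h | h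
        · exact hij h.2
        · exact hxj h.1
      · rw [Sym2.eq_iff] at h
        rcases h with h | h
        · apply hnj; rw [h.1]; exact hx'.symm
        · exact hy.ne h.1
  set B0 : Finset (Fin n) := univ.filter (fun x => x ≠ i ∧ x ≠ j ∧ ¬ G.Adj x i) with hB0
  set A1 : Finset (Fin n) := univ.filter (fun y => y = i ∨ ∃ x ∈ B0, G.Adj x y) with hA1
  have hA : ∀ y ∈ A1, ∀ x', G.Adj j x' → x' ≠ y → G.Adj x' y := by
    intro y hy x' hx' hne
    rw [hA1, mem_filter] at hy
    rcases hy.2 with rfl | ⟨x, hx, hxy⟩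
    · by_contra hcc
      exact hne (h0 x' hx'.symm hcc)
    · rw [hB0, mem_filter] at hx
      exact h1 x hx.2.1 hx.2.2.1 hx.2.2.2 y hxy x' hx' hne
  have hA1card : A1.card ≤ Δ + 1 := by
    obtain ⟨x', hx'⟩ := card_pos.1 (lt_of_lt_of_le Nat.zero_lt_one hj1)
    rw [mem_nb] at hx'
    have : A1 ⊆ insert x' (nb G x') := by
      intro y hy
      rw [mem_insert, mem_nb]
      by_cases h : x' = y
      · exact Or.inl h.symm
      · exact Or.inr (hA y hy x' hx' h)
    exact (card_le_card this).trans ((card_insert_le _ _).trans (Nat.add_le_add_right (hΔ x') 1))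
  have hB0card : n ≤ B0.card + (Δ + 2) := by
    have : (univ : Finset (Fin n)) ⊆ B0 ∪ (nb G i ∪ {i, j}) := by
      intro x _
      simp only [hB0, mem_union, mem_filter, mem_univ, true_and, mem_nb, mem_insert, mem_singleton]
      by_cases h : G.Adj x i
      · exact Or.inr (Or.inl h.symm)
      · tauto
    have := card_le_card this
    rw [card_univ, Fintype.card_fin] at this
    have u1 := card_union_le B0 (nb G i ∪ {i, j})
    have u2 := card_union_le (nb G i) {i, j}
    have u3 : ({i, j} : Finset (Fin n)).card ≤ 2 := card_le_two
    have := hΔ i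
    unfold dg at this
    omega
  have hdisj : ∀ y ∈ A1, dg G j + (nb G y ∩ B0).card ≤ Δ + 1 := by
    intro y hy
    have hd : Disjoint ((nb G j).erase y) (nb G y ∩ B0) := by
      rw [disjoint_left]
      intro z hz hz'
      simp only [mem_erase, mem_nb] at hz
      simp only [hB0, mem_inter, mem_filter] at hz'
      exact hz'.2.2.1 (h0 z hz.2.symm hz'.2.2.2.2)
    have hs : ((nb G j).erase y) ∪ (nb G y ∩ B0) ⊆ nb G y := by
      intro z hz
      simp only [mem_union, mem_erase, mem_inter, mem_nb] at hz ⊢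
      rcases hz with hz | hz
      · exact (hA y hy z hz.2 hz.1).symm
      · exact hz.1
    have := card_le_card hs
    rw [card_union_of_disjoint hd] at this
    have h3 := pred_card_le_card_erase (s := nb G j) (a := y)
    have h4 := hΔ y
    unfold dg at h4 ⊢
    omega
  have hdc : ∑ y ∈ A1, (nb G y ∩ B0).card = ∑ x ∈ B0, dg G x := by
    calc _ = ∑ y ∈ A1, ∑ x ∈ B0, if G.Adj x y then 1 else 0 := by
          refine sum_congr rfl fun y _ => ?_
          rw [← sum_filter, sum_const, smul_eq_mul, mul_one]
          congr 1
          ext z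
          simp only [mem_inter, mem_nb, mem_filter]
          constructor
          · rintro ⟨a, b⟩; exact ⟨b, a.symm⟩
          · rintro ⟨a, b⟩; exact ⟨b.symm, a⟩
      _ = ∑ x ∈ B0, ∑ y ∈ A1, if G.Adj x y then 1 else 0 := sum_comm
      _ = _ := by
          refine sum_congr rfl fun x hx => ?_
          rw [← sum_filter, sum_const, smul_eq_mul, mul_one]
          unfold dg
          congr 1
          ext z
          simp only [mem_nb, mem_filter]
          constructor
          · rintro ⟨_, b⟩; exact b
          · intro b
            exact ⟨by rw [hA1, mem_filter]; exact ⟨mem_univ _, Or.inr ⟨x, hx, b⟩⟩, b⟩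
  have hlow : (n - (Δ + 2 + e)) * δ ≤ ∑ x ∈ B0, dg G x := by
    have hcard : n - (Δ + 2 + e) ≤ (B0.filter (fun x => ¬ dg G x < δ)).card := by
      have s1 := card_filter_add_card_filter_not (s := B0) (fun x => dg G x < δ)
      have s2 : (B0.filter (fun x => dg G x < δ)).card ≤ e :=
        (card_le_card (filter_subset_filter _ (subset_univ _))).trans hδ
      omega
    calc (n - (Δ + 2 + e)) * δ ≤ (B0.filter (fun x => ¬ dg G x < δ)).card * δ :=
          Nat.mul_le_mul_right _ hcard
      _ = ∑ x ∈ B0.filter (fun x => ¬ dg G x < δ), δ := by simp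
      _ ≤ ∑ x ∈ B0.filter (fun x => ¬ dg G x < δ), dg G x := by
          refine sum_le_sum fun x hx => ?_
          rw [mem_filter] at hx
          omega
      _ ≤ _ := sum_le_sum_of_subset (filter_subset _ _)
  have hup : ∑ y ∈ A1, (nb G y ∩ B0).card ≤ A1.card * (Δ + 1 - δ) := by
    rw [← smul_eq_mul]
    refine sum_le_card_nsmul _ _ _ fun y hy => ?_
    have := hdisj y hy
    omega
  have : A1.card * (Δ + 1 - δ) ≤ (Δ + 1) * (Δ + 1 - δ) := Nat.mul_le_mul_right _ hA1card
  omega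

/-- Numerical condition guaranteeing that degrees can be moved around freely. -/
def Num (n lo hi : ℕ) : Prop := 1 ≤ lo ∧ (hi + 2) * (hi + 2 - lo) < (n - (hi + 4)) * lo

lemma Num.lt {lo hi : ℕ} (h : Num n lo hi) : hi + 4 < n := by
  by_contra hc
  have : n - (hi + 4) = 0 := by omega
  have h2 := h.2
  rw [this, zero_mul] at h2
  omega

lemma transfer {lo hi : ℕ} (hN : Num n lo hi) {d : Fin n → ℕ} (hlo : ∀ x, lo ≤ d x)
    (hhi : ∀ x, d x ≤ hi) {G : SimpleGraph (Fin n)} {i j : Fin n}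
    (hG : ∀ x, dg G x + (if x = i then 1 else 0) = d x + (if x = j then 1 else 0)) :
    ∃ G' ∈ Om d, (Df G G').card ≤ 12 := by
  by_cases hij : i = j
  · subst hij
    refine ⟨G, mem_Om.2 fun x => ?_, ?_⟩
    · have := hG x; omega
    · have : Df G G = ∅ := by ext p; simp [mem_Df]
      rw [this]; simp
  have h1 : ∀ x, dg G x ≤ hi + 1 := by
    intro x
    have := hG x
    have := hhi x
    split_ifs at * <;> omega
  have h2 : (univ.filter (fun x => dg G x < lo)).card ≤ 1 := by
    have : univ.filter (fun x => dg G x < lo) ⊆ {i} := by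
      intro x hx
      rw [mem_filter] at hx
      rw [mem_singleton]
      by_contra hxi
      have h3 := hG x
      have h4 := hlo x
      rw [if_neg hxi] at h3
      omega
    exact (card_le_card this).trans (by simp)
  have h3 : lo ≤ dg G j := by
    have h3 := hG j
    have h4 := hlo j
    rw [if_neg (Ne.symm hij), if_pos rfl] at h3
    omega
  obtain ⟨G1, hG1, x, hx1, hx2, hx3⟩ := exists_hinge_after_switch (Δ := hi + 1) (δ := lo) (e := 1)
    hij h1 h2 h3 (hN.1.trans h3) (by
      have := hN.2
      have e : hi + 1 + 2 + 1 = hi + 4 := by omega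
      rw [e]; exact this)
  have hd1 : ∀ y, dg G1 y = dg G y := by
    rcases hG1 with rfl | h
    · intro y; rfl
    · exact h.dg_eq
  refine ⟨hg G1 x j i, mem_Om.2 fun y => ?_, ?_⟩
  · have a := dg_hg hx1 hx2 hx3 y
    rw [hd1] at a
    have b := hG y
    omega
  · have a : (Df G G1).card ≤ 8 := by
      rcases hG1 with rfl | h
      · have : Df G G = ∅ := by ext p; simp [mem_Df]
        rw [this]; simp
      · exact Df_switch h
    have b := Df_hinge ⟨x, j, i, hx1, hx2, hx3, rfl⟩
    have c := Df_triangle G G1 (hg G1 x j i)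
    omega

lemma sum_dg_even (G : SimpleGraph (Fin n)) : Even (∑ x, dg G x) := by
  have : ∀ x, dg G x = G.degree x := by
    intro x
    rw [← SimpleGraph.card_neighborFinset_eq_degree]
    unfold dg
    congr 1
    ext y; simp [mem_nb]
  simp only [this]
  rw [SimpleGraph.sum_degrees_eq_twice_card_edges]
  exact even_two_mul _

/-- Adding one edge. -/
def ae (G : SimpleGraph (Fin n)) (i y : Fin n) : SimpleGraph (Fin n) where
  Adj p q := G.Adj p q ∨ (s(p, q) = s(i, y) ∧ p ≠ q)
  symm := by
    constructor
    intro p q h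
    rw [Sym2.eq_swap (a := q)]
    exact h.imp (fun h => h.symm) (fun h => ⟨h.1, h.2.symm⟩)
  loopless := by
    constructor
    intro p h
    rcases h with h | h
    · exact h.ne rfl
    · exact h.2 rfl

/-- Removing one edge. -/
def re (G : SimpleGraph (Fin n)) (i y : Fin n) : SimpleGraph (Fin n) where
  Adj p q := G.Adj p q ∧ s(p, q) ≠ s(i, y)
  symm := by
    constructor
    intro p q h
    rw [Sym2.eq_swap (a := q)]
    exact ⟨h.1.symm, h.2⟩
  loopless := by
    constructor
    intro p h
    exact h.1.ne rfl

lemma ae_adj {G : SimpleGraph (Fin n)} {i y p q : Fin n} : (ae G i y).Adj p q ↔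
    G.Adj p q ∨ (s(p, q) = s(i, y) ∧ p ≠ q) := Iff.rfl

lemma re_adj {G : SimpleGraph (Fin n)} {i y p q : Fin n} : (re G i y).Adj p q ↔
    G.Adj p q ∧ s(p, q) ≠ s(i, y) := Iff.rfl

lemma dg_ae {G : SimpleGraph (Fin n)} {i y : Fin n} (h : ¬ G.Adj i y) (hne : i ≠ y) (x : Fin n) :
    dg (ae G i y) x = dg G x + (if x = i then 1 else 0) + (if x = y then 1 else 0) := by
  have h' : ¬ G.Adj y i := fun hh => h hh.symm
  unfold dg
  by_cases h1 : x = i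
  · subst h1
    have : nb (ae G x y) x = insert y (nb G x) := by
      ext z; simp only [mem_nb, ae_adj, mem_insert, Sym2.eq_iff]; grind
    rw [this, card_insert_of_notMem (by rwa [mem_nb]), if_pos rfl, if_neg hne]
  by_cases h2 : x = y
  · subst h2
    have : nb (ae G i x) x = insert i (nb G x) := by
      ext z; simp only [mem_nb, ae_adj, mem_insert, Sym2.eq_iff]; grind
    rw [this, card_insert_of_notMem (by rwa [mem_nb]), if_pos rfl, if_neg hne.symm]
  · have : nb (ae G i y) x = nb G x := by
      ext z; simp only [mem_nb, ae_adj, Sym2.eq_iff]; grind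
    rw [this, if_neg h1, if_neg h2, add_zero, add_zero]

lemma re_ae {G : SimpleGraph (Fin n)} {i y : Fin n} (h : G.Adj i y) : ae (re G i y) i y = G := by
  have h' := h.symm
  have hne := h.ne
  ext p q
  simp only [ae_adj, re_adj, ne_eq, Sym2.eq_iff]
  have := @SimpleGraph.Adj.ne _ G p q
  grind

lemma dg_re {G : SimpleGraph (Fin n)} {i y : Fin n} (h : G.Adj i y) (x : Fin n) :
    dg G x = dg (re G i y) x + (if x = i then 1 else 0) + (if x = y then 1 else 0) := by
  have := dg_ae (G := re G i y) (i := i) (y := y) (by rw [re_adj]; simp) h.ne x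
  rwa [re_ae h] at this

lemma Df_ae (G : SimpleGraph (Fin n)) (i y : Fin n) : (Df G (ae G i y)).card ≤ 2 := by
  have : Df G (ae G i y) ⊆ {(i, y), (y, i)} := by
    rintro ⟨p, q⟩
    simp only [mem_Df, ae_adj, mem_insert, mem_singleton, Prod.mk.injEq, Sym2.eq_iff]
    grind
  exact (card_le_card this).trans card_le_two

lemma Df_re (G : SimpleGraph (Fin n)) (i y : Fin n) : (Df G (re G i y)).card ≤ 2 := by
  have : Df G (re G i y) ⊆ {(i, y), (y, i)} := by
    rintro ⟨p, q⟩
    simp only [mem_Df, re_adj, mem_insert, mem_singleton, Prod.mk.injEq, ne_eq, Sym2.eq_iff]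
    grind
  exact (card_le_card this).trans card_le_two

lemma repair {lo hi : ℕ} (hN : Num n lo hi) {d : Fin n → ℕ} (hlo : ∀ x, lo ≤ d x)
    (hhi : ∀ x, d x ≤ hi) (hev : Even (∑ x, d x)) {G : SimpleGraph (Fin n)} {i j : Fin n}
    (hG : ∀ x, |(dg G x : ℤ) - d x| ≤ (if x = i then 1 else 0) + (if x = j then 1 else 0)) :
    ∃ G' ∈ Om d, (Df G G').card ≤ 14 := by
  have hplus : (∀ x, dg G x = d x + (if x = i then 1 else 0) + (if x = j then 1 else 0)) →
      ∃ G' ∈ Om d, (Df G G').card ≤ 14 := by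
    intro h
    have : 0 < dg G i := by
      have := h i; rw [if_pos rfl] at this; omega
    obtain ⟨y, hy⟩ := card_pos.1 this
    rw [mem_nb] at hy
    obtain ⟨G', h1, h2⟩ := transfer hN hlo hhi (G := re G i y) (i := y) (j := j) (fun x => by
      have a := dg_re hy x
      have b := h x
      omega)
    refine ⟨G', h1, (Df_triangle G (re G i y) G').trans ?_⟩
    have := Df_re G i y
    omega
  have hminus : (∀ x, dg G x + (if x = i then 1 else 0) + (if x = j then 1 else 0) = d x) →
      ∃ G' ∈ Om d, (Df G G').card ≤ 14 := by
    intro h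
    have hlt : (insert i (nb G i)).card < (univ : Finset (Fin n)).card := by
      have a := card_insert_le i (nb G i)
      have b := h i
      have c := hhi i
      have := hN.lt
      rw [if_pos rfl] at b
      unfold dg at b
      rw [card_univ, Fintype.card_fin]
      omega
    obtain ⟨y, _, hy⟩ := exists_mem_notMem_of_card_lt_card hlt
    rw [mem_insert, mem_nb, not_or] at hy
    obtain ⟨G', h1, h2⟩ := transfer hN hlo hhi (G := ae G i y) (i := j) (j := y) (fun x => by
      have a := dg_ae hy.2 (Ne.symm hy.1) x
      have b := h x
      omega)
    refine ⟨G', h1, (Df_triangle G (ae G i y) G').trans ?_⟩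
    have := Df_ae G i y
    omega
  have htr : ∀ i j : Fin n,
      (∀ x, dg G x + (if x = i then 1 else 0) = d x + (if x = j then 1 else 0)) →
      ∃ G' ∈ Om d, (Df G G').card ≤ 14 := by
    intro i j h
    obtain ⟨G', h1, h2⟩ := transfer hN hlo hhi h
    exact ⟨G', h1, by omega⟩
  have hsum : Even (∑ x, ((dg G x : ℤ) - d x)) := by
    rw [sum_sub_distrib]
    refine Even.sub ?_ ?_
    · have := sum_dg_even G; exact_mod_cast this
    · exact_mod_cast hev
  have hz : ∀ x, x ≠ i → x ≠ j → (dg G x : ℤ) - d x = 0 := by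
    intro x h1 h2
    have := hG x
    rw [if_neg h1, if_neg h2, add_zero] at this
    exact abs_nonpos_iff.1 this
  by_cases hij : i = j
  · subst hij
    rw [sum_eq_single i (fun x _ h => hz x h h) (fun h => absurd (mem_univ i) h)] at hsum
    have hi' := hG i
    rw [if_pos rfl, abs_le] at hi'
    obtain ⟨k, hk⟩ := hsum
    have : k = -1 ∨ k = 0 ∨ k = 1 := by omega
    rcases this with rfl | rfl | rfl
    · apply hminus
      intro x
      by_cases hx : x = i
      · subst hx; rw [if_pos rfl]; omega
      · have := hz x hx hx; rw [if_neg hx]; omega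
    · apply htr i i
      intro x
      by_cases hx : x = i
      · subst hx; omega
      · have := hz x hx hx; omega
    · apply hplus
      intro x
      by_cases hx : x = i
      · subst hx; rw [if_pos rfl]; omega
      · have := hz x hx hx; rw [if_neg hx]; omega
  · have hs : ∑ x, ((dg G x : ℤ) - d x) = ((dg G i : ℤ) - d i) + ((dg G j : ℤ) - d j) := by
      rw [← sum_pair hij (f := fun x => (dg G x : ℤ) - d x)]
      symm
      apply sum_subset (subset_univ _)
      intro x _ hx
      simp only [mem_insert, mem_singleton, not_or] at hx
      exact hz x hx.1 hx.2
    rw [hs] at hsum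
    have hi' := hG i
    have hj' := hG j
    rw [if_pos rfl, if_neg hij, abs_le] at hi'
    rw [if_pos rfl, if_neg (Ne.symm hij), abs_le] at hj'
    obtain ⟨k, hk⟩ := hsum
    have hx : ∀ (P : Fin n → Prop), P i → P j → (∀ x, x ≠ i → x ≠ j → P x) → ∀ x, P x := by
      intro P h1 h2 h3 x
      by_cases h : x = i
      · rw [h]; exact h1
      by_cases h' : x = j
      · rw [h']; exact h2
      exact h3 x h h'
    have hij' : j ≠ i := Ne.symm hij
    have : k = -1 ∨ (k = 0 ∧ (dg G i : ℤ) - d i = 0) ∨ (k = 0 ∧ (dg G i : ℤ) - d i = 1) ∨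
        (k = 0 ∧ (dg G i : ℤ) - d i = -1) ∨ k = 1 := by omega
    rcases this with rfl | ⟨rfl, h⟩ | ⟨rfl, h⟩ | ⟨rfl, h⟩ | rfl
    · apply hminus
      apply hx
      · simp only [if_true, if_neg hij]; omega
      · simp only [if_true, if_neg hij']; omega
      · intro x h1 h2; have := hz x h1 h2; simp only [if_neg h1, if_neg h2]; omega
    · apply htr i i
      apply hx
      · omega
      · omega
      · intro x h1 h2; have := hz x h1 h2; omega
    · apply htr j i
      apply hx
      · simp only [if_true, if_neg hij]; omega
      · simp only [if_true, if_neg hij']; omega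
      · intro x h1 h2; have := hz x h1 h2; simp only [if_neg h1, if_neg h2]; omega
    · apply htr i j
      apply hx
      · simp only [if_true, if_neg hij]; omega
      · simp only [if_true, if_neg hij']; omega
      · intro x h1 h2; have := hz x h1 h2; simp only [if_neg h1, if_neg h2]; omega
    · apply hplus
      apply hx
      · simp only [if_true, if_neg hij]; omega
      · simp only [if_true, if_neg hij']; omega
      · intro x h1 h2; have := hz x h1 h2; simp only [if_neg h1, if_neg h2]; omega

end SHF

namespace SHF
open Finset
open scoped Classical

section matching
variable {V : Type}

/-- Fixed-point-free involutions, viewed as perfect matchings. -/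
def IsMt (Z : V → V) : Prop := (∀ p, Z (Z p) = p) ∧ ∀ p, Z p ≠ p

/-- Replace the pairs `{v,w},{x,y}` by `{w,x},{v,y}`. -/
noncomputable def sq (Z : V → V) (v w x y : V) (p : V) : V :=
  if p = v then y else if p = y then v else if p = w then x else if p = x then w else Z p

lemma IsMt.sq {Z : V → V} (hZ : IsMt Z) {v w x y : V} (h1 : Z v = w) (h2 : Z x = y)
    (h3 : v ≠ x) (h4 : v ≠ y) : IsMt (sq Z v w x y) := by
  have a1 := hZ.1
  have a2 := hZ.2
  constructor
  · intro p; unfold SHF.sq; grind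
  · intro p; unfold SHF.sq; grind

/-- Invariant of the unwinding process from `a` to `b` currently working at `v`. -/
structure Inv (rk : V → ℕ) (a b : V → V) (v : V) (Z η : V → V) : Prop where
  mZ : IsMt Z
  mη : IsMt η
  low : ∀ p, rk p < rk v → Z p = b p
  gen : ∀ p, p ≠ v → p ≠ b v → p ≠ Z v → p ≠ η (b v) →
    (Z p = a p ∧ η p = b p) ∨ (Z p = b p ∧ η p = a p)
  aq : a (η (b v)) = Z v
  atq : η (b v) = v ∨ (η v = a v ∧ Z (η (b v)) = b (η (b v)))
  atw : Z v = b v ∨ (Z (b v) = a (b v) ∧ η (Z v) = b (Z v))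
  cl : ∀ X : Set V, (∀ p ∈ X, a p ∈ X ∧ b p ∈ X ∧ rk v < rk p) → η (b v) ∉ X ∧ ∀ p ∈ X, Z p = a p

section defs
variable [Fintype V]

/-- Matchings all of whose pairs, except possibly one, lie in `Γ`. -/
noncomputable def Wm (Γ : V → V → Prop) : Finset (V → V) :=
  univ.filter (fun Z => IsMt Z ∧ ∃ v, ∀ p, p ≠ v → p ≠ Z v → Γ p (Z p))

/-- Matchings all of whose pairs lie in `Γ`. -/
noncomputable def Pm (Γ : V → V → Prop) : Finset (V → V) :=
  univ.filter (fun Z => IsMt Z ∧ ∀ p, Γ p (Z p))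

/-- Two maps differing in at most four points. -/
def Near (Z Z' : V → V) : Prop := (univ.filter (fun p => Z p ≠ Z' p)).card ≤ 4

end defs

section order
variable {rk : V → ℕ} {a b Z η : V → V} {v : V}

lemma Inv.start (ha : IsMt a) (hb : IsMt b) (hZ : IsMt Z) (hη : IsMt η)
    (hlow : ∀ p, rk p < rk v → Z p = b p)
    (hgen : ∀ p, (Z p = a p ∧ η p = b p) ∨ (Z p = b p ∧ η p = a p))
    (hcl : ∀ X : Set V, (∀ p ∈ X, a p ∈ X ∧ b p ∈ X ∧ rk v < rk p) → ∀ p ∈ X, Z p = a p)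
    (hv : Z v ≠ b v) : Inv rk a b v Z η := by
  have e1 : Z v = a v ∧ η v = b v := by
    rcases hgen v with h | h
    · exact h
    · exact absurd h.1 hv
  have e2 : η (b v) = v := by rw [← e1.2]; exact hη.1 v
  refine ⟨hZ, hη, hlow, fun p _ _ _ _ => hgen p, by rw [e2, e1.1], Or.inl e2, Or.inr ?_, ?_⟩
  · have h1 := hgen (b v)
    have h2 := hgen (a v)
    have h3 := hb.1 v
    have h4 := ha.1 v
    have h5 := hZ.1 v
    have h6 := ha.2 v
    have h7 := hb.2 v
    have h8 := hZ.1 (b v)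
    have h9 := hη.1 (a v)
    rw [e1.1] at hv h5 ⊢
    constructor
    · rcases h1 with h | h
      · exact h.1
      · rw [h3] at h
        rw [h.1] at h8
        exact absurd (e1.1 ▸ h8) hv
    · rcases h2 with h | h
      · exact h.2
      · rw [h4] at h
        rw [h.2] at h9
        exact absurd (e1.2 ▸ h9).symm hv
  · intro X hX
    refine ⟨?_, hcl X hX⟩
    rw [e2]
    intro h
    exact lt_irrefl (rk v) (hX v h).2.2

lemma Inv.next (ha : IsMt a) (hb : IsMt b) (h : Inv rk a b v Z η) (hv : Z v ≠ b v) :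
    ∃ Z' η', Inv rk a b v Z' η' ∧ (∀ p, Z p = b p → Z' p = b p) ∧ (∃ p, Z p ≠ b p ∧ Z' p = b p) ∧
      ∃ S : Finset V, S.card ≤ 4 ∧ ∀ p, Z p ≠ Z' p → p ∈ S := by
  obtain ⟨mZ, mη, low, gen, aq, atq, atw, cl⟩ := h
  have hw := atw.resolve_left hv
  clear atw
  have bv := hb.1 v
  have b2 := hb.2
  have a1 := ha.1
  have b1 := hb.1
  have a2 := ha.2
  have z1 := mZ.1
  have z2 := mZ.2
  have e1 := mη.1
  have e2 := mη.2
  obtain ⟨u, hu⟩ : ∃ u, b v = u := ⟨_, rfl⟩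
  rw [hu] at gen aq atq hw cl hv bv
  obtain ⟨q, hq⟩ : ∃ q, η u = q := ⟨_, rfl⟩
  rw [hq] at gen aq atq cl
  obtain ⟨w, hw'⟩ : ∃ w, Z v = w := ⟨_, rfl⟩
  rw [hw'] at gen aq hw hv
  obtain ⟨x, hx⟩ : ∃ x, η w = x := ⟨_, rfl⟩
  rw [hx] at hw
  obtain ⟨y, hy⟩ : ∃ y, Z x = y := ⟨_, rfl⟩
  have xb : x = b w := hw.2
  have d1 : v ≠ w := by rw [← hw']; exact (z2 v).symm
  have d2 : v ≠ x := by rintro h; apply hv; rw [← hu, h, xb, b1]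
  have d3 : w ≠ x := by rw [xb]; exact (b2 w).symm
  have d4 : y ≠ v := by rintro h; apply d3; rw [← hw', ← h, ← hy, z1]
  have d5 : y ≠ w := by rintro h; apply d2; rw [← z1 x, hy, h, ← hw', z1]
  have d6 : y ≠ x := by rw [← hy]; exact z2 x
  have d7 : q ≠ u := by rw [← hq]; exact e2 u
  have d8 : w ≠ q := by rw [← aq]; exact a2 q
  have ηx : η x = w := by rw [← hx, e1]
  have ηq : η q = u := by rw [← hq, e1]
  have d9 : x ≠ q := by rintro h; apply hv; rw [← ηx, h, ηq]
  have d10 : x ≠ u := by rintro h; apply d8; rw [← ηx, h, hq]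
  have d11 : u ≠ v := by rw [← hu]; exact b2 v
  have bx : b x = w := by rw [xb, b1]
  have Zw : Z w = v := by rw [← hw', z1]
  have Zy : Z y = x := by rw [← hy, z1]
  have ax : a x = y := by
    rcases gen x d2.symm d10 d3.symm d9 with h | h
    · rw [← h.1, hy]
    · exact absurd (hy.symm.trans (h.1.trans bx)) d5
  have d12 : y ≠ q := by
    intro h
    rcases atq with h' | h'
    · exact d4 (h.trans h')
    · have : b q = x := by rw [← h'.2, ← h, Zy]
      apply d8; rw [← bx, ← this, b1]
  have bu : b u = v := bv
  have bw : b w = x := xb.symm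
  have ZA : ∀ p, p ≠ v → p ≠ y → p ≠ w → p ≠ x → sq Z v w x y p = Z p := by
    intro p h1 h2 h3 h4; simp [sq, h1, h2, h3, h4]
  have Zv' : sq Z v w x y v = y := by simp [sq]
  have Zy' : sq Z v w x y y = v := by simp [sq, d4]
  have Zw' : sq Z v w x y w = x := by simp [sq, d1.symm, d5.symm]
  have Zx' : sq Z v w x y x = w := by simp [sq, d2.symm, d6.symm, d3.symm]
  have EA : ∀ p, p ≠ u → p ≠ x → p ≠ q → p ≠ w → sq η u q w x p = η p := by
    intro p h1 h2 h3 h4; simp [sq, h1, h2, h3, h4]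
  have Eu' : sq η u q w x u = x := by simp [sq]
  have Ex' : sq η u q w x x = u := by simp [sq, d10]
  have Eq' : sq η u q w x q = w := by simp [sq, d7, d9.symm]
  have Ew' : sq η u q w x w = q := by simp [sq, hv, d3, d8]
  have keep : ∀ p, Z p = b p → sq Z v w x y p = b p := by
    intro p hp
    by_cases h1 : p = v
    · subst h1; exact absurd (hw'.symm.trans (hp.trans hu)) hv
    by_cases h3 : p = w
    · subst h3; rw [Zw', bw]
    by_cases h4 : p = x
    · subst h4; rw [Zx', bx]
    by_cases h2 : p = y
    · subst h2; rw [Zy] at hp; exfalso; apply d5; rw [← b1 p, ← hp, bx]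
    rw [ZA p h1 h2 h3 h4, hp]
  refine ⟨sq Z v w x y, sq η u q w x, ⟨mZ.sq hw' hy d2 d4.symm,
    mη.sq hq hx (Ne.symm hv) d10.symm, fun p hp => keep p (low p hp), ?_, ?_, ?_, ?_, ?_⟩,
    keep, ?_, ?_⟩
  · intro p
    rw [hu, Zv', Eu']
    intro p1 p2 p3 p4
    by_cases pw : p = w
    · right; subst pw
      refine ⟨by rw [Zw', bw], by rw [Ew', ← aq, a1]⟩
    by_cases pq : p = q
    · right; subst pq
      rcases atq with h | h
      · exact absurd h p1
      refine ⟨?_, by rw [Eq', aq]⟩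
      rw [ZA p p1 p3 pw p4, h.2]
    · rw [ZA p p1 p3 pw p4, EA p p2 p4 pq pw]
      exact gen p p1 p2 pw pq
  · rw [hu, Zv', Eu', ax]
  · right
    rw [hu, Eu', Zx', bx]
    refine ⟨?_, rfl⟩
    by_cases hvq : v = q
    · rw [hvq, Eq', aq]
    · rw [EA v d11.symm d2 hvq d1]
      rcases atq with h | h
      · exact absurd h.symm hvq
      · exact h.1
  · rw [hu, Zv']
    by_cases hyu : y = u
    · exact Or.inl hyu
    · right
      have g := gen y d4 hyu d5 d12
      have g1 : Z y = a y ∧ η y = b y := by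
        rcases g with g | g
        · exact g
        · exfalso; apply d5; rw [← b1 y, ← g.1, Zy, bx]
      refine ⟨?_, by rw [EA y hyu d6 d12 d5, g1.2]⟩
      by_cases huq : u = x
      · exact absurd huq.symm d10
      · rw [ZA u d11 (Ne.symm hyu) (Ne.symm hv) huq, hw.1]
  · intro X hX
    rw [hu, Eu']
    obtain ⟨c1, c2⟩ := cl X hX
    have hv' : v ∉ X := fun h => lt_irrefl (rk v) (hX v h).2.2
    have hw'' : w ∉ X := by
      intro h; apply c1; have := (hX w h).1; rwa [← aq, a1] at this
    have hx' : x ∉ X := by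
      intro h; apply hw''; have := (hX x h).2.1; rwa [bx] at this
    have hy' : y ∉ X := by
      intro h; apply hx'; have := (hX y h).1; rwa [← ax, a1] at this
    refine ⟨hx', fun p hp => ?_⟩
    rw [ZA p (by rintro rfl; exact hv' hp) (by rintro rfl; exact hy' hp)
      (by rintro rfl; exact hw'' hp) (by rintro rfl; exact hx' hp), c2 p hp]
  · exact ⟨w, by rw [Zw, bw]; exact d2, by rw [Zw', bw]⟩
  · refine ⟨{v, y, w, x}, card_le_four, fun p hp => ?_⟩
    by_contra hc
    simp only [mem_insert, mem_singleton, not_or] at hc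
    exact hp (ZA p hc.1 hc.2.1 hc.2.2.1 hc.2.2.2).symm

lemma Inv.done (ha : IsMt a) (hb : IsMt b) (h : Inv rk a b v Z η) (hv : Z v = b v) :
    ∀ p, (Z p = a p ∧ η p = b p) ∨ (Z p = b p ∧ η p = a p) := by
  obtain ⟨mZ, mη, low, gen, aq, atq, atw, cl⟩ := h
  clear low cl atw
  rw [hv] at gen aq
  have aq' : a (b v) = η (b v) := by have := ha.1 (η (b v)); rwa [aq] at this
  have hbb := hb.1 v
  have Zu : Z (b v) = v := by rw [← hv, mZ.1]
  have ηq : η (η (b v)) = b v := mη.1 _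
  intro p
  by_cases p1 : p = v
  · subst p1
    rcases atq with h | h
    · left; rw [h] at ηq aq
      exact ⟨hv.trans aq.symm, ηq⟩
    · exact Or.inr ⟨hv, h.1⟩
  by_cases p2 : p = b v
  · subst p2
    right; exact ⟨by rw [hbb, Zu], aq'.symm⟩
  by_cases p4 : p = η (b v)
  · subst p4
    right
    exact ⟨(atq.resolve_left p1).2, by rw [ηq, aq]⟩
  exact gen p p1 p2 p2 p4

lemma Inv.bad_left (h : Inv rk a b v Z η) :
    ∀ p, p ≠ v → p ≠ Z v → Z p = a p ∨ Z p = b p := by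
  obtain ⟨mZ, mη, low, gen, aq, atq, atw, cl⟩ := h
  intro p p1 p3
  by_cases p2 : p = b v
  · rcases atw with h | h
    · exact absurd (p2.trans h.symm) p3
    · left; rw [p2]; exact h.1
  by_cases p4 : p = η (b v)
  · rcases atq with h | h
    · exact absurd (p4.trans h) p1
    · right; rw [p4]; exact h.2
  rcases gen p p1 p2 p3 p4 with h | h
  · exact Or.inl h.1
  · exact Or.inr h.1

lemma Inv.bad_right (h : Inv rk a b v Z η) :
    ∀ p, p ≠ b v → p ≠ η (b v) → η p = a p ∨ η p = b p := by
  obtain ⟨mZ, mη, low, gen, aq, atq, atw, cl⟩ := h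
  intro p p2 p4
  by_cases p1 : p = v
  · rcases atq with h | h
    · exact absurd (p1.trans h.symm) p4
    · left; rw [p1]; exact h.1
  by_cases p3 : p = Z v
  · rcases atw with h | h
    · exact absurd (p3.trans h) p2
    · right; rw [p3]; exact h.2
  rcases gen p p1 p2 p3 p4 with h | h
  · exact Or.inr h.2
  · exact Or.inl h.2

lemma Inv.decode {a' b' : V → V} (hrk : Function.Injective rk) (ha : IsMt a) (hb : IsMt b) (ha' : IsMt a') (hb' : IsMt b')
    (h : Inv rk a b v Z η) (h' : Inv rk a' b' v Z η) (hu : b v = b' v) : a = a' ∧ b = b' := by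
  have key : ∀ p, (a p = a' p ∧ b p = b' p) ∨ (a p = b' p ∧ b p = a' p ∧ v ≠ p) := by
    obtain ⟨mZ, mη, low, gen, aq, atq, atw, cl⟩ := h
    obtain ⟨_, _, low', gen', aq', atq', atw', cl'⟩ := h'
    have b1 := hb.1
    have a1 := ha.1
    have b1' := hb'.1
    have a1' := ha'.1
    have z1 := mZ.1
    have e1 := mη.1
    intro p
    have g1 := gen p
    have g2 := gen' p
    rw [← hu] at g2 aq' atq' atw'
    clear gen gen' cl cl'
    by_cases p1 : p = v
    · subst p1
      left
      refine ⟨?_, hu⟩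
      rcases atq with h | h
      · rw [h] at aq aq'; rw [aq, aq']
      · rcases atq' with h' | h'
        · rw [h'] at aq aq'; rw [aq, aq']
        · rw [← h.1, ← h'.1]
    by_cases p2 : p = b v
    · subst p2
      left
      refine ⟨?_, by rw [b1, hu, b1']⟩
      have t : a (Z v) = η (b v) := by have := a1 (η (b v)); rwa [aq] at this
      have t' : a' (Z v) = η (b v) := by have := a1' (η (b v)); rwa [aq'] at this
      rcases atw with h | h
      · rw [← h, t, t']
      · rcases atw' with h' | h'
        · rw [← h', t, t']
        · rw [← h.1, ← h'.1]
    by_cases p3 : p = Z v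
    · subst p3
      left
      refine ⟨by rw [← aq, a1, aq, ← aq', a1'], ?_⟩
      rw [← (atw.resolve_left p2).2, ← (atw'.resolve_left p2).2]
    by_cases p4 : p = η (b v)
    · subst p4
      left
      refine ⟨by rw [aq, aq'], ?_⟩
      rw [← (atq.resolve_left p1).2, ← (atq'.resolve_left p1).2]
    · have g1 := g1 p1 p2 p3 p4
      have g2 := g2 p1 p2 p3 p4
      grind
  have haa : ∀ p, a p = a' p := by
    by_contra hc
    push Not at hc
    obtain ⟨p0, hp0⟩ := hc
    have hX : ∀ p ∈ {p | a p ≠ a' p}, a p ∈ {p | a p ≠ a' p} ∧ b p ∈ {p | a p ≠ a' p} ∧ rk v < rk p := by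
      intro p hp
      simp only [Set.mem_ofPred_eq] at hp ⊢
      have k := key p
      have k1 := ha.1 p
      have k2 := ha'.1 p
      have k3 := ha'.1 (a p)
      have k4 := ha.1 (b p)
      refine ⟨by grind, by grind, ?_⟩
      rcases lt_trichotomy (rk p) (rk v) with hlt | heq | hgt
      · have l1 := h.low p hlt
        have l2 := h'.low p hlt
        grind
      · have := hrk heq; grind
      · exact hgt
    have hX' : ∀ p ∈ {p | a p ≠ a' p}, a' p ∈ {p | a p ≠ a' p} ∧ b' p ∈ {p | a p ≠ a' p} ∧
        rk v < rk p := by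
      intro p hp
      have := hX p hp
      simp only [Set.mem_ofPred_eq] at hp
      have k := key p
      rcases k with k | k
      · exact absurd k.1 hp
      · rw [← k.1, ← k.2.1]; exact ⟨this.2.1, this.1, this.2.2⟩
    have t1 := (h.cl _ hX).2 p0 hp0
    have t2 := (h'.cl _ hX').2 p0 hp0
    exact hp0 (t1.symm.trans t2)
  refine ⟨funext haa, funext fun p => ?_⟩
  have := key p
  have := haa p
  grind

lemma exists_inv [Finite V] (ha : IsMt a) (hb : IsMt b) (hZ : IsMt Z) (hη : IsMt η)
    (hg : ∀ p, (Z p = a p ∧ η p = b p) ∨ (Z p = b p ∧ η p = a p))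
    (hcl : ∀ v, (∀ p, rk p < rk v → Z p = b p) → Z v ≠ b v →
      ∀ X : Set V, (∀ p ∈ X, a p ∈ X ∧ b p ∈ X ∧ rk v < rk p) → ∀ p ∈ X, Z p = a p)
    (hne : Z ≠ b) : ∃ v, Z v ≠ b v ∧ Inv rk a b v Z η := by
  have := Fintype.ofFinite V
  have hne' : (univ.filter (fun p => Z p ≠ b p)).Nonempty := by
    obtain ⟨p, hp⟩ := Function.ne_iff.1 hne
    exact ⟨p, by simp [hp]⟩
  obtain ⟨v, hv, hmin⟩ := exists_min_image _ rk hne'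
  have hv : Z v ≠ b v := (mem_filter.1 hv).2
  have hlow : ∀ p, rk p < rk v → Z p = b p := by
    intro p hp
    by_contra hc
    exact absurd (hmin p (mem_filter.2 ⟨mem_univ _, hc⟩)) (not_le.2 hp)
  exact ⟨v, hv, Inv.start ha hb hZ hη hlow hg (hcl v hlow hv) hv⟩

lemma Inv.advance [Finite V] (hrk : Function.Injective rk) (ha : IsMt a) (hb : IsMt b) (h : Inv rk a b v Z η) (hne : Z ≠ b) :
    ∃ v, Z v ≠ b v ∧ Inv rk a b v Z η := by
  by_cases hv : Z v = b v
  · refine exists_inv ha hb h.mZ h.mη (h.done ha hb hv) ?_ hne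
    intro v' hlow hv' X hX
    have hlt : rk v < rk v' := by
      rcases lt_trichotomy (rk v) (rk v') with h1 | h1 | h1
      · exact h1
      · rw [hrk h1] at hv; exact absurd hv hv'
      · exact absurd (h.low v' h1) hv'
    exact (h.cl X fun p hp => ⟨(hX p hp).1, (hX p hp).2.1, hlt.trans (hX p hp).2.2⟩).2
  · exact ⟨v, hv, h⟩

variable [Fintype V]

lemma Inv.mem {Γ : V → V → Prop} (h : Inv rk a b v Z η) (ha : a ∈ Pm Γ) (hb : b ∈ Pm Γ) :
    Z ∈ Wm Γ ∧ η ∈ Wm Γ := by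
  have ga := (mem_filter.1 ha).2.2
  have gb := (mem_filter.1 hb).2.2
  constructor
  · refine mem_filter.2 ⟨mem_univ _, h.mZ, v, fun p h1 h2 => ?_⟩
    rcases h.bad_left p h1 h2 with e | e
    · rw [e]; exact ga p
    · rw [e]; exact gb p
  · refine mem_filter.2 ⟨mem_univ _, h.mη, b v, fun p h1 h2 => ?_⟩
    rcases h.bad_right p h1 h2 with e | e
    · rw [e]; exact ga p
    · rw [e]; exact gb p

lemma path_bound {Γ : V → V → Prop} (hrk : Function.Injective rk) (F : (V → V) → ℝ) (ha : a ∈ Pm Γ) (hb : b ∈ Pm Γ)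
    (T : ℝ) (hT0 : 0 ≤ T)
    (hT : ∀ Z ∈ Wm Γ, ∀ Z' ∈ Wm Γ, Near Z Z' → (∃ v, ∃ η ∈ Wm Γ, Inv rk a b v Z η) →
      |F Z - F Z'| ≤ T) :
    |F a - F b| ≤ Fintype.card V * T := by
  have ma := (mem_filter.1 ha).2.1
  have mb := (mem_filter.1 hb).2.1
  have main : ∀ k : ℕ, ∀ Z v η, Inv rk a b v Z η → (univ.filter (fun p => Z p ≠ b p)).card ≤ k →
      |F Z - F b| ≤ k * T := by
    intro k
    induction k with
    | zero =>
      intro Z v η h hk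
      have : Z = b := by
        funext p
        by_contra hc
        have h0 := card_eq_zero.1 (Nat.le_zero.1 hk)
        have : p ∈ univ.filter (fun p => Z p ≠ b p) := mem_filter.2 ⟨mem_univ _, hc⟩
        rw [h0] at this
        exact absurd this (notMem_empty _)
      simp [this]
    | succ k ih =>
      intro Z v η h hk
      by_cases hne : Z = b
      · rw [hne, sub_self, abs_zero]; positivity
      obtain ⟨v, hv, h⟩ := h.advance hrk ma mb hne
      obtain ⟨Z', η', h', hsub, ⟨p0, hp0, hp0'⟩, S, hS, hSd⟩ := h.next ma mb hv
      have hcard : (univ.filter (fun p => Z' p ≠ b p)).card < (univ.filter (fun p => Z p ≠ b p)).card := by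
        apply card_lt_card
        rw [ssubset_iff_of_subset]
        · exact ⟨p0, mem_filter.2 ⟨mem_univ _, hp0⟩, by simp [hp0']⟩
        · intro p hp
          refine mem_filter.2 ⟨mem_univ _, fun hc => (mem_filter.1 hp).2 (hsub p hc)⟩
      have t1 := ih Z' v η' h' (by omega)
      have hn : Near Z Z' := (card_le_card (fun p hp => hSd p (mem_filter.1 hp).2)).trans hS
      have t2 := hT Z (h.mem ha hb).1 Z' (h'.mem ha hb).1 hn ⟨v, η, (h.mem ha hb).2, h⟩
      calc |F Z - F b| ≤ |F Z - F Z'| + |F Z' - F b| := abs_sub_le _ _ _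
        _ ≤ T + k * T := add_le_add t2 t1
        _ = _ := by push_cast; ring
  by_cases hne : a = b
  · rw [hne, sub_self, abs_zero]; positivity
  obtain ⟨v, hv, h⟩ := exists_inv (Z := a) (η := b) ma mb ma mb (fun p => Or.inl ⟨rfl, rfl⟩)
    (fun _ _ _ _ _ _ _ => rfl) hne
  refine (main _ a v b h le_rfl).trans ?_
  gcongr
  exact card_le_univ _

lemma code_count {Γ : V → V → Prop} (hrk : Function.Injective rk) (Z : V → V) :
    (((Pm Γ) ×ˢ (Pm Γ)).filter (fun c => ∃ v, ∃ η ∈ Wm Γ, Inv rk c.1 c.2 v Z η)).card ≤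
      (Wm Γ).card * Fintype.card V ^ 2 := by
  have hch : ∀ c ∈ ((Pm Γ) ×ˢ (Pm Γ)).filter (fun c => ∃ v, ∃ η ∈ Wm Γ, Inv rk c.1 c.2 v Z η),
      ∃ t : (V → V) × V, t.1 ∈ Wm Γ ∧ Inv rk c.1 c.2 t.2 Z t.1 := by
    intro c hc
    obtain ⟨v, η, h1, h2⟩ := (mem_filter.1 hc).2
    exact ⟨⟨η, v⟩, h1, h2⟩
  rcases isEmpty_or_nonempty V with hV | hV
  · rw [filter_false_of_mem]
    · simp
    · rintro c - ⟨v, -⟩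
      exact hV.elim v
  choose! t ht1 ht2 using hch
  have : (((Pm Γ) ×ˢ (Pm Γ)).filter (fun c => ∃ v, ∃ η ∈ Wm Γ, Inv rk c.1 c.2 v Z η)).card ≤
      ((Wm Γ) ×ˢ (univ : Finset (V × V))).card := by
    refine card_le_card_of_injOn (fun c => ((t c).1, ((t c).2, c.2 (t c).2))) ?_ ?_
    · intro c hc
      exact mem_coe.2 (mem_product.2 ⟨ht1 c (mem_coe.1 hc), mem_univ _⟩)
    · intro c hc c' hc' he
      have hc := mem_coe.1 hc
      have hc' := mem_coe.1 hc'
      simp only [Prod.mk.injEq] at he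
      obtain ⟨e1, e2, e3⟩ := he
      have i1 := ht2 c hc
      have i2 := ht2 c' hc'
      rw [← e1, ← e2] at i2
      rw [← e2] at e3
      have p1 := mem_product.1 (mem_filter.1 hc).1
      have p2 := mem_product.1 (mem_filter.1 hc').1
      have := Inv.decode hrk (mem_filter.1 p1.1).2.1 (mem_filter.1 p1.2).2.1 (mem_filter.1 p2.1).2.1
        (mem_filter.1 p2.2).2.1 i1 i2 e3
      exact Prod.ext this.1 this.2
  refine this.trans (le_of_eq ?_)
  rw [card_product, card_univ, Fintype.card_prod, _root_.sq]

end order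

/-- Canonical path bound for perfect matchings through nearly perfect ones. -/
lemma matching_energy [Fintype V] (Γ : V → V → Prop) (F : (V → V) → ℝ) :
    ∑ a ∈ Pm Γ, ∑ b ∈ Pm Γ, (F a - F b) ^ 2 ≤
      (Fintype.card V : ℝ) ^ 4 * (Wm Γ).card *
        ∑ Z ∈ Wm Γ, ∑ Z' ∈ Wm Γ, if Near Z Z' then (F Z - F Z') ^ 2 else 0 := by
  obtain ⟨rk, hrk⟩ : ∃ rk : V → ℕ, Function.Injective rk :=
    ⟨fun p => (Fintype.equivFin V p : ℕ), fun p q h => (Fintype.equivFin V).injective (Fin.ext h)⟩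
  set D : (V → V) → (V → V) → ℝ := fun Z Z' => if Near Z Z' then (F Z - F Z') ^ 2 else 0 with hD
  have hD0 : ∀ Z Z', 0 ≤ D Z Z' := fun Z Z' => by simp only [hD]; split_ifs <;> positivity
  set S : (V → V) → (V → V) → ℝ := fun a b => ∑ Z ∈ Wm Γ,
    if (∃ v, ∃ η ∈ Wm Γ, Inv rk a b v Z η) then ∑ Z' ∈ Wm Γ, D Z Z' else 0 with hS
  have hin : ∀ Z, 0 ≤ ∑ Z' ∈ Wm Γ, D Z Z' := fun Z => sum_nonneg fun _ _ => hD0 _ _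
  have hS0 : ∀ a b, 0 ≤ S a b := fun a b => sum_nonneg fun Z _ => by split_ifs; exacts [hin Z, le_rfl]
  have hab : ∀ a ∈ Pm Γ, ∀ b ∈ Pm Γ, (F a - F b) ^ 2 ≤ (Fintype.card V : ℝ) ^ 2 * S a b := by
    intro a ha b hb
    have := path_bound hrk F ha hb (Real.sqrt (S a b)) (Real.sqrt_nonneg _) ?_
    · have h2 := pow_le_pow_left₀ (abs_nonneg _) this 2
      rwa [sq_abs, mul_pow, Real.sq_sqrt (hS0 a b)] at h2
    · intro Z hZ Z' hZ' hn hex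
      apply Real.abs_le_sqrt
      calc (F Z - F Z') ^ 2 = D Z Z' := by simp only [hD]; rw [if_pos hn]
        _ ≤ ∑ Z' ∈ Wm Γ, D Z Z' := single_le_sum (f := fun Z' => D Z Z') (fun _ _ => hD0 _ _) hZ'
        _ = if (∃ v, ∃ η ∈ Wm Γ, Inv rk a b v Z η) then ∑ Z' ∈ Wm Γ, D Z Z' else 0 := by
            rw [if_pos hex]
        _ ≤ S a b := single_le_sum (f := fun Z => if (∃ v, ∃ η ∈ Wm Γ, Inv rk a b v Z η) then
            ∑ Z' ∈ Wm Γ, D Z Z' else 0)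
            (fun Z _ => by split_ifs; exacts [hin Z, le_rfl]) hZ
  calc ∑ a ∈ Pm Γ, ∑ b ∈ Pm Γ, (F a - F b) ^ 2
      ≤ ∑ a ∈ Pm Γ, ∑ b ∈ Pm Γ, (Fintype.card V : ℝ) ^ 2 * S a b :=
        sum_le_sum fun a ha => sum_le_sum fun b hb => hab a ha b hb
    _ = (Fintype.card V : ℝ) ^ 2 * ∑ c ∈ Pm Γ ×ˢ Pm Γ, S c.1 c.2 := by
        rw [sum_product, mul_sum]; exact sum_congr rfl fun _ _ => (mul_sum _ _ _).symm
    _ = (Fintype.card V : ℝ) ^ 2 * ∑ Z ∈ Wm Γ,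
          ((((Pm Γ) ×ˢ (Pm Γ)).filter (fun c => ∃ v, ∃ η ∈ Wm Γ, Inv rk c.1 c.2 v Z η)).card : ℝ) *
            ∑ Z' ∈ Wm Γ, D Z Z' := by
        congr 1
        rw [hS, sum_comm]
        refine sum_congr rfl fun Z _ => ?_
        rw [← sum_filter, sum_const, nsmul_eq_mul]
    _ ≤ (Fintype.card V : ℝ) ^ 2 * ∑ Z ∈ Wm Γ,
          (((Wm Γ).card * Fintype.card V ^ 2 : ℕ) : ℝ) * ∑ Z' ∈ Wm Γ, D Z Z' := by
        gcongr with Z _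
        exact code_count hrk Z
    _ = _ := by
        rw [← mul_sum]; push_cast; ring

end matching
end SHF

namespace SHF
open Finset
open scoped Classical

section ball
variable {V : Type} [Fintype V]

/-- Maps differing from `M` in at most `c` points. -/
noncomputable def ball (M : V → V) (c : ℕ) : Finset (V → V) :=
  univ.filter (fun Z => (univ.filter (fun p => M p ≠ Z p)).card ≤ c)

lemma ball_card [Nonempty V] (M : V → V) (c : ℕ) : (ball M c).card ≤ (Fintype.card V ^ 2) ^ c := by
  induction c with
  | zero =>
    have : ball M 0 ⊆ {M} := by
      intro Z hZ
      have h0 := card_eq_zero.1 (Nat.le_zero.1 (mem_filter.1 hZ).2)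
      rw [mem_singleton]
      funext p
      by_contra hc
      have : p ∈ univ.filter (fun p => M p ≠ Z p) := mem_filter.2 ⟨mem_univ _, fun h => hc h.symm⟩
      rw [h0] at this
      exact absurd this (notMem_empty _)
    simpa using card_le_card this
  | succ c ih =>
    have hsub : ball M (c + 1) ⊆ ((univ : Finset (V × V)) ×ˢ ball M c).image
        (fun t => Function.update t.2 t.1.1 t.1.2) := by
      intro Z hZ
      have hZ := (mem_filter.1 hZ).2
      have key : ∀ p, (M p ≠ Z p ∨ ∀ p, M p = Z p) →
          (univ.filter (fun q => M q ≠ Function.update Z p (M p) q)).card ≤ c := by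
        intro p hp
        have : univ.filter (fun q => M q ≠ Function.update Z p (M p) q) ⊆
            (univ.filter (fun p => M p ≠ Z p)).erase p := by
          intro q hq
          have hq := (mem_filter.1 hq).2
          by_cases hqp : q = p
          · subst hqp; simp at hq
          · rw [Function.update_of_ne hqp] at hq
            simp [hqp, hq]
        refine (card_le_card this).trans ?_
        rcases hp with hp | hp
        · rw [card_erase_of_mem (mem_filter.2 ⟨mem_univ p, hp⟩)]; omega
        · simp [hp]
      obtain ⟨p, hp⟩ : ∃ p, (M p ≠ Z p ∨ ∀ p, M p = Z p) := by
        by_cases h : ∃ p, M p ≠ Z p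
        · obtain ⟨p, hp⟩ := h; exact ⟨p, Or.inl hp⟩
        · push Not at h; exact ⟨Classical.arbitrary V, Or.inr h⟩
      refine mem_image.2 ⟨((p, Z p), Function.update Z p (M p)), ?_, by simp⟩
      exact mem_product.2 ⟨mem_univ _, mem_filter.2 ⟨mem_univ _, key p hp⟩⟩
    calc _ ≤ _ := card_le_card hsub
      _ ≤ _ := card_image_le
      _ = Fintype.card V ^ 2 * (ball M c).card := by
        rw [card_product, card_univ, Fintype.card_prod, ← _root_.sq]
      _ ≤ Fintype.card V ^ 2 * (Fintype.card V ^ 2) ^ c := Nat.mul_le_mul_left _ ih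
      _ = _ := by ring

end ball

variable {n : ℕ}

/-- Points of the gadget: darts and, for each vertex, cores absorbing unused darts. -/
inductive Gd (d : Fin n → ℕ) : Type
  | dart (i j : Fin n)
  | core (i : Fin n) (k : Fin (n - d i))

/-- The gadget as a sum type. -/
def gdEquiv (d : Fin n → ℕ) : ((Fin n × Fin n) ⊕ (Σ i, Fin (n - d i))) ≃ Gd d where
  toFun
    | .inl p => .dart p.1 p.2
    | .inr c => .core c.1 c.2
  invFun
    | .dart i j => .inl (i, j)
    | .core i k => .inr ⟨i, k⟩
  left_inv := by rintro (_ | _) <;> rfl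
  right_inv := by rintro (_ | _) <;> rfl

noncomputable instance (d : Fin n → ℕ) : Fintype (Gd d) := Fintype.ofEquiv _ (gdEquiv d)

/-- The vertex carrying a gadget point. -/
def own {d : Fin n → ℕ} : Gd d → Fin n
  | .dart i _ => i
  | .core i _ => i

/-- Admissible gadget pairs. -/
def Gam (d : Fin n → ℕ) : Gd d → Gd d → Prop
  | .dart i j, .dart k l => i ≠ j ∧ k = j ∧ l = i
  | .dart i _, .core k _ => k = i
  | .core k _, .dart i _ => k = i
  | .core _ _, .core _ _ => False

/-- The graph read off from a matching of the gadget. -/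
def gr {d : Fin n → ℕ} (Z : Gd d → Gd d) : SimpleGraph (Fin n) where
  Adj i j := i ≠ j ∧ Z (.dart i j) = .dart j i ∧ Z (.dart j i) = .dart i j
  symm := by
    constructor
    intro i j h
    exact ⟨h.1.symm, h.2.2, h.2.1⟩
  loopless := by
    constructor
    intro i h
    exact h.1 rfl

variable {d : Fin n → ℕ} {Z : Gd d → Gd d}

lemma gr_adj (hZ : IsMt Z) {i j : Fin n} :
    (gr Z).Adj i j ↔ i ≠ j ∧ Z (.dart i j) = .dart j i := by
  constructor
  · exact fun h => ⟨h.1, h.2.1⟩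
  · intro h
    exact ⟨h.1, h.2, by rw [← h.2, hZ.1]⟩

lemma gr_near {Z' : Gd d → Gd d} (hZ : IsMt Z) (hZ' : IsMt Z') (h : Near Z Z') :
    (Df (gr Z) (gr Z')).card ≤ 4 := by
  refine le_trans ?_ h
  refine card_le_card_of_injOn (fun p => .dart p.1 p.2) ?_ (fun p _ q _ h => by
      simp only [Gd.dart.injEq] at h; exact Prod.ext h.1 h.2)
  rintro ⟨i, j⟩ hp
  have hp := mem_Df.1 (mem_coe.1 hp)
  refine mem_coe.2 (mem_filter.2 ⟨mem_univ _, fun h => hp ?_⟩)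
  dsimp only
  rw [gr_adj hZ, gr_adj hZ', h]

/-- A dart outside the exceptional pair is used by an edge or absorbed by a core of its vertex. -/
lemma dart_cases {v : Gd d} (hZ : IsMt Z) (hv : ∀ p, p ≠ v → p ≠ Z v → Gam d p (Z p))
    {i j : Fin n} (h1 : (.dart i j : Gd d) ≠ v) (h2 : (.dart i j : Gd d) ≠ Z v) :
    (gr Z).Adj i j ∨ ∃ k : Fin (n - d i), Z (.dart i j) = .core i k := by
  have h := hv _ h1 h2
  rw [gr_adj hZ]
  rcases hz : Z (.dart i j) with ⟨k, l⟩ | ⟨a, k⟩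
  · rw [hz] at h
    left
    obtain ⟨h3, rfl, rfl⟩ := h
    exact ⟨h3, rfl⟩
  · rw [hz] at h
    right
    have h : a = i := h
    subst h
    exact ⟨k, rfl⟩

lemma core_cases {v : Gd d} (hv : ∀ p, p ≠ v → p ≠ Z v → Gam d p (Z p))
    {i : Fin n} {k : Fin (n - d i)} (h1 : (.core i k : Gd d) ≠ v)
    (h2 : (.core i k : Gd d) ≠ Z v) : ∃ j, Z (.core i k) = .dart i j := by
  have h := hv _ h1 h2
  rcases hz : Z (.core i k) with ⟨a, b⟩ | ⟨a, b⟩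
  · rw [hz] at h
    have h : i = a := h
    subst h
    exact ⟨b, rfl⟩
  · rw [hz] at h
    exact absurd h id

lemma card_nonnb (G : SimpleGraph (Fin n)) (i : Fin n) :
    (univ.filter (fun j => ¬ G.Adj i j)).card = n - dg G i := by
  have := card_filter_add_card_filter_not (s := (univ : Finset (Fin n))) (G.Adj i)
  rw [card_univ, Fintype.card_fin] at this
  unfold dg nb
  omega

lemma gr_dg (hd : ∀ i, d i ≤ n) {v : Gd d} (hZ : IsMt Z)
    (hv : ∀ p, p ≠ v → p ≠ Z v → Gam d p (Z p)) (i : Fin n) :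
    |(dg (gr Z) i : ℤ) - d i| ≤ (if i = own v then 1 else 0) + (if i = own (Z v) then 1 else 0) := by
  set B : Finset (Gd d) := ({v, Z v} : Finset (Gd d)).filter (fun p => own p = i) with hB
  have hBc : (B.card : ℤ) ≤ (if i = own v then 1 else 0) + (if i = own (Z v) then 1 else 0) := by
    have h1 : B ⊆ (if i = own v then {v} else ∅) ∪ (if i = own (Z v) then {Z v} else ∅) := by
      intro p hp
      simp only [hB, mem_filter, mem_insert, mem_singleton] at hp
      rcases hp with ⟨rfl | rfl, rfl⟩ <;> simp
    have h2 := (card_le_card h1).trans (card_union_le _ _)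
    have h3 : B.card ≤ (if i = own v then 1 else 0) + (if i = own (Z v) then 1 else 0) := by
      refine h2.trans (add_le_add ?_ ?_) <;> split_ifs <;> simp
    exact_mod_cast h3
  have hcores : Fintype.card (Fin (n - d i)) = n - d i := Fintype.card_fin _
  have hdg : dg (gr Z) i ≤ n := by
    have := card_le_univ (nb (gr Z) i)
    rwa [Fintype.card_fin] at this
  have up : n - dg (gr Z) i ≤ (n - d i) + B.card := by
    rw [← card_nonnb]
    have : (univ.filter (fun j => ¬ (gr Z).Adj i j)).image (fun j => (.dart i j : Gd d)) ⊆
        ((univ : Finset (Fin (n - d i))).image (fun k => Z (.core i k))) ∪ B := by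
      intro p hp
      obtain ⟨j, hj, rfl⟩ := mem_image.1 hp
      have hj := (mem_filter.1 hj).2
      by_cases hb : (.dart i j : Gd d) = v ∨ (.dart i j : Gd d) = Z v
      · refine mem_union_right _ (mem_filter.2 ⟨by simpa using hb, rfl⟩)
      · push Not at hb
        rcases dart_cases hZ hv hb.1 hb.2 with h | ⟨k, hk⟩
        · exact absurd h hj
        · refine mem_union_left _ (mem_image.2 ⟨k, mem_univ _, ?_⟩)
          rw [← hk, hZ.1]
    have h2 := (card_le_card this).trans (card_union_le _ _)
    rw [card_image_of_injective _ (fun j j' h => by simpa using h)] at h2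
    refine h2.trans (Nat.add_le_add_right ?_ _)
    refine card_image_le.trans ?_
    rw [card_univ, hcores]
  have lo : n - d i ≤ (n - dg (gr Z) i) + B.card := by
    rw [← card_nonnb, ← hcores, ← card_univ]
    have : (univ : Finset (Fin (n - d i))).image (fun k => (.core i k : Gd d)) ⊆
        (univ.filter (fun j => ¬ (gr Z).Adj i j)).image (fun j => Z (.dart i j)) ∪ B := by
      intro p hp
      obtain ⟨k, _, rfl⟩ := mem_image.1 hp
      by_cases hb : (.core i k : Gd d) = v ∨ (.core i k : Gd d) = Z v
      · refine mem_union_right _ (mem_filter.2 ⟨by simpa using hb, rfl⟩)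
      · push Not at hb
        obtain ⟨j, hj⟩ := core_cases hv hb.1 hb.2
        refine mem_union_left _ (mem_image.2 ⟨j, mem_filter.2 ⟨mem_univ _, ?_⟩, ?_⟩)
        · rw [gr_adj hZ]
          rintro ⟨_, h⟩
          rw [← hj, hZ.1] at h
          cases h
        · rw [← hj, hZ.1]
    have h2 := (card_le_card this).trans (card_union_le _ _)
    rw [card_image_of_injective _ (fun j j' h => by simpa using h)] at h2
    exact h2.trans (Nat.add_le_add_right card_image_le _)
  have := hd i
  refine le_trans ?_ hBc
  rw [abs_le]
  omega

/-- Ways of assigning the cores to the unused darts of `G`. -/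
abbrev Asg (d : Fin n → ℕ) (G : SimpleGraph (Fin n)) : Type :=
  ∀ i, Fin (n - d i) ≃ {j // ¬ G.Adj i j}

/-- The perfect matching encoding a graph and an assignment of cores. -/
noncomputable def mk (G : SimpleGraph (Fin n)) (e : Asg d G) : Gd d → Gd d
  | .dart i j => if h : G.Adj i j then .dart j i else .core i ((e i).symm ⟨j, h⟩)
  | .core i k => .dart i (e i k).1

lemma mk_adj {G : SimpleGraph (Fin n)} (e : Asg d G) {i j : Fin n} (h : G.Adj i j) :
    mk G e (.dart i j) = .dart j i := by simp [mk, h]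

lemma mk_nadj {G : SimpleGraph (Fin n)} (e : Asg d G) {i j : Fin n} (h : ¬ G.Adj i j) :
    mk G e (.dart i j) = .core i ((e i).symm ⟨j, h⟩) := by simp [mk, h]

lemma mk_core {G : SimpleGraph (Fin n)} (e : Asg d G) {i : Fin n} (k : Fin (n - d i)) :
    mk G e (.core i k) = .dart i (e i k).1 := rfl

lemma mk_mem {G : SimpleGraph (Fin n)} (e : Asg d G) : mk G e ∈ Pm (Gam d) := by
  refine mem_filter.2 ⟨mem_univ _, ⟨?_, ?_⟩, ?_⟩
  · rintro (⟨i, j⟩ | ⟨i, k⟩)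
    · by_cases h : G.Adj i j
      · rw [mk_adj e h, mk_adj e h.symm]
      · rw [mk_nadj e h, mk_core]; simp
    · rw [mk_core, mk_nadj e (e i k).2]; simp
  · rintro (⟨i, j⟩ | ⟨i, k⟩)
    · by_cases h : G.Adj i j
      · rw [mk_adj e h]
        intro hh
        simp only [Gd.dart.injEq] at hh
        exact h.ne hh.2
      · rw [mk_nadj e h]; simp
    · rw [mk_core]; simp
  · rintro (⟨i, j⟩ | ⟨i, k⟩)
    · by_cases h : G.Adj i j
      · rw [mk_adj e h]; exact ⟨h.ne, rfl, rfl⟩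
      · rw [mk_nadj e h]; exact rfl
    · rw [mk_core]; exact rfl

lemma gr_mk {G : SimpleGraph (Fin n)} (e : Asg d G) : gr (mk G e) = G := by
  ext i j
  rw [gr_adj (mem_filter.1 (mk_mem e)).2.1]
  constructor
  · rintro ⟨_, h2⟩
    by_contra h
    rw [mk_nadj e h] at h2
    cases h2
  · intro h
    exact ⟨h.ne, mk_adj e h⟩

lemma mk_injective (G : SimpleGraph (Fin n)) :
    Function.Injective (mk G : Asg d G → Gd d → Gd d) := by
  intro e e' h
  funext i
  ext k
  have := congrFun h (.core i k)
  rw [mk_core, mk_core] at this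
  simp only [Gd.dart.injEq, true_and] at this
  rw [this]

/-- The number of core assignments. -/
def Kn (d : Fin n → ℕ) : ℕ := ∏ i, (n - d i).factorial

lemma card_sub {G : SimpleGraph (Fin n)} (hG : G ∈ Om d) (i : Fin n) :
    Fintype.card {j // ¬ G.Adj i j} = n - d i := by
  rw [Fintype.card_subtype, ← mem_Om.1 hG i, ← card_nonnb]

lemma card_asg {G : SimpleGraph (Fin n)} (hG : G ∈ Om d) : Fintype.card (Asg d G) = Kn d := by
  rw [Fintype.card_pi]
  refine prod_congr rfl fun i _ => ?_
  have e : Fin (n - d i) ≃ {j // ¬ G.Adj i j} :=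
    Fintype.equivOfCardEq (by rw [card_sub hG, Fintype.card_fin])
  rw [Fintype.card_equiv e, Fintype.card_fin]

/-- A nearly perfect matching is close to one encoding any graph close to its own. -/
lemma exists_asg {v : Gd d} (hZ : IsMt Z) (hv : ∀ p, p ≠ v → p ≠ Z v → Gam d p (Z p))
    {G : SimpleGraph (Fin n)} (hG : G ∈ Om d) {c : ℕ} (hc : (Df (gr Z) G).card ≤ c) :
    ∃ e : Asg d G, Z ∈ ball (mk G e) (2 * c + 2) := by
  have hex : ∀ i, ∃ e : Fin (n - d i) ≃ {j // ¬ G.Adj i j}, ∀ k (j : {j // ¬ G.Adj i j}),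
      Z (.core i k) = .dart i j.1 → e k = j := by
    intro i
    by_cases hk : IsEmpty (Fin (n - d i))
    · exact ⟨Fintype.equivOfCardEq (by rw [card_sub hG, Fintype.card_fin]), fun k => hk.elim k⟩
    rw [not_isEmpty_iff] at hk
    have hne : Nonempty {j // ¬ G.Adj i j} := by
      rw [← Fintype.card_pos_iff, card_sub hG, ← Fintype.card_fin (n - d i)]
      exact Fintype.card_pos
    let S : Finset (Fin (n - d i)) := univ.filter (fun k => ∃ j : {j // ¬ G.Adj i j},
      Z (.core i k) = .dart i j.1)
    have hS : ∀ k ∈ S, ∃ j : {j // ¬ G.Adj i j}, Z (.core i k) = .dart i j.1 :=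
      fun k hk => (mem_filter.1 hk).2
    choose! f hf using hS
    obtain ⟨g, hg⟩ := Finset.exists_equiv_extend_of_card_eq (α := Fin (n - d i))
      (t := (univ : Finset {j // ¬ G.Adj i j})) (by rw [card_univ, card_sub hG, Fintype.card_fin])
      (s := S) (f := f) (subset_univ _) (by
        intro k hk k' hk' h
        have h1 := hf k (mem_coe.1 hk)
        have h2 := hf k' (mem_coe.1 hk')
        rw [h, ← h2] at h1
        have h3 := congrArg Z h1
        rw [hZ.1, hZ.1] at h3
        simpa using h3)
    refine ⟨g.trans (Equiv.subtypeUnivEquiv (fun x => mem_univ x)), fun k j hkj => ?_⟩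
    have hkS : k ∈ S := mem_filter.2 ⟨mem_univ _, j, hkj⟩
    have h1 := hf k hkS
    rw [hkj] at h1
    have h2 := h1
    simp only [Gd.dart.injEq, true_and] at h2
    have h3 := hg k hkS
    simp only [Equiv.trans_apply, Equiv.subtypeUnivEquiv_apply]
    rw [h3]
    exact Subtype.ext h2.symm
  choose e he using hex
  refine ⟨e, mem_filter.2 ⟨mem_univ _, ?_⟩⟩
  set A : Finset (Gd d) := (Df (gr Z) G).image (fun p => .dart p.1 p.2)
  have hA : A.card ≤ c := card_image_le.trans hc
  have hsub : univ.filter (fun p => mk G e p ≠ Z p) ⊆ (A ∪ A.image Z) ∪ {v, Z v} := by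
    intro p hp
    have hp := (mem_filter.1 hp).2
    by_cases hb : p = v ∨ p = Z v
    · exact mem_union_right _ (by simpa using hb)
    refine mem_union_left _ ?_
    push Not at hb
    rcases p with ⟨i, j⟩ | ⟨i, k⟩
    · refine mem_union_left _ (mem_image.2 ⟨(i, j), mem_Df.2 fun hiff => hp ?_, rfl⟩)
      rcases dart_cases hZ hv hb.1 hb.2 with h | ⟨k, hk⟩
      · rw [mk_adj e (hiff.1 h), ((gr_adj hZ).1 h).2]
      · have hn : ¬ (gr Z).Adj i j := by
          rw [gr_adj hZ, hk]; simp
        have hn' : ¬ G.Adj i j := fun h => hn (hiff.2 h)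
        have hz : Z (.core i k) = .dart i j := by rw [← hk, hZ.1]
        rw [mk_nadj e hn', hk, ← he i k ⟨j, hn'⟩ hz]
        simp
    · obtain ⟨j, hj⟩ := core_cases hv hb.1 hb.2
      refine mem_union_right _ (mem_image.2 ⟨.dart i j, mem_image.2 ⟨(i, j), ?_, rfl⟩, ?_⟩)
      · refine mem_Df.2 fun hiff => ?_
        have hn : ¬ (gr Z).Adj i j := by
          rw [gr_adj hZ, ← hj, hZ.1]; simp
        have hn' : ¬ G.Adj i j := fun h => hn (hiff.2 h)
        apply hp
        rw [mk_core, he i k ⟨j, hn'⟩ hj, hj]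
      · rw [← hj, hZ.1]
  refine (card_le_card hsub).trans ((card_union_le _ _).trans ?_)
  have h1 := card_union_le A (A.image Z)
  have h2 := card_image_le (s := A) (f := Z)
  have h3 : ({v, Z v} : Finset (Gd d)).card ≤ 2 := card_le_two
  omega

lemma card_gd (d : Fin n → ℕ) : Fintype.card (Gd d) ≤ 2 * n ^ 2 := by
  rw [← Fintype.card_congr (gdEquiv d), Fintype.card_sum, Fintype.card_prod, Fintype.card_fin, Fintype.card_sigma]
  have : ∑ i, Fintype.card (Fin (n - d i)) ≤ ∑ _i : Fin n, n := sum_le_sum fun i _ => by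
    rw [Fintype.card_fin]; exact Nat.sub_le _ _
  rw [sum_const, card_univ, Fintype.card_fin, smul_eq_mul] at this
  nlinarith

end SHF

namespace SHF
open Finset
open scoped Classical

variable {n : ℕ} {d : Fin n → ℕ}

/-- Poincaré inequality for the graphs with a fixed degree sequence. -/
lemma fixed_energy {lo hi : ℕ} (hN : Num n lo hi) (hlo : ∀ x, lo ≤ d x)
    (hhi : ∀ x, d x ≤ hi) (hev : Even (∑ x, d x)) (f : SimpleGraph (Fin n) → ℝ) :
    ∑ G ∈ Om d, ∑ G' ∈ Om d, (f G - f G') ^ 2 ≤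
      (Om d).card * ((2 * (n : ℝ) ^ 2) ^ 132 * (12 * (n : ℝ) ^ 4) ^ 32) * En Step (Om d) f := by
  have hn := hN.lt
  have hdn : ∀ i, d i ≤ n := fun i => (hhi i).trans (by omega)
  have hne : Nonempty (Gd d) := ⟨.dart ⟨0, by omega⟩ ⟨0, by omega⟩⟩
  have hex : ∀ Z ∈ Wm (Gam d), ∃ G ∈ Om d, (Df (gr Z) G).card ≤ 14 ∧ (gr Z ∈ Om d → G = gr Z) := by
    intro Z hZ
    by_cases hg : gr Z ∈ Om d
    · refine ⟨gr Z, hg, ?_, fun _ => rfl⟩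
      have : Df (gr Z) (gr Z) = ∅ := by
        ext p; simp [mem_Df]
      simp [this]
    · obtain ⟨v, hv⟩ := (mem_filter.1 hZ).2.2
      obtain ⟨G, h1, h2⟩ := repair hN hlo hhi hev
        (gr_dg hdn (mem_filter.1 hZ).2.1 hv)
      exact ⟨G, h1, h2, fun h => absurd h hg⟩
  choose! φ hφ1 hφ2 hφ3 using hex
  set B : ℕ := Fintype.card (Gd d) ^ 2 with hB
  set W := Wm (Gam d) with hW
  have hfib : ∀ G ∈ Om d, (W.filter (fun Z => φ Z = G)).card ≤ Kn d * B ^ 30 := by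
    intro G hG
    have hsub : W.filter (fun Z => φ Z = G) ⊆
        (univ : Finset (Asg d G)).biUnion (fun e => ball (mk G e) 30) := by
      intro Z hZ
      obtain ⟨hZ, he⟩ := mem_filter.1 hZ
      obtain ⟨v, hv⟩ := (mem_filter.1 hZ).2.2
      obtain ⟨e, he⟩ := exists_asg (mem_filter.1 hZ).2.1 hv hG (he ▸ hφ2 Z hZ)
      exact mem_biUnion.2 ⟨e, mem_univ _, he⟩
    refine (card_le_card hsub).trans ((card_biUnion_le_card_mul _ _ (B ^ 30)
      fun e _ => ball_card _ _).trans ?_)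
    rw [card_univ, card_asg hG]
  have hWc : W.card ≤ (Om d).card * (Kn d * B ^ 30) := by
    rw [card_eq_sum_card_fiberwise (f := φ) (t := Om d) (fun Z hZ => hφ1 Z hZ)]
    exact (sum_le_sum hfib).trans (by rw [sum_const, smul_eq_mul])
  set R : ℝ := ∑ G ∈ Om d, ∑ G' ∈ Om d, if Reach Step (Om d) 32 G G' then (f G - f G') ^ 2 else 0
    with hR
  set F : (Gd d → Gd d) → ℝ := fun Z => f (φ Z) with hF
  have hnear : ∑ Z ∈ W, ∑ Z' ∈ W, (if Near Z Z' then (F Z - F Z') ^ 2 else 0) ≤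
      ((Kn d * B ^ 30 : ℕ) : ℝ) * ((B ^ 4 : ℕ) : ℝ) * R := by
    have h1 : ∀ Z ∈ W, ∑ Z' ∈ W, (if Near Z Z' then (F Z - F Z') ^ 2 else 0) ≤
        ((B ^ 4 : ℕ) : ℝ) * ∑ G' ∈ Om d,
          if Reach Step (Om d) 32 (φ Z) G' then (f (φ Z) - f G') ^ 2 else 0 := by
      intro Z hZ
      set g : SimpleGraph (Fin n) → ℝ := fun G' =>
        if Reach Step (Om d) 32 (φ Z) G' then (f (φ Z) - f G') ^ 2 else 0 with hg
      have hg0 : ∀ G', 0 ≤ g G' := fun G' => by simp only [hg]; split_ifs <;> positivity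
      rw [← sum_filter]
      have hcard : (W.filter (fun Z' => Near Z Z')).card ≤ B ^ 4 := by
        refine (card_le_card (t := ball Z 4) fun Z' h => ?_).trans (ball_card Z 4)
        unfold ball
        rw [mem_filter]
        exact ⟨mem_univ _, (mem_filter.1 h).2⟩
      calc _ ≤ ∑ Z' ∈ W.filter (fun Z' => Near Z Z'), ∑ G' ∈ Om d, g G' := by
            refine sum_le_sum fun Z' hZ' => ?_
            obtain ⟨hZ', hnr⟩ := mem_filter.1 hZ'
            have hD : (Df (φ Z) (φ Z')).card ≤ 32 := by
              have t1 := Df_triangle (φ Z) (gr Z) (φ Z')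
              have t2 := Df_triangle (gr Z) (gr Z') (φ Z')
              have t3 := hφ2 Z hZ
              have t4 := hφ2 Z' hZ'
              have t5 := gr_near (mem_filter.1 hZ).2.1 (mem_filter.1 hZ').2.1 hnr
              rw [Df_comm] at t3
              omega
            have hr := reach_of_Df 32 (hφ1 Z hZ) (hφ1 Z' hZ') hD
            calc (F Z - F Z') ^ 2 = g (φ Z') := by simp only [hg, hF]; rw [if_pos hr]
              _ ≤ _ := single_le_sum (fun G' _ => hg0 G') (hφ1 Z' hZ')
        _ = ((W.filter (fun Z' => Near Z Z')).card : ℝ) * ∑ G' ∈ Om d, g G' := by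
            rw [sum_const, nsmul_eq_mul]
        _ ≤ _ := by
            gcongr
    refine (sum_le_sum h1).trans ?_
    rw [← mul_sum]
    set g : SimpleGraph (Fin n) → ℝ := fun G => ∑ G' ∈ Om d,
          if Reach Step (Om d) 32 G G' then (f G - f G') ^ 2 else 0 with hg
    have hg0 : ∀ G, 0 ≤ g G := fun G => sum_nonneg fun _ _ => by split_ifs <;> positivity
    have h2 : ∑ Z ∈ W, g (φ Z) ≤ ((Kn d * B ^ 30 : ℕ) : ℝ) * R := by
      rw [← sum_fiberwise_of_maps_to (fun Z hZ => hφ1 Z hZ), hR, mul_sum]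
      refine sum_le_sum fun G hG => ?_
      rw [sum_congr rfl (fun Z hZ => by rw [(mem_filter.1 hZ).2] :
        ∀ Z ∈ W.filter (fun Z => φ Z = G), g (φ Z) = g G), sum_const, nsmul_eq_mul]
      exact mul_le_mul_of_nonneg_right (by exact_mod_cast hfib G hG) (hg0 G)
    calc _ ≤ ((B ^ 4 : ℕ) : ℝ) * (((Kn d * B ^ 30 : ℕ) : ℝ) * R) := by gcongr
      _ = _ := by ring
  have hK : (0 : ℝ) < Kn d := by
    unfold Kn; exact_mod_cast prod_pos fun i _ => Nat.factorial_pos _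
  have hR0 : 0 ≤ R := sum_nonneg fun _ _ => sum_nonneg fun _ _ => by split_ifs <;> positivity
  have hlow : (Kn d : ℝ) ^ 2 * ∑ G ∈ Om d, ∑ G' ∈ Om d, (f G - f G') ^ 2 ≤
      ∑ a ∈ Pm (Gam d), ∑ b ∈ Pm (Gam d), (F a - F b) ^ 2 := by
    have hφm : ∀ G ∈ Om d, ∀ e : Asg d G, φ (mk G e) = G := by
      intro G hG e
      have hm : mk G e ∈ W := by
        have := mem_filter.1 (mk_mem e)
        exact mem_filter.2 ⟨mem_univ _, this.2.1, .dart ⟨0, by omega⟩ ⟨0, by omega⟩,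
          fun p _ _ => this.2.2 p⟩
      rw [hφ3 _ hm (by rwa [gr_mk]), gr_mk]
    have gen : ∀ g : (Gd d → Gd d) → ℝ, (∀ Z, 0 ≤ g Z) →
        ∑ G ∈ Om d, ∑ e : Asg d G, g (mk G e) ≤ ∑ a ∈ Pm (Gam d), g a := by
      intro g hg
      rw [sum_sigma']
      rw [← sum_image (f := g) (g := fun x : (Σ G, Asg d G) => mk x.1 x.2)]
      · refine sum_le_sum_of_subset_of_nonneg ?_ fun Z _ _ => hg Z
        intro Z hZ
        obtain ⟨x, _, rfl⟩ := mem_image.1 hZ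
        exact mk_mem _
      · rintro ⟨G, e⟩ _ ⟨G', e'⟩ _ h
        have h : mk G e = mk G' e' := h
        have h1 : G = G' := by rw [← gr_mk e, ← gr_mk e', h]
        subst h1
        rw [mk_injective G h]
    have cs : ∀ (x : ℝ), ∀ G ∈ Om d, ∑ _e : Asg d G, x = Kn d * x := by
      intro x G hG
      rw [sum_const, card_univ, card_asg hG, nsmul_eq_mul]
    calc _ = ∑ G ∈ Om d, ∑ e : Asg d G, ∑ G' ∈ Om d, ∑ e' : Asg d G',
          (F (mk G e) - F (mk G' e')) ^ 2 := by
          rw [mul_sum]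
          refine sum_congr rfl fun G hG => ?_
          have : ∀ e : Asg d G, ∑ G' ∈ Om d, ∑ e' : Asg d G', (F (mk G e) - F (mk G' e')) ^ 2 =
              Kn d * ∑ G' ∈ Om d, (f G - f G') ^ 2 := by
            intro e
            rw [mul_sum]
            refine sum_congr rfl fun G' hG' => ?_
            rw [← cs _ G' hG']
            refine sum_congr rfl fun e' _ => ?_
            simp only [hF]
            rw [hφm G hG e, hφm G' hG' e']
          rw [sum_congr rfl fun e _ => this e, cs _ G hG]
          ring
      _ ≤ ∑ G ∈ Om d, ∑ e : Asg d G, ∑ b ∈ Pm (Gam d), (F (mk G e) - F b) ^ 2 :=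
          sum_le_sum fun G _ => sum_le_sum fun e _ => gen (fun Z => (F (mk G e) - F Z) ^ 2)
            fun _ => sq_nonneg _
      _ ≤ _ := gen (fun Z => ∑ b ∈ Pm (Gam d), (F Z - F b) ^ 2)
          fun _ => sum_nonneg fun _ _ => sq_nonneg _
  have hmat := matching_energy (Gam d) F
  have hRe : R ≤ (12 * (n : ℝ) ^ 4) ^ 32 * En Step (Om d) f := by
    have := reach_energy (S := Step) (Ω := Om d) (fun _ _ h => Step.symm h)
      (step_card (by omega)) f 32
    refine this.trans (le_of_eq ?_)
    push_cast; ring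
  have hBn : (B : ℝ) ≤ (2 * (n : ℝ) ^ 2) ^ 2 := by
    have : B ≤ (2 * n ^ 2) ^ 2 := Nat.pow_le_pow_left (card_gd d) 2
    exact_mod_cast this
  have hE := En_nonneg (S := Step) (Ω := Om d) f
  have hmat' := hlow.trans hmat
  have hW2 : (W.card : ℝ) ≤ (((Om d).card * (Kn d * B ^ 30) : ℕ) : ℝ) := by exact_mod_cast hWc
  rw [← hW] at hmat'
  generalize (∑ Z ∈ W, ∑ Z' ∈ W, if Near Z Z' then (F Z - F Z') ^ 2 else 0) = E2 at hmat' hnear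
  generalize (∑ G ∈ Om d, ∑ G' ∈ Om d, (f G - f G') ^ 2) = L at hmat' ⊢
  have tot : (Kn d : ℝ) ^ 2 * L ≤ (Kn d : ℝ) ^ 2 * ((Om d).card * (B : ℝ) ^ 66 * R) := by
    calc _ ≤ (Fintype.card (Gd d) : ℝ) ^ 4 * W.card * E2 := hmat'
      _ ≤ (Fintype.card (Gd d) : ℝ) ^ 4 * (W.card : ℝ) *
          (((Kn d * B ^ 30 : ℕ) : ℝ) * ((B ^ 4 : ℕ) : ℝ) * R) :=
          mul_le_mul_of_nonneg_left hnear (by positivity)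
      _ ≤ (Fintype.card (Gd d) : ℝ) ^ 4 * (((Om d).card * (Kn d * B ^ 30) : ℕ) : ℝ) *
          (((Kn d * B ^ 30 : ℕ) : ℝ) * ((B ^ 4 : ℕ) : ℝ) * R) :=
          mul_le_mul_of_nonneg_right (mul_le_mul_of_nonneg_left hW2 (by positivity))
            (by positivity)
      _ = _ := by
          rw [hB]; push_cast; ring
  have t2 := le_of_mul_le_mul_left tot (by positivity)
  have hB66 : (B : ℝ) ^ 66 ≤ (2 * (n : ℝ) ^ 2) ^ 132 := by
    have := pow_le_pow_left₀ (Nat.cast_nonneg B) hBn 66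
    rwa [← pow_mul] at this
  have t3 := mul_le_mul hB66 hRe hR0 (by positivity)
  refine t2.trans ?_
  rw [mul_assoc, mul_assoc, mul_assoc]
  exact mul_le_mul_of_nonneg_left t3 (Nat.cast_nonneg _)

end SHF

namespace SHF
open Finset
open scoped Classical

/-- Nonnegative log-concave sequences without internal zeros. -/
def LC (a : ℤ → ℝ) : Prop := (∀ x, 0 ≤ a x) ∧ ∀ i j, i ≤ j → a i * a (j + 1) ≤ a (i + 1) * a j

lemma LC.spread_aux {a : ℤ → ℝ} (h : LC a) (t : ℕ) : ∀ p q : ℤ, p + t ≤ q - t →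
    a p * a q ≤ a (p + t) * a (q - t) := by
  induction t with
  | zero => intro p q _; simp
  | succ t ih =>
    intro p q hpq
    push_cast at hpq
    have h1 := h.2 p (q - 1) (by omega)
    rw [sub_add_cancel] at h1
    have h2 := ih (p + 1) (q - 1) (by omega)
    have e1 : p + 1 + (t : ℤ) = p + ((t + 1 : ℕ) : ℤ) := by push_cast; ring
    have e2 : q - 1 - (t : ℤ) = q - ((t + 1 : ℕ) : ℤ) := by push_cast; ring
    rw [e1, e2] at h2
    exact h1.trans h2

lemma LC.spread {a : ℤ → ℝ} (h : LC a) {p q r s : ℤ} (h1 : p ≤ r) (h2 : p ≤ s)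
    (h3 : r + s = p + q) : a p * a q ≤ a r * a s := by
  rcases le_total r s with hrs | hrs
  · have := h.spread_aux (r - p).toNat p q (by omega)
    rwa [show p + ((r - p).toNat : ℤ) = r by omega, show q - ((r - p).toNat : ℤ) = s by omega]
      at this
  · have := h.spread_aux (s - p).toNat p q (by omega)
    rw [show p + ((s - p).toNat : ℤ) = s by omega, show q - ((s - p).toNat : ℤ) = r by omega]
      at this
    rwa [mul_comm (a r)]

lemma LC.unimodal {a : ℤ → ℝ} (h : LC a) (k : ℕ) : ∀ x y z : ℤ, x ≤ z → z ≤ y → y - x ≤ k →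
    min (a x) (a y) ≤ a z := by
  induction k with
  | zero =>
    intro x y z h1 h2 h3
    have : x = z := by push_cast at h3; omega
    rw [this]; exact min_le_left _ _
  | succ k ih =>
    intro x y z h1 h2 h3
    push_cast at h3
    by_cases hx : x = z
    · rw [hx]; exact min_le_left _ _
    by_cases hy : z = y
    · rw [hy]; exact min_le_right _ _
    have h4 := h.2 x (y - 1) (by omega)
    rw [sub_add_cancel] at h4
    by_cases h5 : a x ≤ a (x + 1)
    · exact (min_le_min_right _ h5).trans (ih (x + 1) y z (by omega) h2 (by omega))
    · have h6 : a y ≤ a (y - 1) := by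
        by_contra h6
        push Not at h5 h6
        have := mul_lt_mul'' h5 h6 (h.1 _) (h.1 _)
        linarith
      exact (min_le_min_left _ h6).trans (ih x (y - 1) z h1 (by omega) (by omega))

lemma LC.conv {a b : ℤ → ℝ} (ha : LC a) (hb : LC b) {N : ℤ}
    (hs : ∀ x, x ∉ Icc 0 N → a x = 0) : LC (fun i => ∑ x ∈ Icc 0 N, a x * b (i - x)) := by
  refine ⟨fun i => sum_nonneg fun x _ => mul_nonneg (ha.1 _) (hb.1 _), fun i j hij => ?_⟩
  have e1 : ∀ i, ∑ x ∈ Icc 0 N, a x * b (i - x) = ∑ x ∈ Icc (-1) N, a x * b (i - x) := by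
    intro i
    refine sum_subset (Icc_subset_Icc (by omega) le_rfl) fun x _ hx => ?_
    rw [hs x hx, zero_mul]
  have e2 : ∀ i, ∑ x ∈ Icc 0 N, a x * b (i + 1 - x) = ∑ x ∈ Icc (-1) N, a (x + 1) * b (i - x) := by
    intro i
    have : ∑ x ∈ Icc (-1) N, a (x + 1) * b (i - x) = ∑ x ∈ Icc 0 (N + 1), a x * b (i + 1 - x) := by
      refine sum_nbij' (fun x => x + 1) (fun x => x - 1) ?_ ?_ ?_ ?_ ?_
      · intro x hx; rw [mem_Icc] at *; omega
      · intro x hx; rw [mem_Icc] at *; omega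
      · intro x _; ring
      · intro x _; ring
      · intro x _
        rw [show i + 1 - (x + 1) = i - x by ring]
    rw [this]
    refine sum_subset (Icc_subset_Icc le_rfl (by omega)) fun x _ hx => ?_
    rw [hs x hx, zero_mul]
  simp only [e2, e1]
  rw [sum_mul_sum, sum_mul_sum, ← sub_nonneg]
  simp only [← sum_sub_distrib]
  set f : ℤ → ℤ → ℝ := fun x y => a (x + 1) * b (i - x) * (a y * b (j - y)) -
    a x * b (i - x) * (a (y + 1) * b (j - y)) with hf
  have hsym : ∑ x ∈ Icc (-1) N, ∑ y ∈ Icc (-1) N, f x y =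
      (1 / 2) * ∑ x ∈ Icc (-1) N, ∑ y ∈ Icc (-1) N, (f x y + f y x) := by
    simp only [sum_add_distrib]
    rw [sum_comm (f := fun x y => f y x)]
    ring
  change 0 ≤ ∑ x ∈ Icc (-1) N, ∑ y ∈ Icc (-1) N, f x y
  rw [hsym]
  refine mul_nonneg (by norm_num) (sum_nonneg fun x _ => sum_nonneg fun y _ => ?_)
  have hfac : f x y + f y x = (a (x + 1) * a y - a x * a (y + 1)) *
      (b (i - x) * b (j - y) - b (i - y) * b (j - x)) := by
    simp only [hf]; ring
  rw [hfac]
  rcases le_total x y with hxy | hxy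
  · refine mul_nonneg (sub_nonneg.2 (ha.2 x y hxy)) (sub_nonneg.2 ?_)
    exact hb.spread (by omega) (by omega) (by ring)
  · refine mul_nonneg_of_nonpos_of_nonpos (sub_nonpos.2 ?_) (sub_nonpos.2 ?_)
    · have := ha.2 y x hxy; linarith
    · exact hb.spread (by omega) (by omega) (by ring)

/-- Poincaré inequality for a log-concave weight on an interval. -/
lemma line_poincare {m : ℤ → ℝ} (hm : LC m) (N : ℕ) (h : ℤ → ℝ) :
    ∑ x ∈ Icc (0 : ℤ) N, ∑ y ∈ Icc (0 : ℤ) N, m x * m y * (h x - h y) ^ 2 ≤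
      (N + 1 : ℝ) ^ 3 * (∑ x ∈ Icc (0 : ℤ) N, m x) *
        ∑ z ∈ Icc (0 : ℤ) N, min (m z) (m (z + 1)) * (h z - h (z + 1)) ^ 2 := by
  set M := ∑ x ∈ Icc (0 : ℤ) N, m x with hM
  set R := ∑ z ∈ Icc (0 : ℤ) N, min (m z) (m (z + 1)) * (h z - h (z + 1)) ^ 2 with hR
  have hmin0 : ∀ z, 0 ≤ min (m z) (m (z + 1)) := fun z => le_min (hm.1 _) (hm.1 _)
  have hR0 : 0 ≤ R := sum_nonneg fun z _ => mul_nonneg (hmin0 z) (sq_nonneg _)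
  have hM0 : 0 ≤ M := sum_nonneg fun x _ => hm.1 x
  have key : ∀ k : ℕ, ∀ x : ℤ, h x - h (x + k) = ∑ z ∈ Ico x (x + k), (h z - h (z + 1)) := by
    intro k
    induction k with
    | zero => intro x; simp
    | succ k ih =>
      intro x
      have : Ico x (x + ((k + 1 : ℕ) : ℤ)) = insert (x + k) (Ico x (x + k)) := by
        ext z; simp only [mem_Ico, mem_insert]; push_cast; omega
      rw [this, sum_insert (by simp), ← ih]
      push_cast
      rw [add_assoc]; ring
  have main : ∀ x ∈ Icc (0 : ℤ) N, ∀ y ∈ Icc (0 : ℤ) N, x ≤ y →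
      m x * m y * (h x - h y) ^ 2 ≤ (N + 1 : ℝ) * M * R := by
    intro x hx y hy hxy
    rw [mem_Icc] at hx hy
    obtain ⟨k, hk⟩ : ∃ k : ℕ, y = x + k := ⟨(y - x).toNat, by omega⟩
    have h1 : (h x - h y) ^ 2 ≤ k * ∑ z ∈ Ico x y, (h z - h (z + 1)) ^ 2 := by
      rw [hk, key]
      have := sq_sum_le_card_mul_sum_sq (s := Ico x (x + k)) (f := fun z => h z - h (z + 1))
      simpa using this
    have h2 : m x * m y ≤ M * min (m x) (m y) := by
      have a1 : m x ≤ M := single_le_sum (f := m) (fun z _ => hm.1 z) (mem_Icc.2 hx)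
      have a2 : m y ≤ M := single_le_sum (f := m) (fun z _ => hm.1 z) (mem_Icc.2 hy)
      rcases min_cases (m x) (m y) with h | h <;> rw [h.1]
      · rw [mul_comm]; exact mul_le_mul_of_nonneg_right a2 (hm.1 _)
      · exact mul_le_mul_of_nonneg_right a1 (hm.1 _)
    have h3 : ∑ z ∈ Ico x y, min (m x) (m y) * (h z - h (z + 1)) ^ 2 ≤ R := by
      calc _ ≤ ∑ z ∈ Ico x y, min (m z) (m (z + 1)) * (h z - h (z + 1)) ^ 2 := by
            refine sum_le_sum fun z hz => ?_
            rw [mem_Ico] at hz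
            refine mul_le_mul_of_nonneg_right (le_min ?_ ?_) (sq_nonneg _)
            · exact hm.unimodal k x y z (by omega) (by omega) (by omega)
            · exact hm.unimodal k x y (z + 1) (by omega) (by omega) (by omega)
        _ ≤ R := by
            refine sum_le_sum_of_subset_of_nonneg ?_ fun z _ _ =>
              mul_nonneg (hmin0 z) (sq_nonneg _)
            intro z hz
            rw [mem_Ico] at hz
            rw [mem_Icc]; omega
    rw [← mul_sum] at h3
    have hmin : 0 ≤ min (m x) (m y) := le_min (hm.1 _) (hm.1 _)
    have hk1 : (k : ℝ) ≤ N + 1 := by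
      have : k ≤ N + 1 := by omega
      exact_mod_cast this
    calc m x * m y * (h x - h y) ^ 2
        ≤ M * min (m x) (m y) * (k * ∑ z ∈ Ico x y, (h z - h (z + 1)) ^ 2) := by
          gcongr
      _ = k * M * (min (m x) (m y) * ∑ z ∈ Ico x y, (h z - h (z + 1)) ^ 2) := by ring
      _ ≤ (N + 1) * M * R := by gcongr
  have main' : ∀ x ∈ Icc (0 : ℤ) N, ∀ y ∈ Icc (0 : ℤ) N,
      m x * m y * (h x - h y) ^ 2 ≤ (N + 1 : ℝ) * M * R := by
    intro x hx y hy
    rcases le_total x y with hxy | hxy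
    · exact main x hx y hy hxy
    · have := main y hy x hx hxy
      calc _ = m y * m x * (h y - h x) ^ 2 := by ring
        _ ≤ _ := this
  calc _ ≤ ∑ x ∈ Icc (0 : ℤ) N, ∑ y ∈ Icc (0 : ℤ) N, (N + 1 : ℝ) * M * R :=
        sum_le_sum fun x hx => sum_le_sum fun y hy => main' x hx y hy
    _ = _ := by
        simp only [sum_const, Int.card_Icc, nsmul_eq_mul]
        rw [show ((N : ℤ) + 1 - 0).toNat = N + 1 by omega]
        push_cast; ring

/-- Stochastic domination from monotone likelihood ratios. -/
lemma cdf_le {μ ν : ℤ → ℝ} {I : Finset ℤ} (hμ : ∑ x ∈ I, μ x = 1) (hν : ∑ x ∈ I, ν x = 1)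
    (h : ∀ i j, i ≤ j → μ i * ν j ≤ ν i * μ j) (k : ℤ) :
    ∑ x ∈ I with x ≤ k, μ x ≤ ∑ x ∈ I with x ≤ k, ν x := by
  have s1 := sum_filter_add_sum_filter_not I (fun x => x ≤ k) μ
  have s2 := sum_filter_add_sum_filter_not I (fun x => x ≤ k) ν
  have h1 : (∑ x ∈ I with x ≤ k, μ x) * (∑ x ∈ I with ¬ x ≤ k, ν x) ≤
      (∑ x ∈ I with x ≤ k, ν x) * (∑ x ∈ I with ¬ x ≤ k, μ x) := by
    rw [sum_mul_sum, sum_mul_sum]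
    refine sum_le_sum fun i hi => sum_le_sum fun j hj => h i j ?_
    have := (mem_filter.1 hi).2
    have := (mem_filter.1 hj).2
    omega
  rw [hμ] at s1
  rw [hν] at s2
  rw [eq_sub_of_add_eq' s1, eq_sub_of_add_eq' s2] at h1
  linarith

end SHF

namespace SHF
open Finset
open scoped Classical

/-- Integer points of the box `[0, N]^n` with coordinate sum `S`. -/
noncomputable def Sl (n N : ℕ) (S : ℤ) : Finset (Fin n → ℤ) :=
  (Fintype.piFinset fun _ => Icc (0 : ℤ) N).filter fun d => ∑ i, d i = S

/-- Product weight. -/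
noncomputable def Wt {n : ℕ} (w : Fin n → ℤ → ℝ) (d : Fin n → ℤ) : ℝ := ∏ i, w i (d i)

/-- Total weight of a slice. -/
noncomputable def Zs {n : ℕ} (N : ℕ) (w : Fin n → ℤ → ℝ) (S : ℤ) : ℝ := ∑ d ∈ Sl n N S, Wt w d

/-- `d` is obtained from `d'` by raising one coordinate. -/
def Dn {n : ℕ} (d d' : Fin n → ℤ) : Prop := ∃ J, ∀ x, d x = d' x + if x = J then 1 else 0

/-- `d'` is obtained from `d` by raising one coordinate and lowering another one. -/
def Unit' {n : ℕ} (d d' : Fin n → ℤ) : Prop :=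
  ∃ a b, a ≠ b ∧ ∀ x, d' x + (if x = b then 1 else 0) = d x + if x = a then 1 else 0

lemma mem_Sl {n N : ℕ} {S : ℤ} {d : Fin n → ℤ} :
    d ∈ Sl n N S ↔ (∀ i, 0 ≤ d i ∧ d i ≤ N) ∧ ∑ i, d i = S := by
  simp [Sl, Fintype.mem_piFinset]

lemma sum_Sl_succ {n N : ℕ} {S : ℤ} (F : (Fin (n + 1) → ℤ) → ℝ) :
    ∑ d ∈ Sl (n + 1) N S, F d =
      ∑ x ∈ Icc (0 : ℤ) N, ∑ d ∈ Sl n N (S - x), F (Matrix.vecCons x d) := by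
  rw [sum_sigma']
  refine sum_nbij' (fun d => ⟨d 0, fun i => d i.succ⟩) (fun p => Matrix.vecCons p.1 p.2) ?_ ?_ ?_ ?_ ?_
  · intro d hd
    rw [mem_Sl, Fin.sum_univ_succ] at hd
    rw [mem_sigma, mem_Icc, mem_Sl]
    exact ⟨hd.1 0, fun i => hd.1 i.succ, by simp only; linarith [hd.2]⟩
  · rintro ⟨x, d⟩ hd
    rw [mem_sigma, mem_Icc, mem_Sl] at hd
    rw [mem_Sl, Fin.sum_univ_succ]
    refine ⟨fun i => ?_, ?_⟩
    · refine Fin.cases ?_ (fun i => ?_) i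
      · simpa using hd.1
      · simpa using hd.2.1 i
    · have := hd.2.2
      simp only [Matrix.cons_val_zero, Matrix.cons_val_succ]
      linarith
  · intro d _
    funext i
    refine Fin.cases ?_ (fun i => ?_) i <;> simp
  · rintro ⟨x, d⟩ _
    simp
  · intro d _
    congr 1
    funext i
    refine Fin.cases ?_ (fun i => ?_) i <;> simp

lemma Wt_cons {n : ℕ} (w : Fin (n + 1) → ℤ → ℝ) (x : ℤ) (d : Fin n → ℤ) :
    Wt w (Matrix.vecCons x d) = w 0 x * Wt (fun i => w i.succ) d := by
  simp [Wt, Fin.prod_univ_succ]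

lemma Wt_nonneg {n : ℕ} {w : Fin n → ℤ → ℝ} (hw : ∀ i, LC (w i)) (d : Fin n → ℤ) : 0 ≤ Wt w d :=
  prod_nonneg fun i _ => (hw i).1 _

lemma Zs_nonneg {n N : ℕ} {w : Fin n → ℤ → ℝ} (hw : ∀ i, LC (w i)) (S : ℤ) : 0 ≤ Zs N w S :=
  sum_nonneg fun d _ => Wt_nonneg hw d

lemma Zs_succ {n N : ℕ} (w : Fin (n + 1) → ℤ → ℝ) (S : ℤ) :
    Zs N w S = ∑ x ∈ Icc (0 : ℤ) N, w 0 x * Zs N (fun i => w i.succ) (S - x) := by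
  simp only [Zs, sum_Sl_succ, Wt_cons, mul_sum]

lemma Zs_LC {N : ℕ} : ∀ {n : ℕ} {w : Fin n → ℤ → ℝ}, (∀ i, LC (w i)) →
    (∀ i x, x ∉ Icc (0 : ℤ) N → w i x = 0) → LC (Zs N w)
  | 0, w, _, _ => by
    have h : ∀ S, Zs N w S = if S = 0 then 1 else 0 := by
      intro S
      have : Sl 0 N S = if S = 0 then {Fin.elim0} else ∅ := by
        ext d
        rw [mem_Sl]
        split_ifs with h
        · simp [h, Subsingleton.elim d Fin.elim0]
        · simp [eq_comm, h]
      rw [Zs, this]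
      split_ifs <;> simp [Wt]
    refine ⟨fun S => by rw [h]; split_ifs <;> norm_num, fun i j hij => ?_⟩
    simp only [h]
    split_ifs <;> first | omega | norm_num
  | n + 1, w, hw, hs => by
    have := LC.conv (hw 0) (Zs_LC (fun i => hw i.succ) fun i => hs i.succ) (hs 0)
    have e : Zs N w = fun S => ∑ x ∈ Icc (0 : ℤ) N, w 0 x * Zs N (fun i => w i.succ) (S - x) :=
      funext fun S => Zs_succ w S
    rwa [e]

lemma sq_sum_mul_le {ι : Type*} (s : Finset ι) (p f : ι → ℝ) (hp : ∀ i ∈ s, 0 ≤ p i) :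
    (∑ i ∈ s, p i * f i) ^ 2 ≤ (∑ i ∈ s, p i) * ∑ i ∈ s, p i * f i ^ 2 := by
  have := sum_sq_le_sum_mul_sum_of_sq_le_mul s (r := fun i => p i * f i) (f := p)
    (g := fun i => p i * f i ^ 2) hp (fun i hi => mul_nonneg (hp i hi) (sq_nonneg _))
    (fun i _ => le_of_eq (by ring))
  exact this
end SHF

namespace SHF
open Finset
open scoped Classical

lemma sum_filter_le_succ {μ : ℤ → ℝ} {M : ℤ} (h0 : ∀ x, x ∉ Icc 0 M → μ x = 0) (k : ℤ) :
    ∑ x ∈ Icc 0 M with x ≤ k, μ x = (∑ x ∈ Icc 0 M with x ≤ k - 1, μ x) + μ k := by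
  by_cases hk : k ∈ Icc 0 M
  · have : (Icc 0 M).filter (fun x => x ≤ k) = insert k ((Icc 0 M).filter fun x => x ≤ k - 1) := by
      ext x
      rw [mem_insert, mem_filter, mem_filter]
      rw [mem_Icc] at *
      omega
    rw [this, sum_insert (by simp)]
    ring
  · rw [h0 k hk, add_zero]
    refine sum_congr ?_ fun _ _ => rfl
    ext x
    rw [mem_filter, mem_filter]
    rw [mem_Icc] at *
    omega

/-- Two interlacing probability distributions can be matched so that the coordinate moves by at
most one. -/
lemma exists_interlace {μ ν : ℤ → ℝ} {N : ℤ}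
    (hμ0 : ∀ x, x ∉ Icc 0 N → μ x = 0) (hν0 : ∀ x, x ∉ Icc 0 N → ν x = 0)
    (hμ : ∑ x ∈ Icc 0 N, μ x = 1) (hν : ∑ x ∈ Icc 0 N, ν x = 1)
    (h1 : ∀ i j, i ≤ j → μ i * ν j ≤ ν i * μ j)
    (h2 : ∀ i j, i ≤ j → ν (i - 1) * μ j ≤ μ i * ν (j - 1)) :
    ∃ s t : ℤ → ℝ, (∀ x, 0 ≤ s x) ∧ (∀ x, 0 ≤ t x) ∧ (∀ x, s x + t x = ν x) ∧
      ∀ x, s x + t (x - 1) = μ x := by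
  have ext1 : ∀ f : ℤ → ℝ, (∀ x, x ∉ Icc 0 N → f x = 0) →
      ∑ x ∈ Icc 0 (N + 1), f x = ∑ x ∈ Icc 0 N, f x := fun f hf =>
    (sum_subset (Icc_subset_Icc le_rfl (by omega)) fun x _ hx => hf x hx).symm
  have ext0 : ∀ f : ℤ → ℝ, (∀ x, x ∉ Icc 0 N → f x = 0) → ∀ x, x ∉ Icc 0 (N + 1) → f x = 0 :=
    fun f hf x hx => hf x fun h => hx (Icc_subset_Icc le_rfl (by omega) h)
  have hμ' := (ext1 μ hμ0).trans hμ
  have hν' := (ext1 ν hν0).trans hν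
  have shift : ∀ p : ℤ → Prop, ∑ x ∈ Icc 0 (N + 1) with p x, ν (x - 1) =
      ∑ x ∈ Icc 0 (N + 1) with p (x + 1), ν x := by
    intro p
    have e1 : ∑ x ∈ Icc 0 (N + 1) with p x, ν (x - 1) =
        ∑ x ∈ Icc 1 (N + 1) with p x, ν (x - 1) := by
      symm
      refine sum_subset (fun x hx => ?_) fun x hx hx' => ?_
      · rw [mem_filter, mem_Icc] at *; exact ⟨by omega, hx.2⟩
      · rw [mem_filter, mem_Icc] at *
        refine hν0 _ fun h => hx' ?_
        rw [mem_Icc] at h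
        exact ⟨by omega, hx.2⟩
    have e2 : ∑ x ∈ Icc 0 (N + 1) with p (x + 1), ν x = ∑ x ∈ Icc 0 N with p (x + 1), ν x := by
      symm
      refine sum_subset (fun x hx => ?_) fun x hx hx' => ?_
      · rw [mem_filter, mem_Icc] at *; exact ⟨by omega, hx.2⟩
      · rw [mem_filter, mem_Icc] at *
        refine hν0 _ fun h => hx' ?_
        rw [mem_Icc] at h
        exact ⟨by omega, hx.2⟩
    rw [e1, e2]
    refine sum_nbij' (fun x => x - 1) (fun x => x + 1) ?_ ?_ ?_ ?_ ?_
    · intro x hx; rw [mem_filter, mem_Icc] at *; refine ⟨by omega, by simpa using hx.2⟩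
    · intro x hx; rw [mem_filter, mem_Icc] at *; exact ⟨by omega, hx.2⟩
    · intro x _; ring
    · intro x _; ring
    · intro x _; rfl
  have hνs : ∑ x ∈ Icc 0 (N + 1), ν (x - 1) = 1 := by
    have := shift fun _ => True
    simpa [hν'] using this
  set t : ℤ → ℝ := fun k => ∑ x ∈ Icc 0 (N + 1) with x ≤ k, ν x -
    ∑ x ∈ Icc 0 (N + 1) with x ≤ k, μ x with ht
  refine ⟨fun k => ν k - t k, t, fun k => ?_, fun k => ?_, fun k => by ring, fun k => ?_⟩
  · have a := cdf_le hνs hμ' h2 k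
    have a' : ∑ x ∈ Icc 0 (N + 1) with x ≤ k, ν (x - 1) =
        ∑ x ∈ Icc 0 (N + 1) with x + 1 ≤ k, ν x := by convert shift fun x => x ≤ k
    rw [a'] at a
    have b := sum_filter_le_succ (ext0 ν hν0) k
    have c : ∑ x ∈ Icc 0 (N + 1) with x + 1 ≤ k, ν x = ∑ x ∈ Icc 0 (N + 1) with x ≤ k - 1, ν x := by
      refine sum_congr (filter_congr fun x _ => ?_) fun _ _ => rfl
      constructor <;> intro h <;> omega
    simp only [ht]
    linarith
  · exact sub_nonneg.2 (cdf_le hμ' hν' h1 k)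
  · have b := sum_filter_le_succ (ext0 ν hν0) k
    have c := sum_filter_le_succ (ext0 μ hμ0) k
    simp only [ht]
    linarith

lemma interlace_sq {a b s t μ ν : ℤ → ℝ} {N : ℤ}
    (hμ0 : ∀ x, x ∉ Icc 0 N → μ x = 0) (hν0 : ∀ x, x ∉ Icc 0 N → ν x = 0)
    (hν : ∑ x ∈ Icc 0 N, ν x = 1)
    (hs : ∀ x, 0 ≤ s x) (ht : ∀ x, 0 ≤ t x) (h1 : ∀ x, s x + t x = ν x)
    (h2 : ∀ x, s x + t (x - 1) = μ x) :
    (∑ x ∈ Icc 0 N, μ x * a x - ∑ x ∈ Icc 0 N, ν x * b x) ^ 2 ≤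
      ∑ x ∈ Icc 0 N, (s x * (a x - b x) ^ 2 + t x * (a (x + 1) - b x) ^ 2) := by
  have sh : ∑ x ∈ Icc 0 N, t (x - 1) * a x = ∑ x ∈ Icc 0 N, t x * a (x + 1) := by
    have tz : ∀ x, x + 1 ∉ Icc 0 N ∨ x ∉ Icc 0 N → t x = 0 := by
      rintro x (hx | hx)
      · have := h2 (x + 1); rw [hμ0 _ hx, add_sub_cancel_right] at this
        linarith [hs (x + 1), ht x]
      · have := h1 x; rw [hν0 _ hx] at this
        linarith [hs x, ht x]
    have e1 : ∑ x ∈ Icc 0 N, t (x - 1) * a x = ∑ x ∈ Icc 0 (N + 1), t (x - 1) * a x := by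
      refine sum_subset (Icc_subset_Icc le_rfl (by omega)) fun x _ hx => ?_
      rw [tz (x - 1) (Or.inl (by simpa using hx)), zero_mul]
    have e2 : ∑ x ∈ Icc 0 N, t x * a (x + 1) = ∑ x ∈ Icc (-1) N, t x * a (x + 1) := by
      refine sum_subset (Icc_subset_Icc (by omega) le_rfl) fun x _ hx => ?_
      rw [tz x (Or.inr hx), zero_mul]
    rw [e1, e2]
    refine sum_nbij' (fun x => x - 1) (fun x => x + 1) ?_ ?_ ?_ ?_ ?_
    · intro x hx; rw [mem_Icc] at *; omega
    · intro x hx; rw [mem_Icc] at *; omega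
    · intro x _; ring
    · intro x _; ring
    · intro x _; simp
  have e : ∑ x ∈ Icc 0 N, μ x * a x - ∑ x ∈ Icc 0 N, ν x * b x =
      ∑ x ∈ Icc 0 N, (s x * (a x - b x) + t x * (a (x + 1) - b x)) := by
    have : ∑ x ∈ Icc 0 N, μ x * a x = ∑ x ∈ Icc 0 N, s x * a x + ∑ x ∈ Icc 0 N, t x * a (x + 1) := by
      rw [← sh, ← sum_add_distrib]
      exact sum_congr rfl fun x _ => by rw [← h2]; ring
    rw [this, ← sum_add_distrib, ← sum_sub_distrib]
    exact sum_congr rfl fun x _ => by rw [← h1]; ring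
  rw [e]
  have := sum_sq_le_sum_mul_sum_of_sq_le_mul (Icc 0 N)
    (r := fun x => s x * (a x - b x) + t x * (a (x + 1) - b x)) (f := ν)
    (g := fun x => s x * (a x - b x) ^ 2 + t x * (a (x + 1) - b x) ^ 2)
    (fun x _ => by rw [← h1]; exact add_nonneg (hs x) (ht x))
    (fun x _ => add_nonneg (mul_nonneg (hs x) (sq_nonneg _)) (mul_nonneg (ht x) (sq_nonneg _)))
    (fun x _ => by
      rw [← h1]
      have := mul_nonneg (mul_nonneg (hs x) (ht x)) (sq_nonneg ((a x - b x) - (a (x + 1) - b x)))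
      nlinarith)
  rwa [hν, one_mul] at this

/-- Weighted average over a slice. -/
noncomputable def av {n : ℕ} (N : ℕ) (w : Fin n → ℤ → ℝ) (S : ℤ) (ψ : (Fin n → ℤ) → ℝ) : ℝ :=
  (∑ d ∈ Sl n N S, Wt w d * ψ d) / Zs N w S

/-- Comparison functional between neighbouring slices. -/
noncomputable def Ef {n : ℕ} (N : ℕ) (w : Fin n → ℤ → ℝ) (S : ℤ) (p q : ℝ)
    (ψ θ : (Fin n → ℤ) → ℝ) : ℝ :=
  ∑ d ∈ Sl n N S, ∑ d' ∈ Sl n N (S - 1),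
    if Dn d d' then min (p * Wt w d) (q * Wt w d') * (ψ d - θ d') ^ 2 else 0

lemma Dn_cons_same {n : ℕ} {x : ℤ} {d d' : Fin n → ℤ} (h : Dn d d') :
    Dn (Matrix.vecCons x d) (Matrix.vecCons x d') := by
  obtain ⟨J, hJ⟩ := h
  refine ⟨J.succ, fun i => Fin.cases ?_ (fun i => ?_) i⟩
  · simp [(Fin.succ_ne_zero J).symm]
  · simp [hJ]

lemma Dn_cons_succ {n : ℕ} {x : ℤ} {d : Fin n → ℤ} :
    Dn (Matrix.vecCons (x + 1) d) (Matrix.vecCons x d) :=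
  ⟨0, fun i => Fin.cases (by simp) (fun i => by simp) i⟩

lemma mul_av_sq_le {n N : ℕ} {w : Fin n → ℤ → ℝ} (hw : ∀ i, LC (w i)) (S : ℤ)
    (ψ : (Fin n → ℤ) → ℝ) (hZ : 0 < Zs N w S) :
    (av N w S ψ) ^ 2 ≤ ∑ d ∈ Sl n N S, Wt w d / Zs N w S * ψ d ^ 2 := by
  have := sq_sum_mul_le (Sl n N S) (Wt w) ψ fun d _ => Wt_nonneg hw d
  rw [av, div_pow, div_le_iff₀ (by positivity), sum_mul]
  refine this.trans (le_of_eq ?_)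
  change Zs N w S * _ = _
  rw [mul_sum]
  refine sum_congr rfl fun d _ => ?_
  field_simp
end SHF

namespace SHF
open Finset
open scoped Classical

lemma Ef_term_nonneg {n : ℕ} {w : Fin n → ℤ → ℝ} (hw : ∀ i, LC (w i)) {p q : ℝ} (hp : 0 ≤ p)
    (hq : 0 ≤ q) (ψ θ : (Fin n → ℤ) → ℝ) (d d' : Fin n → ℤ) :
    0 ≤ if Dn d d' then min (p * Wt w d) (q * Wt w d') * (ψ d - θ d') ^ 2 else 0 := by
  split_ifs
  · exact mul_nonneg (le_min (mul_nonneg hp (Wt_nonneg hw _)) (mul_nonneg hq (Wt_nonneg hw _)))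
      (sq_nonneg _)
  · exact le_rfl

lemma mul_Ef_le {n N : ℕ} {w : Fin n → ℤ → ℝ} (hw : ∀ i, LC (w i)) {S : ℤ} {p q p' q' c : ℝ}
    (hc : 0 ≤ c) (h1 : c * p ≤ p') (h2 : c * q ≤ q') (ψ θ : (Fin n → ℤ) → ℝ) :
    c * Ef N w S p q ψ θ ≤ Ef N w S p' q' ψ θ := by
  rw [Ef, Ef, mul_sum]
  refine sum_le_sum fun d _ => ?_
  rw [mul_sum]
  refine sum_le_sum fun d' _ => ?_
  split_ifs
  · rw [← mul_assoc]
    refine mul_le_mul_of_nonneg_right ?_ (sq_nonneg _)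
    rw [mul_min_of_nonneg _ _ hc]
    refine min_le_min ?_ ?_
    · nlinarith [Wt_nonneg hw d]
    · nlinarith [Wt_nonneg hw d']
  · simp

lemma Ef_split {n N : ℕ} {w : Fin (n + 1) → ℤ → ℝ} (hw : ∀ i, LC (w i))
    {S : ℤ} {p q : ℝ} (hp : 0 ≤ p) (hq : 0 ≤ q) (ψ θ : (Fin (n + 1) → ℤ) → ℝ)
    (T : ℤ → ℝ)
    (hT : ∀ x ∈ Icc (0 : ℤ) N, T x ≤
      (∑ d ∈ Sl n N (S - 1 - x), min (p * (w 0 (x + 1) * Wt (fun i => w i.succ) d))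
        (q * (w 0 x * Wt (fun i => w i.succ) d)) *
        (ψ (Matrix.vecCons (x + 1) d) - θ (Matrix.vecCons x d)) ^ 2))
    (hTN : T N ≤ 0) :
    ∑ x ∈ Icc (0 : ℤ) N, (Ef N (fun i => w i.succ) (S - x) (p * w 0 x) (q * w 0 x)
      (fun d => ψ (Matrix.vecCons x d)) (fun d => θ (Matrix.vecCons x d)) + T x) ≤
      Ef N w S p q ψ θ := by
  set w' : Fin n → ℤ → ℝ := fun i => w i.succ with hw'
  have hw'' : ∀ i, LC (w' i) := fun i => hw i.succ
  set K : ℤ → ℤ → ℝ := fun x y => ∑ d ∈ Sl n N (S - x), ∑ d' ∈ Sl n N (S - 1 - y),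
    (if Dn (Matrix.vecCons x d) (Matrix.vecCons y d') then
      min (p * Wt w (Matrix.vecCons x d)) (q * Wt w (Matrix.vecCons y d')) *
        (ψ (Matrix.vecCons x d) - θ (Matrix.vecCons y d')) ^ 2 else 0) with hK
  have hK0 : ∀ x y, 0 ≤ K x y := fun x y => sum_nonneg fun d _ => sum_nonneg fun d' _ =>
    Ef_term_nonneg hw hp hq ψ θ _ _
  have e : Ef N w S p q ψ θ = ∑ y ∈ Icc (0 : ℤ) N, ∑ x ∈ Icc (0 : ℤ) N, K x y := by
    refine Eq.trans ?_ sum_comm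
    rw [Ef, sum_Sl_succ]
    refine sum_congr rfl fun x _ => ?_
    refine Eq.trans ?_ sum_comm
    refine sum_congr rfl fun d _ => ?_
    rw [sum_Sl_succ]
  rw [e]
  refine sum_le_sum fun x hx => ?_
  have k1 : Ef N w' (S - x) (p * w 0 x) (q * w 0 x)
      (fun d => ψ (Matrix.vecCons x d)) (fun d => θ (Matrix.vecCons x d)) ≤ K x x := by
    rw [Ef, hK, show S - x - 1 = S - 1 - x by ring]
    refine sum_le_sum fun d _ => sum_le_sum fun d' _ => ?_
    split_ifs with h1 h2 h2
    · rw [Wt_cons, Wt_cons, mul_assoc, mul_assoc]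
    · exact absurd (Dn_cons_same h1) h2
    · exact mul_nonneg (le_min (mul_nonneg hp (Wt_nonneg hw _)) (mul_nonneg hq (Wt_nonneg hw _)))
        (sq_nonneg _)
    · exact le_rfl
  have k2 : T x ≤ if x = N then 0 else K (x + 1) x := by
    split_ifs with h
    · rw [h]; exact hTN
    · refine (hT x hx).trans ?_
      rw [hK]
      simp only
      rw [show S - (x + 1) = S - 1 - x by ring]
      refine sum_le_sum fun d hd => ?_
      refine le_trans ?_ (single_le_sum (fun d' _ => Ef_term_nonneg hw hp hq ψ θ _ _) hd)
      rw [if_pos Dn_cons_succ, Wt_cons, Wt_cons]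
  by_cases h : x = N
  · rw [if_pos h] at k2
    have := single_le_sum (f := fun z => K z x) (fun z _ => hK0 z x) hx
    linarith
  · rw [if_neg h] at k2
    have hsub : ({x, x + 1} : Finset ℤ) ⊆ Icc (0 : ℤ) N := by
      intro z hz
      rw [mem_insert, mem_singleton] at hz
      rw [mem_Icc] at *
      omega
    have := sum_le_sum_of_subset_of_nonneg hsub (f := fun z => K z x) fun z _ _ => hK0 z x
    rw [sum_pair (by omega)] at this
    linarith

theorem efron {N : ℕ} : ∀ {n : ℕ} {w : Fin n → ℤ → ℝ}, (∀ i, LC (w i)) →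
    (∀ i x, x ∉ Icc (0 : ℤ) N → w i x = 0) → ∀ (S : ℤ) (ψ θ : (Fin n → ℤ) → ℝ),
    0 < Zs N w S → 0 < Zs N w (S - 1) →
    (av N w S ψ - av N w (S - 1) θ) ^ 2 ≤ Ef N w S (Zs N w S)⁻¹ (Zs N w (S - 1))⁻¹ ψ θ
  | 0, w, _, _ => by
    intro S ψ θ h1 h2
    exfalso
    have key : ∀ S, 0 < Zs N w S → S = 0 := by
      intro S h
      by_contra hS
      have : Sl 0 N S = ∅ := by
        ext d
        rw [mem_Sl]
        simp [Ne.symm hS]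
      rw [Zs, this] at h
      simp at h
    have := key _ h1
    have := key _ h2
    omega
  | n + 1, w, hw, hs => by
    intro S ψ θ hZ1 hZ2
    set w' : Fin n → ℤ → ℝ := fun i => w i.succ with hw'
    have hw'' : ∀ i, LC (w' i) := fun i => hw i.succ
    have hs' : ∀ i x, x ∉ Icc (0 : ℤ) N → w' i x = 0 := fun i => hs i.succ
    have hZ := Zs_LC hw'' hs'
    have ih := efron hw'' hs'
    set Z1 := Zs N w S with hZ1d
    set Z2 := Zs N w (S - 1) with hZ2d
    set μ : ℤ → ℝ := fun x => w 0 x * Zs N w' (S - x) / Z1 with hμ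
    set ν : ℤ → ℝ := fun x => w 0 x * Zs N w' (S - 1 - x) / Z2 with hν
    have hμ0 : ∀ x, x ∉ Icc (0 : ℤ) N → μ x = 0 := fun x hx => by simp [hμ, hs 0 x hx]
    have hν0 : ∀ x, x ∉ Icc (0 : ℤ) N → ν x = 0 := fun x hx => by simp [hν, hs 0 x hx]
    have hμ1 : ∑ x ∈ Icc (0 : ℤ) N, μ x = 1 := by
      rw [← sum_div, ← Zs_succ]; exact div_self hZ1.ne'
    have hν1 : ∑ x ∈ Icc (0 : ℤ) N, ν x = 1 := by
      rw [← sum_div, ← Zs_succ]; exact div_self hZ2.ne'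
    obtain ⟨s, t, h_s, h_t, h1, h2⟩ := exists_interlace hμ0 hν0 hμ1 hν1
      (fun i j hij => by
        have := hZ.spread (p := S - 1 - j) (q := S - i) (r := S - j) (s := S - 1 - i)
          (by omega) (by omega) (by ring)
        simp only [hμ, hν]
        rw [div_mul_div_comm, div_mul_div_comm, mul_comm Z2]
        refine div_le_div_of_nonneg_right ?_ (mul_pos hZ1 hZ2).le
        have := mul_le_mul_of_nonneg_left this (mul_nonneg ((hw 0).1 i) ((hw 0).1 j))
        linarith)
      (fun i j hij => by
        have := (hw 0).2 (i - 1) (j - 1) (by omega)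
        rw [sub_add_cancel, sub_add_cancel] at this
        simp only [hμ, hν]
        rw [div_mul_div_comm, div_mul_div_comm, mul_comm Z2]
        refine div_le_div_of_nonneg_right ?_ (mul_pos hZ1 hZ2).le
        rw [show S - 1 - (i - 1) = S - i by ring, show S - 1 - (j - 1) = S - j by ring]
        have := mul_le_mul_of_nonneg_left this (mul_nonneg (hZ.1 (S - i)) (hZ.1 (S - j)))
        linarith)
    set a : ℤ → ℝ := fun x => av N w' (S - x) fun d => ψ (Matrix.vecCons x d) with ha
    set b : ℤ → ℝ := fun x => av N w' (S - 1 - x) fun d => θ (Matrix.vecCons x d) with hb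
    have avz : ∀ (T : ℤ) (φ : (Fin n → ℤ) → ℝ),
        ∑ d ∈ Sl n N T, Wt w' d * φ d = Zs N w' T * av N w' T φ := by
      intro T φ
      rcases (Zs_nonneg hw'' T (N := N)).eq_or_lt with h | h
      · rw [← h, zero_mul]
        refine sum_eq_zero fun d hd => ?_
        have := (sum_eq_zero_iff_of_nonneg fun d _ => Wt_nonneg hw'' d).1 h.symm d hd
        rw [this, zero_mul]
      · rw [av, mul_div_cancel₀ _ h.ne']
    have ea : av N w S ψ = ∑ x ∈ Icc (0 : ℤ) N, μ x * a x := by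
      rw [av, sum_Sl_succ, sum_div]
      refine sum_congr rfl fun x _ => ?_
      have := avz (S - x) fun d => ψ (Matrix.vecCons x d)
      simp only [Wt_cons, mul_assoc, ← mul_sum, hμ, ha]
      rw [this]; ring
    have eb : av N w (S - 1) θ = ∑ x ∈ Icc (0 : ℤ) N, ν x * b x := by
      rw [av, sum_Sl_succ, sum_div]
      refine sum_congr rfl fun x _ => ?_
      have := avz (S - 1 - x) fun d => θ (Matrix.vecCons x d)
      simp only [Wt_cons, mul_assoc, ← mul_sum, hν, hb]
      rw [this]; ring
    rw [ea, eb]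
    refine (interlace_sq hμ0 hν0 hν1 h_s h_t h1 h2).trans ?_
    have sμ : ∀ x, s x ≤ μ x := fun x => by linarith [h2 x, h_t (x - 1)]
    have sν : ∀ x, s x ≤ ν x := fun x => by linarith [h1 x, h_t x]
    have tν : ∀ x, t x ≤ ν x := fun x => by linarith [h1 x, h_s x]
    have tμ : ∀ x, t x ≤ μ (x + 1) := fun x => by
      have := h2 (x + 1); rw [add_sub_cancel_right] at this; linarith [h_s (x + 1)]
    refine le_trans (sum_le_sum fun x _ => add_le_add_left ?_ _)
      (Ef_split hw (inv_nonneg.2 hZ1.le) (inv_nonneg.2 hZ2.le) ψ θ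
        (fun x => t x * (a (x + 1) - b x) ^ 2) ?_ ?_)
    · have hE0 : ∀ p q, 0 ≤ p → 0 ≤ q → 0 ≤ Ef N w' (S - x) p q (fun d => ψ (Matrix.vecCons x d))
          (fun d => θ (Matrix.vecCons x d)) := fun p q hp hq =>
        sum_nonneg fun d _ => sum_nonneg fun d' _ => Ef_term_nonneg hw'' hp hq
          (fun d => ψ (Matrix.vecCons x d)) (fun d => θ (Matrix.vecCons x d)) d d'
      have hw0 := (hw 0).1 x
      rcases (h_s x).eq_or_lt with h | h
      · rw [← h, zero_mul]
        exact hE0 _ _ (by positivity) (by positivity)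
      · have p1 : 0 < Zs N w' (S - x) := by
          by_contra hc
          have : Zs N w' (S - x) = 0 := le_antisymm (not_lt.1 hc) (hZ.1 _)
          have h3 := sμ x
          simp only [hμ, this, mul_zero, zero_div] at h3
          linarith
        have p2 : 0 < Zs N w' (S - 1 - x) := by
          by_contra hc
          have : Zs N w' (S - 1 - x) = 0 := le_antisymm (not_lt.1 hc) (hZ.1 _)
          have h3 := sν x
          simp only [hν, this, mul_zero, zero_div] at h3
          linarith
        have e : S - x - 1 = S - 1 - x := by ring
        have := ih (S - x) (fun d => ψ (Matrix.vecCons x d)) (fun d => θ (Matrix.vecCons x d)) p1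
          (by rwa [e])
        rw [e] at this
        refine (mul_le_mul_of_nonneg_left this h.le).trans (mul_Ef_le hw'' h.le ?_ ?_ _ _)
        · rw [← div_eq_mul_inv, div_le_iff₀ p1]
          refine (sμ x).trans (le_of_eq ?_)
          simp only [hμ]; ring
        · rw [← div_eq_mul_inv, div_le_iff₀ p2]
          refine (sν x).trans (le_of_eq ?_)
          simp only [hν]; ring
    · intro x hx
      have hR : 0 ≤ ∑ d ∈ Sl n N (S - 1 - x), min (Z1⁻¹ * (w 0 (x + 1) * Wt w' d))
          (Z2⁻¹ * (w 0 x * Wt w' d)) *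
          (ψ (Matrix.vecCons (x + 1) d) - θ (Matrix.vecCons x d)) ^ 2 := by
        refine sum_nonneg fun d _ => mul_nonneg (le_min ?_ ?_) (sq_nonneg _)
        · exact mul_nonneg (inv_nonneg.2 hZ1.le) (mul_nonneg ((hw 0).1 _) (Wt_nonneg hw'' _))
        · exact mul_nonneg (inv_nonneg.2 hZ2.le) (mul_nonneg ((hw 0).1 _) (Wt_nonneg hw'' _))
      rcases (h_t x).eq_or_lt with h | h
      · simp only [← h, zero_mul]; exact hR
      have p2 : 0 < Zs N w' (S - 1 - x) := by
        by_contra hc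
        have : Zs N w' (S - 1 - x) = 0 := le_antisymm (not_lt.1 hc) (hZ.1 _)
        have h3 := tν x
        simp only [hν, this, mul_zero, zero_div] at h3
        linarith
      have e : S - (x + 1) = S - 1 - x := by ring
      have eab : a (x + 1) - b x = av N w' (S - 1 - x)
          fun d => ψ (Matrix.vecCons (x + 1) d) - θ (Matrix.vecCons x d) := by
        simp only [ha, hb, e, av]
        rw [← sub_div, ← sum_sub_distrib]
        simp only [mul_sub]
      simp only [eab]
      refine (mul_le_mul_of_nonneg_left (mul_av_sq_le hw'' _ _ p2) h.le).trans ?_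
      rw [mul_sum]
      refine sum_le_sum fun d _ => ?_
      rw [← mul_assoc]
      refine mul_le_mul_of_nonneg_right (le_min ?_ ?_) (sq_nonneg _)
      · have := mul_le_mul_of_nonneg_right (tμ x) (div_nonneg (Wt_nonneg hw'' d) p2.le)
        refine this.trans (le_of_eq ?_)
        simp only [hμ, e]
        field_simp
        rfl
      · have := mul_le_mul_of_nonneg_right (tν x) (div_nonneg (Wt_nonneg hw'' d) p2.le)
        refine this.trans (le_of_eq ?_)
        simp only [hν]
        field_simp
        rfl
    · have : t N ≤ 0 := (tμ N).trans (le_of_eq (hμ0 _ (by simp)))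
      exact mul_nonpos_of_nonpos_of_nonneg this (sq_nonneg _)
end SHF

namespace SHF
open Finset
open scoped Classical

lemma var_eq {ι : Type*} (s : Finset ι) (p f : ι → ℝ) :
    ∑ x ∈ s, ∑ y ∈ s, p x * p y * (f x - f y) ^ 2 =
      2 * (∑ x ∈ s, p x) * (∑ x ∈ s, p x * f x ^ 2) - 2 * (∑ x ∈ s, p x * f x) ^ 2 := by
  have h : ∀ x y, p x * p y * (f x - f y) ^ 2 =
      (p x * f x ^ 2) * p y + p x * (p y * f y ^ 2) - 2 * ((p x * f x) * (p y * f y)) := by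
    intro x y; ring
  simp only [h, sum_sub_distrib, sum_add_distrib, ← mul_sum, ← sum_mul]
  ring

/-- Dirichlet form of unit moves on a slice. -/
noncomputable def Eu {n : ℕ} (N : ℕ) (w : Fin n → ℤ → ℝ) (S : ℤ) (φ : (Fin n → ℤ) → ℝ) : ℝ :=
  ∑ d ∈ Sl n N S, ∑ d' ∈ Sl n N S,
    if Unit' d d' then min (Wt w d) (Wt w d') * (φ d - φ d') ^ 2 else 0

lemma Eu_term_nonneg {n : ℕ} {w : Fin n → ℤ → ℝ} (hw : ∀ i, LC (w i)) (φ : (Fin n → ℤ) → ℝ)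
    (d d' : Fin n → ℤ) :
    0 ≤ if Unit' d d' then min (Wt w d) (Wt w d') * (φ d - φ d') ^ 2 else 0 := by
  split_ifs
  · exact mul_nonneg (le_min (Wt_nonneg hw _) (Wt_nonneg hw _)) (sq_nonneg _)
  · exact le_rfl

lemma Eu_nonneg {n N : ℕ} {w : Fin n → ℤ → ℝ} (hw : ∀ i, LC (w i)) (S : ℤ)
    (φ : (Fin n → ℤ) → ℝ) : 0 ≤ Eu N w S φ :=
  sum_nonneg fun d _ => sum_nonneg fun d' _ => Eu_term_nonneg hw φ d d'

lemma Unit'_cons_same {n : ℕ} {x : ℤ} {d d' : Fin n → ℤ} (h : Unit' d d') :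
    Unit' (Matrix.vecCons x d) (Matrix.vecCons x d') := by
  obtain ⟨a, b, hab, h⟩ := h
  refine ⟨a.succ, b.succ, by simpa using hab, fun i => Fin.cases ?_ (fun i => ?_) i⟩
  · simp [(Fin.succ_ne_zero _).symm]
  · simpa using h i

lemma Unit'_cons_Dn {n : ℕ} {x : ℤ} {d d' : Fin n → ℤ} (h : Dn d d') :
    Unit' (Matrix.vecCons x d) (Matrix.vecCons (x + 1) d') := by
  obtain ⟨J, hJ⟩ := h
  refine ⟨0, J.succ, (Fin.succ_ne_zero _).symm, fun i => Fin.cases ?_ (fun i => ?_) i⟩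
  · simp [(Fin.succ_ne_zero _).symm]
  · simp [hJ]

lemma Eu_split {n N : ℕ} {w : Fin (n + 1) → ℤ → ℝ} (S : ℤ)
    (φ : (Fin (n + 1) → ℤ) → ℝ) :
    Eu N w S φ = ∑ x ∈ Icc (0 : ℤ) N, ∑ y ∈ Icc (0 : ℤ) N, ∑ d ∈ Sl n N (S - x),
      ∑ d' ∈ Sl n N (S - y), if Unit' (Matrix.vecCons x d) (Matrix.vecCons y d') then
        min (w 0 x * Wt (fun i => w i.succ) d) (w 0 y * Wt (fun i => w i.succ) d') *
          (φ (Matrix.vecCons x d) - φ (Matrix.vecCons y d')) ^ 2 else 0 := by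
  rw [Eu, sum_Sl_succ]
  refine sum_congr rfl fun x _ => ?_
  refine Eq.trans ?_ sum_comm
  refine sum_congr rfl fun d _ => ?_
  rw [sum_Sl_succ]
  simp only [Wt_cons]

theorem slice_poincare {N : ℕ} : ∀ {n : ℕ} {w : Fin n → ℤ → ℝ}, (∀ i, LC (w i)) →
    (∀ i x, x ∉ Icc (0 : ℤ) N → w i x = 0) → ∀ (S : ℤ) (φ : (Fin n → ℤ) → ℝ),
    ∑ d ∈ Sl n N S, ∑ d' ∈ Sl n N S, Wt w d * Wt w d' * (φ d - φ d') ^ 2 ≤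
      n * (N + 1 : ℝ) ^ 3 * Zs N w S * Eu N w S φ
  | 0, w, _, _ => by
    intro S φ
    have : ∀ d d' : Fin 0 → ℤ, d = d' := fun d d' => Subsingleton.elim _ _
    rw [sum_eq_zero fun d _ => sum_eq_zero fun d' _ => by rw [this d d']; ring]
    simp
  | n + 1, w, hw, hs => by
    intro S φ
    set w' : Fin n → ℤ → ℝ := fun i => w i.succ with hw'
    have hw'' : ∀ i, LC (w' i) := fun i => hw i.succ
    have hs' : ∀ i x, x ∉ Icc (0 : ℤ) N → w' i x = 0 := fun i => hs i.succ
    have hZ := Zs_LC hw'' hs'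
    have ih := slice_poincare hw'' hs'
    set Z := Zs N w S with hZd
    have hZ0 : 0 ≤ Z := Zs_nonneg hw S
    set m : ℤ → ℝ := fun x => w 0 x * Zs N w' (S - x) with hm
    have hmLC : LC m := by
      refine ⟨fun x => mul_nonneg ((hw 0).1 _) (hZ.1 _), fun i j hij => ?_⟩
      have h1 := (hw 0).2 i j hij
      have h2 := hZ.2 (S - (j + 1)) (S - (i + 1)) (by omega)
      rw [show S - (i + 1) + 1 = S - i by ring, show S - (j + 1) + 1 = S - j by ring] at h2
      have := mul_le_mul h1 h2 (mul_nonneg (hZ.1 _) (hZ.1 _))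
        (mul_nonneg ((hw 0).1 _) ((hw 0).1 _))
      simp only [hm]
      linarith
    have hmZ : ∑ x ∈ Icc (0 : ℤ) N, m x = Z := (Zs_succ w S).symm
    set h : ℤ → ℝ := fun x => av N w' (S - x) fun d => φ (Matrix.vecCons x d) with hh
    have avz : ∀ (T : ℤ) (φ : (Fin n → ℤ) → ℝ),
        ∑ d ∈ Sl n N T, Wt w' d * φ d = Zs N w' T * av N w' T φ := by
      intro T φ
      rcases (Zs_nonneg hw'' T (N := N)).eq_or_lt with h | h
      · rw [← h, zero_mul]
        refine sum_eq_zero fun d hd => ?_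
        have := (sum_eq_zero_iff_of_nonneg fun d _ => Wt_nonneg hw'' d).1 h.symm d hd
        rw [this, zero_mul]
      · rw [av, mul_div_cancel₀ _ h.ne']
    have e1 : ∑ d ∈ Sl (n + 1) N S, Wt w d * φ d = ∑ x ∈ Icc (0 : ℤ) N, m x * h x := by
      rw [sum_Sl_succ]
      refine sum_congr rfl fun x _ => ?_
      simp only [Wt_cons, mul_assoc, ← mul_sum, hm, hh]
      rw [← avz]
    set E' : ℤ → ℝ := fun x => Eu N w' (S - x) fun d => φ (Matrix.vecCons x d) with hE'
    have e2 : ∑ d ∈ Sl (n + 1) N S, Wt w d * φ d ^ 2 ≤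
        ∑ x ∈ Icc (0 : ℤ) N, (m x * h x ^ 2 + n * (N + 1 : ℝ) ^ 3 / 2 * (w 0 x * E' x)) := by
      rw [sum_Sl_succ]
      refine sum_le_sum fun x _ => ?_
      simp only [Wt_cons, mul_assoc, ← mul_sum]
      have hwx := (hw 0).1 x
      change w 0 x * ∑ d ∈ Sl n N (S - x), Wt w' d * _ ≤ _
      have hEx : 0 ≤ E' x := Eu_nonneg hw'' _ _
      rcases (Zs_nonneg hw'' (S - x) (N := N)).eq_or_lt with h0 | h0
      · have : ∑ d ∈ Sl n N (S - x), Wt w' d * φ (Matrix.vecCons x d) ^ 2 = 0 := by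
          refine sum_eq_zero fun d hd => ?_
          have := (sum_eq_zero_iff_of_nonneg fun d _ => Wt_nonneg hw'' d).1 h0.symm d hd
          rw [this, zero_mul]
        rw [this, mul_zero]
        simp only [hm, ← h0]
        rw [mul_zero, zero_mul, zero_add]
        positivity
      · have h1 := ih (S - x) fun d => φ (Matrix.vecCons x d)
        rw [var_eq, avz (S - x) fun d => φ (Matrix.vecCons x d)] at h1
        change 2 * Zs N w' (S - x) * _ - 2 * (Zs N w' (S - x) * h x) ^ 2 ≤
          _ * Zs N w' (S - x) * E' x at h1
        have h2 : ∑ d ∈ Sl n N (S - x), Wt w' d * φ (Matrix.vecCons x d) ^ 2 ≤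
            Zs N w' (S - x) * h x ^ 2 + n * (N + 1 : ℝ) ^ 3 / 2 * E' x := by
          refine le_of_mul_le_mul_left ?_ h0
          linarith
        refine (mul_le_mul_of_nonneg_left h2 hwx).trans (le_of_eq ?_)
        simp only [hm]
        ring
    have e3 : ∑ x ∈ Icc (0 : ℤ) N, w 0 x * E' x ≤ Eu N w S φ := by
      rw [Eu_split]
      refine sum_le_sum fun x hx => ?_
      refine le_trans ?_ (single_le_sum (fun y _ => sum_nonneg fun d _ => sum_nonneg fun d' _ => ?_) hx)
      · simp only [hE', Eu]
        rw [mul_sum]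
        refine sum_le_sum fun d _ => ?_
        rw [mul_sum]
        refine sum_le_sum fun d' _ => ?_
        split_ifs with h1 h2 h2
        · rw [← mul_assoc, mul_min_of_nonneg _ _ ((hw 0).1 x)]
        · exact absurd (Unit'_cons_same h1) h2
        · rw [mul_zero]
          exact mul_nonneg (le_min (mul_nonneg ((hw 0).1 _) (Wt_nonneg hw'' _))
            (mul_nonneg ((hw 0).1 _) (Wt_nonneg hw'' _))) (sq_nonneg _)
        · rw [mul_zero]
      · split_ifs
        · exact mul_nonneg (le_min (mul_nonneg ((hw 0).1 _) (Wt_nonneg hw'' _))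
            (mul_nonneg ((hw 0).1 _) (Wt_nonneg hw'' _))) (sq_nonneg _)
        · exact le_rfl
    have e4 : ∑ z ∈ Icc (0 : ℤ) N, min (m z) (m (z + 1)) * (h z - h (z + 1)) ^ 2 ≤ Eu N w S φ := by
      rw [Eu_split]
      refine sum_le_sum fun x hx => ?_
      have tn : ∀ y, ∀ d d' : Fin n → ℤ,
          0 ≤ if Unit' (Matrix.vecCons x d) (Matrix.vecCons y d') then
            min (w 0 x * Wt (fun i => w i.succ) d) (w 0 y * Wt (fun i => w i.succ) d') *
            (φ (Matrix.vecCons x d) - φ (Matrix.vecCons y d')) ^ 2 else 0 := by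
        intro y d d'
        split_ifs
        · exact mul_nonneg (le_min (mul_nonneg ((hw 0).1 _) (Wt_nonneg hw'' _))
            (mul_nonneg ((hw 0).1 _) (Wt_nonneg hw'' _))) (sq_nonneg _)
        · exact le_rfl
      have mm0 : 0 ≤ min (m x) (m (x + 1)) := le_min (hmLC.1 _) (hmLC.1 _)
      rcases mm0.eq_or_lt with h0 | h0
      · rw [← h0, zero_mul]
        exact sum_nonneg fun y _ => sum_nonneg fun d _ => sum_nonneg fun d' _ => tn y d d'
      have p0 : ∀ y, 0 < m y → y ∈ Icc (0 : ℤ) N ∧ 0 < Zs N w' (S - y) := by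
        intro y hy
        constructor
        · by_contra hc
          simp only [hm, hs 0 y hc, zero_mul, lt_irrefl] at hy
        · refine (hZ.1 _).lt_of_ne fun hc => ?_
          simp only [hm, ← hc, mul_zero, lt_irrefl] at hy
      obtain ⟨_, q1⟩ := p0 x (lt_min_iff.1 h0).1
      obtain ⟨q3, q2⟩ := p0 (x + 1) (lt_min_iff.1 h0).2
      refine le_trans ?_ (single_le_sum (fun y _ => sum_nonneg fun d _ => sum_nonneg fun d' _ =>
        tn y d d') q3)
      have e : S - x - 1 = S - (x + 1) := by ring
      have ef := efron hw'' hs' (S - x) (fun d => φ (Matrix.vecCons x d))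
        (fun d => φ (Matrix.vecCons (x + 1) d)) q1 (by rwa [e])
      rw [e] at ef
      refine (mul_le_mul_of_nonneg_left ef h0.le).trans ((mul_Ef_le hw'' h0.le (p' := w 0 x)
        (q' := w 0 (x + 1)) ?_ ?_ _ _).trans ?_)
      · rw [← div_eq_mul_inv, div_le_iff₀ q1]; exact min_le_left _ _
      · rw [← div_eq_mul_inv, div_le_iff₀ q2]; exact min_le_right _ _
      · rw [Ef, e]
        refine sum_le_sum fun d _ => sum_le_sum fun d' _ => ?_
        split_ifs with h1 h2 h2
        · exact le_rfl
        · exact absurd (Unit'_cons_Dn h1) h2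
        · exact mul_nonneg (le_min (mul_nonneg ((hw 0).1 _) (Wt_nonneg hw'' _))
            (mul_nonneg ((hw 0).1 _) (Wt_nonneg hw'' _))) (sq_nonneg _)
        · exact le_rfl
    have lp := line_poincare hmLC N h
    rw [var_eq, hmZ] at lp
    rw [var_eq, e1]
    change 2 * Z * _ - _ ≤ _
    have a1 := mul_le_mul_of_nonneg_left e2 (mul_nonneg zero_le_two hZ0)
    rw [sum_add_distrib, ← mul_sum] at a1
    have K0 : (0 : ℝ) ≤ (N + 1 : ℝ) ^ 3 := by positivity
    have a2 := mul_le_mul_of_nonneg_left e3 (mul_nonneg hZ0 (mul_nonneg n.cast_nonneg K0))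
    have a3 := mul_le_mul_of_nonneg_left e4 (mul_nonneg K0 hZ0)
    push_cast
    linarith
end SHF

namespace SHF
open Finset
open scoped Classical
variable {n : ℕ}

/-- Switching at `b, b'` is an involution on graphs with a marked pair of switchable edges. -/
lemma exch (d : Fin n → ℕ) (b b' : Fin n) (F : SimpleGraph (Fin n) → Fin n → Fin n → ℝ) :
    ∑ G ∈ Om d, ∑ v ∈ Lf G b b', ∑ v' ∈ Lf G b' b, F (sw G b v b' v') v' v =
      ∑ G ∈ Om d, ∑ v ∈ Lf G b b', ∑ v' ∈ Lf G b' b, F G v v' := by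
  simp only [← sum_product']
  rw [sum_sigma', sum_sigma']
  refine sum_nbij' (fun t => ⟨sw t.1 b t.2.1 b' t.2.2, (t.2.2, t.2.1)⟩)
    (fun t => ⟨sw t.1 b t.2.1 b' t.2.2, (t.2.2, t.2.1)⟩) ?_ ?_ ?_ ?_ ?_
  · rintro ⟨G, v, v'⟩ ht
    rw [mem_sigma, mem_product] at *
    exact ⟨Switch.mem_Om ⟨b, v, b', v', ht.2.1, ht.2.2, rfl⟩ ht.1, sw_pre ht.2.1 ht.2.2⟩
  · rintro ⟨G, v, v'⟩ ht
    rw [mem_sigma, mem_product] at *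
    exact ⟨Switch.mem_Om ⟨b, v, b', v', ht.2.1, ht.2.2, rfl⟩ ht.1, sw_pre ht.2.1 ht.2.2⟩
  · rintro ⟨G, v, v'⟩ ht
    rw [mem_sigma, mem_product] at ht
    simp only
    rw [sw_sw ht.2.1 ht.2.2]
  · rintro ⟨G, v, v'⟩ ht
    rw [mem_sigma, mem_product] at ht
    simp only
    rw [sw_sw ht.2.1 ht.2.2]
  · rintro ⟨G, v, v'⟩ _
    rfl

lemma Lf_sw {G : SimpleGraph (Fin n)} {b v b' v' : Fin n} (h : v ∈ Lf G b b')
    (h' : v' ∈ Lf G b' b) : Lf (sw G b v b' v') b b' = insert v' ((Lf G b b').erase v) := by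
  have e : ∀ H : SimpleGraph (Fin n), Lf H b b' = (nb H b \ nb H b').erase b' := by
    intro H; ext x; simp [mem_Lf, mem_nb]
  have hh := mem_Lf.1 h
  have hh' := mem_Lf.1 h'
  rw [e, nb_sw_fst h h', nb_sw_snd h h']
  ext x
  simp only [mem_erase, mem_sdiff, mem_insert, mem_nb, mem_Lf]
  have := hh.2.1.ne
  have := hh'.2.1.ne
  grind

lemma Lf_sw' {G : SimpleGraph (Fin n)} {b v b' v' : Fin n} (h : v ∈ Lf G b b')
    (h' : v' ∈ Lf G b' b) : Lf (sw G b v b' v') b' b = insert v ((Lf G b' b).erase v') := by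
  rw [sw_comm]; exact Lf_sw h' h

lemma Lf_disj (G : SimpleGraph (Fin n)) (b b' : Fin n) : Disjoint (Lf G b b') (Lf G b' b) := by
  rw [disjoint_left]
  intro x hx hx'
  rw [mem_Lf] at *
  exact hx.2.2 hx'.2.1

/-- The vertices adjacent to exactly one of `b` and `b'` (other than `b` and `b'`). -/
noncomputable def Dl (G : SimpleGraph (Fin n)) (b b' : Fin n) : Finset (Fin n) :=
  Lf G b b' ∪ Lf G b' b

lemma Dl_sw {G : SimpleGraph (Fin n)} {b v b' v' : Fin n} (h : v ∈ Lf G b b')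
    (h' : v' ∈ Lf G b' b) : Dl (sw G b v b' v') b b' = Dl G b b' := by
  rw [Dl, Dl, Lf_sw h h', Lf_sw' h h']
  ext x
  simp only [mem_union, mem_insert, mem_erase]
  grind

lemma card_insert_erase_inter {T A : Finset (Fin n)} {v v' : Fin n} (hv : v ∉ T) (hv' : v' ∈ T)
    (hAa : v' ∉ A) : (T ∩ insert v' (A.erase v)).card = (T ∩ A).card + 1 := by
  have : T ∩ insert v' (A.erase v) = insert v' (T ∩ A) := by
    ext x; simp only [mem_inter, mem_insert, mem_erase]; grind
  rw [this, card_insert_of_notMem (by simp [hAa])]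

/-- Number of elements of `T` adjacent to `b` but not to `b'`. -/
noncomputable def pc (T : SimpleGraph (Fin n) → Finset (Fin n)) (b b' : Fin n)
    (G : SimpleGraph (Fin n)) : ℝ := ((T G ∩ Lf G b b').card : ℝ)

/-- Number of vertices adjacent to `b` but not to `b'`. -/
noncomputable def Pc (b b' : Fin n) (G : SimpleGraph (Fin n)) : ℝ := ((Lf G b b').card : ℝ)

/-- Functions of graphs which do not change under switches at `b, b'`. -/
def Inva {α : Type*} (b b' : Fin n) (f : SimpleGraph (Fin n) → α) : Prop :=
  ∀ G v v', v ∈ Lf G b b' → v' ∈ Lf G b' b → f (sw G b v b' v') = f G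

lemma pc_nonneg (T : SimpleGraph (Fin n) → Finset (Fin n)) (b b' : Fin n)
    (G : SimpleGraph (Fin n)) : 0 ≤ pc T b b' G := Nat.cast_nonneg _

lemma pc_le (T : SimpleGraph (Fin n) → Finset (Fin n)) (b b' : Fin n)
    (G : SimpleGraph (Fin n)) : pc T b b' G ≤ Pc b b' G := by
  unfold pc Pc; exact_mod_cast card_le_card inter_subset_right

lemma sum_if_mem (A T : Finset (Fin n)) (c : ℝ) :
    ∑ v ∈ A, (if v ∈ T then c else 0) = ((T ∩ A).card : ℝ) * c := by
  rw [← sum_filter, sum_const, nsmul_eq_mul]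
  congr 3
  ext x; simp [and_comm]

lemma sum_if_not_mem (A T : Finset (Fin n)) (c : ℝ) :
    ∑ v ∈ A, (if v ∈ T then 0 else c) = ((A.card : ℝ) - (T ∩ A).card) * c := by
  have h := sum_if_mem A T c
  have : ∑ v ∈ A, (if v ∈ T then c else 0) + ∑ v ∈ A, (if v ∈ T then 0 else c) = A.card * c := by
    rw [← sum_add_distrib]
    rw [sum_congr rfl (g := fun _ => c) fun v _ => by split_ifs <;> simp]
    simp
  linarith

lemma sum_sum_if (A B T : Finset (Fin n)) (c : ℝ) :
    ∑ v ∈ A, ∑ v' ∈ B, (if v ∈ T ∧ v' ∉ T then c else 0) =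
      ((T ∩ A).card : ℝ) * ((B.card : ℝ) - (T ∩ B).card) * c := by
  have : ∀ v ∈ A, ∑ v' ∈ B, (if v ∈ T ∧ v' ∉ T then c else 0) =
      if v ∈ T then ((B.card : ℝ) - (T ∩ B).card) * c else 0 := by
    intro v _
    split_ifs with h
    · rw [← sum_if_not_mem]
      exact sum_congr rfl fun v' _ => by split_ifs <;> simp_all
    · simp [h]
  rw [sum_congr rfl this, sum_if_mem, mul_assoc]

lemma exch_T (d : Fin n → ℕ) (b b' : Fin n) {T : SimpleGraph (Fin n) → Finset (Fin n)}
    (hT : Inva b b' T) {Φ Ψ : SimpleGraph (Fin n) → ℝ}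
    (hΦ : ∀ G v v', v ∈ Lf G b b' → v ∉ T G → v' ∈ Lf G b' b → v' ∈ T G →
      Φ (sw G b v b' v') = Ψ G) :
    ∑ G ∈ Om d, pc T b b' G * (Pc b' b G - pc T b' b G) * Φ G =
      ∑ G ∈ Om d, pc T b' b G * (Pc b b' G - pc T b b' G) * Ψ G := by
  have h := exch d b b' fun G v v' => if v ∈ T G ∧ v' ∉ T G then Φ G else 0
  have e1 : ∀ G ∈ Om d, ∑ v ∈ Lf G b b', ∑ v' ∈ Lf G b' b,
      (if v ∈ T G ∧ v' ∉ T G then Φ G else 0) =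
      pc T b b' G * (Pc b' b G - pc T b' b G) * Φ G := fun G _ => sum_sum_if _ _ _ _
  have e2 : ∀ G ∈ Om d, ∑ v ∈ Lf G b b', ∑ v' ∈ Lf G b' b,
      (if v' ∈ T (sw G b v b' v') ∧ v ∉ T (sw G b v b' v') then Φ (sw G b v b' v') else 0) =
      pc T b' b G * (Pc b b' G - pc T b b' G) * Ψ G := by
    intro G _
    rw [sum_comm]
    refine Eq.trans ?_ (sum_sum_if (Lf G b' b) (Lf G b b') (T G) (Ψ G))
    refine sum_congr rfl fun v' hv' => sum_congr rfl fun v hv => ?_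
    rw [hT G v v' hv hv']
    split_ifs with hc
    · exact hΦ G v v' hv hc.2 hv' hc.1
    · rfl
  rw [sum_congr rfl e1, sum_congr rfl e2] at h
  exact h.symm

/-- Plain form of the exchange identity. -/
lemma exch_plain (d : Fin n → ℕ) (b b' : Fin n) {T : SimpleGraph (Fin n) → Finset (Fin n)}
    (hT : Inva b b' T) {J : SimpleGraph (Fin n) → ℝ} (hJ : Inva b b' J) :
    ∑ G ∈ Om d, pc T b b' G * Pc b' b G * J G = ∑ G ∈ Om d, pc T b' b G * Pc b b' G * J G := by
  have h := exch_T d b b' hT (Φ := J) (Ψ := J) fun G v v' h1 _ h2 _ => hJ G v v' h1 h2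
  have : ∑ G ∈ Om d, pc T b b' G * pc T b' b G * J G =
      ∑ G ∈ Om d, pc T b' b G * pc T b b' G * J G :=
    sum_congr rfl fun G _ => by ring
  calc _ = ∑ G ∈ Om d, pc T b b' G * (Pc b' b G - pc T b' b G) * J G +
        ∑ G ∈ Om d, pc T b b' G * pc T b' b G * J G := by
        rw [← sum_add_distrib]; exact sum_congr rfl fun G _ => by ring
    _ = _ := by
        rw [h, this, ← sum_add_distrib]; exact sum_congr rfl fun G _ => by ring

/-- Size of the exchangeable part. -/
noncomputable def Dc (b b' : Fin n) (G : SimpleGraph (Fin n)) : ℝ := Pc b b' G + Pc b' b G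

/-- Number of elements of `T` in the exchangeable part. -/
noncomputable def zc (T : SimpleGraph (Fin n) → Finset (Fin n)) (b b' : Fin n)
    (G : SimpleGraph (Fin n)) : ℝ := pc T b b' G + pc T b' b G

/-- The centred imbalance. -/
noncomputable def uc (T : SimpleGraph (Fin n) → Finset (Fin n)) (b b' : Fin n)
    (G : SimpleGraph (Fin n)) : ℝ :=
  pc T b b' G - pc T b' b G - zc T b b' G * (Pc b b' G - Pc b' b G) / Dc b b' G

lemma Pc_nonneg (b b' : Fin n) (G : SimpleGraph (Fin n)) : 0 ≤ Pc b b' G := Nat.cast_nonneg _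

lemma Dc_eq (b b' : Fin n) (G : SimpleGraph (Fin n)) : Dc b b' G = (Dl G b b').card := by
  rw [Dl, card_union_of_disjoint (Lf_disj G b b')]; simp [Dc, Pc]

lemma zc_eq (T : SimpleGraph (Fin n) → Finset (Fin n)) (b b' : Fin n) (G : SimpleGraph (Fin n)) :
    zc T b b' G = (T G ∩ Dl G b b').card := by
  rw [Dl, inter_union_distrib_left, card_union_of_disjoint
    ((Lf_disj G b b').mono inter_subset_right inter_subset_right)]
  simp [zc, pc]

lemma Inva.Dc (b b' : Fin n) : Inva b b' (Dc b b') := fun G v v' h h' => by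
  rw [Dc_eq, Dc_eq, Dl_sw h h']

lemma Inva.zc {b b' : Fin n} {T : SimpleGraph (Fin n) → Finset (Fin n)} (hT : Inva b b' T) :
    Inva b b' (zc T b b') := fun G v v' h h' => by
  rw [zc_eq, zc_eq, Dl_sw h h', hT G v v' h h']

lemma Inva.Pc (b b' : Fin n) : Inva b b' (Pc b b') := fun G v v' h h' => by
  have h2 : v' ∉ Lf G b b' := fun hh => disjoint_left.1 (Lf_disj G b b') hh h'
  have : (Lf (sw G b v b' v') b b').card = (Lf G b b').card := by
    rw [Lf_sw h h', card_insert_of_notMem (by simp [h2]), card_erase_add_one h]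
  simp [SHF.Pc, this]

lemma uc_sw {b b' : Fin n} {T : SimpleGraph (Fin n) → Finset (Fin n)} (hT : Inva b b' T)
    {G : SimpleGraph (Fin n)} {v v' : Fin n} (hv : v ∈ Lf G b b') (hvT : v ∉ T G)
    (hv' : v' ∈ Lf G b' b) (hvT' : v' ∈ T G) :
    uc T b b' (sw G b v b' v') = uc T b b' G + 2 := by
  have hz := hT.zc G v v' hv hv'
  have hP := Inva.Pc b b' G v v' hv hv'
  have hD := Inva.Dc b b' G v v' hv hv'
  have hP' : Pc b' b (sw G b v b' v') = Pc b' b G := by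
    have h1 := hD
    unfold SHF.Dc at h1
    linarith
  have h2 : v' ∉ Lf G b b' := fun hh => disjoint_left.1 (Lf_disj G b b') hh hv'
  have e1 : pc T b b' (sw G b v b' v') = pc T b b' G + 1 := by
    unfold pc
    rw [hT G v v' hv hv', Lf_sw hv hv', card_insert_erase_inter hvT hvT' h2]
    push_cast; ring
  have e2 : pc T b' b (sw G b v b' v') = pc T b' b G - 1 := by
    have h3 := hz
    unfold SHF.zc at h3
    linarith
  unfold uc
  rw [hz, hP, hD, hP', e1, e2]
  ring

lemma two_mul_uc_Dc (T : SimpleGraph (Fin n) → Finset (Fin n)) (b b' : Fin n)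
    (G : SimpleGraph (Fin n)) : 2 * (pc T b b' G * Pc b' b G - pc T b' b G * Pc b b' G) =
      uc T b b' G * Dc b b' G := by
  by_cases h : Dc b b' G = 0
  · have h1 := Pc_nonneg b b' G
    have h2 := Pc_nonneg b' b G
    have h3 : Pc b b' G = 0 := by unfold Dc at h; linarith
    have h4 : Pc b' b G = 0 := by unfold Dc at h; linarith
    rw [h, h3, h4]; ring
  · unfold uc
    field_simp
    unfold zc Dc
    ring

/-- Stein-type identity for the centred imbalance. -/
lemma stein (d : Fin n → ℕ) (b b' : Fin n) {T : SimpleGraph (Fin n) → Finset (Fin n)}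
    (hT : Inva b b' T) {J : SimpleGraph (Fin n) → ℝ} (hJ : Inva b b' J) (H : ℝ → ℝ) :
    ∑ G ∈ Om d, uc T b b' G * J G * H (uc T b b' G) =
      ∑ G ∈ Om d, 2 * (pc T b' b G * (Pc b b' G - pc T b b' G) / Dc b b' G) * J G *
        (H (uc T b b' G + 2) - H (uc T b b' G)) := by
  have h := exch_T d b b' hT (Φ := fun G => 2 * J G / Dc b b' G * H (uc T b b' G))
    (Ψ := fun G => 2 * J G / Dc b b' G * H (uc T b b' G + 2)) fun G v v' h1 h2 h3 h4 => by
      rw [uc_sw hT h1 h2 h3 h4, hJ G v v' h1 h3, Inva.Dc b b' G v v' h1 h3]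
  have e : ∀ G, uc T b b' G * J G * H (uc T b b' G) =
      pc T b b' G * (Pc b' b G - pc T b' b G) * (2 * J G / Dc b b' G * H (uc T b b' G)) -
      pc T b' b G * (Pc b b' G - pc T b b' G) * (2 * J G / Dc b b' G * H (uc T b b' G)) := by
    intro G
    have h2 := two_mul_uc_Dc T b b' G
    by_cases hD : Dc b b' G = 0
    · have h3 : uc T b b' G = 0 := by
        have a1 := Pc_nonneg b b' G
        have a2 := Pc_nonneg b' b G
        have a3 := pc_nonneg T b b' G
        have a4 := pc_nonneg T b' b G
        have a5 := pc_le T b b' G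
        have a6 := pc_le T b' b G
        unfold Dc at hD
        have : pc T b b' G = 0 := by linarith
        have : pc T b' b G = 0 := by linarith
        simp [uc, zc, *]
      rw [hD, h3]; simp
    · have : uc T b b' G = 2 * (pc T b b' G * Pc b' b G - pc T b' b G * Pc b b' G) / Dc b b' G := by
        rw [h2]; field_simp
      generalize H (uc T b b' G) = X
      rw [this]
      field_simp
      ring
  rw [sum_congr rfl fun G _ => e G, sum_sub_distrib, h, ← sum_sub_distrib]
  exact sum_congr rfl fun G _ => by ring
end SHF

namespace SHF
open Finset
open scoped Classical
variable {n : ℕ}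

/-- Average over the graphs with degree sequence `d`. -/
noncomputable def Ex (d : Fin n → ℕ) (f : SimpleGraph (Fin n) → ℝ) : ℝ :=
  (∑ G ∈ Om d, f G) / (Om d).card

section Ex
variable {d : Fin n → ℕ} {f g : SimpleGraph (Fin n) → ℝ}

lemma Ex_add : Ex d (fun G => f G + g G) = Ex d f + Ex d g := by
  simp [Ex, sum_add_distrib, add_div]

lemma Ex_sub : Ex d (fun G => f G - g G) = Ex d f - Ex d g := by
  simp [Ex, sum_sub_distrib, sub_div]

lemma Ex_mul (c : ℝ) : Ex d (fun G => c * f G) = c * Ex d f := by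
  simp [Ex, ← mul_sum, mul_div_assoc]

lemma Ex_sum {ι : Type*} (A : Finset ι) (F : ι → SimpleGraph (Fin n) → ℝ) :
    Ex d (fun G => ∑ i ∈ A, F i G) = ∑ i ∈ A, Ex d (F i) := by
  simp only [Ex]
  rw [sum_comm, sum_div]

lemma Ex_mono (h : ∀ G ∈ Om d, f G ≤ g G) : Ex d f ≤ Ex d g := by
  unfold Ex
  gcongr with G hG
  exact h G hG

lemma Ex_congr (h : ∀ G ∈ Om d, f G = g G) : Ex d f = Ex d g := by
  unfold Ex
  rw [sum_congr rfl h]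

lemma Ex_const (hd : (Om d).Nonempty) (c : ℝ) : Ex d (fun _ => c) = c := by
  have : ((Om d).card : ℝ) ≠ 0 := by simpa using hd.ne_empty
  simp [Ex]
  field_simp

lemma Ex_nonneg (h : ∀ G ∈ Om d, 0 ≤ f G) : 0 ≤ Ex d f :=
  div_nonneg (sum_nonneg h) (Nat.cast_nonneg _)

lemma abs_Ex_le : |Ex d f| ≤ Ex d fun G => |f G| := by
  unfold Ex
  rw [abs_div, Nat.abs_cast]
  gcongr
  exact abs_sum_le_sum_abs _ _

lemma Ex_eq_of_sum (h : ∑ G ∈ Om d, f G = ∑ G ∈ Om d, g G) : Ex d f = Ex d g := by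
  unfold Ex; rw [h]

lemma Ex_le_const (hd : (Om d).Nonempty) {c : ℝ} (h : ∀ G ∈ Om d, f G ≤ c) : Ex d f ≤ c :=
  (Ex_mono h).trans_eq (Ex_const hd c)

end Ex

/-- Adjacency indicator. -/
noncomputable def Ad (a b : Fin n) (G : SimpleGraph (Fin n)) : ℝ := if G.Adj a b then 1 else 0

lemma Ad_nonneg (a b : Fin n) (G : SimpleGraph (Fin n)) : 0 ≤ Ad a b G := by
  unfold Ad; split_ifs <;> norm_num

lemma Ad_le_one (a b : Fin n) (G : SimpleGraph (Fin n)) : Ad a b G ≤ 1 := by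
  unfold Ad; split_ifs <;> norm_num

lemma Ad_comm (a b : Fin n) (G : SimpleGraph (Fin n)) : Ad a b G = Ad b a G := by
  unfold Ad; simp [G.adj_comm]

/-- Number of neighbours of `b` in the closed neighbourhood of `a`. -/
noncomputable def Xc (a b : Fin n) (G : SimpleGraph (Fin n)) : ℝ :=
  ((insert a (nb G a) ∩ nb G b).card : ℝ)

lemma Xc_nonneg (a b : Fin n) (G : SimpleGraph (Fin n)) : 0 ≤ Xc a b G := Nat.cast_nonneg _

lemma Xc_comm {a b : Fin n} (h : a ≠ b) (G : SimpleGraph (Fin n)) : Xc a b G = Xc b a G := by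
  have key : ∀ a b : Fin n, a ≠ b →
      (insert a (nb G a) ∩ nb G b).card = (nb G a ∩ nb G b).card + if G.Adj a b then 1 else 0 := by
    intro a b _
    by_cases hab : G.Adj a b
    · rw [insert_inter_of_mem (by simpa [mem_nb] using hab.symm),
        card_insert_of_notMem (by simp [mem_nb])]
      simp [hab]
    · rw [insert_inter_of_notMem (by simpa [mem_nb] using fun h => hab h.symm)]
      simp [hab]
  unfold Xc
  rw [key a b h, key b a h.symm, inter_comm]
  simp [G.adj_comm]

lemma Pc_eq (a b : Fin n) (G : SimpleGraph (Fin n)) : Pc b a G = dg G b - Xc a b G := by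
  have : Lf G b a = nb G b \ (insert a (nb G a) ∩ nb G b) := by
    ext x; simp only [mem_Lf, mem_sdiff, mem_nb, mem_inter, mem_insert]; tauto
  have h2 := card_sdiff_add_card_eq_card (inter_subset_right (s₁ := insert a (nb G a))
    (s₂ := nb G b))
  unfold Pc Xc dg
  rw [this, ← h2]
  push_cast; ring

lemma Xc_le (a b : Fin n) (G : SimpleGraph (Fin n)) : Xc a b G ≤ dg G b := by
  unfold Xc dg; exact_mod_cast card_le_card inter_subset_right

lemma Pc_le (a b : Fin n) (G : SimpleGraph (Fin n)) : Pc b a G ≤ dg G b := by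
  rw [Pc_eq]; linarith [Xc_nonneg a b G]

lemma sum_Ad (a : Fin n) (G : SimpleGraph (Fin n)) : ∑ b, Ad a b G = dg G a := by
  simp [Ad, dg, nb]

lemma sum_inter_nb (A : Finset (Fin n)) (G : SimpleGraph (Fin n)) :
    ∑ b, ((A ∩ nb G b).card : ℝ) = ∑ v ∈ A, (dg G v : ℝ) := by
  have : ∀ b, ((A ∩ nb G b).card : ℝ) = ∑ v ∈ A, Ad v b G := by
    intro b
    simp only [Ad, sum_boole]
    congr 2
    ext v; simp [mem_nb, G.adj_comm]
  simp_rw [this, ← sum_Ad]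
  rw [sum_comm]

lemma sum_Xc (a : Fin n) (G : SimpleGraph (Fin n)) :
    ∑ b ∈ univ.erase a, Xc a b G = ∑ v ∈ nb G a, (dg G v : ℝ) := by
  have h := sum_inter_nb (insert a (nb G a)) G
  rw [sum_insert (by simp [mem_nb]), ← add_sum_erase _ _ (mem_univ a)] at h
  have : ((insert a (nb G a) ∩ nb G a).card : ℝ) = dg G a := by
    rw [inter_eq_right.2 (subset_insert _ _)]; rfl
  rw [this] at h
  unfold Xc
  linarith

/-- Closed neighbourhood of `a` without `b` and `b'`. -/
noncomputable def Td (a b b' : Fin n) (G : SimpleGraph (Fin n)) : Finset (Fin n) :=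
  insert a (nb G a) \ {b, b'}

lemma sw_adj_of_ne {G : SimpleGraph (Fin n)} {b v b' v' a x : Fin n}
    (hab : a ≠ b) (hab' : a ≠ b') (hx : x ≠ b) (hx' : x ≠ b') :
    (sw G b v b' v').Adj a x ↔ G.Adj a x := by
  rw [sw_adj]
  simp only [ne_eq, Sym2.eq_iff]
  tauto

lemma Inva.Td {a b b' : Fin n} (hab : a ≠ b) (hab' : a ≠ b') : Inva b b' (Td a b b') := by
  intro G v v' _ _
  ext x
  simp only [SHF.Td, mem_sdiff, mem_insert, mem_nb, mem_singleton, not_or]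
  constructor
  · rintro ⟨h, h1, h2⟩
    rw [sw_adj_of_ne hab hab' h1 h2] at h
    exact ⟨h, h1, h2⟩
  · rintro ⟨h, h1, h2⟩
    rw [sw_adj_of_ne hab hab' h1 h2]
    exact ⟨h, h1, h2⟩

lemma pc_add_common {b b' : Fin n} {T : Finset (Fin n)} (hb' : b' ∉ T)
    (G : SimpleGraph (Fin n)) :
    ((T ∩ nb G b).card : ℝ) = pc (fun _ => T) b b' G + ((T ∩ nb G b ∩ nb G b').card : ℝ) := by
  have : T ∩ nb G b = (T ∩ Lf G b b') ∪ (T ∩ nb G b ∩ nb G b') := by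
    ext x
    simp only [mem_inter, mem_union, mem_Lf, mem_nb]
    constructor
    · rintro ⟨h1, h2⟩
      have : x ≠ b' := fun h => hb' (h ▸ h1)
      tauto
    · tauto
  unfold pc
  conv_lhs => rw [this]
  rw [card_union_of_disjoint]
  · push_cast; rfl
  · rw [disjoint_left]
    intro x
    simp only [mem_inter, mem_Lf, mem_nb]
    tauto

/-- Exchanging neighbours of `b` and `b'` in an invariant set avoiding both. -/
lemma Ex_exchange_le (d : Fin n → ℕ) {b b' : Fin n} {T : SimpleGraph (Fin n) → Finset (Fin n)}
    (hT : Inva b b' T) (hb : ∀ G, b ∉ T G) (hb' : ∀ G, b' ∉ T G) {hi : ℝ} (hd : ∀ i, d i ≤ hi) :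
    Ex d (fun G => ((T G ∩ nb G b).card : ℝ) * Pc b' b G) ≤
      hi * Ex d fun G => ((T G ∩ nb G b').card : ℝ) := by
  have h := Ex_eq_of_sum (exch_plain d b b' hT (J := fun _ => 1) fun _ _ _ _ _ => rfl)
  have e1 : Ex d (fun G => ((T G ∩ nb G b).card : ℝ) * Pc b' b G) =
      Ex d (fun G => pc T b b' G * Pc b' b G * 1) +
        Ex d (fun G => ((T G ∩ nb G b ∩ nb G b').card : ℝ) * Pc b' b G) := by
    rw [← Ex_add]
    refine Ex_congr fun G _ => ?_
    rw [pc_add_common (hb' G)]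
    simp only [pc]; ring
  rw [e1, h, ← Ex_add, ← Ex_mul]
  refine Ex_mono fun G hG => ?_
  rw [mem_Om] at hG
  have h1 : Pc b b' G ≤ hi := (Pc_le _ _ _).trans (by rw [hG]; exact hd b)
  have h2 : Pc b' b G ≤ hi := (Pc_le _ _ _).trans (by rw [hG]; exact hd b')
  rw [pc_add_common (hb G)]
  have : T G ∩ nb G b' ∩ nb G b = T G ∩ nb G b ∩ nb G b' := by
    rw [inter_right_comm]
  rw [this]
  have h3 := pc_nonneg T b' b G
  have h4 : (0:ℝ) ≤ ((T G ∩ nb G b ∩ nb G b').card : ℝ) := Nat.cast_nonneg _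
  have h5 : pc (fun _ => T G) b' b G = pc T b' b G := rfl
  rw [h5]
  nlinarith

lemma card_Td_inter {a b b' : Fin n} (hab' : a ≠ b')
    (G : SimpleGraph (Fin n)) : ((Td a b b' G ∩ nb G b).card : ℝ) =
      Xc a b G - Ad b b' G * Ad a b' G := by
  have hb : ∀ A : Finset (Fin n), A \ {b, b'} ∩ nb G b = (A ∩ nb G b).erase b' := by
    intro A
    ext x
    simp only [mem_inter, mem_sdiff, mem_insert, mem_singleton, mem_nb, mem_erase]
    constructor
    · tauto
    · rintro ⟨h1, h2, h3⟩
      have := h3.ne'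
      tauto
  unfold Td Xc
  rw [hb]
  by_cases h : G.Adj b b' ∧ G.Adj a b'
  · have hm : b' ∈ insert a (nb G a) ∩ nb G b := by simp [mem_nb, h.1, h.2]
    have := card_erase_add_one hm
    rw [← this]; simp [Ad, h.1, h.2]
  · rw [erase_eq_of_notMem]
    · have : Ad b b' G * Ad a b' G = 0 := by
        unfold Ad; split_ifs <;> simp_all
      rw [this, sub_zero]
    · simp only [mem_inter, mem_insert, mem_nb]
      have := hab'.symm
      tauto

lemma Td_swap (a b b' : Fin n) (G : SimpleGraph (Fin n)) : Td a b b' G = Td a b' b G := by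
  unfold Td; rw [pair_comm]

/-- The imbalance of the closed neighbourhood of `a`. -/
lemma pc_Td_sub {a b b' : Fin n} (hab : a ≠ b) (hab' : a ≠ b')
    (G : SimpleGraph (Fin n)) : pc (Td a b b') b b' G - pc (Td a b b') b' b G =
      Xc a b G - Xc a b' G + Ad b b' G * (Ad a b G - Ad a b' G) := by
  have h1 := card_Td_inter (b := b) hab' G
  have h2 := card_Td_inter (b := b') hab G
  rw [← Td_swap] at h2
  rw [pc_add_common (b' := b') (by simp [Td])] at h1
  rw [pc_add_common (b' := b) (by simp [Td]), inter_right_comm, Ad_comm b' b] at h2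
  have e1 : pc (fun _ => Td a b b' G) b b' G = pc (Td a b b') b b' G := rfl
  have e2 : pc (fun _ => Td a b b' G) b' b G = pc (Td a b b') b' b G := rfl
  rw [e1] at h1
  rw [e2] at h2
  linarith

lemma sum_Pc_ge {d : Fin n → ℕ} {lo hi : ℝ} (hlo : ∀ i, lo ≤ d i) (hhi : ∀ i, d i ≤ hi)
    {a b : Fin n} (hab : a ≠ b) {G : SimpleGraph (Fin n)} (hG : G ∈ Om d) :
    ((n : ℝ) - 2) * lo - hi ^ 2 ≤ ∑ b' ∈ (univ.erase a).erase b, Pc b' b G := by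
  have hG' := mem_Om.1 hG
  simp_rw [Pc_eq]
  rw [sum_sub_distrib]
  have hhi0 : 0 ≤ hi := (Nat.cast_nonneg _).trans (hhi a)
  have c : (((univ.erase a).erase b : Finset (Fin n)).card : ℝ) = n - 2 := by
    have h1 := card_erase_add_one (s := univ.erase a) (a := b) (by simp [hab.symm])
    have h2 := card_erase_add_one (s := univ) (mem_univ a)
    rw [card_univ, Fintype.card_fin] at h2
    have h1' : (((univ.erase a).erase b : Finset (Fin n)).card : ℝ) + 1 =
        ((univ.erase a : Finset (Fin n)).card : ℝ) := by exact_mod_cast h1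
    have h2' : ((univ.erase a : Finset (Fin n)).card : ℝ) + 1 = n := by exact_mod_cast h2
    linarith
  have h1 : ((n : ℝ) - 2) * lo ≤ ∑ b' ∈ (univ.erase a).erase b, (dg G b' : ℝ) := by
    rw [← c, ← nsmul_eq_mul]
    exact card_nsmul_le_sum _ _ _ fun x _ => by rw [hG']; exact hlo x
  have h2 : ∑ b' ∈ (univ.erase a).erase b, Xc b b' G ≤ ∑ b' ∈ univ.erase b, Xc b b' G :=
    sum_le_sum_of_subset_of_nonneg (by rw [erase_right_comm]; exact erase_subset _ _)
      fun _ _ _ => Xc_nonneg _ _ _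
  rw [sum_Xc] at h2
  have h3 : ∑ v ∈ nb G b, (dg G v : ℝ) ≤ hi ^ 2 := by
    calc _ ≤ (nb G b).card • hi := sum_le_card_nsmul _ _ _ fun x _ => by rw [hG']; exact hhi x
      _ = dg G b * hi := by rw [nsmul_eq_mul]; rfl
      _ ≤ hi * hi := by
        gcongr; rw [hG']; exact hhi b
      _ = _ := by ring
  linarith

lemma Ex_Ad_le {d : Fin n → ℕ} {lo hi : ℝ} (hlo : ∀ i, lo ≤ d i) (hhi : ∀ i, d i ≤ hi)
    {a b : Fin n} (hab : a ≠ b) (hd : (Om d).Nonempty) :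
    Ex d (Ad a b) * (((n : ℝ) - 2) * lo - hi ^ 2) ≤ hi ^ 2 := by
  have hhi0 : 0 ≤ hi := (Nat.cast_nonneg _).trans (hhi a)
  have key : ∀ b' ∈ (univ.erase a).erase b, Ex d (fun G => Ad a b G * Pc b' b G) ≤
      hi * Ex d (Ad a b') := by
    intro b' hb'
    simp only [mem_erase, mem_univ, and_true] at hb'
    have h := Ex_exchange_le d (b := b) (b' := b') (T := fun _ => {a}) (fun _ _ _ _ _ => rfl)
      (by simp [hab.symm]) (by simp [hb'.2]) hhi
    have e : ∀ c : Fin n, ∀ G : SimpleGraph (Fin n),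
        (((({a} : Finset (Fin n)) ∩ nb G c).card : ℕ) : ℝ) = Ad a c G := by
      intro c G
      unfold Ad
      split_ifs with hh
      · rw [singleton_inter_of_mem (by simpa [mem_nb] using hh.symm)]; simp
      · rw [singleton_inter_of_notMem (by simpa [mem_nb] using fun h => hh h.symm)]; simp
    simp only [e] at h
    exact h
  have h1 := sum_le_sum key
  rw [← Ex_sum, ← mul_sum, ← Ex_sum] at h1
  have h2 : Ex d (fun G => ∑ b' ∈ (univ.erase a).erase b, Ad a b' G) ≤ hi := by
    refine Ex_le_const hd fun G hG => ?_
    calc _ ≤ ∑ b', Ad a b' G := sum_le_univ_sum_of_nonneg fun _ => Ad_nonneg _ _ _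
      _ ≤ hi := by rw [sum_Ad, mem_Om.1 hG]; exact hhi a
  rw [mul_comm, ← Ex_mul]
  calc _ ≤ Ex d (fun G => ∑ b' ∈ (univ.erase a).erase b, Ad a b G * Pc b' b G) := by
        refine Ex_mono fun G hG => ?_
        rw [← mul_sum, mul_comm]
        exact mul_le_mul_of_nonneg_left (sum_Pc_ge hlo hhi hab hG) (Ad_nonneg _ _ _)
    _ ≤ _ := h1
    _ ≤ hi * hi := by gcongr
    _ = _ := by ring

lemma Ex_Xc_le {d : Fin n → ℕ} {lo hi : ℝ} (hlo : ∀ i, lo ≤ d i) (hhi : ∀ i, d i ≤ hi)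
    {a b : Fin n} (hab : a ≠ b) (hd : (Om d).Nonempty) :
    Ex d (Xc a b) * (((n : ℝ) - 2) * lo - hi ^ 2) ≤ hi ^ 3 + hi ^ 2 := by
  have hhi0 : 0 ≤ hi := (Nat.cast_nonneg _).trans (hhi a)
  have key : ∀ b' ∈ (univ.erase a).erase b, Ex d (fun G => Xc a b G * Pc b' b G) ≤
      hi * Ex d (fun G => Xc a b' G + Ad b b' G) := by
    intro b' hb'
    simp only [mem_erase, mem_univ, and_true] at hb'
    have h := Ex_exchange_le d (b := b) (b' := b') (Inva.Td hab hb'.2.symm)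
      (by simp [Td]) (by simp [Td]) hhi
    have e : Ex d (fun G => Xc a b G * Pc b' b G) ≤
        Ex d (fun G => ((Td a b b' G ∩ nb G b).card : ℝ) * Pc b' b G) +
          hi * Ex d (fun G => Ad b b' G * Ad a b' G) := by
      rw [← Ex_mul, ← Ex_add]
      refine Ex_mono fun G hG => ?_
      rw [card_Td_inter hb'.2.symm]
      have h2 : Pc b' b G ≤ hi := (Pc_le _ _ _).trans (by rw [mem_Om.1 hG]; exact hhi b')
      have h3 := mul_nonneg (Ad_nonneg b b' G) (Ad_nonneg a b' G)
      nlinarith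
    have e2 : Ex d (fun G => ((Td a b b' G ∩ nb G b').card : ℝ)) +
        Ex d (fun G => Ad b b' G * Ad a b' G) ≤ Ex d (fun G => Xc a b' G + Ad b b' G) := by
      rw [← Ex_add]
      refine Ex_mono fun G hG => ?_
      rw [Td_swap, card_Td_inter hab, Ad_comm b' b]
      have h1 := mul_nonneg (Ad_nonneg b b' G) (Ad_nonneg a b G)
      have h2 : Ad b b' G * Ad a b' G ≤ Ad b b' G :=
        mul_le_of_le_one_right (Ad_nonneg _ _ _) (Ad_le_one _ _ _)
      linarith
    have := mul_le_mul_of_nonneg_left e2 hhi0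
    linarith
  have h1 := sum_le_sum key
  rw [← Ex_sum, ← mul_sum, ← Ex_sum] at h1
  have h2 : Ex d (fun G => ∑ b' ∈ (univ.erase a).erase b, (Xc a b' G + Ad b b' G)) ≤
      hi ^ 2 + hi := by
    refine Ex_le_const hd fun G hG => ?_
    have hG' := mem_Om.1 hG
    rw [sum_add_distrib]
    have f1 : ∑ b' ∈ (univ.erase a).erase b, Ad b b' G ≤ hi := by
      calc _ ≤ ∑ b', Ad b b' G := sum_le_univ_sum_of_nonneg fun _ => Ad_nonneg _ _ _
        _ ≤ hi := by rw [sum_Ad, hG']; exact hhi b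
    have f2 : ∑ b' ∈ (univ.erase a).erase b, Xc a b' G ≤ hi ^ 2 := by
      calc _ ≤ ∑ b' ∈ univ.erase a, Xc a b' G :=
            sum_le_sum_of_subset_of_nonneg (erase_subset _ _) fun _ _ _ => Xc_nonneg _ _ _
        _ = ∑ v ∈ nb G a, (dg G v : ℝ) := sum_Xc _ _
        _ ≤ (nb G a).card • hi := sum_le_card_nsmul _ _ _ fun x _ => by rw [hG']; exact hhi x
        _ = dg G a * hi := by rw [nsmul_eq_mul]; rfl
        _ ≤ hi * hi := by gcongr; rw [hG']; exact hhi a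
        _ = _ := by ring
    linarith
  rw [mul_comm, ← Ex_mul]
  calc _ ≤ Ex d (fun G => ∑ b' ∈ (univ.erase a).erase b, Xc a b G * Pc b' b G) := by
        refine Ex_mono fun G hG => ?_
        rw [← mul_sum, mul_comm]
        exact mul_le_mul_of_nonneg_left (sum_Pc_ge hlo hhi hab hG) (Xc_nonneg _ _ _)
    _ ≤ _ := h1
    _ ≤ hi * (hi ^ 2 + hi) := by gcongr
    _ = _ := by ring
end SHF

namespace SHF
open Finset
open scoped Classical
variable {n : ℕ}

section moments
variable {d : Fin n → ℕ} {b b' : Fin n} {T : SimpleGraph (Fin n) → Finset (Fin n)}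

lemma Dc_nonneg (b b' : Fin n) (G : SimpleGraph (Fin n)) : 0 ≤ Dc b b' G :=
  add_nonneg (Pc_nonneg _ _ _) (Pc_nonneg _ _ _)

lemma zc_nonneg (T : SimpleGraph (Fin n) → Finset (Fin n)) (b b' : Fin n)
    (G : SimpleGraph (Fin n)) : 0 ≤ zc T b b' G :=
  add_nonneg (pc_nonneg _ _ _ _) (pc_nonneg _ _ _ _)

lemma zc_le_Dc (T : SimpleGraph (Fin n) → Finset (Fin n)) (b b' : Fin n)
    (G : SimpleGraph (Fin n)) : zc T b b' G ≤ Dc b b' G :=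
  add_le_add (pc_le _ _ _ _) (pc_le _ _ _ _)

lemma zc_div_le_one (T : SimpleGraph (Fin n) → Finset (Fin n)) (b b' : Fin n)
    (G : SimpleGraph (Fin n)) : zc T b b' G / Dc b b' G ≤ 1 :=
  div_le_one_of_le₀ (zc_le_Dc _ _ _ _) (Dc_nonneg _ _ _)

lemma zc_div_nonneg (T : SimpleGraph (Fin n) → Finset (Fin n)) (b b' : Fin n)
    (G : SimpleGraph (Fin n)) : 0 ≤ zc T b b' G / Dc b b' G :=
  div_nonneg (zc_nonneg _ _ _ _) (Dc_nonneg _ _ _)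

lemma stein_weight (T : SimpleGraph (Fin n) → Finset (Fin n)) (b b' : Fin n)
    (G : SimpleGraph (Fin n)) :
    0 ≤ pc T b' b G * (Pc b b' G - pc T b b' G) / Dc b b' G ∧
      pc T b' b G * (Pc b b' G - pc T b b' G) / Dc b b' G ≤ zc T b b' G := by
  have h1 := pc_nonneg T b b' G
  have h2 := pc_nonneg T b' b G
  have h3 := pc_le T b b' G
  have h4 := Pc_nonneg b' b G
  have hD := Dc_nonneg b b' G
  refine ⟨div_nonneg (mul_nonneg h2 (by linarith)) hD, ?_⟩
  rcases hD.eq_or_lt with h0 | h0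
  · rw [← h0, div_zero]; exact zc_nonneg _ _ _ _
  · rw [div_le_iff₀ h0]
    refine mul_le_mul ?_ ?_ (by linarith) (zc_nonneg _ _ _ _)
    · unfold zc; linarith
    · unfold Dc; linarith

lemma Ex_uc (hT : Inva b b' T) {J : SimpleGraph (Fin n) → ℝ} (hJ : Inva b b' J) :
    Ex d (fun G => uc T b b' G * J G) = 0 := by
  have h := stein d b b' hT hJ fun _ => 1
  simp only [mul_one, sub_self, mul_zero, sum_const_zero] at h
  simp [Ex, h]

lemma Ex_uc_sq (hT : Inva b b' T) :
    Ex d (fun G => uc T b b' G ^ 2) ≤ 4 * Ex d (zc T b b') := by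
  have h := stein d b b' hT (J := fun _ => 1) (fun _ _ _ _ _ => rfl) fun x => x
  rw [← Ex_mul]
  calc _ = Ex d fun G => uc T b b' G * 1 * uc T b b' G := by
        congr 1; ext G; ring
    _ = _ := Ex_eq_of_sum h
    _ ≤ _ := by
        refine Ex_mono fun G _ => ?_
        have := (stein_weight T b b' G).2
        ring_nf at this ⊢
        linarith

lemma Ex_uc_four (hT : Inva b b' T) {Z : ℝ} (hZ0 : 0 ≤ Z) (hZ : ∀ G ∈ Om d, zc T b b' G ≤ Z) :
    Ex d (fun G => uc T b b' G ^ 4) ≤ (96 * Z + 28) * Ex d (zc T b b') := by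
  have h := stein d b b' hT (J := fun _ => 1) (fun _ _ _ _ _ => rfl) fun x => x ^ 3
  have h2 := Ex_uc_sq (d := d) hT
  calc _ = Ex d fun G => uc T b b' G * 1 * uc T b b' G ^ 3 := by
        congr 1; ext G; ring
    _ = _ := Ex_eq_of_sum h
    _ ≤ Ex d (fun G => 24 * Z * uc T b b' G ^ 2 + 28 * zc T b b' G) := by
        refine Ex_mono fun G hG => ?_
        obtain ⟨w0, w1⟩ := stein_weight T b b' G
        have hz := hZ G hG
        generalize pc T b' b G * (Pc b b' G - pc T b b' G) / Dc b b' G = M at *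
        generalize uc T b b' G = u at *
        generalize zc T b b' G = z at *
        have e : 2 * M * 1 * ((u + 2) ^ 3 - u ^ 3) = 2 * M * (6 * u ^ 2 + 12 * u + 8) := by ring
        rw [e]
        calc 2 * M * (6 * u ^ 2 + 12 * u + 8) ≤ 2 * M * (12 * u ^ 2 + 14) := by
              gcongr ?_ * ?_
              nlinarith [sq_nonneg (u - 1)]
          _ ≤ 2 * z * (12 * u ^ 2 + 14) := by gcongr
          _ = 24 * z * u ^ 2 + 28 * z := by ring
          _ ≤ _ := by gcongr
    _ = 24 * Z * Ex d (fun G => uc T b b' G ^ 2) + 28 * Ex d (zc T b b') := by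
        rw [Ex_add, Ex_mul, Ex_mul]
    _ ≤ 24 * Z * (4 * Ex d (zc T b b')) + 28 * Ex d (zc T b b') := by gcongr
    _ = _ := by ring

end moments

/-- Near-regular degree sequences in the range of parameters where concentration holds. -/
structure Bx (ρ : ℝ) (r s : ℝ) (d : Fin n → ℕ) : Prop where
  hρ0 : 0 < ρ
  hρ1 : ρ < 1
  hs : 1 ≤ s
  hsr : s * s ≤ r
  hη : 128 * s ≤ ρ * r
  hrn : r ≤ (1 - ρ) * n
  lo : ∀ i, r - s ≤ d i
  hi : ∀ i, (d i : ℝ) ≤ r + s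
  ne : (Om d).Nonempty

namespace Bx
variable {ρ r s : ℝ} {d : Fin n → ℕ}

lemma r_pos (h : Bx ρ r s d) : 0 < r := by nlinarith [h.hs, h.hsr]
lemma one_le_r (h : Bx ρ r s d) : 1 ≤ r := by nlinarith [h.hs, h.hsr]
lemma s_le_r (h : Bx ρ r s d) : s ≤ r := by nlinarith [h.hs, h.hsr]
lemma r_le_n (h : Bx ρ r s d) : r ≤ n := by
  have := h.hrn; have := h.hρ0; have : (0:ℝ) ≤ n := Nat.cast_nonneg _
  nlinarith
lemma n_pos (h : Bx ρ r s d) : (0:ℝ) < n := h.r_pos.trans_le h.r_le_n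
lemma hn (h : Bx ρ r s d) : 128 ≤ ρ * n := by
  have := h.hη; have := h.hs; have := mul_le_mul_of_nonneg_left h.r_le_n h.hρ0.le
  linarith
lemma s_le (h : Bx ρ r s d) : s ≤ r / 128 := by
  have := h.hη; have := mul_le_mul_of_nonneg_right h.hρ1.le h.r_pos.le
  linarith

lemma lam (h : Bx ρ r s d) : ρ * r * n / 2 ≤ (n - 2) * (r - s) - (r + s) ^ 2 := by
  have h1 := h.r_pos
  have h2 := h.n_pos
  have a1 := mul_le_mul_of_nonneg_right h.hη h2.le
  have a2 := mul_le_mul_of_nonneg_right h.hn h1.le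
  have a3 := mul_le_mul_of_nonneg_left h.hrn h1.le
  have a4 := mul_le_mul_of_nonneg_left h.hη h1.le
  have a5 := mul_le_mul_of_nonneg_left h.r_le_n (mul_nonneg h.hρ0.le h1.le)
  have a6 := h.hsr
  have a7 := h.hs
  have a8 := h.r_le_n
  have a9 : 0 ≤ ρ * r * n := by have := h.hρ0; positivity
  nlinarith

lemma deg_le (h : Bx ρ r s d) (i : Fin n) : (d i : ℝ) ≤ 2 * r := by
  have := h.hi i; have := h.s_le_r; linarith

lemma Ex_Ad (h : Bx ρ r s d) {a b : Fin n} (hab : a ≠ b) : Ex d (Ad a b) ≤ 8 / ρ * r / n := by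
  have h1 := Ex_Ad_le h.lo h.hi hab h.ne
  have h2 := h.lam
  have h3 : 0 ≤ Ex d (Ad a b) := Ex_nonneg fun G _ => Ad_nonneg _ _ _
  have h4 : Ex d (Ad a b) * (ρ * r * n / 2) ≤ (2 * r) ^ 2 := by
    refine (mul_le_mul_of_nonneg_left h2 h3).trans (h1.trans ?_)
    have := h.s_le_r; have := h.hs; have := h.r_pos
    exact pow_le_pow_left₀ (by linarith) (by linarith) 2
  have := h.hρ0; have := h.r_pos; have := h.n_pos
  rw [div_mul_eq_mul_div, div_div, le_div_iff₀ (by positivity)]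
  refine le_of_mul_le_mul_right ?_ h.r_pos
  nlinarith

lemma Ex_Xc (h : Bx ρ r s d) {a b : Fin n} (hab : a ≠ b) : Ex d (Xc a b) ≤ 24 / ρ * r ^ 2 / n := by
  have h1 := Ex_Xc_le h.lo h.hi hab h.ne
  have h2 := h.lam
  have h3 : 0 ≤ Ex d (Xc a b) := Ex_nonneg fun G _ => Xc_nonneg _ _ _
  have h4 : Ex d (Xc a b) * (ρ * r * n / 2) ≤ (2 * r) ^ 3 + (2 * r) ^ 2 := by
    refine (mul_le_mul_of_nonneg_left h2 h3).trans (h1.trans ?_)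
    have := h.s_le_r; have := h.hs
    have h0 : 0 ≤ r + s := by linarith [h.r_pos]
    have : r + s ≤ 2 * r := by linarith
    gcongr
  have := h.hρ0; have := h.r_pos; have := h.n_pos
  rw [div_mul_eq_mul_div, div_div, le_div_iff₀ (by positivity)]
  refine le_of_mul_le_mul_right ?_ h.r_pos
  have := h.one_le_r
  nlinarith [sq_nonneg r]

lemma Pc_sub {b b' : Fin n} (hbb : b ≠ b') {G : SimpleGraph (Fin n)} (hG : G ∈ Om d) :
    Pc b b' G - Pc b' b G = (d b : ℝ) - d b' := by
  rw [Pc_eq, Pc_eq, Xc_comm hbb, mem_Om.1 hG, mem_Om.1 hG]; ring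

lemma Dc_eq' {b b' : Fin n} (hbb : b ≠ b') {G : SimpleGraph (Fin n)} (hG : G ∈ Om d) :
    Dc b b' G = d b + d b' - 2 * Xc b b' G := by
  rw [Dc, Pc_eq, Pc_eq, Xc_comm hbb, mem_Om.1 hG, mem_Om.1 hG]; ring

lemma abs_deg_sub (h : Bx ρ r s d) (b b' : Fin n) : |(d b : ℝ) - d b'| ≤ 2 * s := by
  have := h.lo b; have := h.lo b'; have := h.hi b; have := h.hi b'
  rw [abs_le]; constructor <;> linarith

lemma zc_Td_le {a b b' : Fin n} (hab : a ≠ b) (hab' : a ≠ b')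
    {G : SimpleGraph (Fin n)} : zc (Td a b b') b b' G ≤ Xc a b G + Xc a b' G := by
  have h1 := card_Td_inter (b := b) hab' G
  have h2 := card_Td_inter (b := b') hab G
  rw [← Td_swap] at h2
  rw [pc_add_common (b' := b') (by simp [Td])] at h1
  rw [pc_add_common (b' := b) (by simp [Td])] at h2
  have e1 : pc (fun _ => Td a b b' G) b b' G = pc (Td a b b') b b' G := rfl
  have e2 : pc (fun _ => Td a b b' G) b' b G = pc (Td a b b') b' b G := rfl
  rw [e1] at h1
  rw [e2] at h2
  have i1 := mul_nonneg (Ad_nonneg b b' G) (Ad_nonneg a b' G)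
  have i2 := mul_nonneg (Ad_nonneg b' b G) (Ad_nonneg a b G)
  unfold zc
  have j1 : (0:ℝ) ≤ ((Td a b b' G ∩ nb G b ∩ nb G b').card : ℝ) := Nat.cast_nonneg _
  have j2 : (0:ℝ) ≤ ((Td a b b' G ∩ nb G b' ∩ nb G b).card : ℝ) := Nat.cast_nonneg _
  linarith

lemma Ex_zc_Td (h : Bx ρ r s d) {a b b' : Fin n} (hab : a ≠ b) (hab' : a ≠ b') :
    Ex d (zc (Td a b b') b b') ≤ 48 / ρ * r ^ 2 / n := by
  calc _ ≤ Ex d fun G => Xc a b G + Xc a b' G := Ex_mono fun G _ => zc_Td_le hab hab'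
    _ ≤ 24 / ρ * r ^ 2 / n + 24 / ρ * r ^ 2 / n := by
      rw [Ex_add]; exact add_le_add (h.Ex_Xc hab) (h.Ex_Xc hab')
    _ = _ := by ring

lemma Ex_u_sq (h : Bx ρ r s d) {a b b' : Fin n} (hab : a ≠ b) (hab' : a ≠ b') :
    Ex d (fun G => uc (Td a b b') b b' G ^ 2) ≤ 192 / ρ * r ^ 2 / n := by
  refine (Ex_uc_sq (Inva.Td hab hab')).trans ?_
  have := h.Ex_zc_Td hab hab'
  calc _ ≤ 4 * (48 / ρ * r ^ 2 / n) := by gcongr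
    _ = _ := by ring

lemma Ex_u_four (h : Bx ρ r s d) {a b b' : Fin n} (hab : a ≠ b) (hab' : a ≠ b') :
    Ex d (fun G => uc (Td a b b') b b' G ^ 4) ≤ 15168 / ρ * r ^ 3 / n := by
  have hr := h.r_pos
  refine (Ex_uc_four (Z := 3 * r) (Inva.Td hab hab') (by positivity) fun G hG => ?_).trans ?_
  · rw [zc_eq]
    have h1 : (Td a b b' G ∩ Dl G b b').card ≤ dg G a + 1 :=
      (card_le_card (inter_subset_left.trans sdiff_subset)).trans (card_insert_le _ _)
    have h2 : ((Td a b b' G ∩ Dl G b b').card : ℝ) ≤ dg G a + 1 := by exact_mod_cast h1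
    rw [mem_Om.1 hG] at h2
    have := h.deg_le a; have := h.one_le_r
    linarith
  · have := h.Ex_zc_Td hab hab'
    have h1 := h.one_le_r
    have hρ := h.hρ0
    have hn := h.n_pos
    calc _ ≤ (96 * (3 * r) + 28) * (48 / ρ * r ^ 2 / n) := by gcongr
      _ ≤ (316 * r) * (48 / ρ * r ^ 2 / n) := by gcongr; linarith
      _ = _ := by ring

end Bx

/-- Indicator of the event that `b` and `b'` have nearly equal neighbourhoods. -/
noncomputable def Bd (ρ r : ℝ) (b b' : Fin n) (G : SimpleGraph (Fin n)) : ℝ :=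
  if Dc b b' G < ρ * r / 4 then 1 else 0

lemma pow_four_sum_le {ι : Type*} (A : Finset ι) (u : ι → ℝ) :
    (∑ i ∈ A, u i) ^ 4 ≤ (A.card : ℝ) ^ 3 * ∑ i ∈ A, u i ^ 4 := by
  have h1 := sq_sum_le_card_mul_sum_sq (s := A) (f := u)
  have h2 := sq_sum_le_card_mul_sum_sq (s := A) (f := fun i => u i ^ 2)
  have e : ∀ i, (u i ^ 2) ^ 2 = u i ^ 4 := fun i => by ring
  simp only [e] at h2
  calc (∑ i ∈ A, u i) ^ 4 = ((∑ i ∈ A, u i) ^ 2) ^ 2 := by ring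
    _ ≤ ((A.card : ℝ) * ∑ i ∈ A, u i ^ 2) ^ 2 := by gcongr
    _ = (A.card : ℝ) ^ 2 * (∑ i ∈ A, u i ^ 2) ^ 2 := by ring
    _ ≤ (A.card : ℝ) ^ 2 * ((A.card : ℝ) * ∑ i ∈ A, u i ^ 4) := by gcongr
    _ = _ := by ring

lemma card_erase_erase {a b : Fin n} (hab : a ≠ b) :
    (((univ.erase a).erase b : Finset (Fin n)).card : ℝ) = n - 2 := by
  have h1 := card_erase_add_one (s := univ.erase a) (a := b) (by simp [hab.symm])
  have h2 := card_erase_add_one (s := univ) (mem_univ a)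
  rw [card_univ, Fintype.card_fin] at h2
  have h1' : (((univ.erase a).erase b : Finset (Fin n)).card : ℝ) + 1 =
      ((univ.erase a : Finset (Fin n)).card : ℝ) := by exact_mod_cast h1
  have h2' : ((univ.erase a : Finset (Fin n)).card : ℝ) + 1 = n := by exact_mod_cast h2
  linarith

namespace Bx
variable {ρ r s : ℝ} {d : Fin n → ℕ}

lemma abs_corr (h : Bx ρ r s d) (T : SimpleGraph (Fin n) → Finset (Fin n)) {b b' : Fin n} (hbb : b ≠ b')
    {G : SimpleGraph (Fin n)} (hG : G ∈ Om d) :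
    |zc T b b' G * (Pc b b' G - Pc b' b G) / Dc b b' G| ≤ 2 * s * (zc T b b' G / Dc b b' G) := by
  rw [Pc_sub hbb hG, mul_comm, mul_div_assoc, abs_mul, abs_of_nonneg (zc_div_nonneg T b b' G)]
  exact mul_le_mul_of_nonneg_right (h.abs_deg_sub b b') (zc_div_nonneg _ _ _ _)

lemma sum_u_of_bad (h : Bx ρ r s d) {b b' : Fin n} (hbb : b ≠ b') {G : SimpleGraph (Fin n)} (hG : G ∈ Om d)
    (hD : Dc b b' G < ρ * r / 4) :
    ρ * n * r / 2 ≤ ∑ c ∈ (univ.erase b).erase b', uc (Td b b' c) b' c G := by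
  have hX : r - s - ρ * r / 8 ≤ Xc b b' G := by
    have := Dc_eq' hbb hG
    have := h.lo b; have := h.lo b'
    linarith
  have h1 : ∀ c ∈ (univ.erase b).erase b', (Xc b b' G - 1 - 2 * s) - Xc b c G ≤
      uc (Td b b' c) b' c G := by
    intro c hc
    simp only [mem_erase, mem_univ, and_true] at hc
    have hw := pc_Td_sub hbb hc.2.symm G
    have h2 := h.abs_corr (Td b b' c) (Ne.symm hc.1) hG
    have h3 := zc_div_le_one (Td b b' c) b' c G
    have h4 : 2 * s * (zc (Td b b' c) b' c G / Dc b' c G) ≤ 2 * s * 1 := by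
      have := h.hs; gcongr
    rw [abs_le] at h2
    have h5 : -1 ≤ Ad b' c G * (Ad b b' G - Ad b c G) := by
      have := Ad_nonneg b' c G; have := Ad_nonneg b b' G; have := Ad_nonneg b c G
      have := Ad_le_one b' c G; have := Ad_le_one b c G
      nlinarith
    unfold uc
    linarith [h2.2]
  refine le_trans ?_ (sum_le_sum h1)
  rw [sum_sub_distrib, sum_const, nsmul_eq_mul, card_erase_erase hbb]
  have h2 : ∑ c ∈ (univ.erase b).erase b', Xc b c G ≤ (r + s) ^ 2 := by
    have hs := h.hs
    have hr := h.r_pos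
    calc _ ≤ ∑ c ∈ univ.erase b, Xc b c G :=
          sum_le_sum_of_subset_of_nonneg (erase_subset _ _) fun _ _ _ => Xc_nonneg _ _ _
      _ = ∑ v ∈ nb G b, (dg G v : ℝ) := sum_Xc _ _
      _ ≤ (nb G b).card • (r + s) :=
          sum_le_card_nsmul _ _ _ fun x _ => by rw [mem_Om.1 hG]; exact h.hi x
      _ = dg G b * (r + s) := by rw [nsmul_eq_mul]; rfl
      _ ≤ (r + s) * (r + s) := by gcongr; rw [mem_Om.1 hG]; exact h.hi b
      _ = _ := by ring
  have hn2 : (2:ℝ) ≤ n := by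
    have := h.hn; have := h.n_pos; have := h.hρ1
    nlinarith
  have h3 : ((n:ℝ) - 2) * (r - ρ * r / 8 - ρ * r / 32) ≤ (n - 2) * (Xc b b' G - 1 - 2 * s) := by
    refine mul_le_mul_of_nonneg_left ?_ (by linarith)
    have := h.hη; have := h.hs
    linarith
  have hr := h.r_pos
  have hn := h.n_pos
  have a1 := mul_le_mul_of_nonneg_right h.hη hn.le
  have a2 := mul_le_mul_of_nonneg_right h.hn hr.le
  have a3 := mul_le_mul_of_nonneg_left h.hrn hr.le
  have a4 := mul_le_mul_of_nonneg_left h.hη hr.le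
  have a5 := mul_le_mul_of_nonneg_left h.r_le_n (mul_nonneg h.hρ0.le hr.le)
  have a6 := h.hsr
  have a7 : 0 ≤ ρ * r := mul_nonneg h.hρ0.le hr.le
  have a8 := h.r_le_n
  nlinarith

lemma Ex_Bd (h : Bx ρ r s d) {b b' : Fin n} (hbb : b ≠ b') :
    Ex d (Bd ρ r b b') ≤ 242688 / ρ ^ 5 / (r * n) := by
  have hr := h.r_pos
  have hn := h.n_pos
  have hρ := h.hρ0
  have h1 : (ρ * n * r / 2) ^ 4 * Ex d (Bd ρ r b b') ≤
      (n:ℝ) ^ 3 * (n * (15168 / ρ * r ^ 3 / n)) := by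
    have hc : (((univ.erase b).erase b' : Finset (Fin n)).card : ℝ) ≤ n := by
      rw [card_erase_erase hbb]; linarith
    calc _ = Ex d (fun G => (ρ * n * r / 2) ^ 4 * Bd ρ r b b' G) := (Ex_mul _).symm
      _ ≤ Ex d (fun G => (n:ℝ) ^ 3 *
          ∑ c ∈ (univ.erase b).erase b', uc (Td b b' c) b' c G ^ 4) := by
          refine Ex_mono fun G hG => ?_
          unfold Bd
          split_ifs with hD
          · have h2 := h.sum_u_of_bad hbb hG hD
            rw [mul_one]
            calc _ ≤ (∑ c ∈ (univ.erase b).erase b', uc (Td b b' c) b' c G) ^ 4 := by gcongr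
              _ ≤ _ := pow_four_sum_le _ _
              _ ≤ _ := by gcongr
          · rw [mul_zero]; positivity
      _ = (n:ℝ) ^ 3 * ∑ c ∈ (univ.erase b).erase b',
          Ex d (fun G => uc (Td b b' c) b' c G ^ 4) := by rw [Ex_mul, Ex_sum]
      _ ≤ (n:ℝ) ^ 3 * ∑ c ∈ (univ.erase b).erase b', (15168 / ρ * r ^ 3 / n) := by
          gcongr with c hc
          simp only [mem_erase, mem_univ, and_true] at hc
          exact h.Ex_u_four hbb hc.2.symm
      _ ≤ _ := by
          rw [sum_const, nsmul_eq_mul]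
          gcongr
  have e : (n:ℝ) ^ 3 * (n * (15168 / ρ * r ^ 3 / n)) =
      (ρ * n * r / 2) ^ 4 * (242688 / ρ ^ 5 / (r * n)) := by
    field_simp; norm_num
  rw [e] at h1
  exact le_of_mul_le_mul_left h1 (by positivity)

lemma Ex_zc_div_le (h : Bx ρ r s d) (T : SimpleGraph (Fin n) → Finset (Fin n)) {b b' : Fin n} (hbb : b ≠ b') :
    Ex d (fun G => zc T b b' G / Dc b b' G) ≤
      4 / (ρ * r) * Ex d (zc T b b') + 242688 / ρ ^ 5 / (r * n) := by
  have hr := h.r_pos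
  have hρ := h.hρ0
  refine le_trans ?_ (add_le_add le_rfl (h.Ex_Bd hbb))
  rw [← Ex_mul, ← Ex_add]
  refine Ex_mono fun G hG => ?_
  have hz := zc_nonneg T b b' G
  unfold Bd
  split_ifs with hD
  · have := zc_div_le_one T b b' G
    have : 0 ≤ 4 / (ρ * r) * zc T b b' G := by positivity
    linarith
  · push Not at hD
    rw [add_zero, div_mul_eq_mul_div, div_le_div_iff₀ (lt_of_lt_of_le (by positivity) hD)
      (by positivity)]
    nlinarith

end Bx

lemma card_singleton_inter (a : Fin n) (A : Finset (Fin n)) :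
    ((({a} : Finset (Fin n)) ∩ A).card : ℝ) = if a ∈ A then 1 else 0 := by
  split_ifs with hh
  · rw [singleton_inter_of_mem hh]; simp
  · rw [singleton_inter_of_notMem hh]; simp

lemma zc_singleton_le (a b b' : Fin n) (G : SimpleGraph (Fin n)) :
    zc (fun _ => {a}) b b' G ≤ Ad a b G + Ad a b' G := by
  have : ∀ c c' : Fin n, pc (fun _ => {a}) c c' G ≤ Ad a c G := by
    intro c c'
    unfold pc Ad
    rw [card_singleton_inter]
    split_ifs with h1 h2
    · exact le_rfl
    · exact absurd (mem_Lf.1 h1).2.1.symm h2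
    · norm_num
    · norm_num
  exact add_le_add (this _ _) (this _ _)

lemma pc_singleton_sub {a b b' : Fin n} (hab : a ≠ b) (hab' : a ≠ b') (G : SimpleGraph (Fin n)) :
    pc (fun _ => {a}) b b' G - pc (fun _ => {a}) b' b G = Ad a b G - Ad a b' G := by
  unfold pc Ad
  rw [card_singleton_inter, card_singleton_inter]
  simp only [mem_Lf, ne_eq, hab, hab', not_false_eq_true, true_and, G.adj_comm b a,
    G.adj_comm b' a]
  split_ifs <;> simp_all

/-- Probability weight of a fixed vertex in the exchangeable part. -/
lemma exists_Ex_single (ρ : ℝ) (hρ : 0 < ρ) : ∃ C : ℝ, 0 < C ∧ ∀ {n : ℕ} {r s : ℝ}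
    {d : Fin n → ℕ}, Bx ρ r s d → ∀ {a b b' : Fin n}, a ≠ b → a ≠ b' → b ≠ b' →
    Ex d (fun G => zc (fun _ => {a}) b b' G / Dc b b' G) ≤ C / n := by
  refine ⟨64 / ρ ^ 2 + 242688 / ρ ^ 5, by positivity, ?_⟩
  intro n r s d h a b b' hab hab' hbb
  have hr := h.r_pos
  have hn := h.n_pos
  have h1 := h.Ex_zc_div_le (fun _ => {a}) hbb
  have h2 : Ex d (zc (fun _ => {a}) b b') ≤ 16 / ρ * r / n := by
    calc _ ≤ Ex d (fun G => Ad a b G + Ad a b' G) := Ex_mono fun G _ => zc_singleton_le _ _ _ _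
      _ ≤ 8 / ρ * r / n + 8 / ρ * r / n := by
        rw [Ex_add]; exact add_le_add (h.Ex_Ad hab) (h.Ex_Ad hab')
      _ = _ := by ring
  calc _ ≤ _ := h1
    _ ≤ 4 / (ρ * r) * (16 / ρ * r / n) + 242688 / ρ ^ 5 / (1 * n) := by
      have := h.one_le_r
      gcongr
    _ = _ := by field_simp; ring

lemma exists_Ex_zc_Td_div (ρ : ℝ) (hρ : 0 < ρ) : ∃ C : ℝ, 0 < C ∧ ∀ {n : ℕ} {r s : ℝ}
    {d : Fin n → ℕ}, Bx ρ r s d → ∀ {a b b' : Fin n}, a ≠ b → a ≠ b' → b ≠ b' →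
    Ex d (fun G => zc (Td a b b') b b' G / Dc b b' G) ≤ C * r / n := by
  refine ⟨192 / ρ ^ 2 + 242688 / ρ ^ 5, by positivity, ?_⟩
  intro n r s d h a b b' hab hab' hbb
  have hr := h.r_pos
  have hn := h.n_pos
  have h1 := h.Ex_zc_div_le (Td a b b') hbb
  have h2 := h.Ex_zc_Td hab hab'
  have h3 : 242688 / ρ ^ 5 / (r * n) ≤ 242688 / ρ ^ 5 * r / n := by
    rw [div_div, div_mul_eq_mul_div, div_div, div_le_div_iff₀ (by positivity) (by positivity)]
    have : 1 ≤ r * r := by nlinarith [h.one_le_r]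
    have : 0 < 242688 * (ρ ^ 5 * n) := by positivity
    nlinarith
  calc _ ≤ _ := h1
    _ ≤ 4 / (ρ * r) * (48 / ρ * r ^ 2 / n) + 242688 / ρ ^ 5 * r / n := by
      gcongr
    _ = _ := by field_simp; ring

/-- Edge probabilities are nearly constant. -/
lemma exists_Ex_Ad_sub (ρ : ℝ) (hρ : 0 < ρ) : ∃ C : ℝ, 0 < C ∧ ∀ {n : ℕ} {r s : ℝ}
    {d : Fin n → ℕ}, Bx ρ r s d → ∀ {a b b' : Fin n}, a ≠ b → a ≠ b' → b ≠ b' →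
    |Ex d (Ad a b) - Ex d (Ad a b')| ≤ C * s / n := by
  obtain ⟨C, hC, H⟩ := exists_Ex_single ρ hρ
  refine ⟨2 * C, by positivity, ?_⟩
  intro n r s d h a b b' hab hab' hbb
  have h1 := Ex_uc (d := d) (b := b) (b' := b') (T := fun _ => {a}) (J := fun _ => 1)
    (fun _ _ _ _ _ => rfl) (fun _ _ _ _ _ => rfl)
  have hs := h.hs
  rw [← Ex_sub]
  have e : Ex d (fun G => Ad a b G - Ad a b' G) = Ex d (fun G => zc (fun _ => {a}) b b' G *
      (Pc b b' G - Pc b' b G) / Dc b b' G) := by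
    have e1 : ∀ G : SimpleGraph (Fin n), uc (fun _ => {a}) b b' G * 1 =
        (Ad a b G - Ad a b' G) - zc (fun _ => {a}) b b' G *
      (Pc b b' G - Pc b' b G) / Dc b b' G := by
      intro G
      rw [uc, pc_singleton_sub hab hab', mul_one]
    simp only [e1] at h1
    rw [Ex_sub] at h1
    linarith
  rw [e]
  calc _ ≤ _ := abs_Ex_le
    _ ≤ Ex d (fun G => 2 * s * (zc (fun _ => {a}) b b' G / Dc b b' G)) :=
      Ex_mono fun G hG => h.abs_corr _ hbb hG
    _ = 2 * s * Ex d (fun G => zc (fun _ => {a}) b b' G / Dc b b' G) := Ex_mul _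
    _ ≤ 2 * s * (C / n) := by
      have := H h hab hab' hbb
      gcongr
    _ = _ := by ring
end SHF

namespace SHF
open Finset
open scoped Classical
variable {n : ℕ}

/-- Fraction of the exchangeable part of `b, b'` in the closed neighbourhood of `c`. -/
noncomputable def fc (b b' c : Fin n) (G : SimpleGraph (Fin n)) : ℝ :=
  ((insert c (nb G c) ∩ Dl G b b').card : ℝ) / Dc b b' G

lemma notMem_Dl (b b' : Fin n) (G : SimpleGraph (Fin n)) : b ∉ Dl G b b' ∧ b' ∉ Dl G b b' := by
  simp [Dl, mem_Lf]

lemma fc_eq (b b' c : Fin n) (G : SimpleGraph (Fin n)) :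
    fc b b' c G = zc (Td c b b') b b' G / Dc b b' G := by
  rw [fc, zc_eq]
  congr 3
  obtain ⟨h1, h2⟩ := notMem_Dl b b' G
  ext x
  simp only [Td, mem_inter, mem_sdiff, mem_insert, mem_singleton]
  constructor
  · rintro ⟨h3, h4⟩
    exact ⟨⟨h3, by rintro (rfl | rfl) <;> contradiction⟩, h4⟩
  · tauto

lemma fc_nonneg (b b' c : Fin n) (G : SimpleGraph (Fin n)) : 0 ≤ fc b b' c G := by
  rw [fc_eq]; exact zc_div_nonneg _ _ _ _

lemma fc_le_one (b b' c : Fin n) (G : SimpleGraph (Fin n)) : fc b b' c G ≤ 1 := by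
  rw [fc_eq]; exact zc_div_le_one _ _ _ _

lemma card_insert_inter (c : Fin n) (A : Finset (Fin n)) (G : SimpleGraph (Fin n)) :
    ((insert c (nb G c) ∩ A).card : ℝ) = (A ∩ nb G c).card + if c ∈ A then 1 else 0 := by
  split_ifs with h
  · rw [insert_inter_of_mem h, card_insert_of_notMem (by simp [mem_nb]), inter_comm]
    push_cast; rfl
  · rw [insert_inter_of_notMem h, inter_comm]; simp

lemma sum_fc {ρ r s : ℝ} {d : Fin n → ℕ} (h : Bx ρ r s d) {b b' : Fin n}
    {G : SimpleGraph (Fin n)} (hG : G ∈ Om d) :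
    |∑ c, fc b b' c G - r| ≤ 2 * s + r * Bd ρ r b b' G := by
  have hr := h.r_pos
  have hs := h.hs
  have hρ := h.hρ0
  have e : ∑ c, fc b b' c G = (∑ v ∈ Dl G b b', (d v : ℝ) + (Dl G b b').card) / Dc b b' G := by
    unfold fc
    rw [← sum_div]
    simp only [card_insert_inter]
    rw [sum_add_distrib, sum_inter_nb]
    congr 2
    · exact sum_congr rfl fun v _ => by rw [mem_Om.1 hG]
    · simp
  rw [e]
  by_cases hD : Dc b b' G = 0
  · have : Bd ρ r b b' G = 1 := by
      unfold Bd; rw [if_pos (by rw [hD]; positivity)]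
    rw [hD, this, div_zero, zero_sub, abs_neg, abs_of_pos hr]
    linarith
  · have hD' : 0 < Dc b b' G := lt_of_le_of_ne (Dc_nonneg _ _ _) (Ne.symm hD)
    have hB : 0 ≤ Bd ρ r b b' G := by unfold Bd; split_ifs <;> norm_num
    have h1 : ∑ v ∈ Dl G b b', (d v : ℝ) ≤ (Dl G b b').card • (r + s) :=
      sum_le_card_nsmul _ _ _ fun v _ => h.hi v
    have h2 : (Dl G b b').card • (r - s) ≤ ∑ v ∈ Dl G b b', (d v : ℝ) :=
      card_nsmul_le_sum _ _ _ fun v _ => h.lo v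
    rw [nsmul_eq_mul] at h1 h2
    rw [Dc_eq] at hD' ⊢
    have h3 : |(∑ v ∈ Dl G b b', (d v : ℝ) + (Dl G b b').card) / (Dl G b b').card - r| ≤
        2 * s := by
      rw [abs_le]
      constructor
      · rw [le_sub_iff_add_le, le_div_iff₀ hD']; nlinarith
      · rw [sub_le_iff_le_add, div_le_iff₀ hD']; nlinarith
    have : 0 ≤ r * Bd ρ r b b' G := by positivity
    linarith

/-- The exchangeable part of `b, b'` without `a, a'`. -/
noncomputable def Tq (b b' a a' : Fin n) (G : SimpleGraph (Fin n)) : Finset (Fin n) :=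
  Dl G b b' \ {a, a'}

lemma Inva.Tq {a a' b b' : Fin n} (h1 : a ≠ b) (h2 : a ≠ b') (h3 : a' ≠ b) (h4 : a' ≠ b') :
    Inva a a' (Tq b b' a a') := by
  intro G v v' _ _
  ext x
  simp only [SHF.Tq, SHF.Dl, mem_sdiff, mem_union, mem_Lf, mem_insert, mem_singleton, not_or]
  constructor
  · rintro ⟨h, h5, h6⟩
    rw [sw_adj_of_ne h1.symm h3.symm h5 h6, sw_adj_of_ne h2.symm h4.symm h5 h6] at h
    exact ⟨h, h5, h6⟩
  · rintro ⟨h, h5, h6⟩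
    rw [sw_adj_of_ne h1.symm h3.symm h5 h6, sw_adj_of_ne h2.symm h4.symm h5 h6]
    exact ⟨h, h5, h6⟩

lemma ratio_perturb {Y t k κ : ℝ} (hY : 0 ≤ Y) (hYt : Y ≤ t) (hk : 0 ≤ k) (hkκ : k ≤ κ) :
    |(Y + k) / (t + κ) - Y / t| ≤ κ / (t + κ) := by
  rcases (hY.trans hYt).eq_or_lt with h0 | h0
  · have : Y = 0 := by linarith
    rw [← h0, this, div_zero, sub_zero, zero_add, zero_add, abs_div, abs_of_nonneg hk,
      abs_of_nonneg (hk.trans hkκ)]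
    exact div_le_div_of_nonneg_right hkκ (hk.trans hkκ)
  · have h1 : 0 < t + κ := by linarith
    have e : (Y + k) / (t + κ) - Y / t = ((k * t - Y * κ) / t) / (t + κ) := by
      field_simp; ring
    rw [e, abs_div, abs_of_pos h1]
    refine div_le_div_of_nonneg_right ?_ h1.le
    rw [abs_le]
    constructor
    · rw [le_div_iff₀ h0]; nlinarith
    · rw [div_le_iff₀ h0]; nlinarith

lemma fc_sub_le {a a' b b' : Fin n} (haa : a ≠ a')
    (G : SimpleGraph (Fin n)) :
    |fc b b' a G - ((Tq b b' a a' G ∩ nb G a).card : ℝ) / (Tq b b' a a' G).card| ≤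
      zc (fun _ => {a}) b b' G / Dc b b' G + zc (fun _ => {a'}) b b' G / Dc b b' G := by
  have eD : Dc b b' G = ((Tq b b' a a' G).card : ℝ) +
      ((if a ∈ Dl G b b' then 1 else 0) + (if a' ∈ Dl G b b' then 1 else 0)) := by
    rw [Dc_eq]
    have h1 := card_sdiff_add_card_inter (Dl G b b') {a, a'}
    rw [← h1, Tq]
    push_cast
    congr 1
    have : (Dl G b b' ∩ {a, a'}).card = ∑ x ∈ ({a, a'} : Finset (Fin n)),
        if x ∈ Dl G b b' then 1 else 0 := by
      rw [sum_boole, inter_comm]; simp [filter_mem_eq_inter]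
    rw [this, sum_pair haa]
    push_cast; rfl
  have eX : ((insert a (nb G a) ∩ Dl G b b').card : ℝ) = ((Tq b b' a a' G ∩ nb G a).card : ℝ) +
      ((if a ∈ Dl G b b' then 1 else 0) + (if a' ∈ Dl G b b' then Ad a a' G else 0)) := by
    rw [card_insert_inter]
    have h1 := card_sdiff_add_card_inter (Dl G b b' ∩ nb G a) {a, a'}
    have h2 : (Dl G b b' ∩ nb G a) \ {a, a'} = Tq b b' a a' G ∩ nb G a := by
      rw [Tq, sdiff_inter_right_comm]
    have h3 : (((Dl G b b' ∩ nb G a) ∩ {a, a'}).card : ℝ) =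
        (if a' ∈ Dl G b b' then Ad a a' G else 0) := by
      have : ((Dl G b b' ∩ nb G a) ∩ {a, a'}).card = ∑ x ∈ ({a, a'} : Finset (Fin n)),
          if x ∈ Dl G b b' ∩ nb G a then 1 else 0 := by
        rw [sum_boole, filter_mem_eq_inter, inter_comm]; rfl
      rw [this, sum_pair haa]
      simp only [mem_inter, mem_nb, SimpleGraph.irrefl, and_false, if_false, zero_add, Ad]
      split_ifs <;> simp_all
    rw [← h1, h2]
    push_cast
    rw [h3]
    ring
  have ez : ∀ c, zc (fun _ => {c}) b b' G = if c ∈ Dl G b b' then 1 else 0 := by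
    intro c
    rw [zc_eq, card_singleton_inter]
  rw [ez, ez, ← add_div, fc, eX, eD]
  have h1 := Ad_nonneg a a' G
  have h2 := Ad_le_one a a' G
  refine ratio_perturb (Nat.cast_nonneg _) (by exact_mod_cast card_le_card inter_subset_left) ?_ ?_
  · split_ifs <;> linarith
  · split_ifs <;> linarith

namespace Bx
variable {ρ r s : ℝ} {d : Fin n → ℕ}

lemma Ex_zc_Tq (h : Bx ρ r s d) {a a' b b' : Fin n} (h1 : a ≠ b) (h2 : a ≠ b') (h3 : a' ≠ b) (h4 : a' ≠ b') :
    Ex d (zc (Tq b b' a a') a a') ≤ 96 / ρ * r ^ 2 / n := by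
  have key : ∀ c e : Fin n, c ≠ b → c ≠ b' → ∀ G : SimpleGraph (Fin n),
      pc (Tq b b' a a') c e G ≤ Xc b c G + Xc b' c G := by
    intro c e _ _ G
    unfold pc Xc
    norm_cast
    refine (card_le_card ?_).trans (card_union_le _ _)
    intro x
    simp only [Tq, Dl, mem_inter, mem_sdiff, mem_union, mem_Lf, mem_insert, mem_nb]
    tauto
  calc _ ≤ Ex d (fun G => (Xc b a G + Xc b' a G) + (Xc b a' G + Xc b' a' G)) :=
        Ex_mono fun G _ => add_le_add (key _ _ h1 h2 G) (key _ _ h3 h4 G)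
    _ ≤ (24 / ρ * r ^ 2 / n + 24 / ρ * r ^ 2 / n) + (24 / ρ * r ^ 2 / n + 24 / ρ * r ^ 2 / n) := by
        rw [Ex_add, Ex_add, Ex_add]
        gcongr
        · exact h.Ex_Xc h1.symm
        · exact h.Ex_Xc h2.symm
        · exact h.Ex_Xc h3.symm
        · exact h.Ex_Xc h4.symm
    _ = _ := by ring

lemma zc_Tq_div_le (h : Bx ρ r s d) {a a' b b' : Fin n} {G : SimpleGraph (Fin n)} :
    zc (Tq b b' a a') a a' G / Dc a a' G / (Tq b b' a a' G).card ≤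
      32 / (ρ * r) ^ 2 * zc (Tq b b' a a') a a' G + Bd ρ r a a' G + Bd ρ r b b' G := by
  have hr := h.r_pos
  have hρ := h.hρ0
  have z0 := zc_nonneg (Tq b b' a a') a a' G
  have z1 := zc_div_le_one (Tq b b' a a') a a' G
  have z2 := zc_div_nonneg (Tq b b' a a') a a' G
  have z3 : 0 ≤ 32 / (ρ * r) ^ 2 * zc (Tq b b' a a') a a' G := by positivity
  have hB : ∀ c c' : Fin n, 0 ≤ Bd ρ r c c' G := by intro c c'; unfold Bd; split_ifs <;> norm_num
  have q1 : zc (Tq b b' a a') a a' G / Dc a a' G / (Tq b b' a a' G).card ≤ 1 := by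
    rcases Nat.eq_zero_or_pos (Tq b b' a a' G).card with h0 | h0
    · rw [h0, Nat.cast_zero, div_zero]; norm_num
    · have : (1:ℝ) ≤ (Tq b b' a a' G).card := by exact_mod_cast h0
      exact (div_le_self z2 this).trans z1
  by_cases hD : Dc a a' G < ρ * r / 4
  · have : Bd ρ r a a' G = 1 := if_pos hD
    have := hB b b'
    linarith
  by_cases hD' : Dc b b' G < ρ * r / 4
  · have : Bd ρ r b b' G = 1 := if_pos hD'
    have := hB a a'
    linarith
  push Not at hD hD'
  have ht : ρ * r / 8 ≤ (Tq b b' a a' G).card := by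
    have h1 : (Dl G b b').card ≤ (Tq b b' a a' G).card + 2 := by
      have h2 := card_sdiff_add_card_inter (Dl G b b') {a, a'}
      have h3 : (Dl G b b' ∩ {a, a'}).card ≤ 2 :=
        (card_le_card inter_subset_right).trans card_le_two
      unfold Tq; omega
    have h2 : ((Dl G b b').card : ℝ) ≤ (Tq b b' a a' G).card + 2 := by exact_mod_cast h1
    rw [Dc_eq] at hD'
    have := h.hη; have := h.hs
    linarith
  have h5 : zc (Tq b b' a a') a a' G / Dc a a' G / (Tq b b' a a' G).card ≤
      zc (Tq b b' a a') a a' G / (ρ * r / 4) / (ρ * r / 8) := by gcongr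
  have e : zc (Tq b b' a a') a a' G / (ρ * r / 4) / (ρ * r / 8) =
      32 / (ρ * r) ^ 2 * zc (Tq b b' a a') a a' G := by field_simp; ring
  have := hB a a'; have := hB b b'
  linarith

end Bx

lemma exists_Ex_Tq_sub (ρ : ℝ) (hρ : 0 < ρ) : ∃ C : ℝ, 0 < C ∧ ∀ {n : ℕ} {r s : ℝ}
    {d : Fin n → ℕ}, Bx ρ r s d → ∀ {a a' b b' : Fin n}, a ≠ b → a ≠ b' → a' ≠ b → a' ≠ b' →
    a ≠ a' → b ≠ b' →
    |Ex d (fun G => ((Tq b b' a a' G ∩ nb G a).card : ℝ) / (Tq b b' a a' G).card -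
      ((Tq b b' a a' G ∩ nb G a').card : ℝ) / (Tq b b' a a' G).card)| ≤ C * s / n := by
  refine ⟨2 * (3072 / ρ ^ 3 + 2 * (242688 / ρ ^ 5)), by positivity, ?_⟩
  intro n r s d h a a' b b' h1 h2 h3 h4 haa hbb
  have hr := h.r_pos
  have hs := h.hs
  have hn := h.n_pos
  have hT := Inva.Tq h1 h2 h3 h4
  have hJ : Inva a a' fun G => 1 / ((Tq b b' a a' G).card : ℝ) := fun G v v' hv hv' => by
    simp only [hT G v v' hv hv']
  have key := Ex_uc (d := d) hT hJ
  have e1 : ∀ G : SimpleGraph (Fin n), uc (Tq b b' a a') a a' G *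
      (1 / ((Tq b b' a a' G).card : ℝ)) =
      (((Tq b b' a a' G ∩ nb G a).card : ℝ) / (Tq b b' a a' G).card -
      ((Tq b b' a a' G ∩ nb G a').card : ℝ) / (Tq b b' a a' G).card) -
      zc (Tq b b' a a') a a' G * (Pc a a' G - Pc a' a G) / Dc a a' G / (Tq b b' a a' G).card := by
    intro G
    have f1 := pc_add_common (b := a) (b' := a') (T := Tq b b' a a' G) (by simp [Tq]) G
    have f2 := pc_add_common (b := a') (b' := a) (T := Tq b b' a a' G) (by simp [Tq]) G
    rw [inter_right_comm] at f2
    have g1 : pc (fun _ => Tq b b' a a' G) a a' G = pc (Tq b b' a a') a a' G := rfl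
    have g2 : pc (fun _ => Tq b b' a a' G) a' a G = pc (Tq b b' a a') a' a G := rfl
    rw [g1] at f1
    rw [g2] at f2
    rw [uc, f1, f2]
    ring
  simp only [e1] at key
  rw [Ex_sub] at key
  rw [sub_eq_zero.1 key]
  calc _ ≤ _ := abs_Ex_le
    _ ≤ Ex d (fun G => 2 * s * (32 / (ρ * r) ^ 2 * zc (Tq b b' a a') a a' G + Bd ρ r a a' G +
          Bd ρ r b b' G)) := by
        refine Ex_mono fun G hG => ?_
        rw [abs_div, Nat.abs_cast]
        calc _ ≤ 2 * s * (zc (Tq b b' a a') a a' G / Dc a a' G) / (Tq b b' a a' G).card :=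
              div_le_div_of_nonneg_right (h.abs_corr _ haa hG) (Nat.cast_nonneg _)
          _ = 2 * s * (zc (Tq b b' a a') a a' G / Dc a a' G / (Tq b b' a a' G).card) := by ring
          _ ≤ _ := mul_le_mul_of_nonneg_left h.zc_Tq_div_le (by linarith)
    _ = 2 * s * (32 / (ρ * r) ^ 2 * Ex d (zc (Tq b b' a a') a a') + Ex d (Bd ρ r a a') +
          Ex d (Bd ρ r b b')) := by rw [Ex_mul, Ex_add, Ex_add, Ex_mul]
    _ ≤ 2 * s * (32 / (ρ * r) ^ 2 * (96 / ρ * r ^ 2 / n) + 242688 / ρ ^ 5 / (1 * n) +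
          242688 / ρ ^ 5 / (1 * n)) := by
        have k1 := h.Ex_zc_Tq h1 h2 h3 h4
        have hr1 := h.one_le_r
        have k4 : 242688 / ρ ^ 5 / (r * n) ≤ 242688 / ρ ^ 5 / (1 * n) := by gcongr
        have k2 := (h.Ex_Bd haa).trans k4
        have k3 := (h.Ex_Bd hbb).trans k4
        gcongr
    _ = _ := by field_simp; ring

lemma exists_Ex_fc_sub (ρ : ℝ) (hρ : 0 < ρ) : ∃ C : ℝ, 0 < C ∧ ∀ {n : ℕ} {r s : ℝ}
    {d : Fin n → ℕ}, Bx ρ r s d → ∀ {a a' b b' : Fin n}, a ≠ b → a ≠ b' → a' ≠ b → a' ≠ b' →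
    a ≠ a' → b ≠ b' → |Ex d (fc b b' a) - Ex d (fc b b' a')| ≤ C * s / n := by
  obtain ⟨C1, hC1, H1⟩ := exists_Ex_Tq_sub ρ hρ
  obtain ⟨C2, hC2, H2⟩ := exists_Ex_single ρ hρ
  refine ⟨C1 + 4 * C2, by positivity, ?_⟩
  intro n r s d h a a' b b' h1 h2 h3 h4 haa hbb
  have hs := h.hs
  have hn := h.n_pos
  have k1 := H1 h h1 h2 h3 h4 haa hbb
  have k2 := H2 h h1 h2 hbb
  have k3 := H2 h h3 h4 hbb
  have key : ∀ c c' : Fin n, c ≠ c' → Ex d (fun G => zc (fun _ => {c}) b b' G / Dc b b' G) ≤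
      C2 / n → Ex d (fun G => zc (fun _ => {c'}) b b' G / Dc b b' G) ≤ C2 / n →
      |Ex d (fc b b' c) - Ex d (fun G => ((Tq b b' c c' G ∩ nb G c).card : ℝ) /
        (Tq b b' c c' G).card)| ≤ 2 * C2 / n := by
    intro c c' hcc j1 j2
    rw [← Ex_sub]
    calc _ ≤ _ := abs_Ex_le
      _ ≤ Ex d (fun G => zc (fun _ => {c}) b b' G / Dc b b' G +
          zc (fun _ => {c'}) b b' G / Dc b b' G) := Ex_mono fun G _ => fc_sub_le hcc G
      _ ≤ C2 / n + C2 / n := by rw [Ex_add]; exact add_le_add j1 j2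
      _ = _ := by ring
  have e1 := key a a' haa k2 k3
  have e2 := key a' a haa.symm k3 k2
  have e3 : Tq b b' a' a = Tq b b' a a' := by ext G; simp [Tq, pair_comm]
  rw [e3] at e2
  rw [Ex_sub] at k1
  have e4 : 4 * C2 / n ≤ 4 * C2 * s / n := by
    exact div_le_div_of_nonneg_right (le_mul_of_one_le_right (by positivity) hs) hn.le
  have e5 : (C1 + 4 * C2) * s / n = C1 * s / n + 4 * C2 * s / n := by ring
  have e6 : 4 * C2 / (n:ℝ) = 2 * C2 / n + 2 * C2 / n := by ring
  have m1 := abs_le.1 e1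
  have m2 := abs_le.1 e2
  have m3 := abs_le.1 k1
  rw [abs_le, e5]
  constructor
  · linarith [m1.1, m2.2, m3.1]
  · linarith [m1.2, m2.1, m3.2]

/-- The exchangeable part of `b, b'` meets closed neighbourhoods in the expected proportion. -/
lemma exists_Ex_fc (ρ : ℝ) (hρ : 0 < ρ) : ∃ C : ℝ, 0 < C ∧ ∀ {n : ℕ} {r s : ℝ}
    {d : Fin n → ℕ}, Bx ρ r s d → ∀ {a b b' : Fin n}, a ≠ b → a ≠ b' → b ≠ b' →
    |Ex d (fun G => zc (Td a b b') b b' G / Dc b b' G) - d a / n| ≤ C * s / n := by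
  obtain ⟨C, hC, H⟩ := exists_Ex_fc_sub ρ hρ
  refine ⟨C + 5 + 242688 / ρ ^ 5, by positivity, ?_⟩
  intro n r s d h a b b' h1 h2 hbb
  have hs := h.hs
  have hn := h.n_pos
  have hr := h.r_pos
  simp only [← fc_eq]
  have b1 : ∀ c c' : Fin n, |Ex d (fc b b' c) - Ex d (fc b b' c')| ≤ 1 := by
    intro c c'
    have i1 := Ex_le_const h.ne fun G _ => fc_le_one b b' c G
    have i2 := Ex_le_const h.ne fun G _ => fc_le_one b b' c' G
    have i3 := Ex_nonneg (d := d) fun G _ => fc_nonneg b b' c G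
    have i4 := Ex_nonneg (d := d) fun G _ => fc_nonneg b b' c' G
    rw [abs_le]; constructor <;> linarith
  have k0 : 0 ≤ C * s / n := by positivity
  have k1 : ∀ c, |Ex d (fc b b' a) - Ex d (fc b b' c)| ≤
      C * s / n + ((if c = b then 1 else 0) + if c = b' then 1 else 0) := by
    intro c
    have := b1 a c
    by_cases hcb : c = b
    · rw [if_pos hcb]; split_ifs <;> linarith
    by_cases hcb' : c = b'
    · rw [if_pos hcb']; split_ifs <;> linarith
    rw [if_neg hcb, if_neg hcb']
    by_cases hca : c = a
    · rw [hca, sub_self, abs_zero]; linarith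
    · have := H h h1 h2 hcb hcb' (Ne.symm hca) hbb
      linarith
  have k2 : |n * Ex d (fc b b' a) - ∑ c, Ex d (fc b b' c)| ≤ C * s + 2 := by
    have e : n * Ex d (fc b b' a) - ∑ c, Ex d (fc b b' c) =
        ∑ c, (Ex d (fc b b' a) - Ex d (fc b b' c)) := by
      rw [sum_sub_distrib]; simp
    rw [e]
    refine (abs_sum_le_sum_abs _ _).trans ((sum_le_sum fun c _ => k1 c).trans_eq ?_)
    rw [sum_add_distrib, sum_add_distrib]
    simp
    field_simp
    norm_num
  have k3 : |∑ c, Ex d (fc b b' c) - r| ≤ 2 * s + 242688 / ρ ^ 5 := by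
    have e : ∑ c, Ex d (fc b b' c) - r = Ex d (fun G => ∑ c, fc b b' c G - r) := by
      rw [Ex_sub, Ex_const h.ne, Ex_sum]
    rw [e]
    calc _ ≤ _ := abs_Ex_le
      _ ≤ Ex d (fun G => 2 * s + r * Bd ρ r b b' G) := Ex_mono fun G hG => sum_fc h hG
      _ = 2 * s + r * Ex d (Bd ρ r b b') := by rw [Ex_add, Ex_const h.ne, Ex_mul]
      _ ≤ 2 * s + r * (242688 / ρ ^ 5 / (r * n)) := by
        have := h.Ex_Bd hbb
        gcongr
      _ = 2 * s + 242688 / ρ ^ 5 / n := by field_simp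
      _ ≤ _ := by
        have : (1:ℝ) ≤ n := h.one_le_r.trans h.r_le_n
        have := div_le_self (by positivity : 0 ≤ 242688 / ρ ^ 5) this
        linarith
  have k4 : |n * Ex d (fc b b' a) - d a| ≤ (C + 5 + 242688 / ρ ^ 5) * s := by
    have h5 := h.lo a
    have h6 := h.hi a
    have : 242688 / ρ ^ 5 ≤ 242688 / ρ ^ 5 * s := le_mul_of_one_le_right (by positivity) hs
    rw [abs_le] at *
    constructor <;> nlinarith [k2.1, k2.2, k3.1, k3.2]
  have e : Ex d (fc b b' a) - d a / n = (n * Ex d (fc b b' a) - d a) / n := by field_simp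
  rw [e, abs_div, abs_of_pos hn]
  gcongr
end SHF

namespace SHF
open Finset
open scoped Classical
variable {n : ℕ}

/-- The codegree-like statistic of `a, b`, centred. -/
noncomputable def Yc (d : Fin n → ℕ) (a b : Fin n) (G : SimpleGraph (Fin n)) : ℝ :=
  Xc a b G - d a * d b / n

lemma pred_mul_Yc (d : Fin n → ℕ) {a b : Fin n} (hab : a ≠ b) (G : SimpleGraph (Fin n)) :
    ((n:ℝ) - 1) * Yc d a b G = ∑ c ∈ univ.erase a, Yc d a c G +
      ∑ c ∈ (univ.erase a).erase b, (Yc d a b G - Yc d a c G) := by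
  rw [sum_sub_distrib, sum_const, nsmul_eq_mul, card_erase_erase hab,
    ← add_sum_erase (univ.erase a) _ (by simp [hab.symm] : b ∈ univ.erase a)]
  ring

/-- Average of a degree sequence. -/
noncomputable def avg (d : Fin n → ℕ) : ℝ := (∑ v, (d v : ℝ)) / n

lemma sum_Yc {d : Fin n → ℕ} (a : Fin n) {G : SimpleGraph (Fin n)} (hG : G ∈ Om d) :
    ∑ c ∈ univ.erase a, Yc d a c G =
      ∑ v, ((d v : ℝ) - avg d) * Ad a v G + (d a : ℝ) ^ 2 / n := by
  unfold Yc
  rw [sum_sub_distrib, sum_Xc]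
  have h1 : ∑ v ∈ nb G a, (dg G v : ℝ) = ∑ v, (d v : ℝ) * Ad a v G := by
    simp only [Ad, mul_ite, mul_one, mul_zero]
    rw [← sum_filter]
    refine sum_congr (by ext x; simp [mem_nb]) fun v _ => by rw [mem_Om.1 hG]
  have h2 : ∑ v, ((d v : ℝ) - avg d) * Ad a v G = ∑ v, (d v : ℝ) * Ad a v G - avg d * d a := by
    simp only [sub_mul]
    rw [sum_sub_distrib, ← mul_sum, sum_Ad, mem_Om.1 hG]
  have h3 := add_sum_erase univ (fun c => (d a : ℝ) * d c / n) (mem_univ a)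
  have h4 : ∑ c, (d a : ℝ) * d c / n = avg d * d a := by
    rw [← sum_div, ← mul_sum, avg]; ring
  rw [h1, h2]
  rw [h4] at h3
  linear_combination -h3

namespace Bx
variable {ρ r s : ℝ} {d : Fin n → ℕ}

lemma Yc_sub (h : Bx ρ r s d) {a b c : Fin n} (hab : a ≠ b) (hac : a ≠ c) (hbc : b ≠ c) {G : SimpleGraph (Fin n)}
    (hG : G ∈ Om d) : Yc d a b G - Yc d a c G = uc (Td a b c) b c G +
      ((d b : ℝ) - d c) * (zc (Td a b c) b c G / Dc b c G - d a / n) -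
      Ad b c G * (Ad a b G - Ad a c G) := by
  have h1 := pc_Td_sub hab hac G
  have h2 := Pc_sub hbc hG
  unfold Yc
  rw [uc, h2]
  linear_combination -h1

lemma abs_sub_avg (h : Bx ρ r s d) (v : Fin n) : |(d v : ℝ) - avg d| ≤ 2 * s := by
  have hn := h.n_pos
  have h1 : avg d ≤ r + s := by
    rw [avg, div_le_iff₀ hn]
    refine (sum_le_sum fun v _ => h.hi v).trans_eq ?_
    simp; ring
  have h2 : r - s ≤ avg d := by
    rw [avg, le_div_iff₀ hn]
    refine Eq.trans_le ?_ (sum_le_sum fun v _ => h.lo v)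
    simp; ring
  have := h.lo v; have := h.hi v
  rw [abs_le]; constructor <;> linarith

lemma sq_div_le (h : Bx ρ r s d) (a : Fin n) : (d a : ℝ) ^ 2 / n ≤ 4 * r := by
  have := h.deg_le a
  have hr := h.r_pos
  have := h.r_le_n
  rw [div_le_iff₀ h.n_pos]
  nlinarith [Nat.cast_nonneg (α := ℝ) (d a)]

lemma abs_sum_Yc (h : Bx ρ r s d) (a : Fin n) {G : SimpleGraph (Fin n)} (hG : G ∈ Om d) :
    |∑ c ∈ univ.erase a, Yc d a c G| ≤ 8 * s * r := by
  have hs := h.hs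
  have hr := h.r_pos
  rw [sum_Yc a hG]
  have h1 : |∑ v, ((d v : ℝ) - avg d) * Ad a v G| ≤ 2 * s * d a := by
    refine (abs_sum_le_sum_abs _ _).trans ?_
    rw [← mem_Om.1 hG a, ← sum_Ad, mul_sum]
    refine sum_le_sum fun v _ => ?_
    rw [abs_mul, abs_of_nonneg (Ad_nonneg _ _ _)]
    exact mul_le_mul_of_nonneg_right (h.abs_sub_avg v) (Ad_nonneg _ _ _)
  have h2 := h.sq_div_le a
  have h3 : (0:ℝ) ≤ (d a : ℝ) ^ 2 / n := by positivity
  have h4 := h.deg_le a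
  calc _ ≤ _ := abs_add_le _ _
    _ ≤ 2 * s * d a + 4 * r := by rw [abs_of_nonneg h3]; linarith
    _ ≤ _ := by nlinarith

end Bx

lemma exists_Ex_sum_Yc (ρ : ℝ) (hρ : 0 < ρ) : ∃ C : ℝ, 0 < C ∧ ∀ {n : ℕ} {r s : ℝ}
    {d : Fin n → ℕ}, Bx ρ r s d → ∀ {a b : Fin n}, a ≠ b →
    |Ex d (fun G => ∑ c ∈ univ.erase a, Yc d a c G)| ≤ C * r := by
  obtain ⟨C, hC, H⟩ := exists_Ex_Ad_sub ρ hρ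
  refine ⟨2 * C + 6, by positivity, ?_⟩
  intro n r s d h a b hab
  have hs := h.hs
  have hr := h.r_pos
  have hn := h.n_pos
  have hsr := h.hsr
  have hsr' := h.s_le_r
  rw [Ex_congr fun G hG => sum_Yc a hG, Ex_add, Ex_const h.ne, Ex_sum]
  simp only [Ex_mul]
  have hb : 0 ≤ Ex d (Ad a b) := Ex_nonneg fun G _ => Ad_nonneg _ _ _
  have hb1 : Ex d (Ad a b) ≤ 1 := Ex_le_const h.ne fun G _ => Ad_le_one _ _ _
  have h0 : ∑ v, ((d v : ℝ) - avg d) = 0 := by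
    rw [sum_sub_distrib, avg]; simp; field_simp; ring
  have e : ∑ v, ((d v : ℝ) - avg d) * Ex d (Ad a v) =
      ∑ v, ((d v : ℝ) - avg d) * (Ex d (Ad a v) - Ex d (Ad a b)) := by
    simp only [mul_sub]
    rw [sum_sub_distrib, ← sum_mul, h0]; ring
  have h1 : ∀ v, |((d v : ℝ) - avg d) * (Ex d (Ad a v) - Ex d (Ad a b))| ≤
      2 * s * (C * s / n + if v = a then 1 else 0) := by
    intro v
    rw [abs_mul]
    refine mul_le_mul (h.abs_sub_avg v) ?_ (abs_nonneg _) (by linarith)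
    have hp : 0 ≤ C * s / n := by positivity
    by_cases hva : v = a
    · rw [if_pos hva, hva]
      have : Ex d (Ad a a) = 0 := by
        rw [← Ex_const h.ne 0]; exact Ex_congr fun G _ => by simp [Ad]
      rw [this, zero_sub, abs_neg, abs_of_nonneg hb]
      linarith
    · rw [if_neg hva, add_zero]
      by_cases hvb : v = b
      · rw [hvb, sub_self, abs_zero]; exact hp
      · exact H h (Ne.symm hva) hab hvb
  have h2 : |∑ v, ((d v : ℝ) - avg d) * Ex d (Ad a v)| ≤ 2 * s * (C * s + 1) := by
    rw [e]
    refine (abs_sum_le_sum_abs _ _).trans ((sum_le_sum fun v _ => h1 v).trans_eq ?_)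
    rw [← mul_sum, sum_add_distrib]
    simp
    field_simp
    simp
  have h3 := h.sq_div_le a
  have h4 : (0:ℝ) ≤ (d a : ℝ) ^ 2 / n := by positivity
  calc _ ≤ _ := abs_add_le _ _
    _ ≤ 2 * s * (C * s + 1) + 4 * r := by rw [abs_of_nonneg h4]; linarith
    _ ≤ _ := by nlinarith

lemma exists_Ex_Yc (ρ : ℝ) (hρ : 0 < ρ) : ∃ C : ℝ, 0 < C ∧ ∀ {n : ℕ} {r s : ℝ}
    {d : Fin n → ℕ}, Bx ρ r s d → ∀ {a b : Fin n}, a ≠ b → |Ex d (Yc d a b)| ≤ C * r / n := by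
  obtain ⟨C1, hC1, H1⟩ := exists_Ex_sum_Yc ρ hρ
  obtain ⟨C2, hC2, H2⟩ := exists_Ex_fc ρ hρ
  refine ⟨2 * (C1 + 2 * C2 + 2), by positivity, ?_⟩
  intro n r s d h a b hab
  have hs := h.hs
  have hr := h.r_pos
  have hn := h.n_pos
  have hsr := h.hsr
  have hn2 : (2:ℝ) ≤ n := by
    have := h.hn; have := h.hρ1; nlinarith
  have k1 := H1 h hab
  have k2 : ∀ c ∈ (univ.erase a).erase b, |Ex d (fun G => Yc d a b G - Yc d a c G)| ≤
      2 * s * (C2 * s / n) + Ex d (Ad b c) := by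
    intro c hc
    have hac : a ≠ c := by rintro rfl; simp at hc
    have hbc : b ≠ c := by rintro rfl; simp at hc
    have e : Ex d (fun G => Yc d a b G - Yc d a c G) =
        ((d b : ℝ) - d c) * (Ex d (fun G => zc (Td a b c) b c G / Dc b c G) - d a / n) -
          Ex d (fun G => Ad b c G * (Ad a b G - Ad a c G)) := by
      rw [Ex_congr fun G hG => h.Yc_sub hab hac hbc hG, Ex_sub, Ex_add, Ex_mul, Ex_sub,
        Ex_const h.ne]
      have := Ex_uc (d := d) (Inva.Td hab hac) (J := fun _ => 1) fun _ _ _ _ _ => rfl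
      simp only [mul_one] at this
      have h3 : Ex d (fun G => uc (Td a b c) b c G) = 0 := this
      rw [h3, zero_add]
    rw [e]
    refine (abs_sub _ _).trans (add_le_add ?_ ?_)
    · rw [abs_mul]
      exact mul_le_mul (h.abs_deg_sub b c) (H2 h hab hac hbc) (abs_nonneg _) (by linarith)
    · refine abs_Ex_le.trans (Ex_mono fun G _ => ?_)
      rw [abs_mul, abs_of_nonneg (Ad_nonneg _ _ _)]
      refine mul_le_of_le_one_right (Ad_nonneg _ _ _) ?_
      have := Ad_nonneg a b G; have := Ad_nonneg a c G
      have := Ad_le_one a b G; have := Ad_le_one a c G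
      rw [abs_le]; constructor <;> linarith
  have k3 : |∑ c ∈ (univ.erase a).erase b, Ex d (fun G => Yc d a b G - Yc d a c G)| ≤
      2 * C2 * r + 2 * r := by
    calc _ ≤ _ := abs_sum_le_sum_abs _ _
      _ ≤ ∑ c ∈ (univ.erase a).erase b, (2 * s * (C2 * s / n) + Ex d (Ad b c)) := sum_le_sum k2
      _ ≤ ∑ c, (2 * s * (C2 * s / n) + Ex d (Ad b c)) := by
          refine sum_le_sum_of_subset_of_nonneg (subset_univ _) fun c _ _ => ?_
          have : 0 ≤ Ex d (Ad b c) := Ex_nonneg fun G _ => Ad_nonneg _ _ _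
          positivity
      _ = 2 * C2 * (s * s) + d b := by
          rw [sum_add_distrib, ← Ex_sum, Ex_congr (g := fun _ => (d b : ℝ))
            (fun G hG => by rw [sum_Ad, mem_Om.1 hG]), Ex_const h.ne]
          simp
          field_simp
      _ ≤ _ := by have := h.deg_le b; nlinarith
  have e : ((n:ℝ) - 1) * Ex d (Yc d a b) = Ex d (fun G => ∑ c ∈ univ.erase a, Yc d a c G) +
      ∑ c ∈ (univ.erase a).erase b, Ex d (fun G => Yc d a b G - Yc d a c G) := by
    rw [← Ex_sum, ← Ex_add, ← Ex_mul]
    exact Ex_congr fun G _ => pred_mul_Yc d hab G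
  have k4 : ((n:ℝ) - 1) * |Ex d (Yc d a b)| ≤ (C1 + 2 * C2 + 2) * r := by
    have h1 : (0:ℝ) ≤ n - 1 := by linarith
    rw [← abs_of_nonneg h1, ← abs_mul, e]
    refine (abs_add_le _ _).trans ?_
    linarith
  rw [le_div_iff₀ hn]
  nlinarith [abs_nonneg (Ex d (Yc d a b))]

namespace Bx
variable {ρ r s : ℝ} {d : Fin n → ℕ}

lemma deg_le_n (h : Bx ρ r s d) (a : Fin n) : (d a : ℝ) ≤ n := by
  obtain ⟨G, hG⟩ := h.ne
  rw [← mem_Om.1 hG a]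
  have : dg G a ≤ n := (card_le_univ _).trans_eq (by simp)
  exact_mod_cast this

/-- Decomposition of the centred statistic used for its moments. -/
lemma Yc_decomp (h : Bx ρ r s d) {a b : Fin n} (hab : a ≠ b) {G : SimpleGraph (Fin n)} (hG : G ∈ Om d) :
    ∃ S : ℝ, |S| ≤ 10 * s * r ∧ ((n:ℝ) - 1) * Yc d a b G = S +
      ∑ c ∈ (univ.erase a).erase b, uc (Td a b c) b c G +
      ∑ c ∈ (univ.erase a).erase b,
        ((d b : ℝ) - d c) * (zc (Td a b c) b c G / Dc b c G - d a / n) := by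
  have hs := h.hs
  have hr := h.r_pos
  refine ⟨∑ c ∈ univ.erase a, Yc d a c G -
    ∑ c ∈ (univ.erase a).erase b, Ad b c G * (Ad a b G - Ad a c G), ?_, ?_⟩
  · have h1 : |∑ c ∈ (univ.erase a).erase b, Ad b c G * (Ad a b G - Ad a c G)| ≤ d b := by
      calc _ ≤ _ := abs_sum_le_sum_abs _ _
        _ ≤ ∑ c ∈ (univ.erase a).erase b, Ad b c G := by
            refine sum_le_sum fun c _ => ?_
            rw [abs_mul, abs_of_nonneg (Ad_nonneg _ _ _)]
            refine mul_le_of_le_one_right (Ad_nonneg _ _ _) ?_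
            have := Ad_nonneg a b G; have := Ad_nonneg a c G
            have := Ad_le_one a b G; have := Ad_le_one a c G
            rw [abs_le]; constructor <;> linarith
        _ ≤ ∑ c, Ad b c G := sum_le_sum_of_subset_of_nonneg (subset_univ _)
            fun c _ _ => Ad_nonneg _ _ _
        _ = d b := by rw [sum_Ad, mem_Om.1 hG]
    have h2 := h.abs_sum_Yc a hG
    have h3 := h.deg_le b
    refine (abs_sub _ _).trans ?_
    nlinarith
  · rw [pred_mul_Yc d hab, sub_add_eq_add_sub, sub_add_eq_add_sub, add_assoc, add_sub_assoc,
      ← sum_add_distrib, ← sum_sub_distrib]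
    congr 1
    refine sum_congr rfl fun c hc => ?_
    have hac : a ≠ c := by rintro rfl; simp at hc
    have hbc : b ≠ c := by rintro rfl; simp at hc
    exact h.Yc_sub hab hac hbc hG

lemma abs_ratio_sub_le (h : Bx ρ r s d) (a : Fin n) (T : SimpleGraph (Fin n) → Finset (Fin n)) (b c : Fin n)
    (G : SimpleGraph (Fin n)) {x : ℝ} (hx : x = zc T b c G / Dc b c G - d a / n) :
    |x| ≤ 1 ∧ |x| ≤ zc T b c G / Dc b c G + d a / n := by
  have h1 := zc_div_nonneg T b c G
  have h2 := zc_div_le_one T b c G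
  have h3 : (d a : ℝ) / n ≤ 1 := (div_le_one h.n_pos).2 (h.deg_le_n a)
  have h4 : (0:ℝ) ≤ (d a : ℝ) / n := by positivity
  subst hx
  constructor <;> rw [abs_le] <;> constructor <;> linarith

end Bx

lemma exists_Ex_Yc_sq (ρ : ℝ) (hρ : 0 < ρ) : ∃ C : ℝ, 0 < C ∧ ∀ {n : ℕ} {r s : ℝ}
    {d : Fin n → ℕ}, Bx ρ r s d → ∀ {a b : Fin n}, a ≠ b →
    Ex d (fun G => Yc d a b G ^ 2) ≤ C * r ^ 2 / n := by
  obtain ⟨C, hC, H⟩ := exists_Ex_zc_Td_div ρ hρ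
  refine ⟨4 * (3 * (100 + 192 / ρ + 4 * (C + 2))), by positivity, ?_⟩
  intro n r s d h a b hab
  have hs := h.hs
  have hr := h.r_pos
  have hn := h.n_pos
  have hsr := h.hsr
  have hrn := h.r_le_n
  have hn2 : (2:ℝ) ≤ n := by
    have := h.hn; have := h.hρ1; nlinarith
  have hcard : (((univ.erase a).erase b).card : ℝ) ≤ n := by
    rw [card_erase_erase hab]; linarith
  have key : ∀ G ∈ Om d, (((n:ℝ) - 1) * Yc d a b G) ^ 2 ≤ 3 * ((10 * s * r) ^ 2 +
      n * ∑ c ∈ (univ.erase a).erase b, uc (Td a b c) b c G ^ 2 +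
      n * ∑ c ∈ (univ.erase a).erase b, (2 * s) ^ 2 *
        (zc (Td a b c) b c G / Dc b c G + d a / n)) := by
    intro G hG
    obtain ⟨S, hS, e⟩ := h.Yc_decomp hab hG
    rw [e]
    have h1 := sq_sum_le_card_mul_sum_sq (s := (univ.erase a).erase b)
      (f := fun c => uc (Td a b c) b c G)
    have h2 := sq_sum_le_card_mul_sum_sq (s := (univ.erase a).erase b)
      (f := fun c => ((d b : ℝ) - d c) * (zc (Td a b c) b c G / Dc b c G - d a / n))
    have h3 : S ^ 2 ≤ (10 * s * r) ^ 2 := sq_le_sq' (abs_le.1 hS).1 (abs_le.1 hS).2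
    have h4 : ∑ c ∈ (univ.erase a).erase b,
        (((d b : ℝ) - d c) * (zc (Td a b c) b c G / Dc b c G - d a / n)) ^ 2 ≤
        ∑ c ∈ (univ.erase a).erase b, (2 * s) ^ 2 *
          (zc (Td a b c) b c G / Dc b c G + d a / n) := by
      refine sum_le_sum fun c _ => ?_
      obtain ⟨i1, i2⟩ := h.abs_ratio_sub_le a (Td a b c) b c G rfl
      rw [mul_pow, ← sq_abs, ← sq_abs (_ / _ - _)]
      refine mul_le_mul (pow_le_pow_left₀ (abs_nonneg _) (h.abs_deg_sub b c) 2) ?_ (by positivity)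
        (by positivity)
      refine le_trans ?_ i2
      exact pow_le_of_le_one (abs_nonneg _) i1 two_ne_zero
    have h5 : 0 ≤ ∑ c ∈ (univ.erase a).erase b, uc (Td a b c) b c G ^ 2 :=
      sum_nonneg fun c _ => by positivity
    have h6 := h4.trans' (sum_nonneg fun c _ => by positivity)
    have h7 := h1.trans (mul_le_mul_of_nonneg_right hcard h5)
    have h8 := h2.trans (mul_le_mul hcard h4 (sum_nonneg fun c _ => by positivity) hn.le)
    generalize ∑ c ∈ (univ.erase a).erase b, uc (Td a b c) b c G = U at *
    generalize ∑ c ∈ (univ.erase a).erase b,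
      ((d b : ℝ) - d c) * (zc (Td a b c) b c G / Dc b c G - d a / n) = V at *
    nlinarith [sq_nonneg (S - U), sq_nonneg (S - V), sq_nonneg (U - V)]
  have k1 : ∀ c ∈ (univ.erase a).erase b,
      Ex d (fun G => uc (Td a b c) b c G ^ 2) ≤ 192 / ρ * r ^ 2 / n := by
    intro c hc
    have hac : a ≠ c := by rintro rfl; simp at hc
    exact h.Ex_u_sq hab hac
  have k2 : ∀ c ∈ (univ.erase a).erase b,
      Ex d (fun G => (2 * s) ^ 2 * (zc (Td a b c) b c G / Dc b c G + d a / n)) ≤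
        4 * (C + 2) * r ^ 2 / n := by
    intro c hc
    have hac : a ≠ c := by rintro rfl; simp at hc
    have hbc : b ≠ c := by rintro rfl; simp at hc
    have h1 := H h hab hac hbc
    have h2 : (d a : ℝ) / n ≤ 2 * r / n := div_le_div_of_nonneg_right (h.deg_le a) hn.le
    rw [Ex_mul, Ex_add, Ex_const h.ne]
    calc _ ≤ 4 * r * (C * r / n + 2 * r / n) := by
          refine mul_le_mul (by nlinarith) (add_le_add h1 h2) ?_ (by positivity)
          exact add_nonneg (Ex_nonneg fun G _ => zc_div_nonneg _ _ _ _) (by positivity)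
      _ = _ := by ring
  have k3 : ((n:ℝ) - 1) ^ 2 * Ex d (fun G => Yc d a b G ^ 2) ≤ 3 * ((10 * s * r) ^ 2 +
      n * (n * (192 / ρ * r ^ 2 / n)) + n * (n * (4 * (C + 2) * r ^ 2 / n))) := by
    rw [← Ex_mul]
    refine (Ex_mono fun G hG => (mul_pow _ _ _).symm.trans_le (key G hG)).trans ?_
    rw [Ex_mul, Ex_add, Ex_add, Ex_const h.ne, Ex_mul, Ex_mul, Ex_sum, Ex_sum]
    have j1 := (sum_le_card_nsmul _ _ _ k1)
    have j2 := (sum_le_card_nsmul _ _ _ k2)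
    rw [nsmul_eq_mul] at j1 j2
    have j3 := j1.trans (mul_le_mul_of_nonneg_right hcard (by positivity))
    have j4 := j2.trans (mul_le_mul_of_nonneg_right hcard (by positivity))
    have j5 := mul_le_mul_of_nonneg_left j3 hn.le
    have j6 := mul_le_mul_of_nonneg_left j4 hn.le
    linarith
  have k4 : 3 * ((10 * s * r) ^ 2 + n * (n * (192 / ρ * r ^ 2 / n)) +
      n * (n * (4 * (C + 2) * r ^ 2 / n))) ≤ 3 * (100 + 192 / ρ + 4 * (C + 2)) * r ^ 2 * n := by
    have e : 3 * ((10 * s * r) ^ 2 + n * (n * (192 / ρ * r ^ 2 / n)) +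
      n * (n * (4 * (C + 2) * r ^ 2 / n))) = 3 * (100 * (s * s) * r ^ 2 + 192 / ρ * r ^ 2 * n +
        4 * (C + 2) * r ^ 2 * n) := by field_simp; ring
    rw [e]
    have : s * s * r ^ 2 ≤ n * r ^ 2 := mul_le_mul_of_nonneg_right (hsr.trans hrn) (by positivity)
    linarith
  have k5 : (n:ℝ) ^ 2 / 4 ≤ (n - 1) ^ 2 := by nlinarith
  have k6 : 0 ≤ Ex d (fun G => Yc d a b G ^ 2) := Ex_nonneg fun G _ => by positivity
  have k7 := (mul_le_mul_of_nonneg_right k5 k6).trans (k3.trans k4)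
  rw [le_div_iff₀ hn]
  generalize Ex d (fun G => Yc d a b G ^ 2) = E at *
  refine le_of_mul_le_mul_right ?_ hn
  linarith

lemma exists_Ex_Yc_four (ρ : ℝ) (hρ : 0 < ρ) : ∃ C : ℝ, 0 < C ∧ ∀ {n : ℕ} {r s : ℝ}
    {d : Fin n → ℕ}, Bx ρ r s d → ∀ {a b : Fin n}, a ≠ b →
    Ex d (fun G => Yc d a b G ^ 4) ≤ C * r ^ 3 / n := by
  obtain ⟨C, hC, H⟩ := exists_Ex_zc_Td_div ρ hρ
  refine ⟨16 * (27 * (10000 + 15168 / ρ + 16 * (C + 2))), by positivity, ?_⟩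
  intro n r s d h a b hab
  have hs := h.hs
  have hr := h.r_pos
  have hn := h.n_pos
  have hsr := h.hsr
  have hrn := h.r_le_n
  have hn2 : (2:ℝ) ≤ n := by
    have := h.hn; have := h.hρ1; nlinarith
  have hcard : (((univ.erase a).erase b).card : ℝ) ≤ n := by
    rw [card_erase_erase hab]; linarith
  have hcard3 : (((univ.erase a).erase b).card : ℝ) ^ 3 ≤ (n:ℝ) ^ 3 :=
    pow_le_pow_left₀ (Nat.cast_nonneg _) hcard 3
  have key : ∀ G ∈ Om d, (((n:ℝ) - 1) * Yc d a b G) ^ 4 ≤ 27 * ((10 * s * r) ^ 4 +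
      (n:ℝ) ^ 3 * ∑ c ∈ (univ.erase a).erase b, uc (Td a b c) b c G ^ 4 +
      (n:ℝ) ^ 3 * ∑ c ∈ (univ.erase a).erase b, (2 * s) ^ 4 *
        (zc (Td a b c) b c G / Dc b c G + d a / n)) := by
    intro G hG
    obtain ⟨S, hS, e⟩ := h.Yc_decomp hab hG
    rw [e]
    have h1 := pow_four_sum_le ((univ.erase a).erase b) (fun c => uc (Td a b c) b c G)
    have h2 := pow_four_sum_le ((univ.erase a).erase b)
      (fun c => ((d b : ℝ) - d c) * (zc (Td a b c) b c G / Dc b c G - d a / n))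
    have h3 : S ^ 4 ≤ (10 * s * r) ^ 4 := by
      rw [← Even.pow_abs (by decide : Even 4) S]
      exact pow_le_pow_left₀ (abs_nonneg _) hS 4
    have h4 : ∑ c ∈ (univ.erase a).erase b,
        (((d b : ℝ) - d c) * (zc (Td a b c) b c G / Dc b c G - d a / n)) ^ 4 ≤
        ∑ c ∈ (univ.erase a).erase b, (2 * s) ^ 4 *
          (zc (Td a b c) b c G / Dc b c G + d a / n) := by
      refine sum_le_sum fun c _ => ?_
      obtain ⟨i1, i2⟩ := h.abs_ratio_sub_le a (Td a b c) b c G rfl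
      rw [mul_pow, ← Even.pow_abs (by decide : Even 4), ← Even.pow_abs (by decide : Even 4) (_ / _ - _)]
      refine mul_le_mul (pow_le_pow_left₀ (abs_nonneg _) (h.abs_deg_sub b c) 4) ?_ (by positivity)
        (by positivity)
      refine le_trans ?_ i2
      exact pow_le_of_le_one (abs_nonneg _) i1 four_ne_zero
    have h5 : 0 ≤ ∑ c ∈ (univ.erase a).erase b, uc (Td a b c) b c G ^ 4 :=
      sum_nonneg fun c _ => by positivity
    have h7 := h1.trans (mul_le_mul_of_nonneg_right hcard3 h5)
    have h8 := h2.trans (mul_le_mul hcard3 h4 (sum_nonneg fun c _ => by positivity) (by positivity))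
    generalize ∑ c ∈ (univ.erase a).erase b, uc (Td a b c) b c G = U at *
    generalize ∑ c ∈ (univ.erase a).erase b,
      ((d b : ℝ) - d c) * (zc (Td a b c) b c G / Dc b c G - d a / n) = V at *
    have h9 := pow_four_sum_le (univ : Finset (Fin 3)) ![S, U, V]
    simp [Fin.sum_univ_three] at h9
    linarith
  have k1 : ∀ c ∈ (univ.erase a).erase b,
      Ex d (fun G => uc (Td a b c) b c G ^ 4) ≤ 15168 / ρ * r ^ 3 / n := by
    intro c hc
    have hac : a ≠ c := by rintro rfl; simp at hc
    exact h.Ex_u_four hab hac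
  have k2 : ∀ c ∈ (univ.erase a).erase b,
      Ex d (fun G => (2 * s) ^ 4 * (zc (Td a b c) b c G / Dc b c G + d a / n)) ≤
        16 * (C + 2) * r ^ 3 / n := by
    intro c hc
    have hac : a ≠ c := by rintro rfl; simp at hc
    have hbc : b ≠ c := by rintro rfl; simp at hc
    have h1 := H h hab hac hbc
    have h2 : (d a : ℝ) / n ≤ 2 * r / n := div_le_div_of_nonneg_right (h.deg_le a) hn.le
    have h3 : (2 * s) ^ 4 ≤ 16 * r ^ 2 := by
      have := pow_le_pow_left₀ (by positivity) hsr 2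
      linarith
    rw [Ex_mul, Ex_add, Ex_const h.ne]
    calc _ ≤ 16 * r ^ 2 * (C * r / n + 2 * r / n) := by
          refine mul_le_mul h3 (add_le_add h1 h2) ?_ (by positivity)
          exact add_nonneg (Ex_nonneg fun G _ => zc_div_nonneg _ _ _ _) (by positivity)
      _ = _ := by ring
  have k3 : ((n:ℝ) - 1) ^ 4 * Ex d (fun G => Yc d a b G ^ 4) ≤ 27 * ((10 * s * r) ^ 4 +
      (n:ℝ) ^ 3 * (n * (15168 / ρ * r ^ 3 / n)) +
      (n:ℝ) ^ 3 * (n * (16 * (C + 2) * r ^ 3 / n))) := by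
    rw [← Ex_mul]
    refine (Ex_mono fun G hG => (mul_pow _ _ _).symm.trans_le (key G hG)).trans ?_
    rw [Ex_mul, Ex_add, Ex_add, Ex_const h.ne, Ex_mul, Ex_mul, Ex_sum, Ex_sum]
    have j1 := (sum_le_card_nsmul _ _ _ k1)
    have j2 := (sum_le_card_nsmul _ _ _ k2)
    rw [nsmul_eq_mul] at j1 j2
    have j3 := j1.trans (mul_le_mul_of_nonneg_right hcard (by positivity))
    have j4 := j2.trans (mul_le_mul_of_nonneg_right hcard (by positivity))
    have hn3 : (0:ℝ) ≤ (n:ℝ) ^ 3 := by positivity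
    have j5 := mul_le_mul_of_nonneg_left j3 hn3
    have j6 := mul_le_mul_of_nonneg_left j4 hn3
    linarith
  have k4 : 27 * ((10 * s * r) ^ 4 + (n:ℝ) ^ 3 * (n * (15168 / ρ * r ^ 3 / n)) +
      (n:ℝ) ^ 3 * (n * (16 * (C + 2) * r ^ 3 / n))) ≤
      27 * (10000 + 15168 / ρ + 16 * (C + 2)) * r ^ 3 * (n:ℝ) ^ 3 := by
    have e : 27 * ((10 * s * r) ^ 4 + (n:ℝ) ^ 3 * (n * (15168 / ρ * r ^ 3 / n)) +
      (n:ℝ) ^ 3 * (n * (16 * (C + 2) * r ^ 3 / n))) = 27 * (10000 * ((s * s) * (s * s) * r) * r ^ 3 +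
        15168 / ρ * r ^ 3 * (n:ℝ) ^ 3 + 16 * (C + 2) * r ^ 3 * (n:ℝ) ^ 3) := by field_simp; ring
    rw [e]
    have h1 : s * s * (s * s) * r ≤ n * n * n := by gcongr <;> linarith
    have : s * s * (s * s) * r * r ^ 3 ≤ n * n * n * r ^ 3 :=
      mul_le_mul_of_nonneg_right h1 (by positivity)
    linarith
  have k5 : (n:ℝ) ^ 4 / 16 ≤ (n - 1) ^ 4 := by
    have : (n:ℝ) / 2 ≤ n - 1 := by linarith
    have := pow_le_pow_left₀ (by positivity) this 4
    linarith
  have k6 : 0 ≤ Ex d (fun G => Yc d a b G ^ 4) := Ex_nonneg fun G _ => by positivity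
  have k7 := (mul_le_mul_of_nonneg_right k5 k6).trans (k3.trans k4)
  rw [le_div_iff₀ hn]
  generalize Ex d (fun G => Yc d a b G ^ 4) = E at *
  have hn3 : (0:ℝ) < (n:ℝ) ^ 3 := by positivity
  refine le_of_mul_le_mul_right ?_ hn3
  linarith
end SHF

namespace SHF
open Finset
open scoped Classical
variable {n : ℕ}

/-- `d'` arises from `d` by moving one unit from `b` to `a`. -/
def Mv (a b : Fin n) (d d' : Fin n → ℕ) : Prop :=
  ∀ x, d' x + (if x = b then 1 else 0) = d x + (if x = a then 1 else 0)

lemma Mv.symm {a b : Fin n} {d d' : Fin n → ℕ} (h : Mv a b d d') : Mv b a d' d :=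
  fun x => (h x).symm

lemma Mv.at_a {a b : Fin n} {d d' : Fin n → ℕ} (h : Mv a b d d') (hab : a ≠ b) :
    d' a = d a + 1 := by have := h a; rw [if_neg hab, if_pos rfl] at this; omega

lemma Mv.at_b {a b : Fin n} {d d' : Fin n → ℕ} (h : Mv a b d d') (hab : a ≠ b) :
    d' b + 1 = d b := by have := h b; rw [if_neg hab.symm, if_pos rfl] at this; omega

lemma hg_mem_Om {a b v : Fin n} {d d' : Fin n → ℕ} (h : Mv a b d d') {G : SimpleGraph (Fin n)}
    (hG : G ∈ Om d) (h1 : G.Adj v b) (h2 : ¬ G.Adj v a) (h3 : v ≠ a) :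
    hg G v b a ∈ Om d' := by
  rw [mem_Om] at *
  intro x
  have := dg_hg h1 h2 h3 x
  have := h x
  have := hG x
  omega

lemma Xc_hg {a b v : Fin n} {G : SimpleGraph (Fin n)} (h1 : G.Adj v b)
    (h2 : ¬ G.Adj v a) (h3 : v ≠ a) : Xc a b (hg G v b a) = Xc a b G := by
  unfold Xc
  rw [nb_hg_rem h1 h2, nb_hg_add h2 h3]
  congr 2
  have h4 : v ∉ nb G a := by rw [mem_nb]; exact fun h => h2 h.symm
  ext x
  simp only [mem_inter, mem_insert, mem_erase]
  grind

lemma hinge_pairs {a b : Fin n} {d d' : Fin n → ℕ} (h : Mv a b d d')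
    (F : SimpleGraph (Fin n) → SimpleGraph (Fin n) → ℝ) :
    ∑ G ∈ Om d, ∑ v ∈ Lf G b a, F G (hg G v b a) =
      ∑ G ∈ Om d', ∑ v ∈ Lf G a b, F (hg G v a b) G := by
  rw [sum_sigma', sum_sigma']
  have key : ∀ {a b : Fin n} {d d' : Fin n → ℕ}, Mv a b d d' → ∀ {G : SimpleGraph (Fin n)}
      {v : Fin n}, G ∈ Om d → v ∈ Lf G b a → hg G v b a ∈ Om d' ∧ v ∈ Lf (hg G v b a) a b ∧
        hg (hg G v b a) v a b = G := by
    intro a b d d' h G v hG hv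
    rw [mem_Lf] at hv
    have h2 : ¬ G.Adj v a := fun hh => hv.2.2 hh.symm
    have h4 := hg_pre hv.2.1.symm h2 hv.1
    refine ⟨hg_mem_Om h hG hv.2.1.symm h2 hv.1, ?_, hg_hg hv.2.1.symm h2 hv.1⟩
    rw [mem_Lf]
    exact ⟨hv.2.1.ne', h4.1.symm, fun hh => h4.2 hh.symm⟩
  refine sum_nbij' (fun t => ⟨hg t.1 t.2 b a, t.2⟩) (fun t => ⟨hg t.1 t.2 a b, t.2⟩) ?_ ?_ ?_ ?_ ?_
  · rintro ⟨G, v⟩ ht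
    rw [mem_sigma] at *
    exact ⟨(key h ht.1 ht.2).1, (key h ht.1 ht.2).2.1⟩
  · rintro ⟨G, v⟩ ht
    rw [mem_sigma] at *
    exact ⟨(key h.symm ht.1 ht.2).1, (key h.symm ht.1 ht.2).2.1⟩
  · rintro ⟨G, v⟩ ht
    rw [mem_sigma] at ht
    simp only
    rw [(key h ht.1 ht.2).2.2]
  · rintro ⟨G, v⟩ ht
    rw [mem_sigma] at ht
    simp only
    rw [(key h.symm ht.1 ht.2).2.2]
  · rintro ⟨G, v⟩ ht
    rw [mem_sigma] at ht
    simp only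
    rw [(key h ht.1 ht.2).2.2]

lemma hinge_identity {a b : Fin n} {d d' : Fin n → ℕ} (h : Mv a b d d') (hab : a ≠ b)
    (H : ℝ → ℝ) :
    ∑ G ∈ Om d, ((d b : ℝ) - Xc a b G) * H (Xc a b G) =
      ∑ G ∈ Om d', ((d' a : ℝ) - Xc a b G) * H (Xc a b G) := by
  have e := hinge_pairs h fun G _ => H (Xc a b G)
  have e1 : ∀ G ∈ Om d, ∑ v ∈ Lf G b a, H (Xc a b G) =
      ((d b : ℝ) - Xc a b G) * H (Xc a b G) := by
    intro G hG
    rw [sum_const, nsmul_eq_mul, ← mem_Om.1 hG b, ← Pc_eq, Pc]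
  have e2 : ∀ G ∈ Om d', ∑ v ∈ Lf G a b, H (Xc a b (hg G v a b)) =
      ((d' a : ℝ) - Xc a b G) * H (Xc a b G) := by
    intro G hG
    rw [Xc_comm hab, ← mem_Om.1 hG a, ← Pc_eq, Pc, ← nsmul_eq_mul, ← sum_const]
    refine sum_congr rfl fun v hv => ?_
    rw [mem_Lf] at hv
    rw [Xc_comm hab, Xc_hg hv.2.1.symm (fun hh => hv.2.2 hh.symm) hv.1]
  rw [sum_congr rfl e1, sum_congr rfl e2] at e
  exact e

lemma sum_Om_eq (d : Fin n → ℕ) (hd : (Om d).Nonempty) (f : SimpleGraph (Fin n) → ℝ) :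
    ∑ G ∈ Om d, f G = (Om d).card * Ex d f := by
  have : ((Om d).card : ℝ) ≠ 0 := by simpa using hd.ne_empty
  rw [Ex]; field_simp

/-- Moments of the statistic of `a, b` recentred by a perturbation of size `O(r/n)`. -/
lemma exists_moments (ρ : ℝ) (hρ : 0 < ρ) : ∃ C : ℝ, 0 < C ∧ ∀ {n : ℕ} {r s : ℝ}
    {d : Fin n → ℕ}, Bx ρ r s d → ∀ {a b : Fin n}, a ≠ b → ∀ {e : ℝ}, 0 ≤ e → e ≤ 2 * r / n →
    ∀ {y : SimpleGraph (Fin n) → ℝ}, (∀ G, y G = Yc d a b G - e) → (∀ G ∈ Om d, |y G| ≤ 2 * r) →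
    |Ex d y| ≤ C * r / n ∧ |Ex d (fun G => y G ^ 2)| ≤ C * r ^ 2 / n ∧
      |Ex d (fun G => y G ^ 3)| ≤ C * r ^ 3 / n ∧ |Ex d (fun G => y G ^ 4)| ≤ C * r ^ 3 / n := by
  obtain ⟨C1, hC1, H1⟩ := exists_Ex_Yc ρ hρ
  obtain ⟨C2, hC2, H2⟩ := exists_Ex_Yc_sq ρ hρ
  obtain ⟨C4, hC4, H4⟩ := exists_Ex_Yc_four ρ hρ
  refine ⟨(C1 + 2) + 2 * (2 * (C2 + 4)) + 8 * (C4 + 16), by positivity, ?_⟩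
  intro n r s d h a b hab e he0 he y hy hyb
  have hr := h.r_pos
  have hn := h.n_pos
  have hr1 := h.one_le_r
  have hrn := h.r_le_n
  have hn1 : 1 ≤ (n:ℝ) := hr1.trans hrn
  have g1 := H1 h hab
  have g2 := H2 h hab
  have g4 := H4 h hab
  have he2 : e ^ 2 ≤ 4 * r ^ 2 / n := by
    calc e ^ 2 ≤ (2 * r / n) ^ 2 := pow_le_pow_left₀ he0 he 2
      _ = 4 * r ^ 2 / n / n := by field_simp; ring
      _ ≤ _ := div_le_self (by positivity) hn1
  have he4 : e ^ 4 ≤ 16 * r ^ 3 / n := by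
    calc e ^ 4 ≤ (2 * r / n) ^ 4 := pow_le_pow_left₀ he0 he 4
      _ = 16 * r ^ 3 / n * ((r / n) * (1 / n) * (1 / n)) := by field_simp; ring
      _ ≤ 16 * r ^ 3 / n * (1 * 1 * 1) := by
        have : r / n ≤ 1 := (div_le_one hn).2 hrn
        have : 1 / (n:ℝ) ≤ 1 := (div_le_one hn).2 hn1
        gcongr
      _ = _ := by ring
  have k1 : |Ex d y| ≤ (C1 + 2) * r / n := by
    have : Ex d y = Ex d (Yc d a b) - e := by
      rw [← Ex_const h.ne e, ← Ex_sub]; exact Ex_congr fun G _ => by rw [hy]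
    rw [this]
    refine (abs_sub _ _).trans ?_
    rw [abs_of_nonneg he0]
    calc _ ≤ C1 * r / n + 2 * r / n := add_le_add g1 he
      _ = _ := by ring
  have k2 : Ex d (fun G => y G ^ 2) ≤ 2 * (C2 + 4) * r ^ 2 / n := by
    calc _ ≤ Ex d (fun G => 2 * (Yc d a b G ^ 2 + e ^ 2)) := Ex_mono fun G _ => by
          rw [hy]; nlinarith [sq_nonneg (Yc d a b G + e)]
      _ = 2 * (Ex d (fun G => Yc d a b G ^ 2) + e ^ 2) := by rw [Ex_mul, Ex_add, Ex_const h.ne]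
      _ ≤ 2 * (C2 * r ^ 2 / n + 4 * r ^ 2 / n) := by gcongr
      _ = _ := by ring
  have k4 : Ex d (fun G => y G ^ 4) ≤ 8 * (C4 + 16) * r ^ 3 / n := by
    calc _ ≤ Ex d (fun G => 8 * (Yc d a b G ^ 4 + e ^ 4)) := Ex_mono fun G _ => by
          rw [hy]
          have := pow_four_sum_le (univ : Finset (Fin 2)) ![Yc d a b G, -e]
          simp [Fin.sum_univ_two, ← sub_eq_add_neg] at this
          linarith
      _ = 8 * (Ex d (fun G => Yc d a b G ^ 4) + e ^ 4) := by rw [Ex_mul, Ex_add, Ex_const h.ne]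
      _ ≤ 8 * (C4 * r ^ 3 / n + 16 * r ^ 3 / n) := by gcongr
      _ = _ := by ring
  have k3 : |Ex d (fun G => y G ^ 3)| ≤ 2 * (2 * (C2 + 4)) * r ^ 3 / n := by
    calc _ ≤ _ := abs_Ex_le
      _ ≤ Ex d (fun G => 2 * r * y G ^ 2) := Ex_mono fun G hG => by
          rw [show y G ^ 3 = y G * y G ^ 2 by ring, abs_mul, abs_of_nonneg (sq_nonneg (y G))]
          exact mul_le_mul_of_nonneg_right (hyb G hG) (sq_nonneg _)
      _ = 2 * r * Ex d (fun G => y G ^ 2) := Ex_mul _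
      _ ≤ 2 * r * (2 * (C2 + 4) * r ^ 2 / n) := by gcongr
      _ = _ := by ring
  rw [abs_of_nonneg (Ex_nonneg fun G _ => by positivity : 0 ≤ Ex d (fun G => y G ^ 2)),
    abs_of_nonneg (Ex_nonneg fun G _ => by positivity : 0 ≤ Ex d (fun G => y G ^ 4))]
  have w : ∀ {c C p : ℝ}, 0 ≤ p → c ≤ C → c * p / n ≤ C * p / n := fun hp hc =>
    div_le_div_of_nonneg_right (mul_le_mul_of_nonneg_right hc hp) hn.le
  refine ⟨k1.trans (w hr.le ?_), k2.trans (w (by positivity) ?_), k3.trans (w (by positivity) ?_),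
    k4.trans (w (by positivity) ?_)⟩ <;> linarith

lemma ratio_final {N N' R ρ q x s : ℝ} (hN : 0 ≤ N) (hN' : 0 ≤ N') (hρ : 0 < ρ) (hs : 1 ≤ s)
    (hq : 0 ≤ q) (hR : ρ / 6 ≤ R) (hx : 0 ≤ x) (hx2 : x ≤ 1 / 2) (h : N' * (1 - x) ≤ N * (R + q)) :
    N' ≤ N * R * (1 + (2 * (x * s) + 2 * (6 / ρ * q))) := by
  have hR1 : 0 < R := lt_of_lt_of_le (by positivity) hR
  have f2 : R + q ≤ R * (1 + 6 / ρ * q) := by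
    have : 1 ≤ R * (6 / ρ) := by
      calc (1:ℝ) = ρ / 6 * (6 / ρ) := by field_simp
        _ ≤ _ := mul_le_mul_of_nonneg_right hR (by positivity)
    have := mul_le_mul_of_nonneg_right this hq
    linarith
  have g1 : N' ≤ N' * (1 - x) * (1 + 2 * x) := by
    have : N' * (1 - x) * (1 + 2 * x) = N' + N' * x * (1 - 2 * x) := by ring
    rw [this]
    have := mul_nonneg (mul_nonneg hN' hx) (by linarith : 0 ≤ 1 - 2 * x)
    linarith
  have g2 := h.trans (mul_le_mul_of_nonneg_left f2 hN)
  have f3 := g1.trans (mul_le_mul_of_nonneg_right g2 (by linarith : 0 ≤ 1 + 2 * x))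
  refine f3.trans ?_
  rw [mul_assoc, mul_assoc, mul_assoc]
  refine mul_le_mul_of_nonneg_left (mul_le_mul_of_nonneg_left ?_ hR1.le) hN
  have h0 : 0 ≤ 6 / ρ * q := by positivity
  generalize 6 / ρ * q = p at h0
  nlinarith [mul_nonneg h0 (by linarith : 0 ≤ 1 - 2 * x), mul_nonneg hx (by linarith : 0 ≤ s - 1)]

/-- The ratio estimate extracted from the hinge identity. -/
lemma ratio_step {N N' A B β s r n C ρ m1 m2 m3 m4 m4' : ℝ} (hN : 0 ≤ N) (hN' : 0 ≤ N')
    (hC : 0 < C) (hρ : 0 < ρ) (hr : 0 < r) (hs : 1 ≤ s) (hn : 0 < n)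
    (hβ : ρ * r / 4 ≤ β) (hAB : |A - B| ≤ 2 * s)
    (hrn : 512 * C / ρ ^ 4 ≤ r * n)
    (h1 : |m1| ≤ C * r / n) (h2 : |m2| ≤ C * r ^ 2 / n) (h3 : |m3| ≤ C * r ^ 3 / n)
    (h4 : 0 ≤ m4) (h4' : |m4'| ≤ C * r ^ 3 / n)
    (hid : N' * (1 - m4' / β ^ 4) =
      N * (1 - m4 / β ^ 4 + (A - B) * (1 / β + m1 / β ^ 2 + m2 / β ^ 3 + m3 / β ^ 4)))
    {R : ℝ} (hR : R = 1 + (A - B) / β) (hR0 : ρ / 6 ≤ R) :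
    N' ≤ N * R * (1 + (2 * (256 * C / ρ ^ 4) + 2 * (6 / ρ * (2 * C * (16 / ρ ^ 2 + 64 / ρ ^ 3 + 256 / ρ ^ 4)))) *
      s / (r * n)) := by
  have hβ0 : 0 < β := lt_of_lt_of_le (by positivity) hβ
  have hrn0 : 0 < r * n := by positivity
  have i : ∀ k : ℕ, 1 / β ^ k ≤ 4 ^ k / ρ ^ k / r ^ k := by
    intro k
    calc 1 / β ^ k ≤ 1 / (ρ * r / 4) ^ k := by gcongr
      _ = _ := by rw [div_pow, mul_pow]; field_simp
  have x1 : m4' / β ^ 4 ≤ (256 * C / ρ ^ 4) / (r * n) := by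
    calc m4' / β ^ 4 = m4' * (1 / β ^ 4) := by ring
      _ ≤ (C * r ^ 3 / n) * (4 ^ 4 / ρ ^ 4 / r ^ 4) :=
        mul_le_mul ((le_abs_self _).trans h4') (i 4) (by positivity) (by positivity)
      _ = _ := by field_simp; norm_num
  have t1 : |m1 / β ^ 2| ≤ C * (16 / ρ ^ 2) / (r * n) := by
    rw [abs_div, abs_of_pos (by positivity : 0 < β ^ 2)]
    calc |m1| / β ^ 2 = |m1| * (1 / β ^ 2) := by ring
      _ ≤ (C * r / n) * (4 ^ 2 / ρ ^ 2 / r ^ 2) := mul_le_mul h1 (i 2) (by positivity) (by positivity)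
      _ = _ := by field_simp; norm_num
  have t2 : |m2 / β ^ 3| ≤ C * (64 / ρ ^ 3) / (r * n) := by
    rw [abs_div, abs_of_pos (by positivity : 0 < β ^ 3)]
    calc |m2| / β ^ 3 = |m2| * (1 / β ^ 3) := by ring
      _ ≤ (C * r ^ 2 / n) * (4 ^ 3 / ρ ^ 3 / r ^ 3) :=
        mul_le_mul h2 (i 3) (by positivity) (by positivity)
      _ = _ := by field_simp; norm_num
  have t3 : |m3 / β ^ 4| ≤ C * (256 / ρ ^ 4) / (r * n) := by
    rw [abs_div, abs_of_pos (by positivity : 0 < β ^ 4)]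
    calc |m3| / β ^ 4 = |m3| * (1 / β ^ 4) := by ring
      _ ≤ (C * r ^ 3 / n) * (4 ^ 4 / ρ ^ 4 / r ^ 4) :=
        mul_le_mul h3 (i 4) (by positivity) (by positivity)
      _ = _ := by field_simp; norm_num
  have x2 : (A - B) * (m1 / β ^ 2 + m2 / β ^ 3 + m3 / β ^ 4) ≤
      2 * s * (C * (16 / ρ ^ 2 + 64 / ρ ^ 3 + 256 / ρ ^ 4) / (r * n)) := by
    refine (le_abs_self _).trans ?_
    rw [abs_mul]
    refine mul_le_mul hAB ?_ (abs_nonneg _) (by linarith)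
    refine (abs_add_three _ _ _).trans ((add_le_add (add_le_add t1 t2) t3).trans_eq ?_)
    ring
  have m40 : 0 ≤ m4 / β ^ 4 := by positivity
  set x := (256 * C / ρ ^ 4) / (r * n) with hx
  set K := 2 * C * (16 / ρ ^ 2 + 64 / ρ ^ 3 + 256 / ρ ^ 4) with hK
  have hK0 : 0 < K := by positivity
  have hx0 : 0 ≤ x := by positivity
  have hx2 : x ≤ 1 / 2 := by
    rw [hx, div_le_iff₀ hrn0]
    have : 512 * C / ρ ^ 4 = 2 * (256 * C / ρ ^ 4) := by ring
    linarith
  have hx1 : 1 - x ≤ 1 - m4' / β ^ 4 := sub_le_sub_left x1 1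
  have f1 : N' * (1 - x) ≤ N * (R + K * s / (r * n)) := by
    calc N' * (1 - x) ≤ N' * (1 - m4' / β ^ 4) := mul_le_mul_of_nonneg_left hx1 hN'
      _ = _ := hid
      _ ≤ _ := by
        refine mul_le_mul_of_nonneg_left ?_ hN
        have e1 : (A - B) * (1 / β + m1 / β ^ 2 + m2 / β ^ 3 + m3 / β ^ 4) = (A - B) / β +
          (A - B) * (m1 / β ^ 2 + m2 / β ^ 3 + m3 / β ^ 4) := by ring
        have e2 : 2 * s * (C * (16 / ρ ^ 2 + 64 / ρ ^ 3 + 256 / ρ ^ 4) / (r * n)) =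
          K * s / (r * n) := by rw [hK]; ring
        rw [e1, hR]
        rw [e2] at x2
        generalize (A - B) * (m1 / β ^ 2 + m2 / β ^ 3 + m3 / β ^ 4) = z1 at *
        generalize (A - B) / β = z2 at *
        generalize m4 / β ^ 4 = z3 at *
        clear * - x2 m40
        linarith
  have e3 : (2 * (256 * C / ρ ^ 4) + 2 * (6 / ρ * K)) * s / (r * n) =
      2 * (x * s) + 2 * (6 / ρ * (K * s / (r * n))) := by rw [hx]; field_simp
  rw [e3]
  exact ratio_final hN hN' hρ hs (by positivity) hR0 hx0 hx2 f1

/-- Flatness of the graph counts along a unit move, large degrees. -/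
lemma exists_flat_step (ρ : ℝ) (hρ : 0 < ρ) : ∃ C R0 : ℝ, 0 < C ∧ 0 < R0 ∧ ∀ {n : ℕ} {r s : ℝ}
    {d d' : Fin n → ℕ}, Bx ρ r s d → Bx ρ r s d' → R0 ≤ r → ∀ {a b : Fin n}, a ≠ b → Mv a b d d' →
    ((Om d').card : ℝ) * (d' a * (n - d b)) ≤
      (Om d).card * (d b * (n - d' a)) * (1 + C * s / (r * n)) := by
  obtain ⟨C, hC, H⟩ := exists_moments ρ hρ
  refine ⟨(2 * (256 * C / ρ ^ 4) + 2 * (6 / ρ * (2 * C * (16 / ρ ^ 2 + 64 / ρ ^ 3 + 256 / ρ ^ 4)))),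
    512 * C / ρ ^ 4, by positivity, by positivity, ?_⟩
  intro n r s d d' h h' hR0 a b hab hmv
  have hr := h.r_pos
  have hs := h.hs
  have hn := h.n_pos
  have hr1 := h.one_le_r
  have hn1 : 1 ≤ (n:ℝ) := hr1.trans h.r_le_n
  have hsr := h.s_le
  have hA1 := h.lo b
  have hA2 := h.hi b
  have hB1 := h'.lo a
  have hB2 := h'.hi a
  have hAn := h.deg_le_n b
  have hBn := h'.deg_le_n a
  have ea : (d' a : ℝ) = d a + 1 := by exact_mod_cast hmv.at_a hab
  have eb : (d' b : ℝ) + 1 = d b := by exact_mod_cast hmv.at_b hab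
  have hrρ : r + s ≤ (1 - ρ / 2) * n := by
    have h1 := h.hrn; have h2 := h.hη; have := mul_le_mul_of_nonneg_left h.r_le_n hρ.le
    have := h.hρ1
    nlinarith
  set A : ℝ := (d b : ℝ) with hA
  set B : ℝ := (d' a : ℝ) with hB
  have hA0 : 0 ≤ A := Nat.cast_nonneg _
  have hB0 : 0 ≤ B := Nat.cast_nonneg _
  obtain ⟨β, hβ⟩ : ∃ β, β = B * (n - A) / n := ⟨_, rfl⟩
  have hβ1 : ρ * r / 4 ≤ β := by
    rw [hβ, le_div_iff₀ hn]
    calc ρ * r / 4 * n = (r / 2) * (ρ / 2 * n) := by ring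
      _ ≤ B * (n - A) := mul_le_mul (by linarith) (by linarith) (by positivity) hB0
  have hβ0 : 0 < β := lt_of_lt_of_le (by have := h.hρ0; positivity) hβ1
  have hβe : β = B - A * B / n := by rw [hβ]; field_simp
  let y : SimpleGraph (Fin n) → ℝ := fun G => Xc a b G - A * B / n
  have hy : ∀ G, y G = Xc a b G - A * B / n := fun _ => rfl
  clear_value y
  have hABn : A * B / n ≤ A := by rw [div_le_iff₀ hn]; exact mul_le_mul_of_nonneg_left hBn hA0
  have hABn0 : 0 ≤ A * B / n := by positivity
  have y1 : ∀ G, y G = Yc d a b G - A / n := fun G => by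
    rw [hy, Yc, ← hA, ea]; ring
  have y2 : ∀ G, y G = Yc d' a b G - B / n := fun G => by
    rw [hy, Yc, ← hB, ← eb]; ring
  have hyb : ∀ G ∈ Om d, |y G| ≤ 2 * r := by
    intro G hG
    have h1 := Xc_nonneg a b G
    have h2 := Xc_le a b G
    rw [mem_Om.1 hG] at h2
    rw [hy, abs_le]; constructor <;> linarith
  have hyb' : ∀ G ∈ Om d', |y G| ≤ 2 * r := by
    intro G hG
    have h1 := Xc_nonneg a b G
    have h2 := Xc_le a b G
    rw [mem_Om.1 hG] at h2
    rw [hy, abs_le]; constructor <;> linarith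
  obtain ⟨m1, m2, m3, m4⟩ := H h hab (by positivity : 0 ≤ A / n)
    (div_le_div_of_nonneg_right (by linarith) hn.le) y1 hyb
  obtain ⟨-, -, -, m4'⟩ := H h' hab (by positivity : 0 ≤ B / n)
    (div_le_div_of_nonneg_right (by linarith) hn.le) y2 hyb'
  have hid := hinge_identity hmv hab fun x => 1 / β + (x - A * B / n) / β ^ 2 +
    (x - A * B / n) ^ 2 / β ^ 3 + (x - A * B / n) ^ 3 / β ^ 4
  simp only [← hy, ← hA, ← hB] at hid
  have p1 : ∀ G, (B - Xc a b G) * (1 / β + y G / β ^ 2 + y G ^ 2 / β ^ 3 + y G ^ 3 / β ^ 4) =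
      1 - 1 / β ^ 4 * y G ^ 4 := by
    intro G
    have : B - Xc a b G = β - y G := by rw [hy, hβe]; ring
    rw [this]; field_simp; ring
  have p2 : ∀ G, (A - Xc a b G) * (1 / β + y G / β ^ 2 + y G ^ 2 / β ^ 3 + y G ^ 3 / β ^ 4) =
      (1 - 1 / β ^ 4 * y G ^ 4) + (A - B) * (1 / β + 1 / β ^ 2 * y G + 1 / β ^ 3 * y G ^ 2 +
        1 / β ^ 4 * y G ^ 3) := by
    intro G
    rw [← p1]; ring
  simp only [p1, p2] at hid
  rw [sum_Om_eq _ h.ne, sum_Om_eq _ h'.ne] at hid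
  rw [Ex_add, Ex_sub, Ex_const h.ne, Ex_mul, Ex_mul, Ex_add, Ex_add, Ex_add, Ex_const h.ne, Ex_mul,
    Ex_mul, Ex_mul, Ex_sub, Ex_const h'.ne, Ex_mul] at hid
  have hABs : |A - B| ≤ 2 * s := by rw [abs_le]; constructor <;> linarith
  have hRe : (1 + (A - B) / β) * β = β + (A - B) := by field_simp
  have hRe2 : β + (A - B) = A * (n - B) / n := by rw [hβ]; field_simp; ring
  have hR6 : ρ / 6 ≤ 1 + (A - B) / β := by
    refine le_of_mul_le_mul_right ?_ hβ0
    rw [hRe, hRe2, hβ, le_div_iff₀ hn]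
    calc ρ / 6 * (B * (n - A) / n) * n = ρ / 6 * (B * (n - A)) := by field_simp
      _ ≤ ρ / 6 * (3 * A * n) := by
        have : 0 ≤ (n:ℝ) - A := by linarith
        gcongr
        · linarith
        · linarith
      _ = A * (ρ / 2 * n) := by ring
      _ ≤ A * (n - B) := mul_le_mul_of_nonneg_left (by linarith) hA0
  have main := ratio_step (N := (Om d).card) (N' := (Om d').card) (A := A) (B := B) (β := β) (s := s)
    (r := r) (n := n) (C := C) (ρ := ρ) (R := 1 + (A - B) / β)
    (m4 := Ex d (fun G => y G ^ 4)) (Nat.cast_nonneg _) (Nat.cast_nonneg _) hC hρ hr hs hn hβ1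
    hABs (by nlinarith) m1 m2 m3 (Ex_nonneg fun G _ => by positivity) m4' ?_ rfl hR6
  · have hβn : 0 ≤ β * n := by positivity
    have main2 := mul_le_mul_of_nonneg_right main hβn
    have e1 : B * (n - A) = β * n := by rw [hβ]; field_simp
    have e2 : A * (n - B) = (1 + (A - B) / β) * (β * n) := by
      rw [← mul_assoc, hRe, hRe2]; field_simp
    rw [e1, e2]
    refine main2.trans_eq ?_
    ring
  · rw [eq_comm] at hid
    refine Eq.trans ?_ (hid.trans ?_) <;> ring
end SHF

namespace SHF
open Finset
open scoped Classical
variable {n : ℕ}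

lemma nonempty_of_move {lo hi : ℕ} (hN : Num n lo hi) {d d' : Fin n → ℕ} (hlo : ∀ x, lo ≤ d' x)
    (hhi : ∀ x, d' x ≤ hi) {a b : Fin n} (h : Mv a b d d') (hd : (Om d).Nonempty) :
    (Om d').Nonempty := by
  obtain ⟨G, hG⟩ := hd
  obtain ⟨G', h1, -⟩ := transfer hN hlo hhi (G := G) (i := a) (j := b) fun x => by
    rw [mem_Om.1 hG x]; exact (h x).symm
  exact ⟨G', h1⟩

/-- Flatness of the graph counts along a unit move, bounded degrees. -/
lemma flat_step_small {lo H : ℝ} (hlo : 1 ≤ lo) (hH : 1 ≤ H) (hn : 4 + 2 * H ^ 2 ≤ n)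
    (hn2 : 4 * (H ^ 3 + H ^ 2) ≤ n) (hn3 : 2 * H ≤ n) {d d' : Fin n → ℕ}
    (h1 : ∀ i, lo ≤ d' i) (h2 : ∀ i, (d' i : ℝ) ≤ H) (h3 : ∀ i, (d i : ℝ) ≤ H)
    (hd' : (Om d').Nonempty) {a b : Fin n} (hab : a ≠ b) (hmv : Mv a b d d') :
    ((Om d').card : ℝ) * (d' a * (n - d b)) ≤
      (Om d).card * (d b * (n - d' a)) * (1 + (12 * (H ^ 3 + H ^ 2) + 4 * H) / n) := by
  have hid := hinge_identity hmv hab fun _ => 1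
  simp only [mul_one] at hid
  have hX := Ex_Xc_le h1 h2 hab hd'
  have e1 : ∑ G ∈ Om d, ((d b : ℝ) - Xc a b G) ≤ (Om d).card * d b := by
    rw [← nsmul_eq_mul, ← sum_const]
    exact sum_le_sum fun G _ => by linarith [Xc_nonneg a b G]
  rw [hid, sum_Om_eq _ hd', Ex_sub, Ex_const hd'] at e1
  have hB1 := h1 a
  have hB2 := h2 a
  have hA2 := h3 b
  have hA0 : (0:ℝ) ≤ d b := Nat.cast_nonneg _
  set X := Ex d' (Xc a b) with hXd
  have hX0 : 0 ≤ X := Ex_nonneg fun G _ => Xc_nonneg a b G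
  have hN : (0:ℝ) ≤ (Om d).card := Nat.cast_nonneg _
  have hN' : (0:ℝ) ≤ (Om d').card := Nat.cast_nonneg _
  generalize ((Om d).card : ℝ) = N at *
  generalize ((Om d').card : ℝ) = N' at *
  generalize (d' a : ℝ) = B at *
  generalize (d b : ℝ) = A at *
  clear_value X
  have hn0 : (0:ℝ) < n := by nlinarith
  generalize (n:ℝ) = x at *
  set T := H ^ 3 + H ^ 2 with hT
  have hT0 : 0 < T := by positivity
  clear_value T
  have q1 : X * (x / 2) ≤ T := by
    refine le_trans (mul_le_mul_of_nonneg_left ?_ hX0) hX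
    nlinarith
  obtain ⟨ε, hε⟩ : ∃ ε, ε = 2 * T / x := ⟨_, rfl⟩
  have hε0 : 0 ≤ ε := by rw [hε]; positivity
  have hε1 : ε ≤ 1 / 2 := by rw [hε, div_le_iff₀ hn0]; linarith
  have q2 : X ≤ ε := by rw [hε, le_div_iff₀ hn0]; linarith
  have q3 : N' * (B * (1 - ε)) ≤ N * A := by
    refine le_trans (mul_le_mul_of_nonneg_left ?_ hN') e1
    nlinarith
  have q4 : N' * B ≤ N * A * (1 + 2 * ε) := by
    have := mul_le_mul_of_nonneg_right q3 (by linarith : 0 ≤ 1 + 2 * ε)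
    refine le_trans ?_ this
    have h0 : 0 ≤ N' * B := mul_nonneg hN' (by linarith)
    have : N' * (B * (1 - ε)) * (1 + 2 * ε) = N' * B + N' * B * (ε * (1 - 2 * ε)) := by ring
    rw [this]
    have := mul_nonneg h0 (mul_nonneg hε0 (by linarith : 0 ≤ 1 - 2 * ε))
    linarith
  obtain ⟨η, hη⟩ : ∃ η, η = 2 * H / x := ⟨_, rfl⟩
  have hη0 : 0 ≤ η := by rw [hη]; positivity
  have q5 : x - A ≤ (x - B) * (1 + η) := by
    have : H ≤ (x - B) * η := by
      calc H = x / 2 * η := by rw [hη]; field_simp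
        _ ≤ _ := mul_le_mul_of_nonneg_right (by linarith) hη0
    nlinarith
  have q6 : (1 + 2 * ε) * (1 + η) ≤ 1 + (12 * T + 4 * H) / x := by
    have : (12 * T + 4 * H) / x = 6 * ε + 2 * η := by rw [hε, hη]; ring
    rw [this]; nlinarith
  calc N' * (B * (x - A)) = N' * B * (x - A) := by ring
    _ ≤ N * A * (1 + 2 * ε) * ((x - B) * (1 + η)) :=
      mul_le_mul q4 q5 (by linarith) (mul_nonneg (mul_nonneg hN hA0) (by linarith))
    _ = N * (A * (x - B)) * ((1 + 2 * ε) * (1 + η)) := by ring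
    _ ≤ _ := mul_le_mul_of_nonneg_left q6 (mul_nonneg hN (mul_nonneg hA0 (by linarith)))

lemma rpow_facts {α : ℝ} (hα0 : 0 < α) (hα : α < 1 / 2) {r : ℕ} (hr : 2 ≤ r) :
    1 ≤ (r:ℝ) ^ α ∧ (r:ℝ) ^ α * (r:ℝ) ^ α ≤ r := by
  have h1 : (1:ℝ) ≤ r := by exact_mod_cast (by omega : 1 ≤ r)
  refine ⟨Real.one_le_rpow h1 hα0.le, ?_⟩
  rw [← Real.rpow_add (by linarith)]
  calc (r:ℝ) ^ (α + α) ≤ (r:ℝ) ^ (1:ℝ) := Real.rpow_le_rpow_of_exponent_le h1 (by linarith)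
    _ = r := Real.rpow_one _

/-- Flatness of the graph counts along a unit move. -/
lemma exists_move_ratio (ρ : ℝ) (hρ : 0 < ρ) (hρ1 : ρ < 1) : ∃ C n0 : ℝ, 0 < C ∧
    ∀ {n : ℕ} {r : ℕ} {s : ℝ}, n0 ≤ n → 2 ≤ r → 1 ≤ s → s * s ≤ r → (r:ℝ) ≤ (1 - ρ) * n →
    ∀ {d d' : Fin n → ℕ}, (∀ i, r - s ≤ d i) → (∀ i, d i ≤ r + s) → (∀ i, r - s ≤ d' i) →
    (∀ i, d' i ≤ r + s) → (Om d).Nonempty → (Om d').Nonempty → ∀ {a b : Fin n}, a ≠ b →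
    Mv a b d d' → ((Om d').card : ℝ) * (d' a * (n - d b)) ≤
      (Om d).card * (d b * (n - d' a)) * (1 + C / (n * s)) := by
  obtain ⟨C, R0, hC, hR0, hbig⟩ := exists_flat_step ρ hρ
  obtain ⟨R, hR⟩ : ∃ R, R = max R0 (128 ^ 2 / ρ ^ 2) := ⟨_, rfl⟩
  have hR1 : R0 ≤ R := hR ▸ le_max_left _ _
  have hR2 : 128 ^ 2 / ρ ^ 2 ≤ R := hR ▸ le_max_right _ _
  have hRpos : 0 < R := lt_of_lt_of_le hR0 hR1
  obtain ⟨H, hH⟩ : ∃ H, H = 2 * R + 1 := ⟨_, rfl⟩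
  have hH1 : 1 ≤ H := by linarith
  refine ⟨C + (12 * (H ^ 3 + H ^ 2) + 4 * H) * R, 4 + 2 * H ^ 2 + 4 * (H ^ 3 + H ^ 2) + 2 * H,
    by positivity, ?_⟩
  intro n r s hn hr hs hsr hrn d d' h1 h2 h3 h4 hd hd' a b hab hmv
  have hH0 : 0 < H := by linarith
  have hn0 : (0:ℝ) < n := lt_of_lt_of_le (by positivity) hn
  have hr2 : (2:ℝ) ≤ r := by exact_mod_cast hr
  have hs0 : 0 < s := by linarith
  have hcoef : 0 ≤ ((Om d).card : ℝ) * (d b * (n - d' a)) := by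
    obtain ⟨G, hG⟩ := hd'
    have : (d' a : ℝ) ≤ n := by
      rw [← mem_Om.1 hG a, dg]
      exact_mod_cast (card_le_univ _).trans_eq (Fintype.card_fin n)
    have : 0 ≤ (n:ℝ) - d' a := by linarith
    positivity
  rcases le_or_gt R r with hRr | hRr
  · have hη : 128 * s ≤ ρ * r := by
      have k1 : (128 / ρ) ^ 2 ≤ r := by rw [div_pow]; linarith
      have k2 : (128 * s) ^ 2 ≤ (ρ * r) ^ 2 := by
        have : 128 ^ 2 ≤ ρ ^ 2 * r := by
          rw [div_pow, div_le_iff₀ (by positivity)] at k1; linarith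
        calc (128 * s) ^ 2 = 128 ^ 2 * (s * s) := by ring
          _ ≤ ρ ^ 2 * r * r := by gcongr
          _ = _ := by ring
      exact le_of_sq_le_sq k2 (by positivity)
    have B1 : Bx ρ r s d := ⟨hρ, hρ1, hs, hsr, hη, hrn, h1, h2, hd⟩
    have B2 : Bx ρ r s d' := ⟨hρ, hρ1, hs, hsr, hη, hrn, h3, h4, hd'⟩
    refine (hbig B1 B2 (hR1.trans hRr) hab hmv).trans (mul_le_mul_of_nonneg_left ?_ hcoef)
    have : C * s / (r * n) ≤ C / (n * s) := by
      rw [div_le_div_iff₀ (by positivity) (by positivity)]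
      calc C * s * (n * s) = C * n * (s * s) := by ring
        _ ≤ C * n * r := by gcongr
        _ = _ := by ring
    have h0 : 0 ≤ (12 * (H ^ 3 + H ^ 2) + 4 * H) * R / (n * s) := by positivity
    rw [add_div C]; linarith
  · have hsr' : s ≤ r := by nlinarith
    have hlo : 1 ≤ (1:ℝ) := le_rfl
    have hpos : ∀ i, (1:ℝ) ≤ d' i := by
      intro i
      have : s < r := by nlinarith
      have : (0:ℝ) < d' i := by linarith [h3 i]
      exact_mod_cast this
    have p1 : 0 < H ^ 2 := by positivity
    have p2 : 0 < H ^ 3 := by positivity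
    refine (flat_step_small hlo hH1 (by linarith) (by linarith) (by linarith) hpos
      (fun i => by linarith [h4 i]) (fun i => by linarith [h2 i]) hd' hab hmv).trans
      (mul_le_mul_of_nonneg_left ?_ hcoef)
    have : (12 * (H ^ 3 + H ^ 2) + 4 * H) / n ≤ (12 * (H ^ 3 + H ^ 2) + 4 * H) * R / (n * s) := by
      rw [div_le_div_iff₀ hn0 (by positivity)]
      calc (12 * (H ^ 3 + H ^ 2) + 4 * H) * (n * s) ≤ (12 * (H ^ 3 + H ^ 2) + 4 * H) * (n * R) := by
            gcongr; linarith
        _ = _ := by ring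
    have h0 : 0 ≤ C / (n * s) := by positivity
    rw [add_div C]; linarith

/-- Descent along unit moves inside a box. -/
lemma box_induction {l u t : Fin n → ℕ} (ht : ∀ i, l i ≤ t i ∧ t i ≤ u i)
    {P : (Fin n → ℕ) → ℕ → Prop} (h0 : P t 0)
    (hs : ∀ d d' a b k, (∀ i, l i ≤ d i ∧ d i ≤ u i) → (∀ i, l i ≤ d' i ∧ d' i ≤ u i) → a ≠ b →
      Mv a b d d' → P d' k → P d (k + 1)) :
    ∀ (k : ℕ) (d : Fin n → ℕ), (∀ i, l i ≤ d i ∧ d i ≤ u i) → ∑ i, d i = ∑ i, t i →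
      ∑ i, (d i - t i) = k → P d k := by
  intro k
  induction k with
  | zero =>
    intro d _ hsum hk
    have h1 : ∀ i ∈ univ, d i ≤ t i := fun i hi => by
      have := (sum_eq_zero_iff.1 hk) i hi
      omega
    have : d = t := by
      funext i
      exact (sum_eq_sum_iff_of_le h1).1 hsum i (mem_univ i)
    rwa [this]
  | succ k ih =>
    intro d hd hsum hk
    obtain ⟨b, hb⟩ : ∃ b, t b < d b := by
      by_contra hc
      push Not at hc
      rw [sum_eq_zero fun i _ => by have := hc i; omega] at hk
      omega
    obtain ⟨a, ha⟩ : ∃ a, d a < t a := by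
      by_contra hc
      push Not at hc
      have := sum_lt_sum (fun i (_ : i ∈ univ) => hc i) ⟨b, mem_univ b, hb⟩
      omega
    have hab : a ≠ b := by rintro rfl; omega
    let d' : Fin n → ℕ := fun x => if x = a then d a + 1 else if x = b then d b - 1 else d x
    have hmv : Mv a b d d' := by
      intro x
      simp only [d']
      split_ifs <;> subst_vars <;> omega
    have hd' : ∀ i, l i ≤ d' i ∧ d' i ≤ u i := by
      intro x
      have := hd x
      have := ht x
      simp only [d']
      split_ifs <;> subst_vars <;> omega
    refine hs d d' a b k hd hd' hab hmv (ih d' hd' ?_ ?_)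
    · have : ∑ x, (d' x + if x = b then 1 else 0) = ∑ x, (d x + if x = a then 1 else 0) :=
        sum_congr rfl fun x _ => hmv x
      simp only [sum_add_distrib, sum_ite_eq', mem_univ, if_true] at this
      omega
    · have : ∑ x, ((d' x - t x) + if x = b then 1 else 0) = ∑ x, (d x - t x) := by
        refine sum_congr rfl fun x _ => ?_
        simp only [d']
        split_ifs <;> subst_vars <;> omega
      simp only [sum_add_distrib, sum_ite_eq', mem_univ, if_true] at this
      omega

/-- The product weight approximating the number of graphs with given degrees. -/
noncomputable def Wc (d : Fin n → ℕ) : ℝ := ∏ i, ((n - 1).choose (d i) : ℝ)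

lemma Wc_pos {d : Fin n → ℕ} (h : ∀ i, d i < n) : 0 < Wc d :=
  prod_pos fun i _ => by
    have := h i
    exact_mod_cast Nat.choose_pos (by omega)

lemma Wc_move {d d' : Fin n → ℕ} (h : ∀ i, d i < n) (h' : ∀ i, d' i < n) {a b : Fin n}
    (hab : a ≠ b) (hmv : Mv a b d d') :
    Wc d' * (d' a * (n - d b)) = Wc d * (d b * (n - d' a)) := by
  have ea := hmv.at_a hab
  have eb := hmv.at_b hab
  have split : ∀ e : Fin n → ℕ, Wc e = ((n - 1).choose (e a) : ℝ) * ((n - 1).choose (e b) *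
      ∏ i ∈ (univ.erase a).erase b, ((n - 1).choose (e i) : ℝ)) := by
    intro e
    rw [Wc, ← mul_prod_erase _ _ (mem_univ a), ← mul_prod_erase (univ.erase a) _
      (mem_erase.2 ⟨hab.symm, mem_univ b⟩)]
  rw [split d, split d']
  have e1 : ∏ i ∈ (univ.erase a).erase b, ((n - 1).choose (d' i) : ℝ) =
      ∏ i ∈ (univ.erase a).erase b, ((n - 1).choose (d i) : ℝ) := by
    refine prod_congr rfl fun i hi => ?_
    simp only [mem_erase, mem_univ, and_true] at hi
    have := hmv i
    simp only [hi.1, hi.2, if_false, add_zero] at this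
    rw [this]
  rw [e1]
  generalize ∏ i ∈ (univ.erase a).erase b, ((n - 1).choose (d i) : ℝ) = z
  have key : ∀ k, k + 1 < n → ((n - 1).choose (k + 1) : ℝ) * ((k + 1 : ℕ) : ℝ) =
      (n - 1).choose k * (n - ((k + 1 : ℕ) : ℝ)) := by
    intro k hk
    have := Nat.choose_succ_right_eq (n - 1) k
    have e : ((n - 1 - k : ℕ) : ℝ) = n - ((k + 1 : ℕ) : ℝ) := by
      rw [Nat.sub_sub, add_comm 1 k, Nat.cast_sub hk.le]
    rw [← e]
    exact_mod_cast this
  have k1 := key (d a) (by have := h' a; omega)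
  have k2 := key (d' b) (by have := h b; omega)
  rw [← ea] at k1
  rw [eb] at k2
  calc _ = ((n - 1).choose (d' a) : ℝ) * d' a * (((n - 1).choose (d' b) : ℝ) * (n - d b)) * z := by
        ring
    _ = _ := by rw [k1, ← k2]; ring

end SHF

namespace SHF
open Finset
open scoped Classical
variable {n : ℕ}

lemma num_of_large {ρ : ℝ} (hρ : 0 < ρ) {r : ℕ} {s : ℝ} (hn : 54 ^ 2 / ρ ^ 2 ≤ n)
    (hr : 2 ≤ r) (hs : 1 ≤ s) (hsr : s * s ≤ r) (hrn : (r:ℝ) ≤ (1 - ρ) * n) :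
    Num n ⌈(r:ℝ) - s⌉₊ ⌊(r:ℝ) + s⌋₊ := by
  have hr2 : (2:ℝ) ≤ r := by exact_mod_cast hr
  have hs0 : 0 < s := by linarith
  have hlt : 4 * s ≤ 3 * r := by nlinarith [sq_nonneg (s - 4 / 3)]
  have hn0 : (0:ℝ) < n := lt_of_lt_of_le (by positivity) hn
  have hrn' : (r:ℝ) ≤ n := hrn.trans (by nlinarith)
  have h54 : 54 * s ≤ ρ * n := by
    have k2 : (54 * s) ^ 2 ≤ (ρ * n) ^ 2 := by
      have : 54 ^ 2 ≤ ρ ^ 2 * n := by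
        rw [div_le_iff₀ (by positivity)] at hn; linarith
      calc (54 * s) ^ 2 = 54 ^ 2 * (s * s) := by ring
        _ ≤ ρ ^ 2 * n * n := by gcongr; linarith
        _ = _ := by ring
    exact le_of_sq_le_sq k2 (by positivity)
  have f1 := Nat.floor_le (by linarith : 0 ≤ (r:ℝ) + s)
  have c1 := Nat.le_ceil ((r:ℝ) - s)
  set hi := ⌊(r:ℝ) + s⌋₊
  set lo := ⌈(r:ℝ) - s⌉₊
  have hlo : 1 ≤ lo := Nat.ceil_pos.2 (by linarith)
  have hlh : (lo:ℝ) ≤ hi + 2 := by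
    have a1 := Nat.ceil_lt_add_one (by linarith : 0 ≤ (r:ℝ) - s)
    have a2 := Nat.lt_floor_add_one ((r:ℝ) + s)
    change (lo:ℝ) < _ at a1
    change _ < (hi:ℝ) + 1 at a2
    linarith
  have hhn : (hi:ℝ) + 4 ≤ n := by linarith
  refine ⟨hlo, ?_⟩
  have e1 : ((hi + 2 - lo : ℕ) : ℝ) = hi + 2 - lo := by
    rw [Nat.cast_sub (by exact_mod_cast hlh)]; push_cast; ring
  have e2 : ((n - (hi + 4) : ℕ) : ℝ) = n - (hi + 4) := by
    rw [Nat.cast_sub (by exact_mod_cast hhn)]; push_cast; ring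
  rw [← Nat.cast_lt (α := ℝ), Nat.cast_mul, Nat.cast_mul, e1, e2]
  push_cast
  calc ((hi:ℝ) + 2) * (hi + 2 - lo) ≤ (3 * r) * (4 * s) :=
        mul_le_mul (by linarith) (by linarith) (by linarith) (by positivity)
    _ < (49 * s) * (r / 4) := by nlinarith [mul_pos hs0 (by linarith : (0:ℝ) < r)]
    _ ≤ _ := mul_le_mul (by linarith) (by linarith) (by positivity) (by linarith)

lemma Num.deg_lt {lo hi : ℕ} (h : Num n lo hi) {k : ℕ} (hk : k ≤ hi) : k < n := by
  have := h.lt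
  omega

/-- The number of graphs with degree sequence `d` is proportional to `Wc d` over a box, up to a
constant. -/
theorem exists_flatness (ρ : ℝ) (hρ : 0 < ρ) (hρ1 : ρ < 1) : ∃ K n0 : ℝ, 0 < K ∧
    ∀ {n : ℕ} {r : ℕ} {s : ℝ}, n0 ≤ n → 2 ≤ r → 1 ≤ s → s * s ≤ r → (r:ℝ) ≤ (1 - ρ) * n →
    ∀ {l u : Fin n → ℕ}, (∀ i, r - s ≤ l i) → (∀ i, u i ≤ r + s) →
    ∀ {d t : Fin n → ℕ}, (∀ i, l i ≤ d i ∧ d i ≤ u i) → (∀ i, l i ≤ t i ∧ t i ≤ u i) →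
    ∑ i, d i = ∑ i, t i → (Om d).Nonempty →
    (Om t).Nonempty ∧ ((Om t).card : ℝ) * Wc d ≤ K * ((Om d).card * Wc t) := by
  obtain ⟨C, n0, hC, H⟩ := exists_move_ratio ρ hρ hρ1
  refine ⟨Real.exp (2 * C), max n0 (54 ^ 2 / ρ ^ 2), Real.exp_pos _, ?_⟩
  intro n r s hn hr hs hsr hrn l u hl hu d t hd ht hsum hne
  have hn1 := (le_max_left _ _).trans hn
  have hN := num_of_large hρ ((le_max_right _ _).trans hn) hr hs hsr hrn
  have hn0 : (0:ℝ) < n := by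
    have := hN.lt
    exact_mod_cast (by omega : 0 < n)
  have hs0 : 0 < s := by linarith
  have low : ∀ {e : Fin n → ℕ}, (∀ i, l i ≤ e i ∧ e i ≤ u i) → ∀ i, (r:ℝ) - s ≤ e i :=
    fun he i => (hl i).trans (by exact_mod_cast (he i).1)
  have upp : ∀ {e : Fin n → ℕ}, (∀ i, l i ≤ e i ∧ e i ≤ u i) → ∀ i, (e i : ℝ) ≤ r + s :=
    fun he i => le_trans (by exact_mod_cast (he i).2) (hu i)
  have lown : ∀ {e : Fin n → ℕ}, (∀ i, l i ≤ e i ∧ e i ≤ u i) → ∀ i, ⌈(r:ℝ) - s⌉₊ ≤ e i :=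
    fun he i => Nat.ceil_le.2 (low he i)
  have uppn : ∀ {e : Fin n → ℕ}, (∀ i, l i ≤ e i ∧ e i ≤ u i) → ∀ i, e i ≤ ⌊(r:ℝ) + s⌋₊ :=
    fun he i => Nat.le_floor (upp he i)
  have ltn : ∀ {e : Fin n → ℕ}, (∀ i, l i ≤ e i ∧ e i ≤ u i) → ∀ i, e i < n :=
    fun he i => hN.deg_lt (uppn he i)
  obtain ⟨δ, hδ⟩ : ∃ δ, δ = C / (n * s) := ⟨_, rfl⟩
  have hδ0 : 0 ≤ δ := by rw [hδ]; positivity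
  have main := box_induction (l := l) (u := u) ht
    (P := fun d k => (Om d).Nonempty → (Om t).Nonempty ∧
      ((Om t).card : ℝ) * Wc d ≤ (1 + δ) ^ k * ((Om d).card * Wc t))
    (fun h => ⟨h, by simp⟩) (by
      intro d d' a b k hd hd' hab hmv ih hne
      have hne' := nonempty_of_move hN (lown hd') (uppn hd') hmv hne
      obtain ⟨h1, h2⟩ := ih hne'
      refine ⟨h1, ?_⟩
      have h3 := H hn1 hr hs hsr hrn (low hd) (upp hd) (low hd') (upp hd') hne hne' hab hmv
      have h4 := Wc_move (ltn hd) (ltn hd') hab hmv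
      rw [← hδ] at h3
      have hA : (0:ℝ) < d b := by
        have := hmv.at_b hab
        exact_mod_cast (by omega : 0 < d b)
      have hB : (0:ℝ) < n - d' a := sub_pos.2 (by exact_mod_cast ltn hd' a)
      have hX : (0:ℝ) < d b * (n - d' a) := mul_pos hA hB
      have hY : (0:ℝ) ≤ d' a * (n - d b) :=
        mul_nonneg (Nat.cast_nonneg _) (sub_nonneg.2 (by exact_mod_cast (ltn hd b).le))
      have hWt := (Wc_pos (ltn ht)).le
      generalize (d b : ℝ) * (n - d' a) = X at *
      generalize (d' a : ℝ) * (n - d b) = Y at *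
      refine le_of_mul_le_mul_right ?_ hX
      calc ((Om t).card : ℝ) * Wc d * X = (Om t).card * Wc d' * Y := by
            rw [mul_assoc, ← h4]; ring
        _ ≤ (1 + δ) ^ k * ((Om d').card * Wc t) * Y := mul_le_mul_of_nonneg_right h2 hY
        _ = (1 + δ) ^ k * Wc t * ((Om d').card * Y) := by ring
        _ ≤ (1 + δ) ^ k * Wc t * ((Om d).card * X * (1 + δ)) :=
          mul_le_mul_of_nonneg_left h3 (by positivity)
        _ = _ := by ring) _ d hd hsum rfl hne
  refine ⟨main.1, main.2.trans ?_⟩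
  refine mul_le_mul_of_nonneg_right ?_ (mul_nonneg (Nat.cast_nonneg _) (Wc_pos (ltn ht)).le)
  have hk : ((∑ i, (d i - t i) : ℕ) : ℝ) ≤ 2 * (n * s) := by
    rw [Nat.cast_sum]
    calc ∑ i, ((d i - t i : ℕ) : ℝ) ≤ ∑ _i : Fin n, 2 * s := by
          refine sum_le_sum fun i _ => ?_
          rcases le_total (d i) (t i) with h | h
          · rw [Nat.sub_eq_zero_of_le h]; simp; linarith
          · rw [Nat.cast_sub h]; linarith [upp hd i, low ht i]
      _ = _ := by simp; ring
  calc (1 + δ) ^ (∑ i, (d i - t i)) ≤ (Real.exp δ) ^ (∑ i, (d i - t i)) := by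
        gcongr; linarith [Real.add_one_le_exp δ]
    _ = Real.exp ((∑ i, (d i - t i) : ℕ) * δ) := (Real.exp_nat_mul _ _).symm
    _ ≤ _ := by
      refine Real.exp_le_exp.2 ?_
      calc _ ≤ 2 * (n * s) * δ := mul_le_mul_of_nonneg_right hk hδ0
        _ = 2 * C := by rw [hδ]; field_simp

end SHF

namespace SHF
open Finset
open scoped Classical
variable {n : ℕ}

lemma card_le_hinges {lo hi : ℕ} (hN : Num n lo hi) {d : Fin n → ℕ} (hlo : ∀ x, lo ≤ d x)
    (hhi : ∀ x, d x ≤ hi) {a b : Fin n} (hab : a ≠ b) :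
    (Om d).card ≤ 3 * n ^ 4 * ∑ G ∈ Om d, (Lf G b a).card := by
  have hn := hN.lt
  have hsub : Om d ⊆ ((Om d).filter fun G => (Lf G b a).Nonempty).biUnion fun G =>
      univ.filter (fun G' => G = G' ∨ Step G G') := by
    intro G hG
    have hdg := mem_Om.1 hG
    obtain ⟨G1, h1, x, hx1, hx2, hx3⟩ := exists_hinge_after_switch (G := G) (Δ := hi) (δ := lo)
      (e := 0) hab (fun x => (hdg x).trans_le (hhi x))
      (by rw [Nat.le_zero, card_eq_zero, filter_eq_empty_iff]
          intro x _; rw [hdg]; exact not_lt.2 (hlo x))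
      ((hlo b).trans (hdg b).ge) ((hN.1.trans (hlo b)).trans (hdg b).ge) (by
        refine lt_of_le_of_lt (Nat.mul_le_mul (by omega) (by omega)) (hN.2.trans_le ?_)
        exact Nat.mul_le_mul_right _ (by omega))
    have hG1 : G1 ∈ Om d := by
      rcases h1 with rfl | h1
      · exact hG
      · exact h1.mem_Om hG
    rw [mem_biUnion]
    refine ⟨G1, mem_filter.2 ⟨hG1, x, mem_Lf.2 ⟨hx3, hx1.symm, fun h => hx2 h.symm⟩⟩,
      mem_filter.2 ⟨mem_univ _, ?_⟩⟩
    rcases h1 with rfl | h1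
    · exact Or.inl rfl
    · exact Or.inr (Or.inr h1.symm)
  refine (card_le_card hsub).trans (card_biUnion_le.trans ?_)
  refine (sum_le_sum fun G _ => step_card (by omega) G).trans ?_
  rw [sum_const, smul_eq_mul, mul_comm]
  refine Nat.mul_le_mul_left _ ?_
  rw [card_eq_sum_ones, sum_filter]
  refine sum_le_sum fun G _ => ?_
  split_ifs with h
  · exact h.card_pos
  · exact Nat.zero_le _

/-- Centred sum of squares over a degree class. -/
noncomputable def Vr (d : Fin n → ℕ) (f : SimpleGraph (Fin n) → ℝ) : ℝ :=
  ∑ G ∈ Om d, (f G - Ex d f) ^ 2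

/-- Dirichlet form between two degree classes. -/
noncomputable def Ec (d d' : Fin n → ℕ) (f : SimpleGraph (Fin n) → ℝ) : ℝ :=
  ∑ G ∈ Om d, ∑ G' ∈ Om d', if Step G G' then (f G - f G') ^ 2 else 0

lemma Vr_nonneg (d : Fin n → ℕ) (f : SimpleGraph (Fin n) → ℝ) : 0 ≤ Vr d f :=
  sum_nonneg fun _ _ => sq_nonneg _

lemma Ec_nonneg (d d' : Fin n → ℕ) (f : SimpleGraph (Fin n) → ℝ) : 0 ≤ Ec d d' f :=
  sum_nonneg fun _ _ => sum_nonneg fun _ _ => by split_ifs <;> positivity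

lemma Vr_le {d : Fin n → ℕ} {f : SimpleGraph (Fin n) → ℝ} {Q : ℝ}
    (h : ∑ G ∈ Om d, ∑ G' ∈ Om d, (f G - f G') ^ 2 ≤ (Om d).card * Q * Ec d d f) :
    Vr d f ≤ Q * Ec d d f := by
  rcases (Om d).eq_empty_or_nonempty with h0 | h0
  · simp [Vr, Ec, h0]
  have hN : (0:ℝ) < (Om d).card := by exact_mod_cast h0.card_pos
  refine le_of_mul_le_mul_left ?_ hN
  rw [← mul_assoc]
  refine le_trans ?_ h
  rw [Vr, mul_sum]
  refine sum_le_sum fun G _ => ?_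
  have e : ∑ G' ∈ Om d, (f G - f G') = (Om d).card * (f G - Ex d f) := by
    rw [sum_sub_distrib, sum_const, nsmul_eq_mul, sum_Om_eq d h0]; ring
  have := sq_sum_le_card_mul_sum_sq (s := Om d) (f := fun G' => f G - f G')
  rw [e] at this
  refine le_of_mul_le_mul_left (le_of_eq_of_le ?_ this) hN
  ring

lemma card_Lf_le (G : SimpleGraph (Fin n)) (a b : Fin n) : ((Lf G a b).card : ℝ) ≤ n := by
  exact_mod_cast (card_le_univ _).trans_eq (Fintype.card_fin n)

/-- Difference of the means of two degree classes at distance one. -/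
lemma mean_move {lo hi : ℕ} (hN : Num n lo hi) {d d' : Fin n → ℕ} (hlo : ∀ x, lo ≤ d x)
    (hhi : ∀ x, d x ≤ hi) {a b : Fin n} (hab : a ≠ b) (hmv : Mv a b d d')
    (f : SimpleGraph (Fin n) → ℝ) :
    ((Om d).card : ℝ) * (Ex d f - Ex d' f) ^ 2 ≤
      9 * (n:ℝ) ^ 5 * (Vr d f + Vr d' f + Ec d d' f) := by
  have hc : ((Om d).card : ℝ) ≤ 3 * (n:ℝ) ^ 4 * ∑ G ∈ Om d, ((Lf G b a).card : ℝ) := by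
    exact_mod_cast card_le_hinges hN hlo hhi hab
  set m := Ex d f
  set m' := Ex d' f
  have h1 : ∑ G ∈ Om d, ∑ _v ∈ Lf G b a, (f G - m) ^ 2 ≤ n * Vr d f := by
    rw [Vr, mul_sum]
    refine sum_le_sum fun G _ => ?_
    rw [sum_const, nsmul_eq_mul]
    exact mul_le_mul_of_nonneg_right (card_Lf_le _ _ _) (sq_nonneg _)
  have h2 : ∑ G ∈ Om d, ∑ v ∈ Lf G b a, (f (hg G v b a) - m') ^ 2 ≤ n * Vr d' f := by
    rw [hinge_pairs hmv fun _ G' => (f G' - m') ^ 2, Vr, mul_sum]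
    refine sum_le_sum fun G _ => ?_
    rw [sum_const, nsmul_eq_mul]
    exact mul_le_mul_of_nonneg_right (card_Lf_le _ _ _) (sq_nonneg _)
  have h3 : ∑ G ∈ Om d, ∑ v ∈ Lf G b a, (f G - f (hg G v b a)) ^ 2 ≤ n * Ec d d' f := by
    rw [Ec, mul_sum]
    refine sum_le_sum fun G hG => ?_
    have h0 : 0 ≤ ∑ G' ∈ Om d', if Step G G' then (f G - f G') ^ 2 else 0 :=
      sum_nonneg fun _ _ => by split_ifs <;> positivity
    refine le_trans (sum_le_card_nsmul _ _
      (∑ G' ∈ Om d', if Step G G' then (f G - f G') ^ 2 else 0) fun v hv => ?_) ?_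
    · rw [mem_Lf] at hv
      have hh : ¬ G.Adj v a := fun h => hv.2.2 h.symm
      have hst : Step G (hg G v b a) := Or.inl ⟨v, b, a, hv.2.1.symm, hh, hv.1, rfl⟩
      have hm := hg_mem_Om hmv hG hv.2.1.symm hh hv.1
      refine le_trans (le_of_eq ?_) (single_le_sum (f := fun G' =>
        if Step G G' then (f G - f G') ^ 2 else 0)
        (fun _ _ => by split_ifs <;> positivity) hm)
      simp only [hst, if_true]
    · rw [nsmul_eq_mul]
      exact mul_le_mul_of_nonneg_right (card_Lf_le _ _ _) h0
  have h4 : (∑ G ∈ Om d, ((Lf G b a).card : ℝ)) * (m - m') ^ 2 ≤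
      3 * (n * Vr d f + n * Vr d' f + n * Ec d d' f) := by
    have : (∑ G ∈ Om d, ((Lf G b a).card : ℝ)) * (m - m') ^ 2 ≤
        3 * (∑ G ∈ Om d, ∑ _v ∈ Lf G b a, (f G - m) ^ 2 +
          ∑ G ∈ Om d, ∑ v ∈ Lf G b a, (f (hg G v b a) - m') ^ 2 +
          ∑ G ∈ Om d, ∑ v ∈ Lf G b a, (f G - f (hg G v b a)) ^ 2) := by
      rw [← sum_add_distrib, ← sum_add_distrib, sum_mul, mul_sum]
      refine sum_le_sum fun G _ => ?_
      rw [← sum_add_distrib, ← sum_add_distrib, mul_sum, ← nsmul_eq_mul, ← sum_const]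
      refine sum_le_sum fun v _ => ?_
      generalize f (hg G v b a) = y
      generalize f G = x
      nlinarith [sq_nonneg ((x - m) + (y - m')), sq_nonneg ((x - m) + (x - y)),
        sq_nonneg ((y - m') - (x - y))]
    linarith
  calc ((Om d).card : ℝ) * (m - m') ^ 2 ≤
        3 * (n:ℝ) ^ 4 * (∑ G ∈ Om d, ((Lf G b a).card : ℝ)) * (m - m') ^ 2 :=
        mul_le_mul_of_nonneg_right hc (sq_nonneg _)
    _ = 3 * (n:ℝ) ^ 4 * ((∑ G ∈ Om d, ((Lf G b a).card : ℝ)) * (m - m') ^ 2) := by ring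
    _ ≤ 3 * (n:ℝ) ^ 4 * (3 * (n * Vr d f + n * Vr d' f + n * Ec d d' f)) :=
        mul_le_mul_of_nonneg_left h4 (by positivity)
    _ = _ := by ring

end SHF

namespace SHF
open Finset
open scoped Classical
variable {n : ℕ}

/-- Degree sequences in the box `[l, u]` with sum `S`. -/
noncomputable def Bs (l u : Fin n → ℕ) (S : ℕ) : Finset (Fin n → ℕ) :=
  (Fintype.piFinset fun i => Icc (l i) (u i)).filter fun d => ∑ i, d i = S

lemma mem_Bs {l u : Fin n → ℕ} {S : ℕ} {d : Fin n → ℕ} :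
    d ∈ Bs l u S ↔ (∀ i, l i ≤ d i ∧ d i ≤ u i) ∧ ∑ i, d i = S := by
  simp [Bs, Fintype.mem_piFinset]

lemma choose_mul_choose_le (m : ℕ) {i j : ℕ} (h : i ≤ j) :
    m.choose i * m.choose (j + 1) ≤ m.choose (i + 1) * m.choose j := by
  have h1 := Nat.choose_succ_right_eq m i
  have h2 := Nat.choose_succ_right_eq m j
  refine Nat.le_of_mul_le_mul_right ?_ (Nat.mul_pos i.succ_pos j.succ_pos)
  simp only [Nat.succ_eq_add_one]
  calc m.choose i * m.choose (j + 1) * ((i + 1) * (j + 1)) =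
      m.choose i * (i + 1) * (m.choose (j + 1) * (j + 1)) := by ring
    _ = m.choose i * m.choose j * ((i + 1) * (m - j)) := by rw [h2]; ring
    _ ≤ m.choose i * m.choose j * ((j + 1) * (m - i)) :=
      Nat.mul_le_mul_left _ (Nat.mul_le_mul (by omega) (by omega))
    _ = m.choose (i + 1) * (i + 1) * m.choose j * (j + 1) := by rw [h1]; ring
    _ = _ := by ring

lemma LC_choose (m l u : ℕ) : LC fun x : ℤ =>
    if (l:ℤ) ≤ x ∧ x ≤ u then (m.choose x.toNat : ℝ) else 0 := by
  refine ⟨fun x => by positivity, fun i j hij => ?_⟩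
  beta_reduce
  by_cases hi : (l:ℤ) ≤ i ∧ i ≤ u
  · by_cases hj : (l:ℤ) ≤ j + 1 ∧ j + 1 ≤ u
    · rw [if_pos hi, if_pos hj, if_pos ⟨by omega, by omega⟩, if_pos ⟨by omega, by omega⟩]
      have e1 : (i + 1).toNat = i.toNat + 1 := by omega
      have e2 : (j + 1).toNat = j.toNat + 1 := by omega
      rw [e1, e2]
      exact_mod_cast choose_mul_choose_le m (by omega : i.toNat ≤ j.toNat)
    · rw [if_neg hj, mul_zero]; positivity
  · rw [if_neg hi, zero_mul]; positivity

/-- Poincaré inequality for the product weight on a slice of a box. -/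
theorem box_poincare {l u : Fin n → ℕ} (hu : ∀ i, u i ≤ n) (S : ℕ) (φ : (Fin n → ℕ) → ℝ) :
    ∑ d ∈ Bs l u S, ∑ d' ∈ Bs l u S, Wc d * Wc d' * (φ d - φ d') ^ 2 ≤
      n * (n + 1 : ℝ) ^ 3 * (∑ d ∈ Bs l u S, Wc d) *
        ∑ d ∈ Bs l u S, ∑ d' ∈ Bs l u S, if ∃ a b, a ≠ b ∧ Mv a b d d' then
          min (Wc d) (Wc d') * (φ d - φ d') ^ 2 else 0 := by
  let w : Fin n → ℤ → ℝ := fun i x =>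
    if (l i : ℤ) ≤ x ∧ x ≤ u i then ((n - 1).choose x.toNat : ℝ) else 0
  let c : (Fin n → ℕ) → Fin n → ℤ := fun d i => (d i : ℤ)
  let t : (Fin n → ℤ) → Fin n → ℕ := fun d i => (d i).toNat
  have htc : ∀ d, t (c d) = d := fun d => by funext i; simp [t, c]
  have hWc : ∀ d ∈ Bs l u S, Wt w (c d) = Wc d := by
    intro d hd
    rw [mem_Bs] at hd
    refine prod_congr rfl fun i _ => ?_
    have := hd.1 i
    simp only [w, c]
    rw [if_pos ⟨by omega, by omega⟩, Int.toNat_natCast]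
  have hsum : ∀ F : (Fin n → ℤ) → ℝ, (∀ d, Wt w d = 0 → F d = 0) →
      ∑ d ∈ Sl n n S, F d = ∑ d ∈ Bs l u S, F (c d) := by
    intro F hF
    rw [← sum_image (s := Bs l u S) (g := c) fun d _ d' _ h => by rw [← htc d, ← htc d', h]]
    refine (sum_subset ?_ ?_).symm
    · intro d hd
      rw [mem_image] at hd
      obtain ⟨e, he, rfl⟩ := hd
      rw [mem_Bs] at he
      rw [mem_Sl]
      refine ⟨fun i => ?_, ?_⟩
      · have := he.1 i
        have := hu i
        simp only [c]
        omega
      · rw [← he.2]; push_cast; rfl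
    · intro d hd hd'
      apply hF
      by_contra hne
      have hi : ∀ i, (l i : ℤ) ≤ d i ∧ d i ≤ u i := by
        intro i
        by_contra hc
        exact hne (prod_eq_zero (mem_univ i) (if_neg hc))
      rw [mem_Sl] at hd
      refine hd' (mem_image.2 ⟨t d, mem_Bs.2 ⟨fun i => ?_, ?_⟩, ?_⟩)
      · have := hi i
        simp only [t]
        omega
      · have : ((∑ i, t d i : ℕ) : ℤ) = S := by
          rw [← hd.2]; push_cast
          refine sum_congr rfl fun i _ => ?_
          have := hi i
          simp only [t]
          omega
        exact_mod_cast this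
      · funext i
        have := hi i
        simp only [t, c]
        omega
  have hW0 : ∀ d, 0 ≤ Wt w d := Wt_nonneg fun i => LC_choose _ _ _
  have main := slice_poincare (N := n) (w := w) (fun i => LC_choose _ _ _) (by
    intro i x hx
    refine if_neg fun h => hx ?_
    rw [mem_Icc]
    have := hu i
    omega) S fun d => φ (t d)
  rw [Eu, Zs] at main
  rw [hsum _ (fun d h => sum_eq_zero fun d' _ => by rw [h]; ring), hsum _ fun _ h => h,
    hsum _ (fun d h => sum_eq_zero fun d' _ => by
      rw [h, min_eq_left (hW0 d')]; split_ifs <;> ring)] at main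
  refine le_of_eq_of_le ?_ (main.trans_eq ?_)
  · refine sum_congr rfl fun d hd => ?_
    rw [hsum _ fun d' h => by rw [h]; ring]
    refine sum_congr rfl fun d' hd' => ?_
    rw [hWc d hd, hWc d' hd', htc, htc]
  · congr 1
    · congr 1
      exact sum_congr rfl hWc
    · refine sum_congr rfl fun d hd => ?_
      rw [hsum _ fun d' h => by rw [h, min_eq_right (hW0 _)]; split_ifs <;> ring]
      refine sum_congr rfl fun d' hd' => ?_
      rw [hWc d hd, hWc d' hd', htc, htc]
      have : Unit' (c d) (c d') ↔ ∃ a b, a ≠ b ∧ Mv a b d d' := by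
        unfold Unit' Mv
        refine exists_congr fun a => exists_congr fun b => and_congr_right fun _ =>
          forall_congr' fun x => ?_
        simp only [c]
        split_ifs <;> omega
      simp only [this]

end SHF

namespace SHF
open Finset
open scoped Classical
variable {n : ℕ}

/-- Transfer of a Poincaré inequality between proportional weights. -/
lemma poincare_of_flat {ι : Type*} {D : Finset ι} {N W φ : ι → ℝ} {R : ι → ι → Prop} [∀ d t, Decidable (R d t)]
    {K C : ℝ}
    (hK : 0 ≤ K) (hC : 0 ≤ C) (hN : ∀ d ∈ D, 0 < N d) (hW : ∀ d ∈ D, 0 < W d)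
    (hflat : ∀ d ∈ D, ∀ t ∈ D, N t * W d ≤ K * (N d * W t))
    (hp : ∑ d ∈ D, ∑ t ∈ D, W d * W t * (φ d - φ t) ^ 2 ≤ C * (∑ d ∈ D, W d) *
      ∑ d ∈ D, ∑ t ∈ D, if R d t then min (W d) (W t) * (φ d - φ t) ^ 2 else 0) :
    ∑ d ∈ D, ∑ t ∈ D, N d * N t * (φ d - φ t) ^ 2 ≤ K ^ 3 * C * (∑ d ∈ D, N d) *
      ∑ d ∈ D, ∑ t ∈ D, if R d t then N d * (φ d - φ t) ^ 2 else 0 := by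
  rcases D.eq_empty_or_nonempty with rfl | hD
  · simp
  have hA : 0 < ∑ d ∈ D, N d := sum_pos hN hD
  have hZ : 0 < ∑ d ∈ D, W d := sum_pos hW hD
  have b1 : ∀ d ∈ D, (∑ t ∈ D, N t) * W d ≤ K * (N d * ∑ t ∈ D, W t) := fun d hd => by
    rw [sum_mul, mul_sum, mul_sum]
    exact sum_le_sum fun t ht => hflat d hd t ht
  have b2 : ∀ t ∈ D, N t * (∑ d ∈ D, W d) ≤ K * ((∑ d ∈ D, N d) * W t) := fun t ht => by
    rw [sum_mul, mul_sum, mul_sum]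
    exact sum_le_sum fun d hd => hflat d hd t ht
  set A := ∑ d ∈ D, N d
  set Z := ∑ d ∈ D, W d
  have c1 : ∀ d ∈ D, W d ≤ K * (Z / A) * N d := fun d hd => by
    have := b1 d hd
    rw [show K * (Z / A) * N d = K * (N d * Z) / A by ring, le_div_iff₀ hA]; linarith
  have c2 : ∀ d ∈ D, N d ≤ K * (A / Z) * W d := fun d hd => by
    have := b2 d hd
    rw [show K * (A / Z) * W d = K * (A * W d) / Z by ring, le_div_iff₀ hZ]; linarith
  calc ∑ d ∈ D, ∑ t ∈ D, N d * N t * (φ d - φ t) ^ 2 ≤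
        ∑ d ∈ D, ∑ t ∈ D, (K * (A / Z)) ^ 2 * (W d * W t * (φ d - φ t) ^ 2) := by
        refine sum_le_sum fun d hd => sum_le_sum fun t ht => ?_
        have := mul_le_mul (c2 d hd) (c2 t ht) (hN t ht).le
          (mul_nonneg (by positivity) (hW d hd).le)
        calc _ ≤ K * (A / Z) * W d * (K * (A / Z) * W t) * (φ d - φ t) ^ 2 :=
              mul_le_mul_of_nonneg_right this (sq_nonneg _)
          _ = _ := by ring
    _ = (K * (A / Z)) ^ 2 * ∑ d ∈ D, ∑ t ∈ D, W d * W t * (φ d - φ t) ^ 2 := by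
        simp only [mul_sum]
    _ ≤ (K * (A / Z)) ^ 2 * (C * Z *
        ∑ d ∈ D, ∑ t ∈ D, K * (Z / A) * if R d t then N d * (φ d - φ t) ^ 2 else 0) := by
        refine mul_le_mul_of_nonneg_left (hp.trans (mul_le_mul_of_nonneg_left ?_ (by positivity)))
          (by positivity)
        refine sum_le_sum fun d hd => sum_le_sum fun t ht => ?_
        split_ifs
        · rw [← mul_assoc]
          exact mul_le_mul_of_nonneg_right ((min_le_left _ _).trans (c1 d hd)) (sq_nonneg _)
        · simp
    _ = (K * (A / Z)) ^ 2 * (C * Z) * (K * (Z / A)) *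
        ∑ d ∈ D, ∑ t ∈ D, if R d t then N d * (φ d - φ t) ^ 2 else 0 := by
        simp only [← mul_sum]; ring
    _ = _ := by
        congr 1
        field_simp

lemma card_moves_le (D : Finset (Fin n → ℕ)) (d : Fin n → ℕ) :
    (D.filter fun d' => ∃ a b, a ≠ b ∧ Mv a b d d').card ≤ n ^ 2 := by
  have hsub : (D.filter fun d' => ∃ a b, a ≠ b ∧ Mv a b d d') ⊆
      univ.image fun p : Fin n × Fin n => fun x =>
        d x + (if x = p.1 then 1 else 0) - if x = p.2 then 1 else 0 := by
    intro d' h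
    obtain ⟨-, a, b, -, h⟩ := mem_filter.1 h
    refine mem_image.2 ⟨(a, b), mem_univ _, ?_⟩
    funext x
    have := h x
    simp only
    omega
  refine (card_le_card hsub).trans (card_image_le.trans ?_)
  simp [pow_two]

lemma move_symm_iff {d d' : Fin n → ℕ} :
    (∃ a b, a ≠ b ∧ Mv a b d d') ↔ ∃ a b, a ≠ b ∧ Mv a b d' d := by
  constructor <;> rintro ⟨a, b, h, h'⟩ <;> exact ⟨b, a, h.symm, h'.symm⟩

/-- Graphs whose degree sequence lies in the box and has the given sum. -/
noncomputable def Ob (l u : Fin n → ℕ) (S : ℕ) : Finset (SimpleGraph (Fin n)) :=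
  univ.filter fun G => (fun i => dg G i) ∈ Bs l u S

lemma sum_Ob {l u : Fin n → ℕ} {S : ℕ} (F : SimpleGraph (Fin n) → ℝ) :
    ∑ G ∈ Ob l u S, F G = ∑ d ∈ Bs l u S, ∑ G ∈ Om d, F G := by
  rw [← sum_fiberwise_of_maps_to (s := Ob l u S) (t := Bs l u S) (g := fun G i => dg G i)
    fun G hG => (mem_filter.1 hG).2]
  refine sum_congr rfl fun d hd => sum_congr ?_ fun _ _ => rfl
  ext G
  simp only [Ob, mem_filter, mem_univ, true_and, mem_Om, funext_iff]
  refine ⟨fun h => h.2, fun h => ⟨?_, h⟩⟩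
  rwa [funext h]

lemma card_Ob (l u : Fin n → ℕ) (S : ℕ) : ((Ob l u S).card : ℝ) = ∑ d ∈ Bs l u S, ((Om d).card : ℝ) := by
  rw [card_eq_sum_ones, Nat.cast_sum, sum_Ob]
  simp

lemma En_Ob (l u : Fin n → ℕ) (S : ℕ) (f : SimpleGraph (Fin n) → ℝ) : En Step (Ob l u S) f = ∑ d ∈ Bs l u S, ∑ d' ∈ Bs l u S, Ec d d' f := by
  rw [En, sum_Ob]
  refine sum_congr rfl fun d _ => ?_
  simp only [sum_Ob]
  rw [sum_comm]
  rfl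

lemma sum_Ec_le (l u : Fin n → ℕ) (S : ℕ) (f : SimpleGraph (Fin n) → ℝ) : ∑ d ∈ Bs l u S, Ec d d f ≤ En Step (Ob l u S) f := by
  rw [En_Ob]
  exact sum_le_sum fun d hd => single_le_sum (f := fun d' => Ec d d' f)
    (fun _ _ => Ec_nonneg _ _ _) hd

lemma sum_moves_le {lo hi : ℕ} (hN : Num n lo hi) {l u : Fin n → ℕ} {S : ℕ} {Q : ℝ} (hQ1 : 1 ≤ Q)
    (blo : ∀ d ∈ Bs l u S, ∀ i, lo ≤ d i) (bhi : ∀ d ∈ Bs l u S, ∀ i, d i ≤ hi)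
    {f : SimpleGraph (Fin n) → ℝ} (hV2 : ∑ d ∈ Bs l u S, Vr d f ≤ Q * En Step (Ob l u S) f)
    : (∑ d ∈ Bs l u S, ∑ t ∈ Bs l u S, if ∃ a b, a ≠ b ∧ Mv a b d t then
    ((Om d).card : ℝ) * (Ex d f - Ex t f) ^ 2 else 0) ≤
    27 * (n:ℝ) ^ 7 * Q * En Step (Ob l u S) f := by
  have hn := hN.lt
  have hn1 : (1:ℝ) ≤ n := by exact_mod_cast (by omega : 1 ≤ n)
  have hEn0 : 0 ≤ En Step (Ob l u S) f := En_nonneg _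
  have cnt : ∀ d, (∑ t ∈ Bs l u S, if ∃ a b, a ≠ b ∧ Mv a b d t then Vr d f else 0) ≤
      n ^ 2 * Vr d f := by
    intro d
    rw [← sum_filter, sum_const, nsmul_eq_mul]
    exact mul_le_mul_of_nonneg_right (by exact_mod_cast card_moves_le _ d) (Vr_nonneg _ _)
  have s1 : (∑ d ∈ Bs l u S, ∑ t ∈ Bs l u S, if ∃ a b, a ≠ b ∧ Mv a b d t then Vr d f else 0) ≤
      n ^ 2 * ∑ d ∈ Bs l u S, Vr d f := by
    rw [mul_sum]
    exact sum_le_sum fun d _ => cnt d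
  have s2 : (∑ d ∈ Bs l u S, ∑ t ∈ Bs l u S, if ∃ a b, a ≠ b ∧ Mv a b d t then Vr t f else 0) ≤
      n ^ 2 * ∑ d ∈ Bs l u S, Vr d f := by
    rw [sum_comm, mul_sum]
    refine sum_le_sum fun t _ => le_of_eq_of_le (sum_congr rfl fun d _ => ?_) (cnt t)
    simp only [move_symm_iff (d := d) (d' := t)]
  have step : (∑ d ∈ Bs l u S, ∑ t ∈ Bs l u S, if ∃ a b, a ≠ b ∧ Mv a b d t then
      ((Om d).card : ℝ) * (Ex d f - Ex t f) ^ 2 else 0) ≤ 9 * (n:ℝ) ^ 5 *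
      ((∑ d ∈ Bs l u S, ∑ t ∈ Bs l u S, if ∃ a b, a ≠ b ∧ Mv a b d t then Vr d f else 0) +
      (∑ d ∈ Bs l u S, ∑ t ∈ Bs l u S, if ∃ a b, a ≠ b ∧ Mv a b d t then Vr t f else 0) +
      ∑ d ∈ Bs l u S, ∑ t ∈ Bs l u S, Ec d t f) := by
    rw [← sum_add_distrib, ← sum_add_distrib, mul_sum]
    refine sum_le_sum fun d hd => ?_
    rw [← sum_add_distrib, ← sum_add_distrib, mul_sum]
    refine sum_le_sum fun t ht => ?_
    split_ifs with h
    · obtain ⟨a, b, hab, hmv⟩ := h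
      exact mean_move hN (blo d hd) (bhi d hd) hab hmv f
    · have := Ec_nonneg d t f
      positivity
  have n2 : 1 ≤ (n:ℝ) ^ 2 := one_le_pow₀ hn1
  rw [← En_Ob] at step
  refine step.trans ?_
  have t1 : (n:ℝ) ^ 2 * ∑ d ∈ Bs l u S, Vr d f ≤ n ^ 2 * (Q * En Step (Ob l u S) f) :=
    mul_le_mul_of_nonneg_left hV2 (by positivity)
  have t2 : En Step (Ob l u S) f ≤ n ^ 2 * (Q * En Step (Ob l u S) f) := by
    rw [← mul_assoc]
    exact le_mul_of_one_le_left hEn0 (one_le_mul_of_one_le_of_one_le n2 hQ1)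
  calc _ ≤ 9 * (n:ℝ) ^ 5 * (n ^ 2 * (Q * En Step (Ob l u S) f) +
        n ^ 2 * (Q * En Step (Ob l u S) f) + n ^ 2 * (Q * En Step (Ob l u S) f)) :=
        mul_le_mul_of_nonneg_left (add_le_add (add_le_add (s1.trans t1) (s2.trans t1)) t2)
          (by positivity)
    _ = _ := by ring

lemma sum_sq_sub_Ob_le (l u : Fin n → ℕ) (S : ℕ) (f : SimpleGraph (Fin n) → ℝ) : ∑ G ∈ Ob l u S, ∑ G' ∈ Ob l u S, (f G - f G') ^ 2 ≤
    3 * (2 * (Ob l u S).card * ∑ d ∈ Bs l u S, Vr d f +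
      ∑ d ∈ Bs l u S, ∑ t ∈ Bs l u S,
        ((Om d).card : ℝ) * (Om t).card * (Ex d f - Ex t f) ^ 2) := by
  have pt : ∀ d t : Fin n → ℕ, ∑ G ∈ Om d, ∑ G' ∈ Om t, (f G - f G') ^ 2 ≤
      3 * ((Om t).card * Vr d f + (Om d).card * Vr t f +
        (Om d).card * (Om t).card * (Ex d f - Ex t f) ^ 2) := by
    intro d t
    have e1 : ((Om t).card : ℝ) * Vr d f =
        ∑ G ∈ Om d, ∑ G' ∈ Om t, (f G - Ex d f) ^ 2 := by
      simp only [sum_const, nsmul_eq_mul, Vr, mul_sum]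
    have e2 : ((Om d).card : ℝ) * Vr t f =
        ∑ G ∈ Om d, ∑ G' ∈ Om t, (f G' - Ex t f) ^ 2 := by
      simp only [sum_const, nsmul_eq_mul, Vr]
    have e3 : ((Om d).card : ℝ) * (Om t).card * (Ex d f - Ex t f) ^ 2 =
        ∑ G ∈ Om d, ∑ G' ∈ Om t, (Ex d f - Ex t f) ^ 2 := by
      simp only [sum_const, nsmul_eq_mul, mul_assoc]
    rw [e1, e2, e3, ← sum_add_distrib, ← sum_add_distrib, mul_sum]
    refine sum_le_sum fun G _ => ?_
    rw [← sum_add_distrib, ← sum_add_distrib, mul_sum]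
    refine sum_le_sum fun G' _ => ?_
    generalize f G = x
    generalize f G' = y
    generalize Ex d f = m
    generalize Ex t f = m'
    nlinarith [sq_nonneg ((x - m) + (y - m')), sq_nonneg ((x - m) - (m - m')),
      sq_nonneg ((y - m') + (m - m'))]
  calc _ = ∑ d ∈ Bs l u S, ∑ t ∈ Bs l u S, ∑ G ∈ Om d, ∑ G' ∈ Om t, (f G - f G') ^ 2 := by
        rw [sum_Ob]
        refine sum_congr rfl fun d _ => ?_
        simp only [sum_Ob]
        rw [sum_comm]
    _ ≤ _ := sum_le_sum fun d _ => sum_le_sum fun t _ => pt d t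
    _ = _ := by
      simp only [← mul_sum, sum_add_distrib, ← sum_mul]
      rw [card_Ob]
      ring

/-- Poincaré inequality on graphs with degrees in a near-regular box and a fixed number of edges,
deduced from flatness of the counts and the fixed-degree inequality. -/
lemma box_graph_poincare_of {lo hi : ℕ} (hN : Num n lo hi) {l u : Fin n → ℕ} (hl : ∀ i, lo ≤ l i)
    (hu : ∀ i, u i ≤ hi) {S : ℕ} {K : ℝ} (hK : 0 ≤ K)
    (hne : ∀ d ∈ Bs l u S, (Om d).Nonempty)
    (hflat : ∀ d ∈ Bs l u S, ∀ t ∈ Bs l u S,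
      ((Om t).card : ℝ) * Wc d ≤ K * ((Om d).card * Wc t)) {f : SimpleGraph (Fin n) → ℝ} {Q : ℝ}
    (hQ1 : 1 ≤ Q) (hV : ∀ d ∈ Bs l u S, Vr d f ≤ Q * Ec d d f) :
    ∑ G ∈ Ob l u S, ∑ G' ∈ Ob l u S, (f G - f G') ^ 2 ≤
      (Ob l u S).card * ((6 + 648 * K ^ 3) * n ^ 11 * Q) * En Step (Ob l u S) f := by
  have hn := hN.lt
  have hn1 : (1:ℝ) ≤ n := by exact_mod_cast (by omega : 1 ≤ n)
  have blo : ∀ d ∈ Bs l u S, ∀ i, lo ≤ d i := fun d hd i => (hl i).trans ((mem_Bs.1 hd).1 i).1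
  have bhi : ∀ d ∈ Bs l u S, ∀ i, d i ≤ hi := fun d hd i => ((mem_Bs.1 hd).1 i).2.trans (hu i)
  have hV2 : ∑ d ∈ Bs l u S, Vr d f ≤ Q * En Step (Ob l u S) f := by
    refine (sum_le_sum hV).trans ?_
    rw [← mul_sum]
    exact mul_le_mul_of_nonneg_left (sum_Ec_le _ _ _ _) (by linarith)
  have hEn0 : 0 ≤ En Step (Ob l u S) f := En_nonneg _
  have hunit := sum_moves_le hN hQ1 blo bhi hV2
  have hbet := poincare_of_flat (D := Bs l u S) (N := fun d => ((Om d).card : ℝ)) (W := Wc)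
    (φ := fun d => Ex d f) (R := fun d t => ∃ a b, a ≠ b ∧ Mv a b d t) hK (by positivity)
    (fun d hd => by exact_mod_cast (hne d hd).card_pos)
    (fun d hd => Wc_pos fun i => hN.deg_lt (bhi d hd i)) hflat
    (box_poincare (fun i => by have := hu i; omega) S _)
  rw [← card_Ob] at hbet
  refine (sum_sq_sub_Ob_le l u S f).trans ?_
  have n3 : ((n:ℝ) + 1) ^ 3 ≤ (2 * n) ^ 3 := pow_le_pow_left₀ (by positivity) (by linarith) 3
  have hn11 : 1 ≤ (n:ℝ) ^ 11 := one_le_pow₀ hn1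
  have hA0 : (0:ℝ) ≤ (Ob l u S).card := Nat.cast_nonneg _
  have z2 := hbet.trans (mul_le_mul_of_nonneg_left hunit (by positivity))
  generalize En Step (Ob l u S) f = E at *
  generalize ((Ob l u S).card : ℝ) = A at *
  have z1 : 2 * A * ∑ d ∈ Bs l u S, Vr d f ≤ 2 * A * (n ^ 11 * (Q * E)) :=
    mul_le_mul_of_nonneg_left (hV2.trans (le_mul_of_one_le_left (by positivity) hn11))
      (by positivity)
  have z3 : K ^ 3 * (n * ((n:ℝ) + 1) ^ 3) * A * (27 * (n:ℝ) ^ 7 * Q * E) ≤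
      K ^ 3 * (n * (2 * n) ^ 3) * A * (27 * (n:ℝ) ^ 7 * Q * E) := by gcongr
  calc _ ≤ 3 * (2 * A * (n ^ 11 * (Q * E)) +
        K ^ 3 * (n * (2 * n) ^ 3) * A * (27 * (n:ℝ) ^ 7 * Q * E)) := by linarith [z2.trans z3]
    _ = _ := by ring

lemma box_graph_poincare {lo hi : ℕ} (hN : Num n lo hi) {l u : Fin n → ℕ} (hl : ∀ i, lo ≤ l i)
    (hu : ∀ i, u i ≤ hi) {S : ℕ} (hS : Even S) {K : ℝ} (hK : 0 ≤ K)
    (hne : ∀ d ∈ Bs l u S, (Om d).Nonempty)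
    (hflat : ∀ d ∈ Bs l u S, ∀ t ∈ Bs l u S,
      ((Om t).card : ℝ) * Wc d ≤ K * ((Om d).card * Wc t)) (f : SimpleGraph (Fin n) → ℝ) :
    ∑ G ∈ Ob l u S, ∑ G' ∈ Ob l u S, (f G - f G') ^ 2 ≤
      (Ob l u S).card * ((6 + 648 * K ^ 3) * n ^ 11 *
        ((2 * (n : ℝ) ^ 2) ^ 132 * (12 * (n : ℝ) ^ 4) ^ 32)) * En Step (Ob l u S) f := by
  have hfix : ∀ d ∈ Bs l u S, _ := fun d hd => fixed_energy hN
    (fun i => (hl i).trans ((mem_Bs.1 hd).1 i).1) (fun i => ((mem_Bs.1 hd).1 i).2.trans (hu i))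
    ((mem_Bs.1 hd).2 ▸ hS) f
  have hn := hN.lt
  have hn1 : (1:ℝ) ≤ n := by exact_mod_cast (by omega : 1 ≤ n)
  have h2 : 1 ≤ (n:ℝ) ^ 2 := one_le_pow₀ hn1
  have h4 : 1 ≤ (n:ℝ) ^ 4 := one_le_pow₀ hn1
  have hQ1 : 1 ≤ (2 * (n : ℝ) ^ 2) ^ 132 * (12 * (n : ℝ) ^ 4) ^ 32 :=
    one_le_mul_of_one_le_of_one_le (one_le_pow₀ (by linarith)) (one_le_pow₀ (by linarith))
  generalize (2 * (n : ℝ) ^ 2) ^ 132 * (12 * (n : ℝ) ^ 4) ^ 32 = Q at *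
  exact box_graph_poincare_of hN hl hu hK hne hflat hQ1 fun d hd => Vr_le (hfix d hd)

end SHF

namespace SHF
open Finset
open scoped Classical
variable {n : ℕ}

/-- Spectral gap of a lazy symmetric chain from a Poincaré inequality. -/
lemma one_le_of_eigenvector {S : Type*} [Fintype S] [DecidableEq S] {w : S → S → ℝ}
    (hw : ∀ i j, w i j = w j i) {lam : ℝ} {v : S → ℝ} (hv : v ≠ 0)
    (h : ∀ i, ∑ j, (if i = j then 1 - ∑ k ∈ univ.erase i, w i k else w i j) * v j = lam * v i)
    (hl : lam ≠ 1) {C : ℝ}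
    (hp : ∑ i, ∑ j, (v i - v j) ^ 2 ≤ Fintype.card S * (C * ∑ i, ∑ j, w i j * (v i - v j) ^ 2)) :
    1 ≤ C * (1 - lam) := by
  have e1 : ∀ i, ∑ j, w i j * (v i - v j) = (1 - lam) * v i := by
    intro i
    have h1 := h i
    have h2 : ∑ j ∈ univ.erase i, (if i = j then 1 - ∑ k ∈ univ.erase i, w i k else w i j) * v j =
        ∑ j ∈ univ.erase i, w i j * v j :=
      sum_congr rfl fun j hj => by rw [if_neg (ne_of_mem_erase hj).symm]
    rw [← add_sum_erase _ _ (mem_univ i), if_pos rfl, h2] at h1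
    rw [← add_sum_erase _ _ (mem_univ i)]
    simp only [mul_sub, sum_sub_distrib, ← sum_mul]
    linarith
  have e2 : ∑ i, ∑ j, w i j * (v i - v j) = 0 := by
    have : ∑ i, ∑ j, w i j * (v i - v j) = -∑ i, ∑ j, w i j * (v i - v j) := by
      conv_lhs => rw [sum_comm]
      simp only [← sum_neg_distrib]
      refine sum_congr rfl fun i _ => sum_congr rfl fun j _ => ?_
      rw [hw]
      ring
    linarith
  have hs : ∑ i, v i = 0 := by
    simp only [e1, ← mul_sum] at e2
    exact (mul_eq_zero.1 e2).resolve_left (sub_ne_zero.2 hl.symm)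
  have e3 : ∑ i, ∑ j, w i j * (v i - v j) ^ 2 = 2 * ((1 - lam) * ∑ i, v i ^ 2) := by
    have a : ∑ i, ∑ j, w i j * (v i - v j) * v i = (1 - lam) * ∑ i, v i ^ 2 := by
      simp only [← sum_mul, e1, mul_sum]
      exact sum_congr rfl fun i _ => by ring
    have b : ∑ i, ∑ j, w i j * (v i - v j) * v j = -((1 - lam) * ∑ i, v i ^ 2) := by
      rw [← a, sum_comm]
      simp only [← sum_neg_distrib]
      refine sum_congr rfl fun i _ => sum_congr rfl fun j _ => ?_
      rw [hw]
      ring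
    calc _ = ∑ i, ∑ j, w i j * (v i - v j) * v i - ∑ i, ∑ j, w i j * (v i - v j) * v j := by
          simp only [← sum_sub_distrib]
          exact sum_congr rfl fun i _ => sum_congr rfl fun j _ => by ring
      _ = _ := by rw [a, b]; ring
  have e4 : ∑ i, ∑ j, (v i - v j) ^ 2 = 2 * (Fintype.card S * ∑ i, v i ^ 2) := by
    have : ∀ i j, (v i - v j) ^ 2 = v i ^ 2 + v j ^ 2 - 2 * (v i * v j) := fun i j => by ring
    simp only [this, sum_sub_distrib, sum_add_distrib, ← mul_sum, hs, sum_const, card_univ,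
      nsmul_eq_mul, mul_zero]
    ring
  obtain ⟨i, hi⟩ := Function.ne_iff.1 hv
  have hq : 0 < ∑ i, v i ^ 2 :=
    sum_pos' (fun _ _ => sq_nonneg _) ⟨i, mem_univ i, sq_pos_of_ne_zero hi⟩
  have hc : (0:ℝ) < Fintype.card S := by exact_mod_cast Fintype.card_pos_iff.2 ⟨i⟩
  rw [e3, e4] at hp
  generalize ∑ i, v i ^ 2 = q at *
  generalize (Fintype.card S : ℝ) = N at *
  have : 2 * (N * q) * 1 ≤ 2 * (N * q) * (C * (1 - lam)) := by linarith
  exact le_of_mul_le_mul_left this (by positivity)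

lemma switchCount_le_symm (G G' : SimpleGraph (Fin n)) : switchCount G G' ≤ switchCount G' G := by
  refine Set.ncard_le_ncard_of_injOn (fun t => (t.1, t.2.2.2, t.2.2.1, t.2.1)) ?_ ?_
    (Set.toFinite _)
  · rintro ⟨v, w, x, y⟩ ⟨h1, h2, h3, h4, h5⟩
    simp only at h1 h2 h3 h4 h5
    have k1 : s(v, w) ∈ G.edgeSet := h1
    have k2 : s(x, y) ∈ G.edgeSet := h2
    have k3 : s(v, y) ∉ G.edgeSet := h3
    have k4 : s(w, x) ∉ G.edgeSet := h4
    have n1 : s(v, w) ≠ s(v, y) := fun h => k3 (h ▸ k1)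
    have n2 : s(v, w) ≠ s(w, x) := fun h => k4 (h ▸ k1)
    have n3 : s(x, y) ≠ s(v, y) := fun h => k3 (h ▸ k2)
    have n4 : s(x, y) ≠ s(w, x) := fun h => k4 (h ▸ k2)
    have q1 : s(x, w) = s(w, x) := Sym2.eq_swap
    have q2 : s(y, x) = s(x, y) := Sym2.eq_swap
    refine ⟨?_, ?_, ?_, ?_, ?_⟩ <;>
      simp only [← SimpleGraph.mem_edgeSet, h5, q1, q2]
    · simp
    · simp
    · simp [n1, n2]
    · simp [n3, n4]
    · ext e
      simp only [Set.mem_union, Set.mem_sdiff, Set.mem_insert_iff, Set.mem_singleton_iff]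
      by_cases c1 : e = s(v, w)
      · subst c1; simp [k1]
      by_cases c2 : e = s(x, y)
      · subst c2; simp [k2]
      by_cases c3 : e = s(v, y)
      · subst c3; simp [k3, n1.symm, n3.symm]
      by_cases c4 : e = s(w, x)
      · subst c4; simp [k4, n2.symm, n4.symm]
      simp [c1, c2, c3, c4]
  · rintro ⟨v, w, x, y⟩ - ⟨v', w', x', y'⟩ - h
    simp only [Prod.mk.injEq] at h ⊢
    tauto

lemma switchCount_symm (G G' : SimpleGraph (Fin n)) : switchCount G G' = switchCount G' G :=
  (switchCount_le_symm G G').antisymm (switchCount_le_symm G' G)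

lemma hingeCount_le_symm (G G' : SimpleGraph (Fin n)) : hingeCount G G' ≤ hingeCount G' G := by
  refine Set.ncard_le_ncard_of_injOn (fun t => (t.2.2, t.2.1, t.1)) ?_ ?_ (Set.toFinite _)
  · rintro ⟨v, w, x⟩ ⟨h1, h2, h3⟩
    simp only at h1 h2 h3
    have k1 : s(v, w) ∈ G.edgeSet := h1
    have k2 : s(w, x) ∉ G.edgeSet := h2
    have n1 : s(v, w) ≠ s(w, x) := fun h => k2 (h ▸ k1)
    have q1 : s(x, w) = s(w, x) := Sym2.eq_swap
    have q2 : s(w, v) = s(v, w) := Sym2.eq_swap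
    refine ⟨?_, ?_, ?_⟩ <;>
      simp only [← SimpleGraph.mem_edgeSet, h3, q1, q2]
    · simp
    · simp [n1]
    · ext e
      simp only [Set.mem_union, Set.mem_sdiff, Set.mem_singleton_iff]
      by_cases c1 : e = s(v, w)
      · subst c1; simp [k1]
      by_cases c2 : e = s(w, x)
      · subst c2; simp [k2, n1.symm]
      simp [c1, c2]
  · rintro ⟨v, w, x⟩ - ⟨v', w', x'⟩ - h
    simp only [Prod.mk.injEq] at h ⊢
    tauto

lemma hingeCount_symm (G G' : SimpleGraph (Fin n)) : hingeCount G G' = hingeCount G' G :=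
  (hingeCount_le_symm G G').antisymm (hingeCount_le_symm G' G)

lemma Hinge.count_pos {G G' : SimpleGraph (Fin n)} (h : Hinge G G') : 0 < hingeCount G G' := by
  obtain ⟨v, b, a, h1, h2, h3, rfl⟩ := h
  refine (Set.ncard_pos (Set.toFinite _)).2 ⟨(b, v, a), h1.symm, h2, ?_⟩
  ext e
  induction e with | _ x y
  have q : s(b, v) = s(v, b) := Sym2.eq_swap
  simp only [SimpleGraph.mem_edgeSet, hg_adj, Set.mem_union, Set.mem_sdiff, Set.mem_singleton_iff,
    q]
  constructor
  · tauto
  · rintro (h | h)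
    · exact Or.inl h
    · refine Or.inr ⟨h, ?_⟩
      rintro rfl
      rcases Sym2.eq_iff.1 h with h | h <;> exact h3 (by rw [← h.1, ← h.2])

lemma Switch.count_pos {G G' : SimpleGraph (Fin n)} (h : Switch G G') : 0 < switchCount G G' := by
  obtain ⟨b, v, b', v', h1, h2, rfl⟩ := h
  rw [mem_Lf] at h1 h2
  refine (Set.ncard_pos (Set.toFinite _)).2 ⟨(b, v, b', v'), h1.2.1, h2.2.1, h2.2.2,
    fun h => h1.2.2 h.symm, ?_⟩
  ext e
  induction e with | _ x y
  have q : s(v, b') = s(b', v) := Sym2.eq_swap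
  simp only [SimpleGraph.mem_edgeSet, sw_adj, Set.mem_union, Set.mem_sdiff, Set.mem_insert_iff,
    Set.mem_singleton_iff, q, not_or]
  constructor
  · tauto
  · rintro (h | h)
    · exact Or.inl h
    · refine Or.inr ⟨h, ?_⟩
      rintro rfl
      rcases h with h | h <;> rcases Sym2.eq_iff.1 h with h | h
      · exact h2.1 (h.2.symm.trans h.1)
      · exact h2.1 (h.1.symm.trans h.2)
      · exact h1.1 (h.2.symm.trans h.1)
      · exact h1.1 (h.1.symm.trans h.2)

lemma degOf_eq_dg (G : SimpleGraph (Fin n)) (i : Fin n) : degOf G i = dg G i := by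
  rw [degOf, dg, ← Set.ncard_coe_finset]
  congr 1
  ext j
  simp [mem_nb]

lemma mem_Ob_iff {l u : Fin n → ℕ} {m : ℕ} {G : SimpleGraph (Fin n)} :
    G ∈ Ob l u (2 * m) ↔ memGm n l u m G := by
  have h1 : ∀ i, G.degree i = dg G i := fun i => by
    rw [dg, ← SimpleGraph.card_neighborFinset_eq_degree]
    congr 1
    ext j
    simp [mem_nb]
  have h2 := G.sum_degrees_eq_twice_card_edges
  simp only [h1] at h2
  have h3 : G.edgeSet.ncard = G.edgeFinset.card := by
    rw [Set.ncard_eq_toFinset_card']; rfl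
  simp only [Ob, mem_filter, mem_univ, true_and, mem_Bs, memGm, degOf_eq_dg, h2, h3]
  exact and_congr_right fun _ => by omega

/-- Off-diagonal transition weights of the chain. -/
noncomputable def wt (G G' : SimpleGraph (Fin n)) : ℝ :=
  (1 / (6 * (n : ℝ) ^ 4)) * switchCount G G' + (1 / (6 * (n : ℝ) ^ 3)) * hingeCount G G'

lemma wt_symm (G G' : SimpleGraph (Fin n)) : wt G G' = wt G' G := by
  rw [wt, wt, switchCount_symm, hingeCount_symm]

lemma wt_nonneg (G G' : SimpleGraph (Fin n)) : 0 ≤ wt G G' := by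
  unfold wt
  positivity

lemma Step.le_wt (hn : 1 ≤ n) {G G' : SimpleGraph (Fin n)} (h : Step G G') :
    1 ≤ 6 * (n : ℝ) ^ 4 * wt G G' := by
  have hn1 : (1:ℝ) ≤ n := by exact_mod_cast hn
  have e : 6 * (n : ℝ) ^ 4 * wt G G' = switchCount G G' + n * hingeCount G G' := by
    rw [wt]
    field_simp
  rw [e]
  rcases h with h | h
  · have h1 : (1:ℝ) ≤ hingeCount G G' := by exact_mod_cast h.count_pos
    have h2 : (0:ℝ) ≤ switchCount G G' := Nat.cast_nonneg _
    nlinarith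
  · have h1 : (1:ℝ) ≤ switchCount G G' := by exact_mod_cast h.count_pos
    have h2 : 0 ≤ (n:ℝ) * hingeCount G G' := by positivity
    linarith

lemma En_le_wt (hn : 1 ≤ n) (Ω : Finset (SimpleGraph (Fin n))) (f : SimpleGraph (Fin n) → ℝ) :
    En Step Ω f ≤ 6 * (n : ℝ) ^ 4 * ∑ G ∈ Ω, ∑ G' ∈ Ω, wt G G' * (f G - f G') ^ 2 := by
  simp only [En, mul_sum]
  refine sum_le_sum fun G _ => sum_le_sum fun G' _ => ?_
  rw [← mul_assoc]
  split_ifs with h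
  · exact le_mul_of_one_le_left (sq_nonneg _) (h.le_wt hn)
  · have := wt_nonneg G G'
    positivity

/-- A Poincaré inequality on the graphs of the chain, restated on the state space. -/
lemma poincare_state (hn : 1 ≤ n) {l u : Fin n → ℕ} {m : ℕ} {C : ℝ} (hC : 0 ≤ C)
    [Fintype {G : SimpleGraph (Fin n) // memGm n l u m G}]
    (hp : ∀ f : SimpleGraph (Fin n) → ℝ,
      ∑ G ∈ Ob l u (2 * m), ∑ G' ∈ Ob l u (2 * m), (f G - f G') ^ 2 ≤
        (Ob l u (2 * m)).card * C * En Step (Ob l u (2 * m)) f)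
    (v : {G : SimpleGraph (Fin n) // memGm n l u m G} → ℝ) :
    ∑ x, ∑ y, (v x - v y) ^ 2 ≤ Fintype.card {G : SimpleGraph (Fin n) // memGm n l u m G} *
      (C * (6 * (n : ℝ) ^ 4) * ∑ x, ∑ y, wt x.1 y.1 * (v x - v y) ^ 2) := by
  let f : SimpleGraph (Fin n) → ℝ := fun G => if h : memGm n l u m G then v ⟨G, h⟩ else 0
  have hf : ∀ x : {G : SimpleGraph (Fin n) // memGm n l u m G}, f x.1 = v x := fun x =>
    dif_pos x.2
  have hsum : ∀ F : SimpleGraph (Fin n) → SimpleGraph (Fin n) → ℝ,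
      ∑ G ∈ Ob l u (2 * m), ∑ G' ∈ Ob l u (2 * m), F G G' =
        ∑ x : {G : SimpleGraph (Fin n) // memGm n l u m G},
          ∑ y : {G : SimpleGraph (Fin n) // memGm n l u m G}, F x.1 y.1 := by
    intro F
    rw [sum_subtype _ (fun _ => mem_Ob_iff)]
    exact sum_congr rfl fun x _ => sum_subtype _ (fun _ => mem_Ob_iff) _
  have hcard : Fintype.card {G : SimpleGraph (Fin n) // memGm n l u m G} =
      (Ob l u (2 * m)).card := Fintype.card_of_subtype _ fun _ => mem_Ob_iff
  have h1 := (hp f).trans (mul_le_mul_of_nonneg_left (En_le_wt hn _ f) (by positivity))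
  rw [hsum, hsum] at h1
  simp only [hf] at h1
  rwa [← hcard, mul_assoc _ C, ← mul_assoc C] at h1

/-- An eigenvalue other than `1` is bounded away from `1` given a Poincaré inequality. -/
lemma gap_of_poincare (hn : 1 ≤ n) {l u : Fin n → ℕ} {m : ℕ} {C : ℝ} (hC : 0 ≤ C)
    (hp : ∀ f : SimpleGraph (Fin n) → ℝ,
      ∑ G ∈ Ob l u (2 * m), ∑ G' ∈ Ob l u (2 * m), (f G - f G') ^ 2 ≤
        (Ob l u (2 * m)).card * C * En Step (Ob l u (2 * m)) f)
    {lam : ℝ} {v : {G : SimpleGraph (Fin n) // memGm n l u m G} → ℝ} (hv : v ≠ 0)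
    (h : IsEigenPair (shfMatrix n l u m) lam v) (hl : lam ≠ 1) :
    1 ≤ C * (6 * (n : ℝ) ^ 4) * (1 - lam) :=
  @one_le_of_eigenvector {G : SimpleGraph (Fin n) // memGm n l u m G} (Fintype.ofFinite _)
    (Classical.decEq _) (fun x y => wt x.1 y.1) (fun x y => wt_symm x.1 y.1) lam v hv
    (congrFun h) hl _ (@poincare_state _ hn l u m C hC (Fintype.ofFinite _) hp v)

end SHF

/-- Rapid mixing (spectral gap form) of the switch–hinge flip Markov chain on
`G_m(ℓ,u)` for near-regular degree intervals: every eigenvalue `λ ≠ 1` of its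
transition matrix satisfies `λ ≤ 1 − 1/(c·n^k)`. -/
theorem switch_hinge_flip_rapid_mixing (α ρ : ℝ) (hα0 : 0 < α) (hα : α < 1 / 2)
    (hρ0 : 0 < ρ) (hρ : ρ < 1) :
    ∃ c k n₀ : ℕ, 0 < c ∧ ∀ n : ℕ, n₀ ≤ n → ∀ r : ℕ, 2 ≤ r → (r : ℝ) ≤ (1 - ρ) * n →
      ∀ ℓ u : Fin n → ℕ,
        (∀ i, ℓ i ≤ u i ∧ (r : ℝ) - (r : ℝ) ^ α ≤ (ℓ i : ℝ) ∧
          (u i : ℝ) ≤ (r : ℝ) + (r : ℝ) ^ α) →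
        ∀ m : ℕ, (∑ i, ℓ i) ≤ 2 * m → 2 * m ≤ (∑ i, u i) →
          ∀ (lam : ℝ) (v : {G : SimpleGraph (Fin n) // memGm n ℓ u m G} → ℝ),
            v ≠ 0 → IsEigenPair (shfMatrix n ℓ u m) lam v → lam ≠ 1 →
              lam ≤ 1 - 1 / ((c : ℝ) * (n : ℝ) ^ k) := by
  obtain ⟨K, n1, hK, H⟩ := SHF.exists_flatness ρ hρ0 hρ
  have hc0 : 0 < 6 * (6 + 648 * K ^ 3) * (2 ^ 132 * 12 ^ 32) := by positivity
  refine ⟨⌈6 * (6 + 648 * K ^ 3) * (2 ^ 132 * 12 ^ 32)⌉₊, 407, ⌈max n1 (54 ^ 2 / ρ ^ 2)⌉₊,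
    Nat.ceil_pos.2 hc0, ?_⟩
  intro n hn r hr hrn ℓ u hlu m hm1 hm2 lam v hv hP hlam
  have hn' := Nat.ceil_le.1 hn
  obtain ⟨hs, hsr⟩ := SHF.rpow_facts hα0 hα hr
  have hN := SHF.num_of_large hρ0 ((le_max_right _ _).trans hn') hr hs hsr hrn
  have hnpos : 1 ≤ n := by
    have := hN.lt
    omega
  obtain ⟨⟨G, hG⟩, -⟩ := Function.ne_iff.1 hv
  have hGb := (Finset.mem_filter.1 (SHF.mem_Ob_iff.2 hG)).2
  have hbox : ∀ d ∈ SHF.Bs ℓ u (2 * m), (∀ i, ℓ i ≤ d i ∧ d i ≤ u i) ∧ ∑ i, d i = 2 * m :=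
    fun d hd => SHF.mem_Bs.1 hd
  have hfl : ∀ d ∈ SHF.Bs ℓ u (2 * m), (SHF.Om d).Nonempty → ∀ t ∈ SHF.Bs ℓ u (2 * m),
      (SHF.Om t).Nonempty ∧ ((SHF.Om t).card : ℝ) * SHF.Wc d ≤
        K * ((SHF.Om d).card * SHF.Wc t) := fun d hd hne t ht =>
    H ((le_max_left _ _).trans hn') hr hs hsr hrn (fun i => (hlu i).2.1) (fun i => (hlu i).2.2)
      (hbox d hd).1 (hbox t ht).1 ((hbox d hd).2.trans (hbox t ht).2.symm) hne
  have hne : ∀ d ∈ SHF.Bs ℓ u (2 * m), (SHF.Om d).Nonempty := fun d hd =>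
    (hfl _ hGb ⟨G, SHF.mem_Om.2 fun _ => rfl⟩ d hd).1
  have hpoinc := SHF.box_graph_poincare hN (fun i => Nat.ceil_le.2 (hlu i).2.1)
    (fun i => Nat.le_floor (hlu i).2.2) (even_two_mul m) hK.le hne
    (fun d hd t ht => (hfl d hd (hne d hd) t ht).2)
  have hgap := SHF.gap_of_poincare hnpos (by positivity) hpoinc hv hP hlam
  have hn0 : (0:ℝ) < n := by exact_mod_cast hnpos
  have hconst : (6 + 648 * K ^ 3) * (n:ℝ) ^ 11 *
      ((2 * (n : ℝ) ^ 2) ^ 132 * (12 * (n : ℝ) ^ 4) ^ 32) * (6 * (n : ℝ) ^ 4) =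
      6 * (6 + 648 * K ^ 3) * (2 ^ 132 * 12 ^ 32) * (n:ℝ) ^ 407 := by
    rw [mul_pow, mul_pow, ← pow_mul, ← pow_mul]
    generalize (2:ℝ) ^ 132 = x
    generalize (12:ℝ) ^ 32 = y
    ring
  rw [hconst] at hgap
  have hceil := Nat.le_ceil (6 * (6 + 648 * K ^ 3) * (2 ^ 132 * 12 ^ 32))
  have hcpos := hc0.trans_le hceil
  generalize 6 * (6 + 648 * K ^ 3) * (2 ^ 132 * 12 ^ 32) = c at *
  have hp : (0:ℝ) < (n:ℝ) ^ 407 := pow_pos hn0 _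
  generalize (n:ℝ) ^ 407 = q at *
  have hl1 : 0 < 1 - lam := by
    by_contra hle
    have := mul_nonneg (mul_pos hc0 hp).le (sub_nonneg.2 (not_lt.1 hle))
    nlinarith [mul_pos hc0 hp]
  have h2 : 1 / ((⌈c⌉₊ : ℝ) * q) ≤ 1 - lam := by
    rw [div_le_iff₀ (mul_pos hcpos hp)]
    have := mul_le_mul_of_nonneg_right (mul_le_mul_of_nonneg_right hceil hp.le) hl1.le
    linarith
  linarith
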